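/- Let K = ℚ(√−7) with ring of integers 𝒪_K = ℤ[(1+√−7)/2], and let λ = (1+√−7)/2 ∈ 𝒪_K, which has norm 2. There exists a nonzero symmetric Hermitian modular form b₇ of weight 7 for 𝒪_K such that: (i) b₇ vanishes to order ≥ 3 along ℋ₁, i.e., for every symmetric τ ∈ 𝐇₂ the function t ↦ b₇(τ + tA), A = [[0,1],[−1,0]], vanishes to order ≥ 3 at t = 0; (ii) b₇ ∘ φ_λ ≡ 0, i.e., b₇ vanishes on the Heegner divisor ℋ₂; and (iii) every Hermitian modular form F of weight k for 𝒪_K which vanishes to order ≥ 3 along ℋ₁ and vanishes on ℋ₂ can be written F = b₇·G for some Hermitian modular form G of weight k − 7. -/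

import Mathlib

noncomputable section

open Matrix Filter Topology
open scoped ComplexOrder

attribute [local instance] Matrix.normedAddCommGroup Matrix.normedSpace

/-- The algebraic number (1 + √(-d))/2 = (1 + i·√d)/2 , viewed in ℂ. -/
def omg (d : ℕ) : ℂ := (1 + Complex.I * (Real.sqrt d : ℝ)) / 2

/-- The ring of integers ℤ[(1+√(-d))/2] of ℚ(√(-d)) (for d ≡ 3 mod 4), as a subset of ℂ. -/
def ringInts (d : ℕ) : Set ℂ := {z | ∃ a b : ℤ, z = (a : ℂ) + (b : ℂ) * omg d}

/-- The Hermitian upper half-space of degree two: 2×2 complex matrices τ such that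
(τ - conj(τ)ᵀ)/(2i) is positive definite. -/
def HH2 : Set (Matrix (Fin 2) (Fin 2) ℂ) :=
  {τ | (Matrix.of fun i j => (τ i j - (starRingEnd ℂ) (τ j i)) / (2 * Complex.I)).PosDef}

/-- The matrix J = [[0, -I₂],[I₂, 0]]. -/
def Jmat : Matrix (Fin 4) (Fin 4) ℂ :=
  !![0,0,-1,0; 0,0,0,-1; 1,0,0,0; 0,1,0,0]

/-- Upper-left 2×2 block. -/
def blkA (M : Matrix (Fin 4) (Fin 4) ℂ) : Matrix (Fin 2) (Fin 2) ℂ :=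
  !![M 0 0, M 0 1; M 1 0, M 1 1]
/-- Upper-right 2×2 block. -/
def blkB (M : Matrix (Fin 4) (Fin 4) ℂ) : Matrix (Fin 2) (Fin 2) ℂ :=
  !![M 0 2, M 0 3; M 1 2, M 1 3]
/-- Lower-left 2×2 block. -/
def blkC (M : Matrix (Fin 4) (Fin 4) ℂ) : Matrix (Fin 2) (Fin 2) ℂ :=
  !![M 2 0, M 2 1; M 3 0, M 3 1]
/-- Lower-right 2×2 block. -/
def blkD (M : Matrix (Fin 4) (Fin 4) ℂ) : Matrix (Fin 2) (Fin 2) ℂ :=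
  !![M 2 2, M 2 3; M 3 2, M 3 3]

/-- Membership in SU_{2,2}(𝒪_K): entries in 𝒪_K, determinant 1, and Mᵀ·J·conj(M) = J. -/
def inSU (d : ℕ) (M : Matrix (Fin 4) (Fin 4) ℂ) : Prop :=
  (∀ i j, M i j ∈ ringInts d) ∧ M.det = 1 ∧
    Mᵀ * Jmat * M.map (starRingEnd ℂ) = Jmat

/-- Möbius action M·τ = (aτ+b)(cτ+d)⁻¹. -/
def moebius (M : Matrix (Fin 4) (Fin 4) ℂ) (τ : Matrix (Fin 2) (Fin 2) ℂ) :
    Matrix (Fin 2) (Fin 2) ℂ :=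
  (blkA M * τ + blkB M) * (blkC M * τ + blkD M)⁻¹

/-- A Hermitian modular form of weight k for 𝒪_K, K = ℚ(√(-d)): a holomorphic function on
𝐇₂ satisfying F(M·τ) = det(cτ+d)^k·F(τ) for all M ∈ SU_{2,2}(𝒪_K). -/
def IsHMF (d k : ℕ) (F : Matrix (Fin 2) (Fin 2) ℂ → ℂ) : Prop :=
  DifferentiableOn ℂ F HH2 ∧
    ∀ M, inSU d M → ∀ τ ∈ HH2,
      F (moebius M τ) = (blkC M * τ + blkD M).det ^ k * F τ

/-- A symmetric Hermitian modular form: F(τᵀ) = (-1)^k F(τ). -/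
def IsSymHMF (d k : ℕ) (F : Matrix (Fin 2) (Fin 2) ℂ → ℂ) : Prop :=
  IsHMF d k F ∧ ∀ τ ∈ HH2, F τᵀ = (-1) ^ k * F τ

/-- A skew-symmetric Hermitian modular form: F(τᵀ) = -(-1)^k F(τ). -/
def IsSkewHMF (d k : ℕ) (F : Matrix (Fin 2) (Fin 2) ℂ → ℂ) : Prop :=
  IsHMF d k F ∧ ∀ τ ∈ HH2, F τᵀ = -((-1) ^ k * F τ)

/-- The embedding φ_λ of the Siegel upper half-space into 𝐇₂ given by
[[τ, z],[z, w]] ↦ [[τ, conj(λ)z],[λz, ℓw]] with ℓ = λ·conj(λ). -/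
def phiLam (lam : ℂ) (τ : Matrix (Fin 2) (Fin 2) ℂ) : Matrix (Fin 2) (Fin 2) ℂ :=
  !![τ 0 0, (starRingEnd ℂ) lam * τ 0 1;
     lam * τ 0 1, (lam * (starRingEnd ℂ) lam) * τ 1 1]

/-- The antisymmetric matrix A = [[0,1],[-1,0]], the normal direction to the diagonal ℋ₁. -/
def matA : Matrix (Fin 2) (Fin 2) ℂ := !![0, 1; -1, 0]

/-- F vanishes to order ≥ n along ℋ₁: for every symmetric τ ∈ 𝐇₂ the function
t ↦ F(τ + t·A) vanishes to order ≥ n at t = 0. -/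
def VanishesAlongH1 (F : Matrix (Fin 2) (Fin 2) ℂ → ℂ) (n : ℕ) : Prop :=
  ∀ τ ∈ HH2, τᵀ = τ → ∀ m < n, iteratedDeriv m (fun t : ℂ => F (τ + t • matA)) 0 = 0

/-- F vanishes on the Heegner divisor ℋ_ℓ, ℓ = λ·conj(λ): F ∘ φ_λ ≡ 0 on the Siegel upper
half-space (the symmetric matrices in 𝐇₂). -/
def VanishesOnHeegner (lam : ℂ) (F : Matrix (Fin 2) (Fin 2) ℂ → ℂ) : Prop :=
  ∀ τ ∈ HH2, τᵀ = τ → F (phiLam lam τ) = 0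

namespace HermB7

section

variable {N : ℕ}

/-- The normalised exponential `exp (2πiz)`. -/
def ee (z : ℂ) : ℂ := Complex.exp (2 * Real.pi * Complex.I * z)

lemma ee_zero : ee 0 = 1 := by simp [ee]

lemma ee_add (z w : ℂ) : ee (z + w) = ee z * ee w := by
  rw [ee, ee, ee, ← Complex.exp_add]; ring_nf

lemma ee_ne_zero (z : ℂ) : ee z ≠ 0 := Complex.exp_ne_zero _

lemma ee_neg (z : ℂ) : ee (-z) = (ee z)⁻¹ := by
  rw [ee, ee, ← Complex.exp_neg]; ring_nf

lemma ee_int (n : ℤ) : ee n = 1 := by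
  rw [ee, Complex.exp_eq_one_iff]
  exact ⟨n, by ring⟩

lemma norm_ee (z : ℂ) : ‖ee z‖ = Real.exp (-(2 * Real.pi * z.im)) := by
  rw [ee, Complex.norm_exp]; congr 1
  simp [Complex.mul_re, Complex.mul_im]

lemma differentiable_ee : Differentiable ℂ ee := by
  unfold ee; fun_prop

lemma continuous_ee : Continuous ee := differentiable_ee.continuous

lemma hasDerivAt_ee (z : ℂ) : HasDerivAt ee (2 * Real.pi * Complex.I * ee z) z := by
  unfold ee
  have := ((hasDerivAt_id z).const_mul (2 * Real.pi * Complex.I)).cexp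
  simpa [mul_comm] using this

/-- The bilinear pairing of an integral vector with a complex vector. -/
def dot (n : Fin N → ℤ) (z : Fin N → ℂ) : ℂ := ∑ j, (n j : ℂ) * z j

lemma dot_add (n : Fin N → ℤ) (z w : Fin N → ℂ) : dot n (z + w) = dot n z + dot n w := by
  simp [dot, mul_add, Finset.sum_add_distrib]

lemma differentiable_dot (n : Fin N → ℤ) : Differentiable ℂ (dot n) := by
  unfold dot; fun_prop

/-- Imaginary parts of a complex vector. -/
def imv (z : Fin N → ℂ) : Fin N → ℝ := fun j => (z j).im

/-- The tube domain over `Ω`. -/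
def tube (Ω : Set (Fin N → ℝ)) : Set (Fin N → ℂ) := {z | imv z ∈ Ω}

/-- A real vector viewed as a complex one. -/
def rc (x : Fin N → ℝ) : Fin N → ℂ := fun j => (x j : ℂ)

lemma continuous_imv : Continuous (imv : (Fin N → ℂ) → _) := by unfold imv; fun_prop

lemma continuous_rc : Continuous (rc : (Fin N → ℝ) → _) := by unfold rc; fun_prop

lemma imv_rc (x : Fin N → ℝ) : imv (rc x) = 0 := by ext; simp [imv, rc]

lemma imv_add (z w : Fin N → ℂ) : imv (z + w) = imv z + imv w := by ext; simp [imv]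

lemma isOpen_tube {Ω : Set (Fin N → ℝ)} (h : IsOpen Ω) : IsOpen (tube Ω) :=
  h.preimage continuous_imv

lemma imv_smul_rc (s : ℂ) (x : Fin N → ℝ) : imv (s • rc x) = s.im • x := by
  ext; simp [imv, rc]

/-- The unit box. -/
def box (a : Fin N → ℝ) : Set (Fin N → ℝ) := {x | ∀ i, x i ∈ Set.Ioc (a i) (a i + 1)}

lemma measurableSet_box (a : Fin N → ℝ) : MeasurableSet (box a) := by
  have : box a = Set.univ.pi fun i => Set.Ioc (a i) (a i + 1) := by ext; simp [box]
  rw [this]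
  exact MeasurableSet.univ_pi fun i => measurableSet_Ioc

lemma box_subset_Icc : box (0 : Fin N → ℝ) ⊆ Set.Icc 0 1 := by
  intro x hx
  refine ⟨fun i => (hx i).1.le, fun i => ?_⟩
  simpa using (hx i).2

/-- Invariance under the integral lattice on a tube domain. -/
def Periodic (Ω : Set (Fin N → ℝ)) (f : (Fin N → ℂ) → ℂ) : Prop :=
  ∀ z ∈ tube Ω, ∀ n : Fin N → ℤ, f (z + fun j => (n j : ℂ)) = f z

lemma exists_int_of_coe_eq {a b : ℝ} (h : (a : UnitAddCircle) = b) : ∃ n : ℤ, b = a + n := by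
  have h1 : ((b - a : ℝ) : UnitAddCircle) = 0 := by
    rw [AddCircle.coe_sub, h, sub_self]
  obtain ⟨n, hn⟩ := (AddCircle.coe_eq_zero_iff (1 : ℝ)).1 h1
  refine ⟨n, ?_⟩
  simp at hn
  linarith

/-- The function on the torus induced by the restriction of `g` to the real translates of `z`. -/
def torusLift (g : (Fin N → ℂ) → ℂ) (z : Fin N → ℂ) (p : UnitAddTorus (Fin N)) : ℂ :=
  g (z + rc fun j => Quotient.out (p j))

lemma add_rc_mem_tube {Ω : Set (Fin N → ℝ)} {z : Fin N → ℂ} (hz : z ∈ tube Ω) (x : Fin N → ℝ) :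
    z + rc x ∈ tube Ω := by
  simpa [tube, imv_add, imv_rc] using hz

lemma torusLift_coe {Ω : Set (Fin N → ℝ)} {g : (Fin N → ℂ) → ℂ} (hg : Periodic Ω g)
    {z : Fin N → ℂ} (hz : z ∈ tube Ω) (x : Fin N → ℝ) :
    torusLift g z (fun j => (x j : UnitAddCircle)) = g (z + rc x) := by
  have h : ∀ j, ∃ n : ℤ, Quotient.out (x j : UnitAddCircle) = x j + n := fun j =>
    exists_int_of_coe_eq (Quotient.out_eq (x j : UnitAddCircle)).symm
  choose n hn using h
  rw [torusLift, ← hg _ (add_rc_mem_tube hz x) n]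
  congr 1
  ext j
  simp only [Pi.add_apply, rc, hn]
  push_cast
  ring

lemma continuous_torusLift {Ω : Set (Fin N → ℝ)} {g : (Fin N → ℂ) → ℂ} (hg : Periodic Ω g)
    (hc : ContinuousOn g (tube Ω)) {z : Fin N → ℂ} (hz : z ∈ tube Ω) :
    Continuous (torusLift g z) := by
  have hq : IsOpenQuotientMap (Pi.map fun _ : Fin N => ((↑) : ℝ → UnitAddCircle)) :=
    IsOpenQuotientMap.piMap fun _ => QuotientAddGroup.isOpenQuotientMap_mk
  rw [← hq.continuous_comp_iff]
  have : torusLift g z ∘ (Pi.map fun _ : Fin N => ((↑) : ℝ → UnitAddCircle)) =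
      fun x => g (z + rc x) := by
    ext x
    exact torusLift_coe hg hz x
  rw [this]
  exact hc.comp_continuous (by have := continuous_rc (N := N); fun_prop)
    fun x => add_rc_mem_tube hz x

open MeasureTheory in
lemma box_integral_translate {Ω : Set (Fin N → ℝ)} {g : (Fin N → ℂ) → ℂ} (hg : Periodic Ω g)
    {z : Fin N → ℂ} (hz : z ∈ tube Ω) (t : Fin N → ℝ) :
    ∫ x in box 0, g (z + rc t + rc x) = ∫ x in box 0, g (z + rc x) := by
  have e1 : ∀ a : Fin N → ℝ, ∫ x in box a, g (z + rc x) =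
      @integral _ _ _ _ _ (@volume (UnitAddTorus (Fin N))
        (@MeasureSpace.pi _ _ _ fun _ => ⟨AddCircle.haarAddCircle⟩)) (torusLift g z) := by
    intro a
    refine Eq.trans ?_ (UnitAddTorus.integral_preimage (torusLift g z) a).symm
    refine setIntegral_congr_fun (measurableSet_box a) fun x _ => ?_
    exact (torusLift_coe hg hz x).symm
  have e2 : ∫ x in box 0, g (z + rc t + rc x) = ∫ x in box t, g (z + rc x) := by
    rw [← (measurePreserving_add_right volume t).setIntegral_preimage_emb
      (measurableEmbedding_addRight t) (fun x => g (z + rc x)) (box t)]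
    have : (fun x => x + t) ⁻¹' box t = box (0 : Fin N → ℝ) := by
      ext x
      simp only [box, Set.mem_preimage, Set.mem_ofPred_eq, Set.mem_Ioc, Pi.add_apply, Pi.zero_apply]
      refine forall_congr' fun i => ?_
      constructor <;> rintro ⟨h1, h2⟩ <;> constructor <;> linarith
    rw [this]
    congr 1
    ext x
    congr 1
    ext j
    simp [rc]
    ring
  rw [e2, e1, e1]

end

section

variable {N : ℕ}

open MeasureTheory in
/-- Differentiation under the integral sign over the unit box along a complex direction. -/
lemma hasDerivAt_box_integral {Ω : Set (Fin N → ℝ)} (hΩ : IsOpen Ω) {g : (Fin N → ℂ) → ℂ}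
    (hg : DifferentiableOn ℂ g (tube Ω)) (z w : Fin N → ℂ) {s₀ : ℂ}
    (hs : z + s₀ • w ∈ tube Ω) :
    DifferentiableAt ℂ (fun s : ℂ => ∫ x in box 0, g (z + s • w + rc x)) s₀ := by
  have hopen : IsOpen {s : ℂ | z + s • w ∈ tube Ω} :=
    (isOpen_tube hΩ).preimage (by fun_prop)
  obtain ⟨δ, hδ, hball⟩ := Metric.isOpen_iff.1 hopen s₀ hs
  set ρ := δ / 4 with hρ
  have hρ0 : 0 < ρ := by positivity
  have hin : ∀ s ∈ Metric.closedBall s₀ (2 * ρ), ∀ x, z + s • w + rc x ∈ tube Ω := by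
    intro s h x
    refine add_rc_mem_tube (hball ?_) x
    rw [Metric.mem_ball]
    rw [Metric.mem_closedBall] at h
    linarith
  have hrc := continuous_rc (N := N)
  have hcont : ContinuousOn (fun p : ℂ × (Fin N → ℝ) => g (z + p.1 • w + rc p.2))
      (Metric.closedBall s₀ (2 * ρ) ×ˢ Set.Icc 0 1) :=
    hg.continuousOn.comp (by fun_prop) fun p hp => hin p.1 hp.1 p.2
  obtain ⟨M, hM⟩ := ((isCompact_closedBall s₀ (2 * ρ)).prod isCompact_Icc).exists_bound_of_continuousOn
    hcont
  have hbound : ∀ s ∈ Metric.closedBall s₀ (2 * ρ), ∀ x ∈ box (0 : Fin N → ℝ),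
      ‖g (z + s • w + rc x)‖ ≤ M := fun s h x hx => hM (s, x) ⟨h, box_subset_Icc hx⟩
  have hder : ∀ s ∈ Metric.closedBall s₀ (2 * ρ), ∀ x : Fin N → ℝ,
      DifferentiableAt ℂ (fun s : ℂ => g (z + s • w + rc x)) s := by
    intro s h x
    have h1 : DifferentiableAt ℂ g (z + s • w + rc x) :=
      hg.differentiableAt ((isOpen_tube hΩ).mem_nhds (hin s h x))
    exact h1.comp s (by fun_prop)
  have hmeas : ∀ s ∈ Metric.closedBall s₀ (2 * ρ),
      AEStronglyMeasurable (fun x => g (z + s • w + rc x)) (volume.restrict (box 0)) := by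
    intro s h
    refine (Continuous.aestronglyMeasurable ?_)
    exact hg.continuousOn.comp_continuous (by fun_prop) fun x => hin s h x
  have hfin : volume (box (0 : Fin N → ℝ)) < ⊤ :=
    (measure_mono box_subset_Icc).trans_lt isCompact_Icc.measure_lt_top
  have hs0 : s₀ ∈ Metric.closedBall s₀ (2 * ρ) := Metric.mem_closedBall_self (by positivity)
  have hfm : IsFiniteMeasure (volume.restrict (box (0 : Fin N → ℝ))) := ⟨by simpa using hfin⟩
  have key := hasDerivAt_integral_of_dominated_loc_of_deriv_le (𝕜 := ℂ)
    (μ := volume.restrict (box (0 : Fin N → ℝ))) (bound := fun _ => M / ρ)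
    (F := fun s x => g (z + s • w + rc x)) (x₀ := s₀) (s := Metric.ball s₀ ρ)
    (F' := fun s x => deriv (fun s : ℂ => g (z + s • w + rc x)) s)
    (Metric.ball_mem_nhds _ hρ0) ?_ ?_ ?_ ?_ ?_ ?_
  · exact key.2.differentiableAt
  · filter_upwards [Metric.ball_mem_nhds s₀ hρ0] with s h
    exact hmeas s (Metric.mem_closedBall.2 (by have := Metric.mem_ball.1 h; linarith))
  · refine Integrable.mono' (integrable_const M) (hmeas s₀ hs0) ?_
    filter_upwards [ae_restrict_mem (measurableSet_box 0)] with x hx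
    exact hbound s₀ hs0 x hx
  · have hu : Tendsto (fun n : ℕ => s₀ + ((ρ / (n + 1) : ℝ) : ℂ)) atTop (𝓝[≠] s₀) := by
      rw [tendsto_nhdsWithin_iff]
      constructor
      · have h1 : Tendsto (fun n : ℕ => ρ / ((n : ℝ) + 1)) atTop (𝓝 0) :=
          tendsto_const_div_atTop_nhds_zero_nat ρ |>.comp (tendsto_add_atTop_nat 1) |>.congr
            fun n => by simp
        have h2 := (Complex.continuous_ofReal.tendsto 0).comp h1
        simpa using h2.const_add s₀
      · refine Eventually.of_forall fun n => ?_
        have : (ρ / ((n : ℝ) + 1)) ≠ 0 := by positivity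
        simpa [-Complex.ofReal_div] using this
    refine aestronglyMeasurable_of_tendsto_ae atTop
      (f := fun (n : ℕ) x => slope (fun s : ℂ => g (z + s • w + rc x)) s₀ (s₀ + ((ρ / (n + 1) : ℝ) : ℂ)))
      (fun n => ?_) (Eventually.of_forall fun x => ?_)
    · simp only [slope_def_module, smul_eq_mul]
      refine ((hmeas _ ?_).sub (hmeas s₀ hs0)).const_mul _
      rw [Metric.mem_closedBall, dist_eq_norm, add_sub_cancel_left, Complex.norm_real,
        Real.norm_of_nonneg (by positivity)]
      calc ρ / ((n : ℝ) + 1) ≤ ρ := div_le_self hρ0.le (by linarith [Nat.cast_nonneg (α := ℝ) n])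
        _ ≤ 2 * ρ := by linarith
    · exact (hasDerivAt_iff_tendsto_slope.1 (hder s₀ hs0 x).hasDerivAt).comp hu
  · filter_upwards [ae_restrict_mem (measurableSet_box 0)] with x hx s h
    have hsub : Metric.closedBall s ρ ⊆ Metric.closedBall s₀ (2 * ρ) := by
      refine Metric.closedBall_subset_closedBall' ?_
      have := Metric.mem_ball.1 h
      linarith
    refine Complex.norm_deriv_le_of_forall_mem_sphere_norm_le hρ0 ?_ fun u hu =>
      hbound u (hsub (Metric.sphere_subset_closedBall hu)) x hx
    refine DifferentiableOn.diffContOnCl fun u hu => ?_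
    rw [closure_ball _ hρ0.ne'] at hu
    exact (hder u (hsub hu) x).differentiableWithinAt
  · exact integrable_const _
  · refine Eventually.of_forall fun x s h => (hder s ?_ x).hasDerivAt
    exact Metric.mem_closedBall.2 (by have := Metric.mem_ball.1 h; linarith)

open MeasureTheory in
lemma box_integral_eq {Ω : Set (Fin N → ℝ)} (hΩ : IsOpen Ω) (hconv : Convex ℝ Ω)
    {g : (Fin N → ℂ) → ℂ} (hg : DifferentiableOn ℂ g (tube Ω)) (hp : Periodic Ω g)
    {z z' : Fin N → ℂ} (hz : z ∈ tube Ω) (hz' : z' ∈ tube Ω) :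
    ∫ x in box 0, g (z + rc x) = ∫ x in box 0, g (z' + rc x) := by
  set w : Fin N → ℝ := imv z' - imv z
  set t : Fin N → ℝ := fun j => (z' j).re - (z j).re
  set h : ℂ → ℂ := fun s => ∫ x in box 0, g (z + s • rc w + rc x)
  set S : Set ℂ := {s | z + s • rc w ∈ tube Ω}
  have hS : IsOpen S := (isOpen_tube hΩ).preimage (by fun_prop)
  have hSc : Convex ℝ S := by
    intro a ha b hb α β hα hβ hαβ
    have := hconv ha hb hα hβ hαβ
    have e : imv (z + (α • a + β • b) • rc w) =
        α • imv (z + a • rc w) + β • imv (z + b • rc w) := by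
      rw [imv_add, imv_add, imv_add, imv_smul_rc, imv_smul_rc, imv_smul_rc]
      ext j
      simp only [Complex.add_im, Complex.real_smul, Complex.im_ofReal_mul, Pi.add_apply,
        Pi.smul_apply, smul_eq_mul]
      linear_combination (-imv z j) * hαβ
    change imv _ ∈ Ω
    rw [e]
    exact this
  have hd : ∀ s ∈ S, DifferentiableAt ℂ h s := fun s hs =>
    hasDerivAt_box_integral hΩ hg z (rc w) hs
  have hreal : ∀ s ∈ S, ∀ r : ℝ, h (s + r) = h s := by
    intro s hs r
    have := box_integral_translate hp hs (r • w)
    simp only [h]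
    rw [← this]
    refine setIntegral_congr_fun (measurableSet_box 0) fun x _ => ?_
    congr 1
    ext j
    simp [rc]
    ring
  have hzero : Set.EqOn (deriv h) 0 S := by
    intro s hs
    have h1 : HasDerivAt h (deriv h s) (s + ((0 : ℝ) : ℂ)) := by simpa using (hd s hs).hasDerivAt
    have h2 : HasDerivAt (fun r : ℝ => h (s + r)) (deriv h s) 0 := by
      have := h1.comp_const_add s ((0 : ℝ) : ℂ)
      exact this.comp_ofReal
    have h3 : (fun r : ℝ => h (s + r)) = fun _ => h s := funext fun r => hreal s hs r
    rw [h3] at h2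
    exact h2.unique (hasDerivAt_const _ _)
  have h0 : (0 : ℂ) ∈ S := by simpa [S] using hz
  have h1 : Complex.I ∈ S := by
    change imv _ ∈ Ω
    rw [imv_add, imv_smul_rc]
    simpa [w] using (show imv z' ∈ Ω from hz')
  have key := hS.is_const_of_deriv_eq_zero hSc.isPreconnected
    (fun s hs => (hd s hs).differentiableWithinAt) hzero h0 h1
  have ht := box_integral_translate hp h1 t
  have e1 : z + Complex.I • rc w + rc t = z' := by
    ext j
    apply Complex.ext <;> simp [rc, w, t, imv]
  rw [e1] at ht
  rw [ht]
  simpa [h] using key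

end

section

variable {N : ℕ}

lemma summable_prod_pi {a : ℤ → ℝ} (ha : Summable a) (h0 : ∀ n, 0 ≤ a n) :
    ∀ N : ℕ, Summable fun n : Fin N → ℤ => ∏ j, a (n j) := by
  intro N
  induction N with
  | zero => exact Summable.of_finite
  | succ k ih =>
    rw [← (Fin.consEquiv fun _ : Fin (k + 1) => ℤ).summable_iff]
    have := ha.mul_of_nonneg ih h0 fun n => Finset.prod_nonneg fun _ _ => h0 _
    refine this.congr fun p => ?_
    simp [Fin.consEquiv, Fin.prod_univ_succ]

lemma summable_exp_neg_abs {δ : ℝ} (hδ : 0 < δ) :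
    Summable fun n : ℤ => Real.exp (-(δ * |(n : ℝ)|)) := by
  have h : Summable fun n : ℕ => Real.exp (-(δ * (n : ℝ))) := by
    have := Real.summable_exp_nat_mul_iff.2 (neg_lt_zero.2 hδ)
    exact this.congr fun n => by ring_nf
  refine Summable.of_nat_of_neg ?_ ?_
  · exact h.congr fun n => by simp
  · exact h.congr fun n => by simp

lemma norm_ee_dot (n : Fin N → ℤ) (z : Fin N → ℂ) :
    ‖ee (dot n z)‖ = Real.exp (-(2 * Real.pi * ∑ j, (n j : ℝ) * imv z j)) := by
  rw [norm_ee]; congr 3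
  simp [dot, imv]

lemma dot_intCast (n m : Fin N → ℤ) : ee (dot n fun j => (m j : ℂ)) = 1 := by
  have : dot n (fun j => (m j : ℂ)) = ((∑ j, n j * m j : ℤ) : ℂ) := by simp [dot]
  rw [this, ee_int]

lemma mFourier_coe (n : Fin N → ℤ) (x : Fin N → ℝ) :
    UnitAddTorus.mFourier n (fun j => (x j : UnitAddCircle)) = ee (dot n (rc x)) := by
  simp only [UnitAddTorus.mFourier, ContinuousMap.coe_mk, fourier_coe_apply, dot, rc, ee,
    Finset.mul_sum, Complex.exp_sum]
  exact Finset.prod_congr rfl fun j _ => by congr 1; simp; ring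

lemma exists_bound_of_periodic {Ω : Set (Fin N → ℝ)} {f : (Fin N → ℂ) → ℂ}
    (hc : ContinuousOn f (tube Ω)) (hp : Periodic Ω f) {K : Set (Fin N → ℝ)} (hK : IsCompact K)
    (hKΩ : K ⊆ Ω) : ∃ M, ∀ z, imv z ∈ K → ‖f z‖ ≤ M := by
  have hcomb : Continuous fun p : (Fin N → ℝ) × (Fin N → ℝ) => rc p.1 + Complex.I • rc p.2 := by
    have := continuous_rc (N := N)
    fun_prop
  have him : ∀ p : (Fin N → ℝ) × (Fin N → ℝ), imv (rc p.1 + Complex.I • rc p.2) = p.2 := by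
    intro p
    ext; simp [imv, rc]
  have h1 : ContinuousOn (fun p : (Fin N → ℝ) × (Fin N → ℝ) => f (rc p.1 + Complex.I • rc p.2))
      (Set.Icc 0 1 ×ˢ K) := by
    refine hc.comp hcomb.continuousOn fun p hp => ?_
    change imv _ ∈ Ω
    rw [him]
    exact hKΩ hp.2
  obtain ⟨M, hM⟩ := (isCompact_Icc.prod hK).exists_bound_of_continuousOn h1
  refine ⟨M, fun z hz => ?_⟩
  have hzT : z ∈ tube Ω := hKΩ hz
  have e : z + (fun j => ((-⌊(z j).re⌋ : ℤ) : ℂ)) =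
      rc (fun j => Int.fract (z j).re) + Complex.I • rc (imv z) := by
    ext j
    apply Complex.ext
    · have := Int.self_sub_floor (z j).re
      simp [rc]
      linarith
    · simp [rc, imv]
  rw [← hp z hzT fun j => -⌊(z j).re⌋, e]
  exact hM (_, imv z) ⟨⟨fun j => Int.fract_nonneg _, fun j => (Int.fract_lt_one _).le⟩, hz⟩

open MeasureTheory in
/-- Fourier expansion of a periodic holomorphic function on a tube domain over a convex base. -/
theorem fourier_expansion {Ω : Set (Fin N → ℝ)} (hΩ : IsOpen Ω) (hconv : Convex ℝ Ω)
    {f : (Fin N → ℂ) → ℂ} (hf : DifferentiableOn ℂ f (tube Ω)) (hp : Periodic Ω f) :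
    ∃ c : (Fin N → ℤ) → ℂ,
      (∀ z ∈ tube Ω, HasSum (fun n => c n * ee (dot n z)) (f z)) ∧
      ∀ z ∈ tube Ω, ∀ M, (∀ x, ‖f (z + rc x)‖ ≤ M) → ∀ n, ‖c n * ee (dot n z)‖ ≤ M := by
  by_cases hne : (tube Ω).Nonempty
  swap
  · rw [Set.not_nonempty_iff_eq_empty] at hne
    exact ⟨0, by simp [hne]⟩
  obtain ⟨z₀, hz₀⟩ := hne
  set g : (Fin N → ℤ) → (Fin N → ℂ) → ℂ := fun n z => ee (-dot n z) * f z with hgdef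
  have hgd : ∀ n, DifferentiableOn ℂ (g n) (tube Ω) := fun n => by
    have h1 : Differentiable ℂ fun z : Fin N → ℂ => ee (-dot n z) :=
      differentiable_ee.comp (differentiable_dot n).neg
    exact h1.differentiableOn.mul hf
  have hgp : ∀ n, Periodic Ω (g n) := by
    intro n z hz m
    simp only [hgdef]
    rw [hp z hz m, dot_add, neg_add, ee_add, ee_neg (dot n fun j => ((m j : ℤ) : ℂ)), dot_intCast]
    simp
  set c : (Fin N → ℤ) → ℂ := fun n => ∫ x in box 0, g n (z₀ + rc x) with hcdef
  have hc : ∀ n, ∀ z ∈ tube Ω, c n * ee (dot n z) =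
      ∫ x in box 0, ee (-dot n (rc x)) * f (z + rc x) := by
    intro n z hz
    simp only [hcdef]
    rw [box_integral_eq hΩ hconv (hgd n) (hgp n) hz₀ hz, mul_comm, ← integral_const_mul]
    congr 1
    ext x
    simp only [hgdef]
    rw [dot_add, neg_add, ee_add, ee_neg (dot n z)]
    field_simp [ee_ne_zero]
  have hvol : volume.real (box (0 : Fin N → ℝ)) = 1 := by
    have : box (0 : Fin N → ℝ) = Set.univ.pi fun i => Set.Ioc (0 : ℝ) (0 + 1) := by
      ext; simp [box]
    rw [this, Measure.real, Real.volume_pi_Ioc]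
    simp
  have hbd : ∀ z ∈ tube Ω, ∀ M, (∀ x, ‖f (z + rc x)‖ ≤ M) → ∀ n, ‖c n * ee (dot n z)‖ ≤ M := by
    intro z hz M hM n
    rw [hc n z hz]
    refine (norm_setIntegral_le_of_norm_le_const (C := M) ?_ fun x _ => ?_).trans ?_
    · exact (measure_mono box_subset_Icc).trans_lt isCompact_Icc.measure_lt_top
    · rw [norm_mul, ee_neg, norm_inv, norm_ee_dot, imv_rc]
      simpa using hM x
    · rw [hvol, mul_one]
  refine ⟨c, fun z hz => ?_, hbd⟩
  have hsum : Summable fun n => c n * ee (dot n z) := by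
    obtain ⟨δ', hδ', hball⟩ := Metric.isOpen_iff.1 hΩ (imv z) hz
    set δ := δ' / 2
    have hδ : 0 < δ := by positivity
    have hsub : Metric.closedBall (imv z) δ ⊆ Ω :=
      (Metric.closedBall_subset_ball (by simp [δ, hδ'])).trans hball
    obtain ⟨M, hM⟩ := exists_bound_of_periodic hf.continuousOn hp
      (isCompact_closedBall (imv z) δ) hsub
    have hs := summable_prod_pi (summable_exp_neg_abs (δ := 2 * Real.pi * δ) (by positivity))
      (fun _ => (Real.exp_pos _).le) N
    refine Summable.of_norm_bounded (hs.mul_left M) fun n => ?_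
    set w : Fin N → ℝ := fun j => if 0 ≤ n j then -δ else δ with hw
    set z' := z + Complex.I • rc w
    have him : imv z' = imv z + w := by rw [imv_add, imv_smul_rc]; simp
    have hz' : imv z' ∈ Metric.closedBall (imv z) δ := by
      rw [him, Metric.mem_closedBall, dist_eq_norm, add_sub_cancel_left, pi_norm_le_iff_of_nonneg hδ.le]
      intro j
      simp only [hw]
      split_ifs <;> simp [abs_of_pos hδ]
    have h1 := hbd z' (hsub hz') M (fun x => hM _ (by rwa [imv_add, imv_rc, add_zero])) n
    have h2 : ‖ee (dot n z)‖ = ‖ee (dot n z')‖ *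
        ∏ j, Real.exp (-(2 * Real.pi * δ * |(n j : ℝ)|)) := by
      rw [norm_ee_dot, norm_ee_dot, ← Real.exp_sum, ← Real.exp_add, him]
      congr 1
      rw [Finset.mul_sum, Finset.mul_sum, ← Finset.sum_neg_distrib, ← Finset.sum_neg_distrib,
        ← Finset.sum_add_distrib]
      refine Finset.sum_congr rfl fun j _ => ?_
      simp only [Pi.add_apply, hw]
      split_ifs with h
      · rw [abs_of_nonneg (by exact_mod_cast h)]; ring
      · rw [abs_of_neg (by exact_mod_cast not_le.1 h)]; ring
    rw [norm_mul, h2, ← mul_assoc, ← norm_mul]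
    exact mul_le_mul_of_nonneg_right h1 (Finset.prod_nonneg fun _ _ => (Real.exp_pos _).le)
  set F : C(UnitAddTorus (Fin N), ℂ) := ⟨torusLift f z, continuous_torusLift hp hf.continuousOn hz⟩
  have hF : ∀ n, UnitAddTorus.mFourierCoeff F n = c n * ee (dot n z) := by
    intro n
    rw [hc n z hz, UnitAddTorus.mFourierCoeff_eq_integral _ _ 0]
    refine setIntegral_congr_fun (measurableSet_box 0) fun x _ => ?_
    simp only [smul_eq_mul]
    congr 1
    · rw [mFourier_coe]; congr 1; simp [dot]
    · exact torusLift_coe hp hz x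
  have := UnitAddTorus.hasSum_mFourier_series_apply_of_summable (f := F)
    (hsum.congr fun n => (hF n).symm) (fun j => ((0 : ℝ) : UnitAddCircle))
  have e0 : F (fun j : Fin N => ((0 : ℝ) : UnitAddCircle)) = f z := by
    have := torusLift_coe hp hz (0 : Fin N → ℝ)
    simp only [Pi.zero_apply] at this
    refine this.trans ?_
    congr 1
    ext; simp [rc]
  rw [e0] at this
  refine this.congr_fun fun n => ?_
  rw [hF, mFourier_coe]
  simp [dot, rc, ee_zero]

local instance : MeasureTheory.MeasureSpace UnitAddCircle := ⟨AddCircle.haarAddCircle⟩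

local instance : MeasureTheory.IsProbabilityMeasure
    (MeasureTheory.volume : MeasureTheory.Measure UnitAddCircle) :=
  inferInstanceAs (MeasureTheory.IsProbabilityMeasure AddCircle.haarAddCircle)

/-- Uniqueness of the coefficients of an absolutely convergent Fourier series. -/
theorem fourier_unique {c : (Fin N → ℤ) → ℂ} (hs : Summable c)
    (h : ∀ x : Fin N → ℝ, ∑' n, c n * ee (dot n (rc x)) = 0) : c = 0 := by
  have hs' : Summable fun n => c n • (UnitAddTorus.mFourier n : C(UnitAddTorus (Fin N), ℂ)) := by
    refine Summable.of_norm ?_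
    simpa [norm_smul, UnitAddTorus.mFourier_norm] using hs.norm
  obtain ⟨F, hF⟩ := hs'
  have hF0 : F = 0 := by
    ext p
    obtain ⟨x, rfl⟩ : ∃ x : Fin N → ℝ, (fun j => (x j : UnitAddCircle)) = p :=
      ⟨fun j => Quotient.out (p j), funext fun j => Quotient.out_eq (p j)⟩
    have h1 := (ContinuousMap.evalCLM ℂ (fun j => (x j : UnitAddCircle))).hasSum hF
    have h2 := h1.tsum_eq
    refine Eq.trans h2.symm (Eq.trans (tsum_congr fun n => ?_) (h x))
    simp [mFourier_coe]
  ext m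
  have h1 := (ContinuousMap.toLp 2 MeasureTheory.volume ℂ).hasSum hF
  have h2 := (innerSL ℂ (UnitAddTorus.mFourierLp 2 m)).hasSum h1
  rw [hF0, map_zero, map_zero] at h2
  have h3 : ∀ n, (innerSL ℂ (UnitAddTorus.mFourierLp 2 m))
      (ContinuousMap.toLp 2 MeasureTheory.volume ℂ (c n • UnitAddTorus.mFourier n)) =
      if n = m then c n else 0 := by
    intro n
    rw [map_smul, map_smul]
    have := orthonormal_iff_ite.1 (UnitAddTorus.orthonormal_mFourier (d := Fin N)) m n
    change c n • inner ℂ (UnitAddTorus.mFourierLp (d := Fin N) 2 m)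
      (UnitAddTorus.mFourierLp (d := Fin N) 2 n) = _
    refine (congrArg (c n • ·) this).trans ?_
    by_cases hnm : n = m
    · simp [hnm]
    · simp [hnm, Ne.symm hnm]
  have h4 := h2.unique ((hasSum_ite_eq m (c m)).congr_fun ?_)
  · exact h4.symm
  · intro n
    refine (h3 n).trans ?_
    by_cases hnm : n = m <;> simp [hnm]

end

section

variable {N : ℕ}

/-- The pairing with an integral vector as a continuous linear map. -/
def dotL (n : Fin N → ℤ) : (Fin N → ℂ) →L[ℂ] ℂ :=
  ∑ j, (n j : ℂ) • ContinuousLinearMap.proj (R := ℂ) (φ := fun _ : Fin N => ℂ) j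

lemma dotL_apply (n : Fin N → ℤ) (z : Fin N → ℂ) : dotL n z = dot n z := by
  simp [dotL, dot]

/-- The `ℓ¹` size of an integral vector. -/
def sz (n : Fin N → ℤ) : ℝ := ∑ j, |(n j : ℝ)|

lemma sz_nonneg (n : Fin N → ℤ) : 0 ≤ sz n := Finset.sum_nonneg fun _ _ => abs_nonneg _

lemma norm_dot_le (n : Fin N → ℤ) (z : Fin N → ℂ) : ‖dot n z‖ ≤ sz n * ‖z‖ := by
  rw [dot, sz, Finset.sum_mul]
  refine (norm_sum_le _ _).trans (Finset.sum_le_sum fun j _ => ?_)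
  rw [norm_mul, Complex.norm_intCast]
  exact mul_le_mul_of_nonneg_left (norm_le_pi_norm z j) (abs_nonneg _)

lemma norm_dotL_le (n : Fin N → ℤ) : ‖dotL n‖ ≤ sz n :=
  ContinuousLinearMap.opNorm_le_bound _ (sz_nonneg n) fun z => by
    rw [dotL_apply]; exact norm_dot_le n z

/-- Local domination of an absolutely convergent Fourier series with an exponential margin. -/
lemma exists_local_bound {Ω : Set (Fin N → ℝ)} (hΩ : IsOpen Ω) {c : (Fin N → ℤ) → ℂ}
    (hc : ∀ z ∈ tube Ω, Summable fun n => c n * ee (dot n z)) {z₀ : Fin N → ℂ}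
    (hz₀ : z₀ ∈ tube Ω) : ∃ δ > 0, Metric.ball z₀ δ ⊆ tube Ω ∧ ∃ u : (Fin N → ℤ) → ℝ, Summable u ∧
      ∀ n, ∀ z ∈ Metric.ball z₀ δ,
        Real.exp (2 * Real.pi * δ * sz n) * ‖c n * ee (dot n z)‖ ≤ u n := by
  obtain ⟨δ', hδ', hball⟩ := Metric.isOpen_iff.1 hΩ (imv z₀) hz₀
  set δ := δ' / 4 with hδdef
  have hδ : 0 < δ := by positivity
  have himd : ∀ z ∈ Metric.ball z₀ δ, ∀ j, |imv z j - imv z₀ j| ≤ δ := by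
    intro z hz j
    have h1 := (norm_le_pi_norm (z - z₀) j).trans (mem_ball_iff_norm.1 hz).le
    have h2 := (Complex.abs_im_le_norm ((z - z₀) j)).trans h1
    simpa [imv] using h2
  have hsubs : ∀ z, (∀ j, |imv z j - imv z₀ j| ≤ 2 * δ) → z ∈ tube Ω := by
    intro z hz
    refine hball ?_
    rw [Metric.mem_ball, dist_eq_norm]
    refine lt_of_le_of_lt ((pi_norm_le_iff_of_nonneg (by positivity : (0 : ℝ) ≤ 2 * δ)).2 hz) ?_
    linarith
  refine ⟨δ, hδ, fun z hz => hsubs z fun j => (himd z hz j).trans (by linarith), ?_⟩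
  set zs : (Fin N → Bool) → Fin N → ℂ :=
    fun ε j => z₀ j + Complex.I * ((if ε j then 2 * δ else -(2 * δ) : ℝ) : ℂ)
  have hzs : ∀ ε, zs ε ∈ tube Ω := by
    intro ε
    refine hsubs _ fun j => ?_
    simp only [zs, imv, Complex.add_im, Complex.I_mul_im, Complex.ofReal_re, add_sub_cancel_left]
    split_ifs <;> simp [abs_of_pos hδ]
  refine ⟨fun n => ∑ ε, ‖c n * ee (dot n (zs ε))‖,
    summable_sum fun ε _ => (hc _ (hzs ε)).norm, fun n z hz => ?_⟩
  set ε : Fin N → Bool := fun j => decide (n j < 0)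
  refine le_trans ?_ (Finset.single_le_sum (f := fun ε => ‖c n * ee (dot n (zs ε))‖)
    (fun _ _ => norm_nonneg _) (Finset.mem_univ ε))
  simp only [norm_mul]
  rw [mul_left_comm]
  refine mul_le_mul_of_nonneg_left ?_ (norm_nonneg _)
  rw [norm_ee_dot, norm_ee_dot, ← Real.exp_add, Real.exp_le_exp]
  have key : ∑ j, (n j : ℝ) * imv (zs ε) j + δ * sz n ≤ ∑ j, (n j : ℝ) * imv z j := by
    rw [sz, Finset.mul_sum, ← Finset.sum_add_distrib]
    refine Finset.sum_le_sum fun j _ => ?_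
    have h1 := abs_le.1 (himd z hz j)
    have h2 : imv (zs ε) j = imv z₀ j + if n j < 0 then 2 * δ else -(2 * δ) := by
      simp [zs, ε, imv]
    rw [h2]
    split_ifs with h
    · have h3 : (n j : ℝ) < 0 := by exact_mod_cast h
      rw [abs_of_neg h3]
      nlinarith
    · have h3 : (0 : ℝ) ≤ n j := by exact_mod_cast not_lt.1 h
      rw [abs_of_nonneg h3]
      nlinarith
  nlinarith [Real.pi_pos]

lemma hasFDerivAt_term (c : ℂ) (n : Fin N → ℤ) (z : Fin N → ℂ) :
    HasFDerivAt (fun z => c * ee (dot n z))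
      ((c * (2 * Real.pi * Complex.I * ee (dot n z))) • dotL n) z := by
  have h1 : HasFDerivAt (fun z => dot n z) (dotL n) z := by
    have := (dotL n).hasFDerivAt (x := z)
    exact this.congr_of_eventuallyEq (Eventually.of_forall fun z => (dotL_apply n z).symm)
  have := ((hasDerivAt_ee (dot n z)).comp_hasFDerivAt z h1).const_mul c
  rwa [smul_smul] at this

theorem series_hasFDerivAt {Ω : Set (Fin N → ℝ)} (hΩ : IsOpen Ω) {c : (Fin N → ℤ) → ℂ}
    (hc : ∀ z ∈ tube Ω, Summable fun n => c n * ee (dot n z)) {z₀ : Fin N → ℂ}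
    (hz₀ : z₀ ∈ tube Ω) :
    (Summable fun n => (c n * (2 * Real.pi * Complex.I * ee (dot n z₀))) • dotL n) ∧
    HasFDerivAt (fun z => ∑' n, c n * ee (dot n z))
      (∑' n, (c n * (2 * Real.pi * Complex.I * ee (dot n z₀))) • dotL n) z₀ := by
  obtain ⟨δ, hδ, hsub, u, hu, hb⟩ := exists_local_bound hΩ hc hz₀
  have hbound : ∀ n, ∀ z ∈ Metric.ball z₀ δ,
      ‖(c n * (2 * Real.pi * Complex.I * ee (dot n z))) • dotL n‖ ≤ u n / δ := by
    intro n z hz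
    rw [le_div_iff₀ hδ]
    refine le_trans ?_ (hb n z hz)
    rw [norm_smul, norm_mul, norm_mul, norm_mul, norm_mul, norm_mul, Complex.norm_I, Complex.norm_real,
      Real.norm_of_nonneg Real.pi_pos.le]
    have h1 : 2 * Real.pi * δ * sz n ≤ Real.exp (2 * Real.pi * δ * sz n) :=
      (le_add_of_nonneg_right zero_le_one).trans (Real.add_one_le_exp _)
    have h2 := mul_le_mul_of_nonneg_right h1 (norm_nonneg (c n * ee (dot n z)))
    rw [norm_mul] at h2
    refine le_trans ?_ h2
    have h3 := mul_le_mul_of_nonneg_left (norm_dotL_le n)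
      (show 0 ≤ ‖c n‖ * (2 * Real.pi * ‖ee (dot n z)‖) * δ by have := Real.pi_pos; positivity)
    simp only [Complex.norm_ofNat]
    linarith
  refine ⟨Summable.of_norm_bounded (hu.div_const δ) fun n => hbound n z₀ (Metric.mem_ball_self hδ),
    ?_⟩
  exact hasFDerivAt_tsum_of_isPreconnected (hu.div_const δ) Metric.isOpen_ball
    (convex_ball z₀ δ).isPreconnected (fun n z _ => hasFDerivAt_term (c n) n z) hbound
    (Metric.mem_ball_self hδ) (hc z₀ hz₀) (Metric.mem_ball_self hδ)

theorem series_differentiableOn {Ω : Set (Fin N → ℝ)} (hΩ : IsOpen Ω) {c : (Fin N → ℤ) → ℂ}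
    {f : (Fin N → ℂ) → ℂ} (hc : ∀ z ∈ tube Ω, HasSum (fun n => c n * ee (dot n z)) (f z)) :
    DifferentiableOn ℂ f (tube Ω) := by
  intro z hz
  have := (series_hasFDerivAt hΩ (fun z hz => (hc z hz).summable) hz).2
  refine (this.differentiableAt.congr_of_eventuallyEq ?_).differentiableWithinAt
  filter_upwards [(isOpen_tube hΩ).mem_nhds hz] with w hw
  exact (hc w hw).tsum_eq.symm

theorem series_directional {Ω : Set (Fin N → ℝ)} (hΩ : IsOpen Ω) {c : (Fin N → ℤ) → ℂ}
    {f : (Fin N → ℂ) → ℂ} (hc : ∀ z ∈ tube Ω, HasSum (fun n => c n * ee (dot n z)) (f z))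
    {z w : Fin N → ℂ} {t : ℂ} (hz : z + t • w ∈ tube Ω) :
    HasSum (fun n => (2 * Real.pi * Complex.I * dot n w * c n) * ee (dot n (z + t • w)))
      (deriv (fun t : ℂ => f (z + t • w)) t) := by
  obtain ⟨h1, h2⟩ := series_hasFDerivAt hΩ (fun z hz => (hc z hz).summable) hz
  have h3 : HasFDerivAt f _ (z + t • w) := h2.congr_of_eventuallyEq (by
    filter_upwards [(isOpen_tube hΩ).mem_nhds hz] with w hw
    exact (hc w hw).tsum_eq.symm)
  have h4 : HasDerivAt (fun t : ℂ => z + t • w) w t := by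
    simpa using ((hasDerivAt_id t).smul_const w).const_add z
  have h5 := h3.comp_hasDerivAt t h4
  have h7 : deriv (fun t : ℂ => f (z + t • w)) t = _ := h5.deriv
  rw [h7]
  have h6 := (ContinuousLinearMap.apply ℂ ℂ w).hasSum h1.hasSum
  refine h6.congr_fun fun n => ?_
  simp [dotL_apply]
  ring

theorem series_iteratedDeriv {Ω : Set (Fin N → ℝ)} (hΩ : IsOpen Ω) {c : (Fin N → ℤ) → ℂ}
    {f : (Fin N → ℂ) → ℂ} (hc : ∀ z ∈ tube Ω, HasSum (fun n => c n * ee (dot n z)) (f z))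
    (w : Fin N → ℂ) (j : ℕ) : ∀ {z : Fin N → ℂ} {t : ℂ}, z + t • w ∈ tube Ω →
    HasSum (fun n => ((2 * Real.pi * Complex.I * dot n w) ^ j * c n) * ee (dot n (z + t • w)))
      (iteratedDeriv j (fun t : ℂ => f (z + t • w)) t) := by
  induction j with
  | zero => intro z t hz; simpa using hc _ hz
  | succ j ih =>
    intro z t hz
    have hs : ∀ z ∈ tube Ω, HasSum
        (fun n => ((2 * Real.pi * Complex.I * dot n w) ^ j * c n) * ee (dot n z))
        (iteratedDeriv j (fun t : ℂ => f (z + t • w)) 0) := by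
      intro z hz
      have := ih (z := z) (t := 0) (by simpa using hz)
      simpa using this
    have := series_directional hΩ hs hz
    rw [iteratedDeriv_succ]
    have e : deriv (iteratedDeriv j fun t : ℂ => f (z + t • w)) t =
        deriv (fun t : ℂ => iteratedDeriv j (fun s : ℂ => f (z + t • w + s • w)) 0) t := by
      refine Filter.EventuallyEq.deriv_eq ?_
      have : ∀ᶠ s in 𝓝 t, z + s • w ∈ tube Ω :=
        ((isOpen_tube hΩ).preimage (by fun_prop : Continuous fun s : ℂ => z + s • w)).mem_nhds hz
      filter_upwards [this] with s hs'
      exact (ih hs').unique (hs _ hs')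
    rw [e]
    refine this.congr_fun fun n => ?_
    ring

end

section

/-- The odd Jacobi theta function, normalised to be periodic in both variables. -/
def th (τ x : ℂ) : ℂ := jacobiTheta₂ (x + 1 / 2 + τ / 2) τ

/-- Triangular numbers. -/
def tri (n : ℤ) : ℤ := n * (n + 1) / 2

lemma two_mul_tri (n : ℤ) : 2 * tri n = n * (n + 1) :=
  Int.mul_ediv_cancel' (Int.even_mul_succ_self n).two_dvd

lemma tri_cast (n : ℤ) : (tri n : ℂ) = n * (n + 1) / 2 := by
  have : (2 : ℂ) * tri n = n * (n + 1) := by exact_mod_cast two_mul_tri n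
  linear_combination this / 2

lemma tri_nonneg (n : ℤ) : 0 ≤ tri n := by
  have := two_mul_tri n
  rcases lt_or_ge n 0 with h | h <;> nlinarith

lemma ee_half : ee (1 / 2) = -1 := by
  rw [ee, show 2 * (Real.pi : ℂ) * Complex.I * (1 / 2) = Real.pi * Complex.I by ring,
    Complex.exp_pi_mul_I]

lemma ee_mul_int (n : ℤ) (z : ℂ) : ee (n * z) = ee z ^ n := by
  rw [ee, ee, ← Complex.exp_int_mul]; ring_nf

lemma ee_add_int (z : ℂ) (n : ℤ) : ee (z + n) = ee z := by rw [ee_add, ee_int, mul_one]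

theorem th_hasSum {τ : ℂ} (hτ : 0 < τ.im) (x : ℂ) :
    HasSum (fun n : ℤ => (-1 : ℂ) ^ n * ee (tri n * τ + n * x)) (th τ x) := by
  refine (hasSum_jacobiTheta₂_term (x + 1 / 2 + τ / 2) hτ).congr_fun fun n => ?_
  rw [jacobiTheta₂_term, ← ee_half, ← ee_mul_int, ← ee_add, ee, tri_cast]
  congr 1
  ring

lemma th_add_int (τ x : ℂ) (k : ℤ) (hτ : 0 < τ.im) : th τ (x + k) = th τ x := by
  refine (th_hasSum hτ _).unique ((th_hasSum hτ x).congr_fun fun n => ?_)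
  rw [show (tri n : ℂ) * τ + n * (x + k) = tri n * τ + n * x + ((n * k : ℤ) : ℂ) by push_cast; ring,
    ee_add_int]

lemma th_add_mul_tau (τ x : ℂ) (k : ℤ) (hτ : 0 < τ.im) :
    th τ (x + k * τ) = (-1) ^ k * ee (-(tri k * τ + k * x)) * th τ x := by
  have h1 := ((Equiv.addRight k).hasSum_iff.2 (th_hasSum hτ x)).mul_left
    ((-1) ^ k * ee (-(tri k * τ + k * x)))
  refine (th_hasSum hτ _).unique (h1.congr_fun fun n => ?_)
  simp only [Function.comp, Equiv.coe_addRight]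
  rw [zpow_add₀ (by norm_num : (-1 : ℂ) ≠ 0), show tri n * τ + n * (x + k * τ) =
    -(tri k * τ + k * x) + (tri (n + k) * τ + ((n + k : ℤ) : ℂ) * x) by
      simp only [tri_cast]; push_cast; ring, ee_add]
  have : ((-1 : ℂ) ^ k) * (-1) ^ k = 1 := by
    rw [← mul_zpow]; simp
  linear_combination (-(-1) ^ n * ee (-(tri k * τ + k * x)) *
    ee (tri (n + k) * τ + ((n + k : ℤ) : ℂ) * x)) * this

lemma th_neg (τ x : ℂ) (hτ : 0 < τ.im) : th τ (-x) = -ee x * th τ x := by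
  have h1 := (((Equiv.neg ℤ).trans (Equiv.addRight (-1))).hasSum_iff.2 (th_hasSum hτ x)).mul_left
    (-ee x)
  refine (th_hasSum hτ _).unique (h1.congr_fun fun n => ?_)
  simp only [Function.comp, Equiv.trans_apply, Equiv.neg_apply, Equiv.coe_addRight]
  rw [show tri n * τ + n * (-x) = x + (tri (-n + -1) * τ + ((-n + -1 : ℤ) : ℂ) * x) by
      simp only [tri_cast]; push_cast; ring, ee_add, zpow_add₀ (by norm_num : (-1 : ℂ) ≠ 0),
      _root_.zpow_neg, ← _root_.inv_zpow]
  norm_num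
  ring

lemma th_zero (τ : ℂ) (hτ : 0 < τ.im) : th τ 0 = 0 := by
  have := th_neg τ 0 hτ
  rw [neg_zero, ee_zero] at this
  linear_combination this / 2

lemma differentiable_th {τ : ℂ} (hτ : 0 < τ.im) : Differentiable ℂ (th τ) := by
  intro x
  have := differentiableAt_jacobiTheta₂_fst (x + 1 / 2 + τ / 2) hτ
  unfold th
  exact this.comp x (f := fun x => x + 1 / 2 + τ / 2) (by fun_prop)

/-- The multiplier of `th` under the inversion. -/
def sMul (τ : ℂ) : ℂ := (-Complex.I * τ) ^ (1 / 2 : ℂ) * ee ((τ - 1) ^ 2 / (8 * τ))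

lemma sMul_pow (τ : ℂ) (hτ : 0 < τ.im) : sMul τ ^ 8 = τ ^ 4 * ee (τ + 1 / τ) := by
  have h0 : τ ≠ 0 := by rintro rfl; simp at hτ
  have h1 : ((-Complex.I * τ) ^ (1 / 2 : ℂ)) ^ 8 = τ ^ 4 := by
    have h2 := Complex.cpow_nat_inv_pow (-Complex.I * τ) two_ne_zero
    rw [Nat.cast_ofNat, ← one_div] at h2
    rw [show (8 : ℕ) = 2 * 4 by norm_num, pow_mul, h2, mul_pow, neg_pow, Complex.I_pow_four]
    norm_num
  rw [sMul, mul_pow, h1]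
  congr 1
  have := ee_mul_int 8 ((τ - 1) ^ 2 / (8 * τ))
  have h8 : ee ((τ - 1) ^ 2 / (8 * τ)) ^ (8 : ℤ) = ee ((τ - 1) ^ 2 / (8 * τ)) ^ 8 := by norm_cast
  rw [← h8, ← this, ← ee_add_int (τ + 1 / τ) (-2)]
  congr 1
  field_simp
  push_cast
  ring

theorem th_S (τ x : ℂ) (hτ : 0 < τ.im) :
    th (-1 / τ) (x / τ) = sMul τ * ee (x ^ 2 / (2 * τ) + x / 2 - x / (2 * τ)) * th τ x := by
  have h0 : τ ≠ 0 := by rintro rfl; simp at hτ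
  have hI : (-Complex.I * τ) ^ (1 / 2 : ℂ) ≠ 0 := by
    rw [Complex.cpow_ne_zero_iff]
    left
    simp [h0]
  have h1 := jacobiTheta₂_functional_equation (x + τ / 2 - 1 / 2) τ
  have h2 : jacobiTheta₂ (x + τ / 2 - 1 / 2) τ = th τ x := by
    rw [th, ← jacobiTheta₂_add_left]
    congr 1
    ring
  have h3 : th (-1 / τ) (x / τ) = jacobiTheta₂ ((x + τ / 2 - 1 / 2) / τ) (-1 / τ) := by
    rw [th]
    congr 1
    field_simp
    ring
  rw [h3, ← h2, h1, sMul]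
  have h4 : ee ((τ - 1) ^ 2 / (8 * τ)) * ee (x ^ 2 / (2 * τ) + x / 2 - x / (2 * τ)) *
      Complex.exp (-Real.pi * Complex.I * (x + τ / 2 - 1 / 2) ^ 2 / τ) = 1 := by
    rw [ee, ee, ← Complex.exp_add, ← Complex.exp_add, Complex.exp_eq_one_iff]
    refine ⟨0, ?_⟩
    field_simp
    ring
  generalize (-Complex.I * τ) ^ (1 / 2 : ℂ) = a at hI ⊢
  generalize jacobiTheta₂ ((x + τ / 2 - 1 / 2) / τ) (-1 / τ) = j
  linear_combination (-j) * h4 - j * ee ((τ - 1) ^ 2 / (8 * τ)) *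
    ee (x ^ 2 / (2 * τ) + x / 2 - x / (2 * τ)) *
    Complex.exp (-Real.pi * Complex.I * (x + τ / 2 - 1 / 2) ^ 2 / τ) *
    mul_one_div_cancel hI

end

section

variable {N : ℕ}

/-- The infinite product `∏ (1 - qⁿ ζ)`. -/
def qp (τ x : ℂ) : ℂ := ∏' n : ℕ, (1 + -ee (n * τ + x))

lemma norm_ee_lt_one {τ : ℂ} (hτ : 0 < τ.im) : ‖ee τ‖ < 1 := by
  rw [norm_ee]
  exact Real.exp_lt_one_iff.2 (neg_lt_zero.2 (by positivity))

lemma ee_nat_mul_add (n : ℕ) (τ x : ℂ) : ee (n * τ + x) = ee τ ^ n * ee x := by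
  rw [ee_add]; congr 1
  have := ee_mul_int n τ
  simpa using this

lemma summable_qp {τ : ℂ} (hτ : 0 < τ.im) (x : ℂ) : Summable fun n : ℕ => ‖-ee (n * τ + x)‖ := by
  simp only [norm_neg, ee_nat_mul_add, norm_mul, norm_pow]
  exact (summable_geometric_of_lt_one (norm_nonneg _) (norm_ee_lt_one hτ)).mul_right _

lemma qp_rec {τ : ℂ} (hτ : 0 < τ.im) (x : ℂ) : qp τ x = (1 - ee x) * qp τ (x + τ) := by
  have h : ∀ n : ℕ, ((n + 1 : ℕ) : ℂ) * τ + x = n * τ + (x + τ) := fun n => by push_cast; ring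
  rw [qp, tprod_eq_zero_mul', qp]
  · simp only [h]
    simp [sub_eq_add_neg]
  · simp only [h]
    exact multipliable_one_add_of_summable (summable_qp hτ _)

lemma qp_ne_zero {τ : ℂ} (hτ : 0 < τ.im) {x : ℂ} (h : ∀ n : ℕ, ee (n * τ + x) ≠ 1) :
    qp τ x ≠ 0 :=
  tprod_one_add_ne_zero_of_summable (fun n hn => h n (by linear_combination -hn))
    (summable_qp hτ x)

lemma differentiable_qp {τ : ℂ} (hτ : 0 < τ.im) : Differentiable ℂ (qp τ) := by
  intro x
  set K : Set ℂ := {y | x.im - 1 < y.im}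
  have hK : IsOpen K := isOpen_lt continuous_const Complex.continuous_im
  have h : HasProdLocallyUniformlyOn (fun (n : ℕ) y => 1 + -ee (n * τ + y)) (qp τ) K := by
    refine Summable.hasProdLocallyUniformlyOn_nat_one_add hK
      (u := fun n => ‖ee τ‖ ^ n * Real.exp (-(2 * Real.pi * (x.im - 1))))
      ((summable_geometric_of_lt_one (norm_nonneg _) (norm_ee_lt_one hτ)).mul_right _)
      (.of_forall fun n y hy => ?_) fun n => ?_
    · rw [norm_neg, ee_nat_mul_add, norm_mul, norm_pow, norm_ee y]
      have : x.im - 1 < y.im := hy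
      gcongr
    · have := continuous_ee
      fun_prop
  have hd : DifferentiableOn ℂ (qp τ) K := by
    refine TendstoLocallyUniformlyOn.differentiableOn h (.of_forall fun s => ?_) hK
    have := differentiable_ee
    fun_prop
  exact hd.differentiableAt (hK.mem_nhds (by simp [K]))

/-- The product side of the Jacobi triple product. -/
def jp (τ x : ℂ) : ℂ := qp τ (x + τ) * qp τ (-x)

lemma qp_add_int (τ x : ℂ) (k : ℤ) : qp τ (x + k) = qp τ x := by
  simp only [qp, ← add_assoc, ee_add_int]

lemma jp_add_int (τ x : ℂ) (k : ℤ) : jp τ (x + k) = jp τ x := by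
  have h2 := qp_add_int τ (-x) (-k)
  rw [jp, jp, show x + k + τ = x + τ + k by ring, qp_add_int]
  congr 1
  rw [← h2]; push_cast; ring_nf

lemma jp_add_tau {τ : ℂ} (hτ : 0 < τ.im) (x : ℂ) : jp τ (x + τ) = -ee (-x - τ) * jp τ x := by
  rw [jp, jp, qp_rec hτ (x + τ), qp_rec hτ (-(x + τ)), show -(x + τ) + τ = -x by ring,
    show -x - τ = -(x + τ) by ring, ee_neg]
  field_simp [ee_ne_zero (x + τ)]
  ring

lemma differentiable_jp {τ : ℂ} (hτ : 0 < τ.im) : Differentiable ℂ (jp τ) := by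
  have := differentiable_qp hτ
  unfold jp; fun_prop

lemma exists_jp_eq {τ : ℂ} (hτ : 0 < τ.im) : ∃ C : ℂ, ∀ x, jp τ x = C * th τ x := by
  obtain ⟨c, hc, -⟩ := fourier_expansion (N := 1) isOpen_univ convex_univ
    (f := fun z => jp τ (z 0)) (by
      have := differentiable_jp hτ
      fun_prop) (fun z _ n => by simp only [Pi.add_apply]; exact jp_add_int _ _ _)
  have hc1 : ∀ x, HasSum (fun n : ℤ => c ![n] * ee (n * x)) (jp τ x) := by
    intro x
    have := (Equiv.funUnique (Fin 1) ℤ).symm.hasSum_iff.2 (hc ![x] (Set.mem_univ _))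
    refine this.congr_fun fun n => ?_
    have hn : ((Equiv.funUnique (Fin 1) ℤ).symm n) = ![n] := by ext i; simp
    simp only [Function.comp, hn, dot]
    simp
  have hrec : ∀ n : ℤ, c ![n + 1] = -ee ((n + 1) * τ) * c ![n] := by
    have h1 : ∀ x : ℂ, HasSum (fun n : ℤ => (c ![n] * ee (n * τ) + c ![n + 1] * ee (-τ)) *
        ee (n * x)) 0 := by
      intro x
      have e1 := hc1 (x + τ)
      have e2 := ((Equiv.addRight (1 : ℤ)).hasSum_iff.2 (hc1 x)).mul_left (ee (-x - τ))
      have e3 := e1.add e2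
      rw [jp_add_tau hτ, neg_mul, neg_add_cancel] at e3
      refine e3.congr_fun fun n => ?_
      simp only [Function.comp, Equiv.coe_addRight]
      rw [show ee ((n : ℂ) * (x + τ)) = ee (n * τ) * ee (n * x) by rw [← ee_add]; ring_nf,
        show ee (((n + 1 : ℤ) : ℂ) * x) = ee (n * x) * ee x by
          rw [← ee_add]; push_cast; ring_nf,
        show ee (-x - τ) = ee (-τ) * (ee x)⁻¹ by rw [← ee_neg, ← ee_add]; ring_nf]
      field_simp [ee_ne_zero x]
    have h2 : (fun n : Fin 1 → ℤ => c ![n 0] * ee (n 0 * τ) + c ![n 0 + 1] * ee (-τ)) = 0 := by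
      have key : ∀ x : ℂ, HasSum (fun n : Fin 1 → ℤ => (c ![n 0] * ee (n 0 * τ) +
          c ![n 0 + 1] * ee (-τ)) * ee (n 0 * x)) 0 := by
        intro x
        exact (Equiv.funUnique (Fin 1) ℤ).hasSum_iff.2 (h1 x)
      refine fourier_unique ?_ fun x => ?_
      · refine (key 0).summable.congr fun n => ?_
        rw [mul_zero, ee_zero, mul_one]
      · rw [← (key (x 0)).tsum_eq]
        simp [dot, rc]
    intro n
    have h3 := congrFun h2 ![n]
    simp only [Matrix.cons_val_zero, Pi.zero_apply] at h3
    rw [show ((n : ℂ) + 1) * τ = n * τ + τ by ring, ee_add]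
    rw [ee_neg] at h3
    have := ee_ne_zero τ
    field_simp at h3
    linear_combination h3
  have hval : ∀ n : ℤ, c ![n] = c ![0] * ((-1) ^ n * ee (tri n * τ)) := by
    have hstep : ∀ n : ℤ, ((-1 : ℂ) ^ (n + 1) * ee (tri (n + 1) * τ)) =
        -ee ((n + 1) * τ) * ((-1) ^ n * ee (tri n * τ)) := by
      intro n
      rw [show (tri (n + 1) : ℂ) * τ = (n + 1) * τ + tri n * τ by
        simp only [tri_cast]; push_cast; ring, ee_add, zpow_add₀ (by norm_num : (-1 : ℂ) ≠ 0)]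
      ring
    intro n
    induction n using Int.induction_on with
    | zero => simp [tri, ee_zero]
    | succ k ih =>
      rw [hrec, hstep, ih]; ring
    | pred k ih =>
      have h1 := hrec (-k - 1)
      have h2 := hstep (-k - 1)
      rw [sub_add_cancel] at h1 h2
      rw [h1, h2] at ih
      have h3 := ee_ne_zero ((((-k - 1 : ℤ) : ℂ) + 1) * τ)
      apply mul_left_cancel₀ (neg_ne_zero.2 h3)
      rw [ih]; ring
  refine ⟨c ![0], fun x => (hc1 x).unique (((th_hasSum hτ x).mul_left _).congr_fun fun n => ?_)⟩
  rw [hval, ee_add]; ring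

lemma ee_eq_one {z : ℂ} (h : ee z = 1) : ∃ n : ℤ, z = n := by
  rw [ee, Complex.exp_eq_one_iff] at h
  obtain ⟨n, hn⟩ := h
  refine ⟨n, ?_⟩
  have : 2 * (Real.pi : ℂ) * Complex.I ≠ 0 := Complex.two_pi_I_ne_zero
  apply mul_left_cancel₀ this
  rw [hn]; ring

lemma jp_ne_zero {τ : ℂ} (hτ : 0 < τ.im) {x : ℂ} (h : ∀ k l : ℤ, x ≠ k * τ + l) :
    jp τ x ≠ 0 := by
  refine mul_ne_zero (qp_ne_zero hτ fun n hn => ?_) (qp_ne_zero hτ fun n hn => ?_)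
  · obtain ⟨l, hl⟩ := ee_eq_one hn
    exact h (-(n + 1)) l (by push_cast; linear_combination hl)
  · obtain ⟨l, hl⟩ := ee_eq_one hn
    exact h n (-l) (by push_cast; linear_combination -hl)

lemma th_ne_zero {τ : ℂ} (hτ : 0 < τ.im) {x : ℂ} (h : ∀ k l : ℤ, x ≠ k * τ + l) :
    th τ x ≠ 0 := by
  obtain ⟨C, hC⟩ := exists_jp_eq hτ
  have := jp_ne_zero hτ h
  rw [hC] at this
  exact right_ne_zero_of_mul this

/-- The derivative of the odd theta function at the origin. -/
def thD (τ : ℂ) : ℂ := deriv (th τ) 0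

lemma thD_ne_zero {τ : ℂ} (hτ : 0 < τ.im) : thD τ ≠ 0 := by
  obtain ⟨C, hC⟩ := exists_jp_eq hτ
  have h1 : HasDerivAt (jp τ) (C * thD τ) 0 := by
    have := ((differentiable_th hτ) 0).hasDerivAt.const_mul C
    rwa [show (fun y => C * th τ y) = jp τ from funext fun x => (hC x).symm] at this
  have h2 : HasDerivAt (fun x => (1 - ee (-x)) * (qp τ (x + τ) * qp τ (-x + τ)))
      (2 * Real.pi * Complex.I * (qp τ τ * qp τ τ)) 0 := by
    have hA : HasDerivAt (fun x : ℂ => 1 - ee (-x)) (2 * Real.pi * Complex.I) 0 := by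
      have := ((hasDerivAt_ee (-0)).comp 0 (hasDerivAt_neg (0 : ℂ))).const_sub 1
      simpa [ee_zero, Function.comp_def] using this
    have hB : DifferentiableAt ℂ (fun x => qp τ (x + τ) * qp τ (-x + τ)) 0 := by
      have := differentiable_qp hτ
      fun_prop
    have := hA.mul hB.hasDerivAt
    simpa [ee_zero, Pi.mul_def] using this
  have h3 : (fun x => (1 - ee (-x)) * (qp τ (x + τ) * qp τ (-x + τ))) = jp τ := by
    funext x
    rw [jp, qp_rec hτ (-x)]; ring
  rw [h3] at h2
  have h4 := h1.unique h2
  have h5 : qp τ τ ≠ 0 := qp_ne_zero hτ fun n hn => by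
    have : ‖ee (n * τ + τ)‖ < 1 := norm_ee_lt_one (by
      have : 0 ≤ (n : ℝ) * τ.im := by positivity
      simp only [Complex.add_im, Complex.mul_im, Complex.natCast_re, Complex.natCast_im]
      linarith)
    rw [hn] at this
    simp at this
  intro h0
  rw [h0, mul_zero] at h4
  exact mul_ne_zero Complex.two_pi_I_ne_zero (mul_ne_zero h5 h5) h4.symm

lemma thD_S (τ : ℂ) (hτ : 0 < τ.im) : thD (-1 / τ) = τ * sMul τ * thD τ := by
  have h0 : τ ≠ 0 := by rintro rfl; simp at hτ
  have hτ' : 0 < (-1 / τ).im := by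
    rw [neg_div, one_div, Complex.neg_im, Complex.inv_im, neg_div, neg_neg]
    exact div_pos hτ (Complex.normSq_pos.2 h0)
  have h1 : HasDerivAt (fun x => th (-1 / τ) (x / τ)) (thD (-1 / τ) * (1 / τ)) 0 := by
    have e1 : HasDerivAt (th (-1 / τ)) (thD (-1 / τ)) (0 / τ) := by
      rw [zero_div]; exact ((differentiable_th hτ') 0).hasDerivAt
    exact e1.comp (0 : ℂ) ((hasDerivAt_id (0 : ℂ)).div_const τ)
  have h2 : HasDerivAt (fun x => sMul τ * ee (x ^ 2 / (2 * τ) + x / 2 - x / (2 * τ)) * th τ x)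
      (sMul τ * thD τ) 0 := by
    have hA : DifferentiableAt ℂ (fun x => sMul τ * ee (x ^ 2 / (2 * τ) + x / 2 - x / (2 * τ)))
        0 := by
      have := differentiable_ee
      fun_prop
    have := hA.hasDerivAt.mul ((differentiable_th hτ) 0).hasDerivAt
    rw [th_zero τ hτ] at this
    simpa [ee_zero, Pi.mul_def, thD] using this
  rw [show (fun x => sMul τ * ee (x ^ 2 / (2 * τ) + x / 2 - x / (2 * τ)) * th τ x) =
    fun x => th (-1 / τ) (x / τ) from funext fun x => (th_S τ x hτ).symm] at h2
  have := h1.unique h2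
  linear_combination τ * this - thD (-1 / τ) * mul_one_div_cancel h0

end

section

/-- Indices of Fourier expansions in three variables. -/
abbrev T3 : Type := ℤ × ℤ × ℤ

/-- The character attached to an index. -/
def e3 (T : T3) (τ x₁ x₂ : ℂ) : ℂ := ee (T.1 * τ + T.2.1 * x₁ + T.2.2 * x₂)

lemma e3_add (S T : T3) (τ x₁ x₂ : ℂ) : e3 (S + T) τ x₁ x₂ = e3 S τ x₁ x₂ * e3 T τ x₁ x₂ := by
  rw [e3, e3, e3, ← ee_add]
  congr 1
  simp only [Prod.fst_add, Prod.snd_add, Int.cast_add]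
  ring

lemma e3_ne_zero (T : T3) (τ x₁ x₂ : ℂ) : e3 T τ x₁ x₂ ≠ 0 := ee_ne_zero _

lemma norm_e3 (T : T3) (τ x₁ x₂ : ℂ) : ‖e3 T τ x₁ x₂‖ =
    Real.exp (-(2 * Real.pi * (T.1 * τ.im + T.2.1 * x₁.im + T.2.2 * x₂.im))) := by
  rw [e3, norm_ee]; simp

/-- Vectors of integers as triples. -/
def vec3 : (Fin 3 → ℤ) ≃ T3 where
  toFun n := (n 0, n 1, n 2)
  invFun T := ![T.1, T.2.1, T.2.2]
  left_inv n := by ext i; fin_cases i <;> rfl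
  right_inv T := rfl

lemma ee_dot_vec3 (n : Fin 3 → ℤ) (z : Fin 3 → ℂ) :
    ee (dot n z) = e3 (vec3 n) (z 0) (z 1) (z 2) := by
  simp only [dot, Fin.sum_univ_three]
  rfl

theorem fourier3 {Ω : Set (Fin 3 → ℝ)} (hΩ : IsOpen Ω) (hconv : Convex ℝ Ω) {f : ℂ → ℂ → ℂ → ℂ}
    (hf : DifferentiableOn ℂ (fun z : Fin 3 → ℂ => f (z 0) (z 1) (z 2)) (tube Ω))
    (hp : ∀ τ x₁ x₂, ![τ.im, x₁.im, x₂.im] ∈ Ω → ∀ a b c : ℤ,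
      f (τ + a) (x₁ + b) (x₂ + c) = f τ x₁ x₂) :
    ∃ c : T3 → ℂ, (∀ τ x₁ x₂, ![τ.im, x₁.im, x₂.im] ∈ Ω →
        HasSum (fun T => c T * e3 T τ x₁ x₂) (f τ x₁ x₂)) ∧
      ∀ τ x₁ x₂, ![τ.im, x₁.im, x₂.im] ∈ Ω → ∀ M,
        (∀ a b c : ℝ, ‖f (τ + a) (x₁ + b) (x₂ + c)‖ ≤ M) → ∀ T, ‖c T * e3 T τ x₁ x₂‖ ≤ M := by
  have him : ∀ z : Fin 3 → ℂ, imv z = ![(z 0).im, (z 1).im, (z 2).im] := by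
    intro z; ext i; fin_cases i <;> rfl
  obtain ⟨c, h1, h2⟩ := fourier_expansion hΩ hconv hf (fun z hz n => by
    have hz' : imv z ∈ Ω := hz
    rw [him] at hz'
    exact hp _ _ _ hz' (n 0) (n 1) (n 2))
  refine ⟨fun T => c (vec3.symm T), fun τ x₁ x₂ h => ?_, fun τ x₁ x₂ h M hM T => ?_⟩
  · rw [← vec3.hasSum_iff]
    refine (h1 ![τ, x₁, x₂] (by rw [tube, Set.mem_ofPred_eq, him]; exact h)).congr_fun fun n => ?_
    rw [ee_dot_vec3]
    simp
  · have := h2 ![τ, x₁, x₂] (by rw [tube, Set.mem_ofPred_eq, him]; exact h) M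
      (fun x => hM (x 0) (x 1) (x 2)) (vec3.symm T)
    rw [ee_dot_vec3] at this
    simpa using this

theorem unique3 {c : T3 → ℂ} {τ x₁ x₂ : ℂ}
    (h : ∀ s t u : ℝ, HasSum (fun T => c T * e3 T (τ + s) (x₁ + t) (x₂ + u)) 0) : c = 0 := by
  have key : (fun n : Fin 3 → ℤ => c (vec3 n) * e3 (vec3 n) τ x₁ x₂) = 0 := by
    have h' : ∀ x : Fin 3 → ℝ, HasSum (fun n : Fin 3 → ℤ =>
        (c (vec3 n) * e3 (vec3 n) τ x₁ x₂) * ee (dot n (rc x))) 0 := fun x => by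
      have := vec3.hasSum_iff.2 (h (x 0) (x 1) (x 2))
      refine this.congr_fun fun n => ?_
      rw [ee_dot_vec3, Function.comp, mul_assoc]
      congr 1
      rw [e3, e3, e3, ← ee_add]
      congr 1
      simp only [rc]
      ring
    refine fourier_unique ?_ fun x => (h' x).tsum_eq
    refine (h' 0).summable.congr fun n => ?_
    rw [ee_dot_vec3]
    simp [e3, rc, ee_zero]
  funext T
  have := congrFun key (vec3.symm T)
  simpa [e3_ne_zero] using this

/-- Uniqueness of Fourier expansions in two variables. -/
theorem unique2 {c : ℤ × ℤ → ℂ} {x y : ℂ}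
    (h : ∀ s t : ℝ, HasSum (fun T : ℤ × ℤ => c T * ee (T.1 * (x + s) + T.2 * (y + t))) 0) :
    c = 0 := by
  let ι : ℤ × ℤ → T3 := fun T => (T.1, T.2, 0)
  have hι : Function.Injective ι := fun a b hab => by simpa [ι, Prod.ext_iff] using hab
  have := unique3 (c := Function.extend ι c 0) (τ := x) (x₁ := y) (x₂ := 0) fun s t u => by
    rw [← hι.hasSum_iff]
    · refine (h s t).congr_fun fun T => ?_
      simp [hι.extend_apply, e3, ι]
    · intro T hT
      rw [Function.extend_apply' _ _ _ (by simpa using hT)]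
      simp
  funext T
  have := congrFun this (ι T)
  rwa [hι.extend_apply] at this

/-- Uniqueness of Fourier expansions in one variable. -/
theorem unique1 {c : ℤ → ℂ} {x : ℂ}
    (h : ∀ s : ℝ, HasSum (fun n : ℤ => c n * ee (n * (x + s))) 0) : c = 0 := by
  let ι : ℤ → ℤ × ℤ := fun n => (n, 0)
  have hι : Function.Injective ι := fun a b hab => by simpa [ι] using hab
  have := unique2 (c := Function.extend ι c 0) (x := x) (y := 0) fun s t => by
    rw [← hι.hasSum_iff]
    · refine (h s).congr_fun fun T => ?_
      simp [hι.extend_apply, ι]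
    · intro T hT
      rw [Function.extend_apply' _ _ _ (by simpa using hT)]
      simp
  funext T
  have := congrFun this (ι T)
  rwa [hι.extend_apply] at this

/-- `f` has the absolutely convergent Fourier expansion with coefficients `c`, supported on
non-negative powers of `q`. -/
def Rep (c : T3 → ℂ) (f : ℂ → ℂ → ℂ → ℂ) : Prop :=
  (∀ T : T3, T.1 < 0 → c T = 0) ∧
    ∀ τ x₁ x₂ : ℂ, 0 < τ.im → HasSum (fun T => c T * e3 T τ x₁ x₂) (f τ x₁ x₂)

/-- The half space where `Rep` expansions converge. -/
def UH3 : Set (Fin 3 → ℝ) := {y | 0 < y 0}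

lemma isOpen_UH3 : IsOpen UH3 := isOpen_lt continuous_const (continuous_apply 0)

lemma convex_UH3 : Convex ℝ UH3 := by
  have : UH3 = (LinearMap.proj (R := ℝ) (φ := fun _ : Fin 3 => ℝ) 0) ⁻¹' Set.Ioi 0 := by
    ext; simp [UH3]
  rw [this]
  exact (convex_Ioi 0).linear_preimage _

lemma Rep.hasSum_vec {c : T3 → ℂ} {f : ℂ → ℂ → ℂ → ℂ} (h : Rep c f) {z : Fin 3 → ℂ}
    (hz : z ∈ tube UH3) :
    HasSum (fun n => c (vec3 n) * ee (dot n z)) (f (z 0) (z 1) (z 2)) := by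
  have := vec3.hasSum_iff.2 (h.2 (z 0) (z 1) (z 2) hz)
  exact this.congr_fun fun n => by rw [ee_dot_vec3]; rfl

lemma Rep.differentiableOn {c : T3 → ℂ} {f : ℂ → ℂ → ℂ → ℂ} (h : Rep c f) :
    DifferentiableOn ℂ (fun z : Fin 3 → ℂ => f (z 0) (z 1) (z 2)) (tube UH3) :=
  series_differentiableOn isOpen_UH3 fun _ hz => h.hasSum_vec hz

lemma Rep.periodic {c : T3 → ℂ} {f : ℂ → ℂ → ℂ → ℂ} (h : Rep c f) {τ : ℂ} (hτ : 0 < τ.im)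
    (x₁ x₂ : ℂ) (k l m : ℤ) : f (τ + k) (x₁ + l) (x₂ + m) = f τ x₁ x₂ := by
  refine (h.2 _ _ _ (by simpa using hτ)).unique ((h.2 τ x₁ x₂ hτ).congr_fun fun T => ?_)
  rw [show e3 T τ x₁ x₂ = _ from (ee_add_int _ (T.1 * k + T.2.1 * l + T.2.2 * m)).symm, e3]
  congr 2
  push_cast
  ring

lemma Rep.unique {c c' : T3 → ℂ} {f : ℂ → ℂ → ℂ → ℂ} (h : Rep c f) (h' : Rep c' f) : c = c' := by
  rw [← sub_eq_zero]
  refine unique3 (τ := Complex.I) (x₁ := 0) (x₂ := 0) fun s t u => ?_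
  have hI : 0 < (Complex.I + s).im := by simp
  have := (h.2 _ (0 + t) (0 + u) hI).sub (h'.2 _ (0 + t) (0 + u) hI)
  rw [sub_self] at this
  exact this.congr_fun fun T => by rw [Pi.sub_apply, sub_mul]

theorem Rep.coeff_le {c : T3 → ℂ} {f : ℂ → ℂ → ℂ → ℂ} (h : Rep c f) {τ x₁ x₂ : ℂ}
    (hτ : 0 < τ.im) {M : ℝ} (hM : ∀ s t u : ℝ, ‖f (τ + s) (x₁ + t) (x₂ + u)‖ ≤ M) (T : T3) :
    ‖c T * e3 T τ x₁ x₂‖ ≤ M := by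
  obtain ⟨c', h1, h2⟩ := fourier3 isOpen_UH3 convex_UH3 h.differentiableOn
    fun τ x₁ x₂ hm k l m => h.periodic hm x₁ x₂ k l m
  have : c = c' := by
    rw [← sub_eq_zero]
    refine unique3 (τ := Complex.I) (x₁ := 0) (x₂ := 0) fun s t u => ?_
    have hI : 0 < (Complex.I + s).im := by simp
    have := (h.2 _ (0 + t) (0 + u) hI).sub (h1 _ (0 + t) (0 + u) hI)
    rw [sub_self] at this
    exact this.congr_fun fun T => by rw [Pi.sub_apply, sub_mul]
  rw [this]
  exact h2 τ x₁ x₂ hτ M hM T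

lemma Rep.const_mul {c : T3 → ℂ} {f : ℂ → ℂ → ℂ → ℂ} (a : ℂ) (h : Rep c f) :
    Rep (fun T => a * c T) fun τ x₁ x₂ => a * f τ x₁ x₂ :=
  ⟨fun T hT => by simp [h.1 T hT], fun τ x₁ x₂ hτ =>
    ((h.2 τ x₁ x₂ hτ).mul_left a).congr_fun fun T => mul_assoc _ _ _⟩

lemma Rep.sub {c c' : T3 → ℂ} {f f' : ℂ → ℂ → ℂ → ℂ} (h : Rep c f) (h' : Rep c' f') :
    Rep (fun T => c T - c' T) fun τ x₁ x₂ => f τ x₁ x₂ - f' τ x₁ x₂ :=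
  ⟨fun T hT => by simp [h.1 T hT, h'.1 T hT], fun τ x₁ x₂ hτ =>
    ((h.2 τ x₁ x₂ hτ).sub (h'.2 τ x₁ x₂ hτ)).congr_fun fun T => sub_mul _ _ _⟩

lemma Rep.sum {ι : Type*} (s : Finset ι) {c : ι → T3 → ℂ} {f : ι → ℂ → ℂ → ℂ → ℂ}
    (h : ∀ i ∈ s, Rep (c i) (f i)) :
    Rep (fun T => ∑ i ∈ s, c i T) fun τ x₁ x₂ => ∑ i ∈ s, f i τ x₁ x₂ :=
  ⟨fun T hT => Finset.sum_eq_zero fun i hi => (h i hi).1 T hT, fun τ x₁ x₂ hτ =>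
    (hasSum_sum fun i hi => (h i hi).2 τ x₁ x₂ hτ).congr_fun fun _ => Finset.sum_mul _ _ _⟩

/-- Multiplication of absolutely convergent expansions in characters of a group. -/
theorem hasSum_conv {ι : Type*} [AddCommGroup ι] {χ a b : ι → ℂ} (hχ : ∀ S T, χ (S + T) = χ S * χ T)
    {x y : ℂ} (ha : HasSum (fun T => a T * χ T) x) (hb : HasSum (fun T => b T * χ T) y) :
    HasSum (fun T => (∑' S, a S * b (T - S)) * χ T) (x * y) := by
  have hs : Summable fun p : ι × ι => (a p.1 * χ p.1) * (b p.2 * χ p.2) :=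
    summable_mul_of_summable_norm (f := fun T => a T * χ T) (g := fun T => b T * χ T)
      ha.summable.norm hb.summable.norm
  have h1 := ha.mul hb hs
  let e : ι × ι ≃ ι × ι :=
    { toFun := fun p => (p.2, p.1 - p.2)
      invFun := fun p => (p.1 + p.2, p.1)
      left_inv := fun p => by simp
      right_inv := fun p => by simp }
  have h2 := e.hasSum_iff.2 h1
  have h3 : HasSum (fun p : ι × ι => a p.2 * b (p.1 - p.2) * χ p.1) (x * y) := by
    refine h2.congr_fun fun p => ?_
    simp only [Function.comp, e, Equiv.coe_fn_mk]
    have := hχ p.2 (p.1 - p.2)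
    rw [add_sub_cancel] at this
    rw [this]; ring
  refine (h3.prod_fiberwise fun T => ((h3.summable.prod_factor T).hasSum)).congr_fun fun T => ?_
  exact tsum_mul_right.symm

lemma Rep.mul {c c' : T3 → ℂ} {f f' : ℂ → ℂ → ℂ → ℂ} (h : Rep c f) (h' : Rep c' f') :
    Rep (fun T => ∑' S, c S * c' (T - S)) fun τ x₁ x₂ => f τ x₁ x₂ * f' τ x₁ x₂ := by
  refine ⟨fun T hT => ?_, fun τ x₁ x₂ hτ =>
    hasSum_conv (fun S T => e3_add S T τ x₁ x₂) (h.2 τ x₁ x₂ hτ) (h'.2 τ x₁ x₂ hτ)⟩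
  refine (tsum_congr fun S => ?_).trans tsum_zero
  rcases lt_or_ge S.1 0 with hS | hS
  · rw [h.1 S hS, zero_mul]
  · rw [h'.1 (T - S) (by rw [Prod.fst_sub]; omega), mul_zero]

/-- Expansions over an arbitrary index type give expansions of the standard shape. -/
lemma Rep.of_family {κ : Type*} (ι : κ → T3) (hι : ∀ k, 0 ≤ (ι k).1) (a : κ → ℂ)
    {f : ℂ → ℂ → ℂ → ℂ}
    (h : ∀ τ x₁ x₂ : ℂ, 0 < τ.im → HasSum (fun k => a k * e3 (ι k) τ x₁ x₂) (f τ x₁ x₂)) :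
    ∃ c, Rep c f := by
  refine ⟨fun T => ∑' k : ι ⁻¹' {T}, a k, fun T hT => ?_, fun τ x₁ x₂ hτ => ?_⟩
  · have : IsEmpty (ι ⁻¹' {T}) := ⟨fun ⟨k, hk⟩ => by
      have h1 := hι k
      rw [show ι k = T from hk] at h1
      omega⟩
    exact tsum_empty
  · refine ((h τ x₁ x₂ hτ).tsum_fiberwise ι).congr_fun fun T => ?_
    rw [← tsum_mul_right]
    refine tsum_congr fun k => ?_
    rw [show ι k = T from k.2]

lemma Rep.exp (T : T3) (hT : 0 ≤ T.1) : ∃ c, Rep c fun τ x₁ x₂ => e3 T τ x₁ x₂ :=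
  Rep.of_family (κ := Unit) (fun _ => T) (fun _ => hT) (fun _ => 1) fun τ x₁ x₂ _ => by
    simp

lemma Rep.reindex {c : T3 → ℂ} {f g : ℂ → ℂ → ℂ → ℂ} (h : Rep c f) (e : T3 ≃ T3)
    (he : ∀ T, (e T).1 = T.1) (hg : ∀ τ x₁ x₂, ∃ y₁ y₂, g τ x₁ x₂ = f τ y₁ y₂ ∧
      ∀ T, e3 (e T) τ y₁ y₂ = e3 T τ x₁ x₂) :
    Rep (fun T => c (e T)) g := by
  refine ⟨fun T hT => h.1 _ (by rwa [he]), fun τ x₁ x₂ hτ => ?_⟩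
  obtain ⟨y₁, y₂, h1, h2⟩ := hg τ x₁ x₂
  rw [h1]
  refine (e.hasSum_iff.2 (h.2 τ y₁ y₂ hτ)).congr_fun fun T => ?_
  rw [Function.comp, h2]

lemma Rep.continuous {c : T3 → ℂ} {f : ℂ → ℂ → ℂ → ℂ} (h : Rep c f) {τ : ℂ} (hτ : 0 < τ.im)
    {p q : ℂ → ℂ} (hp : Continuous p) (hq : Continuous q) : Continuous fun t => f τ (p t) (q t) := by
  rw [continuous_iff_continuousAt]
  intro t
  have h1 := (h.differentiableOn.differentiableAt (x := ![τ, p t, q t])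
    ((isOpen_tube isOpen_UH3).mem_nhds hτ)).continuousAt
  have h2 : ContinuousAt (fun t => ![τ, p t, q t]) t := by
    refine Continuous.continuousAt (continuous_pi fun i => ?_)
    fin_cases i
    · exact continuous_const
    · exact hp
    · exact hq
  exact ContinuousAt.comp (f := fun t => ![τ, p t, q t]) h1 h2

lemma Rep.differentiable {c : T3 → ℂ} {f : ℂ → ℂ → ℂ → ℂ} (h : Rep c f) {τ : ℂ} (hτ : 0 < τ.im)
    {p q : ℂ → ℂ} (hp : Differentiable ℂ p) (hq : Differentiable ℂ q) :
    Differentiable ℂ fun t => f τ (p t) (q t) := by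
  intro t
  have h1 := (h.differentiableOn.differentiableAt (x := ![τ, p t, q t])
    ((isOpen_tube isOpen_UH3).mem_nhds hτ))
  have h2 : DifferentiableAt ℂ (fun t => ![τ, p t, q t]) t := by
    rw [differentiableAt_pi]
    intro i
    fin_cases i
    · exact differentiableAt_const _
    · exact hp t
    · exact hq t
  exact DifferentiableAt.comp (f := fun t => ![τ, p t, q t]) t h1 h2

end

section

variable {N : ℕ}

lemma exists_entire_quotient {d f : ℂ → ℂ} (hd : Differentiable ℂ d) (hf : Differentiable ℂ f)
    (hne : ∀ x, analyticOrderAt d x ≠ ⊤) (hle : ∀ x, analyticOrderAt d x ≤ analyticOrderAt f x) :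
    ∃ h : ℂ → ℂ, Differentiable ℂ h ∧ ∀ x, f x = d x * h x := by
  have hloc : ∀ x, ∃ k : ℂ → ℂ, AnalyticAt ℂ k x ∧ (∀ᶠ y in 𝓝 x, f y = d y * k y) ∧
      ∀ᶠ y in 𝓝[≠] x, d y ≠ 0 := by
    intro x
    obtain ⟨u, hu, hu0, hdu⟩ := ((hd.analyticAt x).analyticOrderAt_ne_top).1 (hne x)
    obtain ⟨v, hv, hfv⟩ := (natCast_le_analyticOrderAt (hf.analyticAt x)).1
      ((ENat.natCast_toNat (hne x)).trans_le (hle x))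
    have hune : ∀ᶠ y in 𝓝 x, u y ≠ 0 := hu.continuousAt.eventually_ne hu0
    refine ⟨fun y => v y / u y, hv.div hu hu0, ?_, ?_⟩
    · filter_upwards [hdu, hfv, hune] with y h1 h2 h3
      rw [h1, h2]
      simp only [smul_eq_mul, analyticOrderNatAt]
      field_simp
    · filter_upwards [nhdsWithin_le_nhds hdu, nhdsWithin_le_nhds hune, self_mem_nhdsWithin]
        with y h1 h2 h3
      rw [h1]
      exact mul_ne_zero (pow_ne_zero _ (sub_ne_zero.2 h3)) h2
  choose k hk1 hk2 hk3 using hloc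
  refine ⟨fun x => k x x, fun x => ?_, fun x => (hk2 x).self_of_nhds⟩
  refine (hk1 x).differentiableAt.congr_of_eventuallyEq ?_
  have h1 : ∀ᶠ y in 𝓝 x, y ≠ x → d y ≠ 0 := eventually_nhdsWithin_iff.1 (hk3 x)
  filter_upwards [h1, hk2 x] with y h1 h2
  rcases eq_or_ne y x with rfl | hy
  · rfl
  · exact mul_left_cancel₀ (h1 hy) ((hk2 y).self_of_nhds.symm.trans h2)

/-- The open cone of imaginary parts between consecutive walls. -/
def cham (k : ℤ) : Set (Fin 3 → ℝ) := {y | 0 < y 0 ∧ k * y 0 < y 2 ∧ y 2 < (k + 1) * y 0}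

lemma isOpen_cham (k : ℤ) : IsOpen (cham k) := by
  have h0 := continuous_apply (A := fun _ : Fin 3 => ℝ) 0
  have h2 := continuous_apply (A := fun _ : Fin 3 => ℝ) 2
  exact (isOpen_lt continuous_const h0).inter ((isOpen_lt (continuous_const.mul h0) h2).inter
    (isOpen_lt h2 (continuous_const.mul h0)))

lemma convex_cham (k : ℤ) : Convex ℝ (cham k) := by
  rintro x ⟨hx0, hx1, hx2⟩ y ⟨hy0, hy1, hy2⟩ a b ha hb hab
  rcases ha.eq_or_lt with rfl | ha
  · rw [zero_add] at hab
    subst hab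
    simpa using ⟨hy0, hy1, hy2⟩
  · refine ⟨?_, ?_, ?_⟩ <;> simp only [Pi.add_apply, Pi.smul_apply, smul_eq_mul] <;>
      nlinarith [mul_lt_mul_of_pos_left hx0 ha, mul_le_mul_of_nonneg_left hy0.le hb,
        mul_lt_mul_of_pos_left hx1 ha, mul_le_mul_of_nonneg_left hy1.le hb,
        mul_lt_mul_of_pos_left hx2 ha, mul_le_mul_of_nonneg_left hy2.le hb]

lemma cham_subset (k : ℤ) : cham k ⊆ UH3 := fun _ h => h.1

/-- Every height is in a chamber or on a wall. -/
lemma exists_cham {v : ℝ} (hv : 0 < v) (y : ℝ) :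
    ∃ k : ℤ, y = k * v ∨ (k * v < y ∧ y < (k + 1) * v) := by
  refine ⟨⌊y / v⌋, ?_⟩
  have h1 := Int.floor_le (y / v)
  have h2 := Int.lt_floor_add_one (y / v)
  rw [le_div_iff₀ hv] at h1
  rw [div_lt_iff₀ hv] at h2
  rcases h1.eq_or_lt with h | h
  · exact Or.inl h.symm
  · exact Or.inr ⟨h, h2⟩

lemma swapHasSum {c : T3 → ℂ} {τ x₁ x₂ s : ℂ} (h : HasSum (fun T => c T * e3 T τ x₁ x₂) s) :
    HasSum (fun r : ℤ => (∑' p : ℤ × ℤ, c (p.1, p.2, r) * ee (p.1 * τ + p.2 * x₁)) * ee (r * x₂)) s := by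
  let e : ℤ × (ℤ × ℤ) ≃ T3 :=
    { toFun := fun p => (p.2.1, p.2.2, p.1)
      invFun := fun T => (T.2.2, (T.1, T.2.1))
      left_inv := fun _ => rfl
      right_inv := fun _ => rfl }
  have h1 := e.hasSum_iff.2 h
  refine (h1.prod_fiberwise fun r => (h1.summable.prod_factor r).hasSum).congr_fun fun r => ?_
  rw [← tsum_mul_right]
  refine tsum_congr fun p => ?_
  simp only [Function.comp, e, Equiv.coe_fn_mk, e3]
  rw [mul_assoc, ← ee_add]

lemma summable_slice {c : T3 → ℂ} {τ x₁ x₂ : ℂ} (h : Summable fun T => c T * e3 T τ x₁ x₂) (r : ℤ) :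
    Summable fun p : ℤ × ℤ => c (p.1, p.2, r) * ee (p.1 * τ + p.2 * x₁) := by
  have hinj : Function.Injective fun p : ℤ × ℤ => ((p.1, p.2, r) : T3) := fun a b hab => by
    simpa [Prod.ext_iff] using hab
  have h1 := (h.comp_injective hinj).mul_right (ee (-(r * x₂)))
  refine h1.congr fun p => ?_
  simp only [Function.comp, e3]
  rw [mul_assoc, ← ee_add]
  congr 2
  ring

theorem Rep.div {d : ℂ → ℂ → ℂ} {f : ℂ → ℂ → ℂ → ℂ} {cd c : T3 → ℂ}
    (hd1 : Rep cd fun τ _ x₂ => d τ x₂)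
    (hd2 : ∀ τ x : ℂ, 0 < τ.im → (∀ k l : ℤ, x ≠ k * τ + l) → d τ x ≠ 0)
    (hd3 : ∀ τ x₁ x₂ : ℂ, 0 < τ.im → analyticOrderAt (d τ) x₂ ≤ analyticOrderAt (f τ x₁) x₂)
    {δ ε v₀ : ℝ} (hδ : 0 < δ) (hε : 0 < ε)
    (hd4 : ∀ τ x : ℂ, v₀ ≤ τ.im → x.im = δ → ε ≤ ‖d τ x‖) (hf : Rep c f) :
    ∃ c' g, Rep c' g ∧ ∀ τ x₁ x₂ : ℂ, 0 < τ.im → f τ x₁ x₂ = d τ x₂ * g τ x₁ x₂ := by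
  have hdd : ∀ τ : ℂ, 0 < τ.im → Differentiable ℂ (d τ) := fun τ hτ =>
    hd1.differentiable hτ (differentiable_const 0) differentiable_id
  have hfd : ∀ τ x₁ : ℂ, 0 < τ.im → Differentiable ℂ (f τ x₁) := fun τ x₁ hτ =>
    hf.differentiable hτ (differentiable_const x₁) differentiable_id
  have hper : ∀ τ x : ℂ, 0 < τ.im → ∀ a b : ℤ, d (τ + a) (x + b) = d τ x := fun τ x hτ a b =>
    hd1.periodic hτ 0 x a 0 b
  have hnetop : ∀ τ x : ℂ, 0 < τ.im → analyticOrderAt (d τ) x ≠ ⊤ := by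
    intro τ x hτ h
    have h1 := (AnalyticOnNhd.eq_of_eventuallyEq (f := d τ) (g := 0)
      (fun y _ => (hdd τ hτ).analyticAt y) (fun y _ => analyticAt_const)
      (analyticOrderAt_eq_top.1 h))
    refine hd2 τ ((1 / 2 : ℝ) : ℂ) hτ (fun k l hkl => ?_) (congrFun h1 _)
    have him := congrArg Complex.im hkl
    have hre := congrArg Complex.re hkl
    simp only [Complex.ofReal_im, Complex.add_im, Complex.mul_im, Complex.intCast_re,
      Complex.intCast_im, zero_mul, add_zero, Complex.ofReal_re, Complex.add_re,
      Complex.mul_re, sub_zero] at him hre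
    have hk : (k : ℝ) = 0 := by
      rcases mul_eq_zero.1 him.symm with h | h
      · exact h
      · exact absurd h hτ.ne'
    rw [hk, zero_mul, zero_add] at hre
    have : (1 : ℤ) = 2 * l := by
      have : (1 : ℝ) = 2 * l := by rw [← hre]; norm_num
      exact_mod_cast this
    omega
  have hquot : ∀ τ x₁ : ℂ, ∃ h : ℂ → ℂ, 0 < τ.im → Differentiable ℂ h ∧
      ∀ x₂, f τ x₁ x₂ = d τ x₂ * h x₂ := by
    intro τ x₁
    by_cases hτ : 0 < τ.im
    · obtain ⟨h, h1, h2⟩ := exists_entire_quotient (hdd τ hτ) (hfd τ x₁ hτ)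
        (fun x => hnetop τ x hτ) (fun x => hd3 τ x₁ x hτ)
      exact ⟨h, fun _ => ⟨h1, h2⟩⟩
    · exact ⟨0, fun h => absurd h hτ⟩
  choose g hg using hquot
  have hnz : ∀ (k : ℤ) (τ x₁ x₂ : ℂ), ![τ.im, x₁.im, x₂.im] ∈ cham k → d τ x₂ ≠ 0 := by
    rintro k τ x₁ x₂ ⟨h0, h1, h2⟩
    simp only [Matrix.cons_val_zero, Matrix.cons_val] at h0 h1 h2
    refine hd2 τ x₂ h0 fun k' l hkl => ?_
    have him := congrArg Complex.im hkl
    simp only [Complex.add_im, Complex.mul_im, Complex.intCast_re, Complex.intCast_im, zero_mul,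
      add_zero] at him
    rw [him] at h1 h2
    have e1 : k < k' := by exact_mod_cast lt_of_mul_lt_mul_right h1 h0.le
    have e2 : k' < k + 1 := by exact_mod_cast lt_of_mul_lt_mul_right h2 h0.le
    omega
  have hexp : ∀ k : ℤ, ∃ c : T3 → ℂ, (∀ τ x₁ x₂, ![τ.im, x₁.im, x₂.im] ∈ cham k →
        HasSum (fun T => c T * e3 T τ x₁ x₂) (g τ x₁ x₂)) ∧
      ∀ τ x₁ x₂, ![τ.im, x₁.im, x₂.im] ∈ cham k → ∀ M,
        (∀ a b c : ℝ, ‖f (τ + a) (x₁ + b) (x₂ + c) / d (τ + a) (x₂ + c)‖ ≤ M) →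
          ∀ T, ‖c T * e3 T τ x₁ x₂‖ ≤ M := by
    intro k
    obtain ⟨c, h1, h2⟩ := fourier3 (isOpen_cham k) (convex_cham k)
      (f := fun τ x₁ x₂ => f τ x₁ x₂ / d τ x₂)
      (by
        simp only [div_eq_mul_inv]
        exact (hf.differentiableOn.mono fun (z : Fin 3 → ℂ) hz => cham_subset k hz).mul
          (DifferentiableOn.inv
            (hd1.differentiableOn.mono fun (z : Fin 3 → ℂ) hz => cham_subset k hz)
            fun (z : Fin 3 → ℂ) hz => hnz k (z 0) (z 1) (z 2) hz))
      (fun τ x₁ x₂ hm a b c => by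
        have h0 : 0 < τ.im := hm.1
        rw [hf.periodic h0, hper _ _ h0])
    refine ⟨c, fun τ x₁ x₂ hm => ?_, h2⟩
    have := h1 τ x₁ x₂ hm
    rwa [(hg τ x₁ hm.1).2 x₂, mul_div_cancel_left₀ _ (hnz k τ x₁ x₂ hm)] at this
  choose C hC hCM using hexp
  have hmem : ∀ (k : ℤ) (τ x₁ x₂ : ℂ), 0 < τ.im → k * τ.im < x₂.im → x₂.im < (k + 1) * τ.im →
      ![τ.im, x₁.im, x₂.im] ∈ cham k := fun k τ x₁ x₂ h0 h1 h2 => ⟨h0, h1, h2⟩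
  have hlau : ∀ τ x₁ : ℂ, 0 < τ.im → ∃ a : ℤ → ℂ, ∀ x₂, HasSum (fun r : ℤ => a r * ee (r * x₂))
      (g τ x₁ x₂) := by
    intro τ x₁ hτ
    have hgp : ∀ (x₂ : ℂ) (l : ℤ), g τ x₁ (x₂ + l) = g τ x₁ x₂ := by
      intro x₂ l
      have h1 : (fun x => g τ x₁ (x + l)) = g τ x₁ := by
        have hgd := (hg τ x₁ hτ).1
        refine AnalyticOnNhd.eq_of_eventuallyEq (z₀ := ((1 / 2 : ℝ) * τ.im : ℝ) * Complex.I)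
          (fun y _ => Differentiable.analyticAt (by fun_prop) y)
          (fun y _ => hgd.analyticAt y) ?_
        have hop : IsOpen {x : ℂ | 0 < x.im ∧ x.im < τ.im} :=
          (isOpen_lt continuous_const Complex.continuous_im).inter
            (isOpen_lt Complex.continuous_im continuous_const)
        filter_upwards [hop.mem_nhds (by
          simp only [Set.mem_ofPred_eq, Complex.mul_im, Complex.ofReal_re, Complex.I_im,
            Complex.ofReal_im, Complex.I_re]
          constructor <;> linarith)] with x hx
        have hx' := hnz 0 τ x₁ x (hmem 0 τ x₁ x hτ (by simpa using hx.1) (by simpa using hx.2))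
        have e1 := (hg τ x₁ hτ).2 (x + l)
        have e2 := (hg τ x₁ hτ).2 x
        have e3' := hper τ x hτ 0 l
        have e4 := hf.periodic hτ x₁ x 0 0 l
        simp only [Int.cast_zero, add_zero] at e3' e4
        rw [e4, e3', e2] at e1
        exact (mul_left_cancel₀ hx' e1).symm
      exact congrFun h1 x₂
    obtain ⟨a, ha, -⟩ := fourier_expansion (N := 1) isOpen_univ convex_univ
      (f := fun z => g τ x₁ (z 0)) (by
        have := (hg τ x₁ hτ).1
        fun_prop) (fun z _ n => by simp only [Pi.add_apply]; exact hgp _ _)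
    refine ⟨fun n => a ![n], fun x => ?_⟩
    have := (Equiv.funUnique (Fin 1) ℤ).symm.hasSum_iff.2 (ha ![x] (Set.mem_univ _))
    refine this.congr_fun fun n => ?_
    have hn : ((Equiv.funUnique (Fin 1) ℤ).symm n) = ![n] := by ext i; simp
    simp only [Function.comp, hn, dot]
    simp
  choose! a ha using hlau
  have hslice : ∀ (k : ℤ) (τ x₁ : ℂ), 0 < τ.im → ∀ r : ℤ,
      HasSum (fun p : ℤ × ℤ => C k (p.1, p.2, r) * ee (p.1 * τ + p.2 * x₁)) (a τ x₁ r) := by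
    intro k τ x₁ hτ r
    set x₂ : ℂ := (((k + 1 / 2 : ℝ) * τ.im : ℝ) : ℂ) * Complex.I with hx₂
    have him : x₂.im = (k + 1 / 2 : ℝ) * τ.im := by simp [hx₂]
    have hm : ∀ s : ℝ, ![τ.im, x₁.im, (x₂ + s).im] ∈ cham k := fun s =>
      hmem k τ x₁ _ hτ (by rw [Complex.add_im, him, Complex.ofReal_im]; linarith)
        (by rw [Complex.add_im, him, Complex.ofReal_im]; linarith)
    have h0 := hC k τ x₁ _ (hm 0)
    have huniq := unique1 (x := x₂)
      (c := fun r => (∑' p : ℤ × ℤ, C k (p.1, p.2, r) * ee (p.1 * τ + p.2 * x₁)) - a τ x₁ r)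
      fun s => by
        have := (swapHasSum (hC k τ x₁ _ (hm s))).sub (ha τ x₁ hτ (x₂ + s))
        rw [sub_self] at this
        exact this.congr_fun fun r => by rw [sub_mul]
    have := congrFun huniq r
    rw [Pi.zero_apply, sub_eq_zero] at this
    rw [← this]
    exact (summable_slice h0.summable r).hasSum
  have hCeq : ∀ k, C k = C 0 := by
    intro k
    funext T
    obtain ⟨n, r₁, r₂⟩ := T
    have := unique2 (c := fun p : ℤ × ℤ => C k (p.1, p.2, r₂) - C 0 (p.1, p.2, r₂))
      (x := Complex.I) (y := 0) fun s t => by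
        have hI : 0 < (Complex.I + s).im := by simp
        have := (hslice k (Complex.I + s) (0 + t) hI r₂).sub (hslice 0 (Complex.I + s) (0 + t) hI r₂)
        rw [sub_self] at this
        exact this.congr_fun fun p => by rw [sub_mul]
    exact sub_eq_zero.1 (congrFun this (n, r₁))
  have hsum : ∀ τ x₁ x₂ : ℂ, 0 < τ.im → Summable fun T => C 0 T * e3 T τ x₁ x₂ := by
    intro τ x₁ x₂ hτ
    obtain ⟨k, hk | ⟨hk1, hk2⟩⟩ := exists_cham hτ x₂.im
    swap
    · have := (hC k τ x₁ x₂ (hmem k τ x₁ x₂ hτ hk1 hk2)).summable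
      rwa [hCeq] at this
    · set w : ℂ := ((τ.im / 2 : ℝ) : ℂ) * Complex.I with hw
      have hwi : w.im = τ.im / 2 := by simp [hw]
      have h1 := (hC k τ x₁ (x₂ + w) (hmem k τ x₁ _ hτ
        (by rw [Complex.add_im, hwi, hk]; linarith)
        (by rw [Complex.add_im, hwi, hk]; linarith))).summable.norm
      have h2 := (hC (k - 1) τ x₁ (x₂ - w) (hmem (k - 1) τ x₁ _ hτ
        (by rw [Complex.sub_im, hwi, hk]; push_cast; linarith)
        (by rw [Complex.sub_im, hwi, hk]; push_cast; linarith))).summable.norm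
      rw [hCeq] at h1 h2
      refine Summable.of_norm_bounded (h1.add h2) fun T => ?_
      simp only [norm_mul, ← mul_add]
      refine mul_le_mul_of_nonneg_left ?_ (norm_nonneg _)
      simp only [norm_e3, Complex.add_im, Complex.sub_im, hwi]
      rcases le_total 0 (T.2.2 : ℝ) with hT | hT
      · refine le_add_of_nonneg_of_le (Real.exp_pos _).le (Real.exp_le_exp.2 ?_)
        have := mul_nonneg hT hτ.le
        nlinarith [Real.pi_pos]
      · refine le_add_of_le_of_nonneg (Real.exp_le_exp.2 ?_) (Real.exp_pos _).le
        have := mul_nonneg (neg_nonneg.2 hT) hτ.le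
        nlinarith [Real.pi_pos]
  have hcont : ∀ τ x₁ x₂ : ℂ, 0 < τ.im → HasSum (fun T => C 0 T * e3 T τ x₁ x₂) (g τ x₁ x₂) := by
    intro τ x₁ x₂ hτ
    have h1 := swapHasSum (hsum τ x₁ x₂ hτ).hasSum
    have h2 := ha τ x₁ hτ x₂
    have h3 := h1.unique (h2.congr_fun fun r => by rw [(hslice 0 τ x₁ hτ r).tsum_eq])
    rw [← h3]
    exact (hsum τ x₁ x₂ hτ).hasSum
  refine ⟨C 0, g, ⟨fun T hT => ?_, hcont⟩, fun τ x₁ x₂ hτ => (hg τ x₁ hτ).2 x₂⟩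
  set M : ℝ := ∑' T, ‖c T * e3 T Complex.I 0 (δ * Complex.I)‖ with hM
  have hMs : Summable fun T => ‖c T * e3 T Complex.I 0 (δ * Complex.I)‖ :=
    (hf.2 Complex.I 0 (δ * Complex.I) (by simp)).summable.norm
  have hbd : ∀ v : ℝ, max (max v₀ 1) (δ + 1) ≤ v →
      ‖C 0 T‖ * Real.exp (-(2 * Real.pi * (T.1 * v + T.2.2 * δ))) ≤ M / ε := by
    intro v hv
    have hv0 : v₀ ≤ v := (le_max_left _ _).trans ((le_max_left _ _).trans hv)
    have hv1 : 1 ≤ v := (le_max_right _ _).trans ((le_max_left _ _).trans hv)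
    have hvδ : δ + 1 ≤ v := (le_max_right _ _).trans hv
    have h1 := hCM 0 (v * Complex.I) 0 (δ * Complex.I)
      (hmem 0 _ _ _ (by simp; linarith) (by simp [hδ]) (by simp; linarith)) (M / ε)
      (fun s t u => by
        rw [norm_div]
        refine div_le_div₀ (tsum_nonneg fun _ => norm_nonneg _) ?_ hε
          (hd4 _ _ (by simpa using hv0) (by simp))
        have hs := hf.2 (v * Complex.I + s) (0 + t) (δ * Complex.I + u) (by simp; linarith)
        rw [← hs.tsum_eq]
        refine (norm_tsum_le_tsum_norm hs.summable.norm).trans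
          (hs.summable.norm.tsum_le_tsum (fun T => ?_) hMs)
        rw [norm_mul, norm_mul]
        rcases lt_or_ge T.1 0 with hT | hT
        · rw [hf.1 T hT]; simp
        · refine mul_le_mul_of_nonneg_left ?_ (norm_nonneg _)
          rw [norm_e3, norm_e3]
          refine Real.exp_le_exp.2 ?_
          have hT' : (0 : ℝ) ≤ T.1 := by exact_mod_cast hT
          have := mul_le_mul_of_nonneg_left hv1 hT'
          simp
          nlinarith [Real.pi_pos]) T
    rw [norm_mul, norm_e3] at h1
    simpa using h1
  by_contra hne
  have hpos : 0 < ‖C 0 T‖ := norm_pos_iff.2 hne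
  have hTn : (T.1 : ℝ) ≤ -1 := by exact_mod_cast Int.le_sub_one_of_lt hT
  have hlim : Tendsto (fun v : ℝ => ‖C 0 T‖ * Real.exp (-(2 * Real.pi * (T.1 * v + T.2.2 * δ))))
      atTop atTop := by
    refine Tendsto.const_mul_atTop hpos (Real.tendsto_exp_atTop.comp ?_)
    have h1 : Tendsto (fun v : ℝ => 2 * Real.pi * (-T.1) * v + -(2 * Real.pi * (T.2.2 * δ)))
        atTop atTop :=
      tendsto_atTop_add_const_right _ _ (tendsto_id.const_mul_atTop
        (mul_pos Real.two_pi_pos (by linarith)))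
    exact h1.congr fun v => by ring
  obtain ⟨v, hv1, hv2⟩ := ((hlim.eventually_gt_atTop (M / ε)).and
    (eventually_ge_atTop (max (max v₀ 1) (δ + 1)))).exists
  exact absurd (hbd v hv2) (not_le.2 hv1)

end

section

/-- Points of the lattice `ℤτ + ℤ`. -/
lemma countable_lattice (τ : ℂ) : {x : ℂ | ∃ k l : ℤ, x = k * τ + l}.Countable := by
  refine (Set.countable_range fun p : ℤ × ℤ => (p.1 : ℂ) * τ + p.2).mono ?_
  rintro x ⟨k, l, rfl⟩
  exact ⟨(k, l), rfl⟩

lemma countable_th {τ : ℂ} (hτ : 0 < τ.im) : {x : ℂ | th τ x = 0}.Countable :=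
  (countable_lattice τ).mono fun x hx => by
    by_contra h
    exact th_ne_zero hτ (fun k l hkl => h ⟨k, l, hkl⟩) hx

lemma cancel_of_countable {d A B : ℂ → ℂ} (hd : {t | d t = 0}.Countable) (hA : Continuous A)
    (hB : Continuous B) (h : ∀ t, d t * A t = d t * B t) : A = B := by
  refine Continuous.ext_on (hd.dense_compl ℂ) hA hB fun t ht => ?_
  exact mul_left_cancel₀ ht (h t)

lemma th_deriv_hasSum {τ : ℂ} (hτ : 0 < τ.im) (x : ℂ) :
    HasSum (fun n : ℤ => ((-1 : ℂ) ^ n * (2 * Real.pi * Complex.I * n)) * ee (tri n * τ + n * x))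
      (jacobiTheta₂' (x + 1 / 2 + τ / 2) τ) := by
  refine (hasSum_jacobiTheta₂'_term _ hτ).congr_fun fun n => ?_
  rw [jacobiTheta₂'_term, jacobiTheta₂_term, ← ee_half, ← ee_mul_int, mul_right_comm, ← ee_add,
    mul_comm (ee _)]
  congr 1
  rw [ee, tri_cast]
  congr 1
  ring

lemma thD_eq {τ : ℂ} (hτ : 0 < τ.im) : thD τ = jacobiTheta₂' (0 + 1 / 2 + τ / 2) τ := by
  have h2 : HasDerivAt (fun x : ℂ => x + 1 / 2 + τ / 2) 1 0 :=
    ((hasDerivAt_id (0 : ℂ)).add_const _).add_const _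
  have := (hasDerivAt_jacobiTheta₂_fst (0 + 1 / 2 + τ / 2) hτ).comp (0 : ℂ) h2
  rw [mul_one] at this
  exact this.deriv

/-- Dominance of the two leading terms of a theta-like series. -/
lemma leading_terms {a : ℤ → ℂ} {F : ℂ → ℂ → ℂ} (δ : ℝ)
    (h : ∀ τ x : ℂ, 0 < τ.im → HasSum (fun n : ℤ => a n * ee (tri n * τ + n * x)) (F τ x)) :
    ∃ M : ℝ, ∀ τ x : ℂ, 1 ≤ τ.im → x.im = δ →
      ‖F τ x - (a 0 + a (-1) * ee (-x))‖ ≤ Real.exp (-(2 * Real.pi * (τ.im - 1))) * M := by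
  have hs := (h Complex.I (δ * Complex.I) (by simp)).summable.norm
  refine ⟨∑' n : ℤ, ‖a n * ee (tri n * Complex.I + n * (δ * Complex.I))‖, fun τ x hτ hx => ?_⟩
  have h1 := h τ x (by linarith)
  have h2 : HasSum (fun n : ℤ => if n ∈ ({0, -1} : Finset ℤ) then a n * ee (tri n * τ + n * x)
      else 0) (a 0 + a (-1) * ee (-x)) := by
    have := hasSum_sum_of_ne_finset_zero (L := SummationFilter.unconditional ℤ) (f := fun n : ℤ => if n ∈ ({0, -1} : Finset ℤ) then
      a n * ee (tri n * τ + n * x) else 0) (s := {0, -1}) fun n hn => if_neg hn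
    convert this using 1
    rw [Finset.sum_insert (by decide), Finset.sum_singleton]
    simp [tri, ee_zero]
  have h3 := h1.sub h2
  rw [← h3.tsum_eq, ← tsum_mul_left]
  refine tsum_of_norm_bounded ((hs.mul_left _).hasSum) fun n => ?_
  split_ifs with hn
  · rw [sub_self, norm_zero]; positivity
  · rw [sub_zero, norm_mul, norm_mul, norm_ee, norm_ee, mul_left_comm]
    refine mul_le_mul_of_nonneg_left ?_ (norm_nonneg _)
    rw [← Real.exp_add]
    refine Real.exp_le_exp.2 ?_
    have ht : (1 : ℝ) ≤ tri n := by
      have h2 := two_mul_tri n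
      simp only [Finset.mem_insert, Finset.mem_singleton, not_or] at hn
      have : 1 ≤ tri n := by
        rcases lt_or_ge n 0 with h | h
        · have : n ≤ -2 := by omega
          nlinarith
        · have : 1 ≤ n := by omega
          nlinarith
      exact_mod_cast this
    simp [hx]
    nlinarith [Real.pi_pos, mul_le_mul_of_nonneg_right ht (sub_nonneg.2 hτ)]

lemma lower_bound {a : ℤ → ℂ} {F : ℂ → ℂ → ℂ} (δ ε : ℝ)
    (h : ∀ τ x : ℂ, 0 < τ.im → HasSum (fun n : ℤ => a n * ee (tri n * τ + n * x)) (F τ x))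
    (hε : 0 < ε) (hx : ∀ x : ℂ, x.im = δ → 2 * ε ≤ ‖a 0 + a (-1) * ee (-x)‖) :
    ∃ v₀ : ℝ, ∀ τ x : ℂ, v₀ ≤ τ.im → x.im = δ → ε ≤ ‖F τ x‖ := by
  obtain ⟨M, hM⟩ := leading_terms δ h
  have hlim : Tendsto (fun v : ℝ => Real.exp (-(2 * Real.pi * (v - 1))) * M) atTop (𝓝 0) := by
    rw [← zero_mul M]
    refine Tendsto.mul_const _ (Real.tendsto_exp_neg_atTop_nhds_zero.comp ?_)
    exact (tendsto_atTop_add_const_right _ (-1) tendsto_id).const_mul_atTop Real.two_pi_pos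
  obtain ⟨v, hv⟩ := eventually_atTop.1 (hlim.eventually_le_const hε)
  refine ⟨max v 1, fun τ x hτ hxδ => ?_⟩
  have h1 := hM τ x ((le_max_right _ _).trans hτ) hxδ
  have h2 := hv τ.im ((le_max_left _ _).trans hτ)
  have h3 := hx x hxδ
  have h4 := norm_sub_norm_le (a 0 + a (-1) * ee (-x)) (F τ x)
  rw [norm_sub_rev] at h4
  linarith

lemma th_lower : ∃ v₀ ε : ℝ, 0 < ε ∧ ∀ τ x : ℂ, v₀ ≤ τ.im → x.im = 1 → ε ≤ ‖th τ x‖ := by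
  obtain ⟨v₀, hv⟩ := lower_bound (a := fun n : ℤ => (-1 : ℂ) ^ n) (F := th) 1 (1 / 2)
    (fun τ x hτ => th_hasSum hτ x) (by norm_num) fun x hx => by
      have h1 : ‖ee (-x)‖ = Real.exp (2 * Real.pi) := by rw [norm_ee]; simp [hx]
      have h2 := Real.add_one_le_exp (2 * Real.pi)
      have h3 := norm_sub_norm_le (ee (-x)) 1
      rw [norm_sub_rev, h1, norm_one] at h3
      rw [show (-1 : ℂ) ^ (0 : ℤ) + (-1) ^ (-1 : ℤ) * ee (-x) = 1 - ee (-x) by norm_num; ring]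
      linarith [Real.pi_gt_three]
  exact ⟨v₀, 1 / 2, by norm_num, hv⟩

lemma thD_lower : ∃ v₀ ε : ℝ, 0 < ε ∧ ∀ τ x : ℂ, v₀ ≤ τ.im → x.im = 1 → ε ≤ ‖thD τ‖ := by
  obtain ⟨v₀, hv⟩ := lower_bound
    (a := fun n : ℤ => (-1 : ℂ) ^ n * (2 * Real.pi * Complex.I * n))
    (F := fun τ x => jacobiTheta₂' (x + 1 / 2 + τ / 2) τ) 0 1
    (fun τ x hτ => th_deriv_hasSum hτ x) (by norm_num) fun x hx => by
      have h1 : ‖ee (-x)‖ = 1 := by rw [norm_ee]; simp [hx]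
      simp [h1]
      rw [abs_of_pos Real.pi_pos]
      linarith [Real.pi_gt_three]
  refine ⟨max v₀ 1, 1, one_pos, fun τ x hτ _ => ?_⟩
  rw [thD_eq (by linarith [(le_max_right v₀ 1).trans hτ])]
  exact hv τ 0 ((le_max_left _ _).trans hτ) rfl

lemma order_th {τ : ℂ} (hτ : 0 < τ.im) : analyticOrderAt (th τ) 0 = 1 := by
  have han := (differentiable_th hτ).analyticAt 0
  exact han.analyticOrderAt_eq_one_of_zero_deriv_ne_zero (th_zero τ hτ) (thD_ne_zero hτ)

/-- Order at a translate of the origin by a quasi-period. -/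
lemma order_translate {f : ℂ → ℂ} (hf : Differentiable ℂ f) {p b c : ℂ}
    (h : ∀ y, f (y + p) = ee (b * y + c) * f y) :
    analyticOrderAt f p = analyticOrderAt f 0 := by
  have he : Differentiable ℂ fun y => ee (b * y + c) :=
    differentiable_ee.comp (g := ee) (f := fun y => b * y + c) (by fun_prop)
  have h1 : analyticOrderAt (f ∘ fun y => y + p) 0 = analyticOrderAt f p := by
    have := analyticOrderAt_comp_of_deriv_ne_zero (f := f) (g := fun y => y + p) (z₀ := 0)
      (by fun_prop) (by simp)
    simpa using this
  rw [← h1, show (f ∘ fun y => y + p) = (fun y => ee (b * y + c)) * f from funext h,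
    analyticOrderAt_mul (he.analyticAt _) (hf.analyticAt _),
    (he.analyticAt _).analyticOrderAt_eq_zero.2 (ee_ne_zero _), zero_add]

/-- Quasi-periodicity with exponential affine multipliers. -/
def QP (f : ℂ → ℂ → ℂ → ℂ) : Prop :=
  ∀ τ : ℂ, 0 < τ.im → ∀ k l : ℤ, ∃ a b c : ℂ, ∀ x₁ x₂,
    f τ (x₁ + k * τ) (x₂ + l * τ) = ee (a * x₁ + b * x₂ + c) * f τ x₁ x₂

lemma QP_th : QP fun τ _ x₂ => th τ x₂ := fun τ hτ k l =>
  ⟨0, -l, l / 2 - tri l * τ, fun x₁ x₂ => by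
    change th τ (x₂ + l * τ) = _ * th τ x₂
    rw [th_add_mul_tau τ x₂ l hτ, ← ee_half, ← ee_mul_int, ← ee_add]
    congr 2
    ring⟩

lemma rep_th : ∃ c, Rep c fun τ _ x₂ => th τ x₂ :=
  Rep.of_family (fun n : ℤ => (tri n, 0, n)) tri_nonneg (fun n => (-1 : ℂ) ^ n)
    fun τ _ x₂ hτ => (th_hasSum hτ x₂).congr_fun fun n => by simp [e3]

lemma rep_thD : ∃ c, Rep c fun τ _ _ => thD τ :=
  Rep.of_family (fun n : ℤ => (tri n, 0, 0)) tri_nonneg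
    (fun n => (-1 : ℂ) ^ n * (2 * Real.pi * Complex.I * n))
    fun τ _ x₂ hτ => by
      have := th_deriv_hasSum hτ 0
      rw [← thD_eq hτ] at this
      exact this.congr_fun fun n => by simp [e3]

/-- Division by `th τ x₂`. -/
lemma div_th {c : T3 → ℂ} {f : ℂ → ℂ → ℂ → ℂ} (hf : Rep c f) (hq : QP f) (j : ℕ)
    (ho : ∀ τ x₁ : ℂ, 0 < τ.im → (j + 1 : ℕ) ≤ analyticOrderAt (f τ x₁) 0) :
    ∃ c' g, Rep c' g ∧ QP g ∧ (∀ τ x₁ : ℂ, 0 < τ.im → (j : ℕ) ≤ analyticOrderAt (g τ x₁) 0) ∧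
      ∀ τ x₁ x₂ : ℂ, 0 < τ.im → f τ x₁ x₂ = th τ x₂ * g τ x₁ x₂ := by
  obtain ⟨cd, hcd⟩ := rep_th
  obtain ⟨v₀, ε, hε, hv⟩ := th_lower
  have hfd : ∀ τ x₁ : ℂ, 0 < τ.im → Differentiable ℂ (f τ x₁) := fun τ x₁ hτ =>
    hf.differentiable hτ (differentiable_const x₁) differentiable_id
  obtain ⟨c', g, hg, hfg⟩ := Rep.div hcd (fun τ x hτ h => th_ne_zero hτ h) (f := f)
    (fun τ x₁ x₂ hτ => by
      by_cases hx : th τ x₂ = 0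
      · have : ∃ k l : ℤ, x₂ = k * τ + l := by
          by_contra h
          push Not at h
          exact th_ne_zero hτ h hx
        obtain ⟨k, l, rfl⟩ := this
        rw [order_translate (differentiable_th hτ) (b := -k) (c := k / 2 - tri k * τ) fun y => by
          rw [show y + (k * τ + l) = y + k * τ + l by ring, th_add_int _ _ _ hτ,
            th_add_mul_tau τ y k hτ, ← ee_half, ← ee_mul_int, ← ee_add]
          congr 2
          ring, order_th hτ]
        obtain ⟨a, b, e, habe⟩ := hq τ hτ 0 k
        rw [order_translate (hfd τ x₁ hτ) (b := b) (c := a * x₁ + e) fun y => by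
          have h1 := hf.periodic hτ x₁ (y + k * τ) 0 0 l
          have h2 := habe x₁ y
          simp only [Int.cast_zero, add_zero, zero_mul] at h1 h2
          rw [← add_assoc, h1, h2]
          congr 2
          ring]
        refine le_trans ?_ (ho τ x₁ hτ)
        exact_mod_cast Nat.le_add_left 1 j
      · rw [((differentiable_th hτ).analyticAt x₂).analyticOrderAt_eq_zero.2 hx]
        exact bot_le) one_pos hε hv hf
  have hgd : ∀ τ x₁ : ℂ, 0 < τ.im → Differentiable ℂ (g τ x₁) := fun τ x₁ hτ =>
    hg.differentiable hτ (differentiable_const x₁) differentiable_id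
  refine ⟨c', g, hg, fun τ hτ k l => ?_, fun τ x₁ hτ => ?_, hfg⟩
  · obtain ⟨a, b, e, h⟩ := hq τ hτ k l
    obtain ⟨a', b', e', h'⟩ := QP_th τ hτ k l
    refine ⟨a - a', b - b', e - e', fun x₁ x₂ => ?_⟩
    have := cancel_of_countable (countable_th hτ)
      (A := fun x₂ => ee (a' * x₁ + b' * x₂ + e') * g τ (x₁ + k * τ) (x₂ + l * τ))
      (B := fun x₂ => ee (a * x₁ + b * x₂ + e) * g τ x₁ x₂)
      ((continuous_ee.comp (by fun_prop)).mul (hg.continuous hτ continuous_const (by fun_prop)))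
      ((continuous_ee.comp (by fun_prop)).mul (hg.continuous hτ continuous_const (by fun_prop)))
      fun t => by
        have h1 := h x₁ t
        have h2 : th τ (t + l * τ) = _ * th τ t := h' x₁ t
        rw [hfg _ _ _ hτ, hfg _ _ _ hτ, h2] at h1
        linear_combination h1
    have h2 : ee (a' * x₁ + b' * x₂ + e') * g τ (x₁ + k * τ) (x₂ + l * τ) =
        ee (a * x₁ + b * x₂ + e) * g τ x₁ x₂ := congrFun this x₂
    refine mul_left_cancel₀ (ee_ne_zero (a' * x₁ + b' * x₂ + e')) ?_
    rw [h2, ← mul_assoc, ← ee_add]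
    congr 2
    ring
  · have h1 := ho τ x₁ hτ
    rw [show f τ x₁ = th τ * g τ x₁ from funext fun x₂ => hfg τ x₁ x₂ hτ,
      analyticOrderAt_mul ((differentiable_th hτ).analyticAt 0) ((hgd τ x₁ hτ).analyticAt 0),
      order_th hτ, Nat.cast_add, Nat.cast_one, add_comm] at h1
    exact (ENat.add_le_add_iff_left (by simp)).1 h1

end

section

/-- Integral linear substitutions in expansions. -/
lemma Rep.lin {c : T3 → ℂ} {f : ℂ → ℂ → ℂ → ℂ} (h : Rep c f) (p q r s u : ℤ)
    (hu : p * s - q * r = u) (hu2 : u * u = 1) :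
    Rep (fun T => c (T.1, u * (s * T.2.1 - r * T.2.2), u * (p * T.2.2 - q * T.2.1)))
      fun τ x₁ x₂ => f τ (p * x₁ + q * x₂) (r * x₁ + s * x₂) := by
  let e : T3 ≃ T3 :=
    { toFun := fun T => (T.1, u * (s * T.2.1 - r * T.2.2), u * (p * T.2.2 - q * T.2.1))
      invFun := fun T => (T.1, p * T.2.1 + r * T.2.2, q * T.2.1 + s * T.2.2)
      left_inv := fun T => by
        refine Prod.ext rfl (Prod.ext ?_ ?_)
        · linear_combination T.2.1 * hu2 + u * T.2.1 * hu
        · linear_combination T.2.2 * hu2 + u * T.2.2 * hu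
      right_inv := fun T => by
        refine Prod.ext rfl (Prod.ext ?_ ?_)
        · linear_combination T.2.1 * hu2 + u * T.2.1 * hu
        · linear_combination T.2.2 * hu2 + u * T.2.2 * hu }
  refine h.reindex e (fun _ => rfl) fun τ x₁ x₂ => ⟨_, _, rfl, fun T => ?_⟩
  obtain ⟨n, a, b⟩ := T
  have hu' : (u : ℂ) * (p * s - q * r) = 1 := by
    have : u * (p * s - q * r) = 1 := by rw [hu, hu2]
    exact_mod_cast this
  simp only [e3, e, Equiv.coe_fn_mk]
  congr 1
  push_cast
  linear_combination (a * x₁ + b * x₂) * hu'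

lemma QP.lin {f : ℂ → ℂ → ℂ → ℂ} (h : QP f) (p q r s : ℤ) :
    QP fun τ x₁ x₂ => f τ (p * x₁ + q * x₂) (r * x₁ + s * x₂) := fun τ hτ k l => by
  obtain ⟨a, b, e, h1⟩ := h τ hτ (p * k + q * l) (r * k + s * l)
  refine ⟨a * p + b * r, a * q + b * s, e, fun x₁ x₂ => ?_⟩
  have := h1 (p * x₁ + q * x₂) (r * x₁ + s * x₂)
  push_cast at this
  beta_reduce
  rw [show p * (x₁ + k * τ) + q * (x₂ + l * τ) = p * x₁ + q * x₂ + (p * k + q * l) * τ by ring,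
    show r * (x₁ + k * τ) + s * (x₂ + l * τ) = r * x₁ + s * x₂ + (r * k + s * l) * τ by ring, this]
  congr 2
  ring

lemma Rep.shift {c : T3 → ℂ} {f : ℂ → ℂ → ℂ → ℂ} (h : Rep c f) (S : T3)
    (hS : ∀ T, T.1 < S.1 → c T = 0) :
    Rep (fun T => c (T + S)) fun τ x₁ x₂ => ee (-(S.1 * τ + S.2.1 * x₁ + S.2.2 * x₂)) * f τ x₁ x₂ := by
  refine ⟨fun T hT => hS _ (by rw [Prod.fst_add]; omega), fun τ x₁ x₂ hτ => ?_⟩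
  refine (((Equiv.addRight S).hasSum_iff.2 (h.2 τ x₁ x₂ hτ)).mul_left _).congr_fun fun T => ?_
  simp only [Function.comp, Equiv.coe_addRight]
  rw [e3_add, ee_neg, show e3 S τ x₁ x₂ = ee (S.1 * τ + S.2.1 * x₁ + S.2.2 * x₂) from rfl]
  have := mul_inv_cancel₀ (ee_ne_zero (S.1 * τ + S.2.1 * x₁ + S.2.2 * x₂))
  linear_combination -(c (T + S) * e3 T τ x₁ x₂) * this

lemma QP.exp_mul {f : ℂ → ℂ → ℂ → ℂ} (h : QP f) (p q r : ℂ) :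
    QP fun τ x₁ x₂ => ee (-(p * τ + q * x₁ + r * x₂)) * f τ x₁ x₂ := fun τ hτ k l => by
  obtain ⟨a, b, e, h1⟩ := h τ hτ k l
  refine ⟨a, b, e - (q * k + r * l) * τ, fun x₁ x₂ => ?_⟩
  beta_reduce
  rw [h1, ← mul_assoc, ← mul_assoc, ← ee_add, ← ee_add]
  congr 2
  ring

/-- Division by the derivative `thD`. -/
lemma div_thD {c : T3 → ℂ} {f : ℂ → ℂ → ℂ → ℂ} (hf : Rep c f) :
    ∃ c' g, Rep c' g ∧ ∀ τ x₁ x₂ : ℂ, 0 < τ.im → f τ x₁ x₂ = thD τ * g τ x₁ x₂ := by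
  obtain ⟨cd, hcd⟩ := rep_thD
  obtain ⟨v₀, ε, hε, hv⟩ := thD_lower
  exact Rep.div (d := fun τ _ => thD τ) hcd (fun τ x hτ _ => thD_ne_zero hτ)
    (fun τ x₁ x₂ hτ => by
      rw [analyticAt_const.analyticOrderAt_eq_zero.2 (thD_ne_zero hτ)]
      exact bot_le) one_pos hε hv hf

/-- The basic Jacobi form: a theta block of weight `7` and lattice index one. -/
def phi (τ x₁ x₂ : ℂ) : ℂ :=
  ee (τ + x₁ + 2 * x₂) * thD τ ^ 3 * th τ x₂ ^ 3 * th τ x₁ * th τ (x₁ + x₂)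

theorem div_phi {c : T3 → ℂ} {f : ℂ → ℂ → ℂ → ℂ} (hf : Rep c f) (hc : ∀ T, T.1 < 1 → c T = 0)
    (hq : QP f) (h2 : ∀ τ x₁ : ℂ, 0 < τ.im → (3 : ℕ) ≤ analyticOrderAt (f τ x₁) 0)
    (h1 : ∀ τ x : ℂ, 0 < τ.im → f τ 0 x = 0) (h12 : ∀ τ x : ℂ, 0 < τ.im → f τ x (-x) = 0) :
    ∃ c' g, Rep c' g ∧ ∀ τ x₁ x₂ : ℂ, 0 < τ.im → f τ x₁ x₂ = phi τ x₁ x₂ * g τ x₁ x₂ := by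
  have hf1 := hf.shift (1, 1, 2) hc
  have hq1 := hq.exp_mul ((1 : ℤ) : ℂ) ((1 : ℤ) : ℂ) ((2 : ℤ) : ℂ)
  obtain ⟨_, g₁, hg₁, hqg₁, ho₁, he₁⟩ := div_th hf1 hq1 2 fun τ x₁ hτ => by
    have hE : Differentiable ℂ fun x₂ : ℂ =>
        ee (-(((1 : ℤ) : ℂ) * τ + ((1 : ℤ) : ℂ) * x₁ + ((2 : ℤ) : ℂ) * x₂)) :=
      differentiable_ee.comp (g := ee) (by fun_prop)
    change _ ≤ analyticOrderAt ((fun x₂ : ℂ =>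
      ee (-(((1 : ℤ) : ℂ) * τ + ((1 : ℤ) : ℂ) * x₁ + ((2 : ℤ) : ℂ) * x₂))) * f τ x₁) 0
    have hfd : Differentiable ℂ (f τ x₁) :=
      hf.differentiable hτ (differentiable_const x₁) differentiable_id
    rw [analyticOrderAt_mul (hE.analyticAt _) (hfd.analyticAt _), (hE.analyticAt _).analyticOrderAt_eq_zero.2 (ee_ne_zero _),
      zero_add]
    exact h2 τ x₁ hτ
  obtain ⟨_, g₂, hg₂, hqg₂, ho₂, he₂⟩ := div_th hg₁ hqg₁ 1 ho₁
  obtain ⟨_, g₃, hg₃, hqg₃, ho₃, he₃⟩ := div_th hg₂ hqg₂ 0 ho₂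
  have he : ∀ τ x₁ x₂ : ℂ, 0 < τ.im →
      f τ x₁ x₂ = ee (τ + x₁ + 2 * x₂) * th τ x₂ ^ 3 * g₃ τ x₁ x₂ := fun τ x₁ x₂ hτ => by
    have := he₁ τ x₁ x₂ hτ
    rw [he₂ τ x₁ x₂ hτ, he₃ τ x₁ x₂ hτ] at this
    rw [show ee (τ + x₁ + 2 * x₂) * th τ x₂ ^ 3 * g₃ τ x₁ x₂ = ee (τ + x₁ + 2 * x₂) *
      (th τ x₂ * (th τ x₂ * (th τ x₂ * g₃ τ x₁ x₂))) by ring, ← this, ← mul_assoc, ← ee_add]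
    simp [ee_zero]
  have hz1 : ∀ τ x : ℂ, 0 < τ.im → g₃ τ 0 x = 0 := fun τ x hτ => by
    have := cancel_of_countable (countable_th hτ) (A := fun x => g₃ τ 0 x) (B := fun _ => 0)
      (hg₃.continuous hτ continuous_const continuous_id) continuous_const fun x => by
        have := h1 τ x hτ
        rw [he _ _ _ hτ] at this
        simpa [ee_ne_zero] using this
    exact congrFun this x
  have hz2 : ∀ τ x : ℂ, 0 < τ.im → g₃ τ x (-x) = 0 := fun τ x hτ => by
    have := cancel_of_countable (countable_th hτ) (A := fun x => g₃ τ (-x) x) (B := fun _ => 0)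
      (hg₃.continuous hτ (by fun_prop) continuous_id) continuous_const fun x => by
        have := h12 τ (-x) hτ
        rw [neg_neg, he _ _ _ hτ] at this
        simpa [ee_ne_zero] using this
    simpa using congrFun this (-x)
  have ord1 : ∀ F : ℂ → ℂ, Differentiable ℂ F → F 0 = 0 → ((0 + 1 : ℕ) : ℕ∞) ≤ analyticOrderAt F 0 :=
    fun F hF h0 => by
      rw [zero_add, Nat.cast_one, Order.one_le_iff_ne_zero]
      exact analyticOrderAt_ne_zero.2 ⟨hF.analyticAt 0, h0⟩
  have hlin₁ := hg₃.lin 0 1 1 0 (-1) rfl rfl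
  obtain ⟨_, h, hh, hqh, -, heh⟩ := div_th hlin₁ (hqg₃.lin 0 1 1 0) 0 fun τ x₁ hτ =>
    ord1 _ (hlin₁.differentiable hτ (differentiable_const x₁) differentiable_id) (by
      simpa using hz1 τ x₁ hτ)
  have heh' : ∀ τ x₁ x₂ : ℂ, 0 < τ.im → g₃ τ x₁ x₂ = th τ x₁ * h τ x₂ x₁ := fun τ x₁ x₂ hτ => by
    simpa using heh τ x₂ x₁ hτ
  have hz3 : ∀ τ x : ℂ, 0 < τ.im → h τ (-x) x = 0 := fun τ x hτ => by
    have := cancel_of_countable (countable_th hτ) (A := fun x => h τ (-x) x) (B := fun _ => 0)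
      (hh.continuous hτ (by fun_prop) continuous_id) continuous_const fun x => by
        have := hz2 τ x hτ
        rw [heh' _ _ _ hτ] at this
        simpa using this
    exact congrFun this x
  have hlin₂ := hh.lin (-1) 1 1 0 (-1) rfl rfl
  obtain ⟨_, p, hp, -, -, hep⟩ := div_th hlin₂ (hqh.lin (-1) 1 1 0) 0 fun τ x₁ hτ =>
    ord1 _ (hlin₂.differentiable hτ (differentiable_const x₁) differentiable_id) (by
      simpa using hz3 τ x₁ hτ)
  have hep' : ∀ τ x₁ x₂ : ℂ, 0 < τ.im → h τ x₂ x₁ = th τ (x₁ + x₂) * p τ x₁ (x₁ + x₂) :=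
    fun τ x₁ x₂ hτ => by simpa using hep τ x₁ (x₁ + x₂) hτ
  obtain ⟨_, r₁, hr₁, hd₁⟩ := div_thD hp
  obtain ⟨_, r₂, hr₂, hd₂⟩ := div_thD hr₁
  obtain ⟨_, r₃, hr₃, hd₃⟩ := div_thD hr₂
  refine ⟨_, _, hr₃.lin 1 0 1 1 1 rfl rfl, fun τ x₁ x₂ hτ => ?_⟩
  rw [he _ _ _ hτ, heh' _ _ _ hτ, hep' _ _ _ hτ, hd₁ _ _ _ hτ, hd₂ _ _ _ hτ, hd₃ _ _ _ hτ, phi]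
  simp only [Int.cast_one, Int.cast_zero, one_mul, zero_mul, add_zero]
  ring

end

section

/-- The norm form. -/
def Qf (x₁ x₂ : ℂ) : ℂ := x₁ ^ 2 + x₁ * x₂ + 2 * x₂ ^ 2

/-- The bilinear form attached to `Qf`. -/
def Bf (k l x₁ x₂ : ℂ) : ℂ := 2 * k * x₁ + k * x₂ + l * x₁ + 4 * l * x₂

/-- Jacobi forms of weight `κ` and index `m` for the norm form, with Fourier coefficients `c`.
Poles at the cusp are excluded only in the variable `τ`. -/
structure Jac (κ : ℤ) (m : ℕ) (c : T3 → ℂ) (f : ℂ → ℂ → ℂ → ℂ) : Prop where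
  rep : Rep c f
  heis : ∀ τ x₁ x₂ : ℂ, 0 < τ.im → ∀ k l : ℤ, f τ (x₁ + k * τ) (x₂ + l * τ) =
    ee (-(m * (Qf k l * τ + Bf k l x₁ x₂))) * f τ x₁ x₂
  inv : ∀ τ x₁ x₂ : ℂ, 0 < τ.im → f (-1 / τ) (x₁ / τ) (x₂ / τ) =
    τ ^ κ * ee (m * (Qf x₁ x₂ / τ)) * f τ x₁ x₂

lemma ne_zero_of_im_pos {τ : ℂ} (hτ : 0 < τ.im) : τ ≠ 0 := by
  rintro rfl
  simp at hτ

lemma im_neg_one_div {τ : ℂ} (hτ : 0 < τ.im) : 0 < (-1 / τ).im := by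
  rw [neg_div, one_div, Complex.neg_im, Complex.inv_im, neg_div, neg_neg]
  exact div_pos hτ (Complex.normSq_pos.2 (ne_zero_of_im_pos hτ))

lemma Jac.sub {κ : ℤ} {m : ℕ} {c c' : T3 → ℂ} {f f' : ℂ → ℂ → ℂ → ℂ} (h : Jac κ m c f)
    (h' : Jac κ m c' f') :
    Jac κ m (fun T => c T - c' T) fun τ x₁ x₂ => f τ x₁ x₂ - f' τ x₁ x₂ where
  rep := h.rep.sub h'.rep
  heis τ x₁ x₂ hτ k l := by rw [h.heis _ _ _ hτ, h'.heis _ _ _ hτ, mul_sub]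
  inv τ x₁ x₂ hτ := by rw [h.inv _ _ _ hτ, h'.inv _ _ _ hτ, mul_sub]

lemma Jac.sum {ι : Type*} (s : Finset ι) {κ : ℤ} {m : ℕ} {c : ι → T3 → ℂ}
    {f : ι → ℂ → ℂ → ℂ → ℂ} (h : ∀ i ∈ s, Jac κ m (c i) (f i)) :
    Jac κ m (fun T => ∑ i ∈ s, c i T) fun τ x₁ x₂ => ∑ i ∈ s, f i τ x₁ x₂ where
  rep := Rep.sum s fun i hi => (h i hi).rep
  heis τ x₁ x₂ hτ k l := by
    rw [Finset.mul_sum]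
    exact Finset.sum_congr rfl fun i hi => (h i hi).heis _ _ _ hτ _ _
  inv τ x₁ x₂ hτ := by
    rw [Finset.mul_sum]
    exact Finset.sum_congr rfl fun i hi => (h i hi).inv _ _ _ hτ

lemma Jac.mul {κ κ' : ℤ} {m m' : ℕ} {c c' : T3 → ℂ} {f f' : ℂ → ℂ → ℂ → ℂ} (h : Jac κ m c f)
    (h' : Jac κ' m' c' f') :
    Jac (κ + κ') (m + m') (fun T => ∑' S, c S * c' (T - S))
      fun τ x₁ x₂ => f τ x₁ x₂ * f' τ x₁ x₂ where
  rep := h.rep.mul h'.rep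
  heis τ x₁ x₂ hτ k l := by
    rw [h.heis _ _ _ hτ, h'.heis _ _ _ hτ, Nat.cast_add, add_mul, neg_add, ee_add]
    ring
  inv τ x₁ x₂ hτ := by
    rw [h.inv _ _ _ hτ, h'.inv _ _ _ hτ, Nat.cast_add, add_mul, ee_add,
      zpow_add₀ (ne_zero_of_im_pos hτ)]
    ring

lemma Jac.qp {κ : ℤ} {m : ℕ} {c : T3 → ℂ} {f : ℂ → ℂ → ℂ → ℂ} (h : Jac κ m c f) : QP f :=
  fun τ hτ k l => ⟨-(m * (2 * k + l)), -(m * (k + 4 * l)), -(m * (Qf k l * τ)), fun x₁ x₂ => by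
    rw [h.heis _ _ _ hτ, Bf]
    congr 2
    ring⟩

lemma countable_phi {τ : ℂ} (hτ : 0 < τ.im) (x₁ x₂ : ℂ) :
    {t : ℂ | phi τ (x₁ + t) (x₂ + t) = 0}.Countable := by
  have h0 := countable_th hτ
  refine (((h0.preimage (add_right_injective x₂)).union (h0.preimage (add_right_injective x₁))).union
    (h0.preimage (f := fun t => x₁ + x₂ + 2 * t) fun a b hab => by simpa using hab)).mono fun t ht => ?_
  simp only [phi, Set.mem_ofPred_eq, mul_eq_zero, ee_ne_zero, thD_ne_zero hτ, pow_eq_zero_iff,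
    false_or, ne_eq, OfNat.ofNat_ne_zero, not_false_eq_true] at ht
  rcases ht with (ht | ht) | ht
  · exact Or.inl (Or.inl ht)
  · exact Or.inl (Or.inr ht)
  · refine Or.inr ?_
    change th τ _ = 0
    rw [← ht]
    congr 1
    ring

/-- Equality after multiplication by `phi` implies equality. -/
lemma phi_cancel {A B : ℂ → ℂ → ℂ} {τ : ℂ} (hτ : 0 < τ.im) (x₁ x₂ : ℂ)
    (hA : Continuous fun t => A (x₁ + t) (x₂ + t)) (hB : Continuous fun t => B (x₁ + t) (x₂ + t))
    (he : ∀ x₁ x₂, phi τ x₁ x₂ * A x₁ x₂ = phi τ x₁ x₂ * B x₁ x₂) : A x₁ x₂ = B x₁ x₂ := by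
  have := cancel_of_countable (countable_phi hτ x₁ x₂) hA hB fun t => he _ _
  simpa using congrFun this 0

lemma phi_heis {τ : ℂ} (hτ : 0 < τ.im) (x₁ x₂ : ℂ) (k l : ℤ) :
    phi τ (x₁ + k * τ) (x₂ + l * τ) = ee (-(Qf k l * τ + Bf k l x₁ x₂)) * phi τ x₁ x₂ := by
  have h12 : x₁ + k * τ + (x₂ + l * τ) = x₁ + x₂ + ((k + l : ℤ) : ℂ) * τ := by push_cast; ring
  have hs : ((-1 : ℂ) ^ l) ^ 3 * (-1) ^ k * (-1) ^ (k + l) = 1 := by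
    rw [zpow_add₀ (by norm_num)]
    have h1 : ((-1 : ℂ) ^ l) * (-1) ^ l = 1 := by rw [← mul_zpow]; norm_num
    have h2 : ((-1 : ℂ) ^ k) * (-1) ^ k = 1 := by rw [← mul_zpow]; norm_num
    linear_combination ((-1 : ℂ) ^ l) ^ 2 * (-1) ^ l * (-1) ^ l * h2 + (((-1 : ℂ) ^ l) * (-1) ^ l + 1) * h1
  have he : ee (τ + (x₁ + k * τ) + 2 * (x₂ + l * τ)) * ee (-(tri l * τ + l * x₂)) ^ 3 *
      ee (-(tri k * τ + k * x₁)) * ee (-(tri (k + l) * τ + ((k + l : ℤ) : ℂ) * (x₁ + x₂))) =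
      ee (-(Qf k l * τ + Bf k l x₁ x₂)) * ee (τ + x₁ + 2 * x₂) := by
    rw [pow_succ, pow_two]
    simp only [← ee_add]
    congr 1
    have h1 := tri_cast l
    have h2 := tri_cast k
    have h3 := tri_cast (k + l)
    rw [h1, h2, h3, Qf, Bf]
    push_cast
    ring
  rw [phi, phi, h12, th_add_mul_tau τ _ l hτ, th_add_mul_tau τ _ k hτ, th_add_mul_tau τ _ _ hτ]
  linear_combination (ee (τ + (x₁ + k * τ) + 2 * (x₂ + l * τ)) * ee (-(tri l * τ + l * x₂)) ^ 3 *
      ee (-(tri k * τ + k * x₁)) * ee (-(tri (k + l) * τ + ((k + l : ℤ) : ℂ) * (x₁ + x₂)))) *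
      thD τ ^ 3 * th τ x₂ ^ 3 * th τ x₁ * th τ (x₁ + x₂) * hs +
      thD τ ^ 3 * th τ x₂ ^ 3 * th τ x₁ * th τ (x₁ + x₂) * he

lemma phi_inv {τ : ℂ} (hτ : 0 < τ.im) (x₁ x₂ : ℂ) :
    phi (-1 / τ) (x₁ / τ) (x₂ / τ) = τ ^ 7 * ee (Qf x₁ x₂ / τ) * phi τ x₁ x₂ := by
  have h0 := ne_zero_of_im_pos hτ
  have he : ee (-1 / τ + x₁ / τ + 2 * (x₂ / τ)) * ee (x₂ ^ 2 / (2 * τ) + x₂ / 2 - x₂ / (2 * τ)) ^ 3 *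
      ee (x₁ ^ 2 / (2 * τ) + x₁ / 2 - x₁ / (2 * τ)) *
      ee ((x₁ + x₂) ^ 2 / (2 * τ) + (x₁ + x₂) / 2 - (x₁ + x₂) / (2 * τ)) * ee (τ + 1 / τ) =
      ee (Qf x₁ x₂ / τ) * ee (τ + x₁ + 2 * x₂) := by
    rw [pow_succ, pow_two]
    simp only [← ee_add]
    congr 1
    rw [Qf]
    field_simp
    ring
  have hs := sMul_pow τ hτ
  rw [phi, phi, ← add_div x₁ x₂ τ, th_S τ _ hτ, th_S τ _ hτ, th_S τ _ hτ, thD_S τ hτ]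
  linear_combination ee (-1 / τ + x₁ / τ + 2 * (x₂ / τ)) *
    ee (x₂ ^ 2 / (2 * τ) + x₂ / 2 - x₂ / (2 * τ)) ^ 3 *
      ee (x₁ ^ 2 / (2 * τ) + x₁ / 2 - x₁ / (2 * τ)) *
      ee ((x₁ + x₂) ^ 2 / (2 * τ) + (x₁ + x₂) / 2 - (x₁ + x₂) / (2 * τ)) * τ ^ 3 *
      thD τ ^ 3 * th τ x₂ ^ 3 * th τ x₁ * th τ (x₁ + x₂) * hs +
      τ ^ 7 * thD τ ^ 3 * th τ x₂ ^ 3 * th τ x₁ * th τ (x₁ + x₂) * he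

lemma phi_neg {τ : ℂ} (hτ : 0 < τ.im) (x₁ x₂ : ℂ) : phi τ (-x₁) (-x₂) = -phi τ x₁ x₂ := by
  have he : ee (τ + -x₁ + 2 * -x₂) * ee x₂ ^ 3 * ee x₁ * ee (x₁ + x₂) = ee (τ + x₁ + 2 * x₂) := by
    rw [pow_succ, pow_two]
    simp only [← ee_add]
    congr 1
    ring
  rw [phi, phi, ← neg_add, th_neg τ _ hτ, th_neg τ _ hτ, th_neg τ _ hτ]
  linear_combination -(thD τ ^ 3 * th τ x₂ ^ 3 * th τ x₁ * th τ (x₁ + x₂)) * he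

lemma phi_sigma {τ : ℂ} (hτ : 0 < τ.im) (x₁ x₂ : ℂ) : phi τ (x₁ + x₂) (-x₂) = -phi τ x₁ x₂ := by
  have he : ee (τ + (x₁ + x₂) + 2 * -x₂) * ee x₂ ^ 3 = ee (τ + x₁ + 2 * x₂) := by
    rw [pow_succ, pow_two]
    simp only [← ee_add]
    congr 1
    ring
  rw [phi, phi, th_neg τ _ hτ, show x₁ + x₂ + -x₂ = x₁ by ring]
  linear_combination -(thD τ ^ 3 * th τ x₂ ^ 3 * th τ x₁ * th τ (x₁ + x₂)) * he

lemma Rep.congr {c : T3 → ℂ} {f g : ℂ → ℂ → ℂ → ℂ} (h : Rep c f)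
    (hfg : ∀ τ x₁ x₂ : ℂ, 0 < τ.im → f τ x₁ x₂ = g τ x₁ x₂) : Rep c g :=
  ⟨h.1, fun τ x₁ x₂ hτ => hfg τ x₁ x₂ hτ ▸ h.2 τ x₁ x₂ hτ⟩

theorem exists_jac_phi : ∃ c, Jac 7 1 c phi ∧ ∀ T, T.1 < 1 → c T = 0 := by
  obtain ⟨c, hc⟩ := rep_th
  obtain ⟨d, hd⟩ := rep_thD
  have h1 := hc.lin 0 1 1 0 (-1) rfl rfl
  have h12 := hc.lin 1 0 1 1 1 rfl rfl
  obtain ⟨e, he⟩ := Rep.exp (0, 1, 2) le_rfl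
  have hm := ((((he.mul hd).mul (hd.mul hd)).mul ((hc.mul hc).mul hc)).mul h1).mul h12
  have hs := hm.shift (-1, 0, 0) fun T hT => hm.1 T (by simp only at hT; omega)
  have hphi := hs.congr (g := phi) fun τ x₁ x₂ _ => by
    simp only [phi, e3, Int.cast_one, Int.cast_zero, Int.cast_neg, one_mul, zero_mul, add_zero,
      zero_add, neg_mul, neg_neg, Int.cast_ofNat]
    rw [add_assoc, ee_add τ]
    ring
  exact ⟨_, ⟨hphi, fun τ x₁ x₂ hτ k l => by rw [phi_heis hτ, Nat.cast_one, one_mul],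
    fun τ x₁ x₂ hτ => by
      rw [phi_inv hτ, Nat.cast_one, one_mul]
      norm_cast⟩, fun T hT => hm.1 _ (by rw [Prod.fst_add]; omega)⟩

lemma Jac.of_phi_mul {κ : ℤ} {m : ℕ} {c c' : T3 → ℂ} {f g : ℂ → ℂ → ℂ → ℂ}
    (hf : Jac (κ + 7) (m + 1) c f) (hg : Rep c' g)
    (he : ∀ τ x₁ x₂ : ℂ, 0 < τ.im → f τ x₁ x₂ = phi τ x₁ x₂ * g τ x₁ x₂) : Jac κ m c' g where
  rep := hg
  heis τ x₁ x₂ hτ k l := by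
    have hE : Continuous fun t =>
        ee (-(m * (Qf k l * τ + Bf k l (x₁ + t) (x₂ + t)))) * g τ (x₁ + t) (x₂ + t) :=
      (continuous_ee.comp (by unfold Bf; fun_prop)).mul (hg.continuous hτ (by fun_prop) (by fun_prop))
    refine phi_cancel (A := fun x₁ x₂ => g τ (x₁ + k * τ) (x₂ + l * τ))
      (B := fun x₁ x₂ => ee (-(m * (Qf k l * τ + Bf k l x₁ x₂))) * g τ x₁ x₂) hτ x₁ x₂
      (hg.continuous hτ (by fun_prop) (by fun_prop)) hE fun x₁ x₂ => ?_
    have h1 := hf.heis τ x₁ x₂ hτ k l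
    rw [he _ _ _ hτ, he _ _ _ hτ, phi_heis hτ] at h1
    refine mul_left_cancel₀ (ee_ne_zero (-(Qf k l * τ + Bf k l x₁ x₂))) ?_
    rw [← mul_assoc, h1, Nat.cast_add, add_mul, neg_add, ee_add, Nat.cast_one, one_mul]
    ring
  inv τ x₁ x₂ hτ := by
    have h0 := ne_zero_of_im_pos hτ
    refine phi_cancel (A := fun x₁ x₂ => g (-1 / τ) (x₁ / τ) (x₂ / τ))
      (B := fun x₁ x₂ => τ ^ κ * ee (m * (Qf x₁ x₂ / τ)) * g τ x₁ x₂) hτ x₁ x₂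
      (hg.continuous (im_neg_one_div hτ) (by fun_prop) (by fun_prop))
      ((continuous_const.mul (continuous_ee.comp (by unfold Qf; fun_prop))).mul
        (hg.continuous hτ (by fun_prop) (by fun_prop))) fun x₁ x₂ => ?_
    have h1 := hf.inv τ x₁ x₂ hτ
    rw [he _ _ _ hτ, he _ _ _ (im_neg_one_div hτ), phi_inv hτ, Nat.cast_add, add_mul, ee_add,
      Nat.cast_one, one_mul, zpow_add₀ h0] at h1
    refine mul_left_cancel₀ (mul_ne_zero (pow_ne_zero 7 h0) (ee_ne_zero (Qf x₁ x₂ / τ))) ?_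
    rw [← mul_assoc, h1]
    norm_cast
    ring

end

section

/-- The slash action of an integral matrix of determinant `m` on a Jacobi form of weight `7`. -/
def slashF (f : ℂ → ℂ → ℂ → ℂ) (m a b c d : ℤ) (τ x₁ x₂ : ℂ) : ℂ :=
  ((c * τ + d) ^ 7)⁻¹ * ee (-(m * c * Qf x₁ x₂ / (c * τ + d))) *
    f ((a * τ + b) / (c * τ + d)) (m * x₁ / (c * τ + d)) (m * x₂ / (c * τ + d))

lemma lin_ne_zero {τ : ℂ} (hτ : 0 < τ.im) {c d : ℤ} (h : c ≠ 0 ∨ d ≠ 0) : (c * τ + d : ℂ) ≠ 0 := by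
  intro h0
  have h1 := congrArg Complex.im h0
  have h2 := congrArg Complex.re h0
  simp at h1 h2
  rcases h1 with h1 | h1
  · subst h1
    simp at h2
    simp_all
  · exact hτ.ne' h1

lemma im_moeb {τ : ℂ} (hτ : 0 < τ.im) {m a b c d : ℤ} (hd : a * d - b * c = m) (hm : 0 < m) :
    0 < ((a * τ + b) / (c * τ + d)).im := by
  have h : (c * τ + d : ℂ) ≠ 0 := lin_ne_zero hτ (by
    by_contra! h
    rw [h.1, h.2] at hd
    simp at hd
    omega)
  have h1 : ((a * τ + b) / (c * τ + d)).im = m * τ.im / Complex.normSq (c * τ + d) := by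
    have hd' : (m : ℝ) = a * d - b * c := by exact_mod_cast hd.symm
    rw [Complex.div_im, hd']
    simp
    ring
  rw [h1]
  exact div_pos (mul_pos (by exact_mod_cast hm) hτ) (Complex.normSq_pos.2 h)

section
variable {c₀ : T3 → ℂ} {f : ℂ → ℂ → ℂ → ℂ} (hf : Jac 7 1 c₀ f)
include hf

lemma slashF_T {m a b c d : ℤ} {τ : ℂ} (hτ : 0 < τ.im) (x₁ x₂ : ℂ)
    (hd : a * d - b * c = m) (hm : 0 < m) :
    slashF f m (a + c) (b + d) c d τ x₁ x₂ = slashF f m a b c d τ x₁ x₂ := by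
  have h : (c * τ + d : ℂ) ≠ 0 := lin_ne_zero hτ (by
    by_contra! h
    rw [h.1, h.2] at hd
    simp at hd
    omega)
  have := hf.rep.periodic (im_moeb hτ hd hm) (m * x₁ / (c * τ + d)) (m * x₂ / (c * τ + d)) 1 0 0
  simp only [Int.cast_one, Int.cast_zero, add_zero] at this
  rw [slashF, slashF, ← this]
  congr 2
  push_cast
  field_simp
  ring

lemma slashF_S {m a b c d : ℤ} {τ : ℂ} (hτ : 0 < τ.im) (x₁ x₂ : ℂ)
    (hd : a * d - b * c = m) (hm : 0 < m) :
    slashF f m (-c) (-d) a b τ x₁ x₂ = slashF f m a b c d τ x₁ x₂ := by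
  have h : (c * τ + d : ℂ) ≠ 0 := lin_ne_zero hτ (by
    by_contra! h
    rw [h.1, h.2] at hd
    simp at hd
    omega)
  have h' : (a * τ + b : ℂ) ≠ 0 := lin_ne_zero hτ (by
    by_contra! h
    rw [h.1, h.2] at hd
    simp at hd
    omega)
  have hdc : (a * d - b * c : ℂ) = m := by exact_mod_cast hd
  have := hf.inv _ (m * x₁ / (c * τ + d)) (m * x₂ / (c * τ + d)) (im_moeb hτ hd hm)
  have e1 : -1 / ((a * τ + b) / (c * τ + d) : ℂ) = (((-c : ℤ) : ℂ) * τ + ((-d : ℤ) : ℂ)) / (a * τ + b) := by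
    push_cast
    field_simp
    ring
  have e2 : ∀ x : ℂ, m * x / (c * τ + d) / ((a * τ + b) / (c * τ + d)) = m * x / (a * τ + b) := fun x => by
    field_simp
  rw [e1, e2, e2] at this
  rw [slashF, slashF, this]
  have e3 : ee (-(m * a * Qf x₁ x₂ / (a * τ + b))) * ee (((1 : ℕ) : ℂ) * (Qf (m * x₁ / (c * τ + d)) (m * x₂ / (c * τ + d)) /
      ((a * τ + b) / (c * τ + d)))) = ee (-(m * c * Qf x₁ x₂ / (c * τ + d))) := by
    rw [← ee_add]
    congr 1
    rw [Qf, Qf, ← hdc]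
    field_simp
    push_cast
    ring
  rw [← e3]
  have e4 : ((a * τ + b) / (c * τ + d) : ℂ) ^ (7 : ℤ) = (a * τ + b) ^ 7 * ((c * τ + d) ^ 7)⁻¹ := by
    rw [← div_eq_mul_inv, ← div_pow]
    norm_cast
  rw [e4]
  field_simp

omit hf in
lemma slashF_mul_S {m a b c d : ℤ} {τ : ℂ} (hτ : 0 < τ.im) (x₁ x₂ : ℂ)
    (hd : a * d - b * c = m) (hm : 0 < m) :
    slashF f m a b c d (-1 / τ) (x₁ / τ) (x₂ / τ) =
      τ ^ 7 * ee (m * (Qf x₁ x₂ / τ)) * slashF f m b (-a) d (-c) τ x₁ x₂ := by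
  have h0 := ne_zero_of_im_pos hτ
  have h : (d * τ - c : ℂ) ≠ 0 := by
    have := lin_ne_zero hτ (c := d) (d := -c) (by
      by_contra! h
      simp at h
      rw [h.1, h.2] at hd
      simp at hd
      omega)
    push_cast at this
    rwa [← sub_eq_add_neg] at this
  have e1 : (c * (-1 / τ) + d : ℂ) = (d * τ - c) / τ := by field_simp; ring
  have e2 : (a * (-1 / τ) + b : ℂ) = (b * τ - a) / τ := by field_simp; ring
  have e3 : ee (m * (Qf x₁ x₂ / τ)) * ee (-(m * d * Qf x₁ x₂ / (d * τ - c))) =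
      ee (-(m * c * Qf (x₁ / τ) (x₂ / τ) / ((d * τ - c) / τ))) := by
    rw [← ee_add]
    congr 1
    rw [Qf, Qf]
    obtain ⟨q, hq⟩ : ∃ q : ℂ, q = d * τ - c := ⟨_, rfl⟩
    rw [show (c : ℂ) = d * τ - q by rw [hq]; ring] at h ⊢
    rw [sub_sub_cancel] at h ⊢
    field_simp
    ring
  have e4 : ∀ x : ℂ, m * (x / τ) / ((d * τ - c) / τ) = m * x / (d * τ - c) := fun x => by field_simp
  rw [slashF, slashF, e1, e2, e4, e4, ← e3, div_div_div_cancel_right₀ h0]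
  push_cast
  rw [← sub_eq_add_neg, ← sub_eq_add_neg]
  field_simp

open FixedDetMatrices in
lemma exists_reps {m : ℤ} (hm : 0 < m) (A : FixedDetMatrix (Fin 2) ℤ m) :
    ∃ R ∈ reps m, (∃ γ : SpecialLinearGroup (Fin 2) ℤ, R = γ • A) ∧ ∀ τ x₁ x₂ : ℂ, 0 < τ.im →
      slashF f m (R.1 0 0) (R.1 0 1) (R.1 1 0) (R.1 1 1) τ x₁ x₂ =
        slashF f m (A.1 0 0) (A.1 0 1) (A.1 1 0) (A.1 1 1) τ x₁ x₂ := by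
  have hdet : ∀ A : FixedDetMatrix (Fin 2) ℤ m, A.1 0 0 * A.1 1 1 - A.1 0 1 * A.1 1 0 = m := fun A => by
    rw [← Matrix.det_fin_two, A.2]
  induction A using induction_on hm.ne' with
  | h0 A h1 h2 h3 h4 => exact ⟨A, ⟨h1, h2, h3, h4⟩, ⟨1, (one_smul _ _).symm⟩, fun _ _ _ _ => rfl⟩
  | hS B ih =>
    obtain ⟨R, hR, ⟨γ, hγ⟩, h⟩ := ih
    refine ⟨R, hR, ⟨γ * ModularGroup.S⁻¹, by rw [mul_smul, inv_smul_smul, hγ]⟩, fun τ x₁ x₂ hτ => ?_⟩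
    rw [h _ _ _ hτ, ← slashF_S hf hτ x₁ x₂ (hdet B) hm, smul_coe]
    simp [ModularGroup.S, Matrix.mul_apply, Fin.sum_univ_two]
  | hT B ih =>
    obtain ⟨R, hR, ⟨γ, hγ⟩, h⟩ := ih
    refine ⟨R, hR, ⟨γ * ModularGroup.T⁻¹, by rw [mul_smul, inv_smul_smul, hγ]⟩, fun τ x₁ x₂ hτ => ?_⟩
    rw [h _ _ _ hτ, ← slashF_T hf hτ x₁ x₂ (hdet B) hm, smul_coe]
    simp [ModularGroup.T, Matrix.mul_apply, Fin.sum_univ_two]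

omit hf in
open FixedDetMatrices in
lemma reps_unique {m : ℤ} {R R' : FixedDetMatrix (Fin 2) ℤ m} (hR : R ∈ reps m) (hR' : R' ∈ reps m)
    (γ : SpecialLinearGroup (Fin 2) ℤ) (h : R' = γ • R) : R' = R := by
  obtain ⟨h1, h2, h3, h4⟩ := hR
  obtain ⟨h1', h2', h3', h4'⟩ := hR'
  have hm : R'.1 = γ.1 * R.1 := by rw [h, smul_coe]
  have m00 := congrFun₂ hm 0 0
  have m01 := congrFun₂ hm 0 1
  have m10 := congrFun₂ hm 1 0
  have m11 := congrFun₂ hm 1 1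
  have hg := γ.2
  rw [Matrix.det_fin_two] at hg
  simp only [Matrix.mul_apply, Fin.sum_univ_two, h1, h1', mul_zero, add_zero] at m00 m01 m10 m11
  have g10 : γ.1 1 0 = 0 := by
    rcases mul_eq_zero.1 m10.symm with h | h
    · exact h
    · omega
  rw [g10, mul_zero, sub_zero] at hg
  have g00 : 0 < γ.1 0 0 := by
    rw [m00] at h2'
    exact pos_of_mul_pos_left h2' h2.le
  have g00' : γ.1 0 0 = 1 := by
    rcases Int.mul_eq_one_iff_eq_one_or_neg_one.1 hg with h | h
    · exact h.1
    · omega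
  have g11 : γ.1 1 1 = 1 := by rwa [g00', one_mul] at hg
  rw [g10, g11, zero_mul, one_mul, zero_add] at m11
  rw [g00', one_mul] at m00 m01
  have g01 : γ.1 0 1 = 0 := by
    by_contra hne
    rw [m11] at h4'
    have h5 : |R'.1 0 1 - R.1 0 1| < |R.1 1 1| := by
      rw [abs_of_nonneg h3] at h4
      rw [abs_of_nonneg h3'] at h4'
      rw [abs_lt]
      constructor <;> omega
    rw [m01, add_sub_cancel_left, abs_mul] at h5
    have := Int.one_le_abs hne
    nlinarith [abs_nonneg (R.1 1 1)]
  rw [g01, zero_mul, add_zero] at m01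
  ext i j
  fin_cases i <;> fin_cases j <;> simp [m00, m01, m11, h1, h1']

open FixedDetMatrices in
lemma sum_slashF_inv {m : ℤ} (hm : 0 < m) {τ : ℂ} (hτ : 0 < τ.im) (x₁ x₂ : ℂ) :
    ∑ R : reps m, slashF f m (R.1.1 0 0) (R.1.1 0 1) (R.1.1 1 0) (R.1.1 1 1) (-1 / τ) (x₁ / τ) (x₂ / τ) =
      τ ^ 7 * ee (m * (Qf x₁ x₂ / τ)) *
        ∑ R : reps m, slashF f m (R.1.1 0 0) (R.1.1 0 1) (R.1.1 1 0) (R.1.1 1 1) τ x₁ x₂ := by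
  let rS : FixedDetMatrix (Fin 2) ℤ m → FixedDetMatrix (Fin 2) ℤ m := fun A =>
    ⟨!![A.1 0 1, -A.1 0 0; A.1 1 1, -A.1 1 0], by
      have := A.2
      rw [Matrix.det_fin_two] at this ⊢
      simp
      linarith⟩
  have rS_smul : ∀ (γ : SpecialLinearGroup (Fin 2) ℤ) A, rS (γ • A) = γ • rS A := fun γ A => by
    ext i j
    rw [smul_coe]
    fin_cases i <;> fin_cases j <;> simp [rS, smul_coe, Matrix.mul_apply, Fin.sum_univ_two] <;> ring
  have rS_inj : ∀ A B, rS A = rS B → A = B := fun A B h => by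
    have h1 := congrArg Subtype.val h
    have h00 := congrFun₂ h1 0 0
    have h01 := congrFun₂ h1 0 1
    have h10 := congrFun₂ h1 1 0
    have h11 := congrFun₂ h1 1 1
    simp [rS] at h00 h01 h10 h11
    ext i j
    fin_cases i <;> fin_cases j <;> simp [*]
  choose g hg1 hg2 hg3 using exists_reps hf hm
  choose γ hγ using hg2
  let p : reps m → reps m := fun R => ⟨g (rS R.1), hg1 _⟩
  have hp : Function.Injective p := fun R R' h => by
    have h1 : g (rS R.1) = g (rS R'.1) := congrArg Subtype.val h
    rw [hγ, hγ, eq_comm, ← eq_inv_smul_iff, smul_smul, ← rS_smul] at h1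
    exact (Subtype.ext (reps_unique R.2 R'.2 _ (rS_inj _ _ h1))).symm
  have hb : Function.Bijective p := Finite.injective_iff_bijective.1 hp
  rw [← (Equiv.ofBijective p hb).sum_comp fun R : reps m =>
    slashF f m (R.1.1 0 0) (R.1.1 0 1) (R.1.1 1 0) (R.1.1 1 1) τ x₁ x₂, Finset.mul_sum]
  refine Finset.sum_congr rfl fun R _ => ?_
  have hd : R.1.1 0 0 * R.1.1 1 1 - R.1.1 0 1 * R.1.1 1 0 = m := by
    rw [← Matrix.det_fin_two, R.1.2]
  rw [slashF_mul_S hτ x₁ x₂ hd hm]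
  congr 1
  exact (hg3 (rS R.1) τ x₁ x₂ hτ).symm

end

end

section

/-- The Hecke type operator raising the index by the factor `m`, on functions of weight `7`. -/
def liftV (f : ℂ → ℂ → ℂ → ℂ) (m : ℕ) (τ x₁ x₂ : ℂ) : ℂ :=
  ∑ a ∈ m.divisors, ((a : ℂ) ^ 6 / (m / a : ℕ)) *
    ∑ b ∈ Finset.range (m / a), f ((a * τ + b) / (m / a : ℕ)) (a * x₁) (a * x₂)

/-- Fourier coefficients of `liftV`. -/
def liftC (c : T3 → ℂ) (m : ℕ) (T : T3) : ℂ :=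
  ∑ a ∈ m.divisors, ((a : ℂ) ^ 6 / (m / a : ℕ)) *
    if (a : ℤ) ∣ T.1 ∧ (a : ℤ) ∣ T.2.1 ∧ (a : ℤ) ∣ T.2.2 then
      (m / a : ℕ) * c ((m / a : ℕ) * (T.1 / a), T.2.1 / a, T.2.2 / a) else 0

open FixedDetMatrices in
lemma sum_reps {m : ℕ} (hm : 0 < m) (G : ℤ → ℤ → ℤ → ℤ → ℂ) :
    ∑ R : reps (m : ℤ), G (R.1.1 0 0) (R.1.1 0 1) (R.1.1 1 0) (R.1.1 1 1) =
      ∑ a ∈ m.divisors, ∑ b ∈ Finset.range (m / a), G a b 0 (m / a : ℕ) := by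
  rw [Finset.sum_sigma']
  symm
  refine Finset.sum_bij (fun p hp => ⟨⟨!![(p.1 : ℤ), p.2; 0, (m / p.1 : ℕ)], by
      rw [Finset.mem_sigma, Nat.mem_divisors] at hp
      rw [Matrix.det_fin_two]
      simp only [Matrix.of_apply, Matrix.cons_val', Matrix.cons_val_zero, Matrix.cons_val_one,
        Matrix.cons_val_fin_one, mul_zero, sub_zero]
      exact_mod_cast Nat.mul_div_cancel' hp.1.1⟩, by
      rw [Finset.mem_sigma, Nat.mem_divisors, Finset.mem_range] at hp
      have h1 : 0 < p.1 := Nat.pos_of_dvd_of_pos hp.1.1 hm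
      refine ⟨rfl, ?_, ?_, ?_⟩
      · simpa using h1
      · simp
      · simp only [Matrix.of_apply, Matrix.cons_val', Matrix.cons_val_zero, Matrix.cons_val_one,
          Matrix.cons_val_fin_one, Nat.abs_cast]
        exact_mod_cast hp.2⟩) (fun _ _ => Finset.mem_univ _) ?_ ?_ ?_
  · rintro ⟨a, b⟩ hp ⟨a', b'⟩ hp' h
    have h1 := congrArg (fun R : reps (m : ℤ) => R.1.1) h
    have h00 := congrFun₂ h1 0 0
    have h01 := congrFun₂ h1 0 1
    simp at h00 h01
    subst h00 h01
    rfl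
  · rintro ⟨⟨A, hA⟩, h1, h2, h3, h4⟩ -
    simp only at h1 h2 h3 h4
    rw [Matrix.det_fin_two, h1, mul_zero, sub_zero] at hA
    have hd : 0 < A 1 1 := pos_of_mul_pos_right (a := A 0 0) (by rw [hA]; exact_mod_cast hm) h2.le
    rw [abs_of_nonneg h3, abs_of_pos hd] at h4
    obtain ⟨a, ha⟩ := Int.eq_ofNat_of_zero_le h2.le
    obtain ⟨b, hb⟩ := Int.eq_ofNat_of_zero_le h3
    obtain ⟨d, hd'⟩ := Int.eq_ofNat_of_zero_le hd.le
    rw [ha, hd'] at hA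
    have hA' : a * d = m := by exact_mod_cast hA
    have ha0 : 0 < a := by omega
    have hdm : m / a = d := by rw [← hA', Nat.mul_div_cancel_left _ ha0]
    refine ⟨⟨a, b⟩, ?_, ?_⟩
    · rw [Finset.mem_sigma, Nat.mem_divisors, Finset.mem_range]
      exact ⟨⟨⟨d, hA'.symm⟩, hm.ne'⟩, by simp only [hdm]; omega⟩
    · refine Subtype.ext (FixedDetMatrices.ext _ _ fun i j => ?_)
      fin_cases i <;> fin_cases j <;> simp [ha, hb, hd', h1]
      exact_mod_cast hdm
  · rintro ⟨a, b⟩ hp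
    simp

lemma dvd_facts {m a : ℕ} (ha : a ∈ m.divisors) : 0 < a ∧ 0 < m / a ∧ (a : ℂ) * (m / a : ℕ) = m := by
  rw [Nat.mem_divisors] at ha
  have h1 := Nat.pos_of_dvd_of_pos ha.1 (Nat.pos_of_ne_zero ha.2)
  exact ⟨h1, Nat.div_pos (Nat.le_of_dvd (Nat.pos_of_ne_zero ha.2) ha.1) h1,
    by exact_mod_cast Nat.mul_div_cancel' ha.1⟩

lemma im_hecke {τ : ℂ} (hτ : 0 < τ.im) {a d : ℕ} (ha : 0 < a) (hd : 0 < d) (b : ℕ) :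
    0 < ((a * τ + b) / d : ℂ).im := by
  rw [Complex.div_natCast_im]
  simp only [Complex.add_im, Complex.mul_im, Complex.natCast_re, Complex.natCast_im, zero_mul, add_zero]
  positivity

open FixedDetMatrices in
lemma liftV_eq {f : ℂ → ℂ → ℂ → ℂ} {m : ℕ} (hm : 0 < m) (τ x₁ x₂ : ℂ) :
    liftV f m τ x₁ x₂ = m ^ 6 *
      ∑ R : reps (m : ℤ), slashF f m (R.1.1 0 0) (R.1.1 0 1) (R.1.1 1 0) (R.1.1 1 1) τ x₁ x₂ := by
  rw [sum_reps hm fun a b c d => slashF f m a b c d τ x₁ x₂, liftV, Finset.mul_sum]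
  refine Finset.sum_congr rfl fun a ha => ?_
  obtain ⟨h1, h2, h3⟩ := dvd_facts ha
  rw [Finset.mul_sum, Finset.mul_sum]
  refine Finset.sum_congr rfl fun b _ => ?_
  have hd : ((m / a : ℕ) : ℂ) ≠ 0 := by exact_mod_cast h2.ne'
  have hx : ∀ x : ℂ, m * x / (m / a : ℕ) = a * x := fun x => by
    rw [← h3]
    field_simp
  rw [slashF]
  simp only [Int.cast_zero, zero_mul, zero_add, mul_zero, zero_div, neg_zero, ee_zero, mul_one,
    Int.cast_natCast, hx]
  rw [← mul_assoc]
  congr 1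
  rw [← h3]
  field_simp

lemma sum_ee_root (d : ℕ) (hd : 0 < d) (n : ℤ) :
    ∑ b ∈ Finset.range d, ee (n * b / d) = if (d : ℤ) ∣ n then (d : ℂ) else 0 := by
  have hd' : (d : ℂ) ≠ 0 := by exact_mod_cast hd.ne'
  have h1 : ∀ b : ℕ, ee (n * b / d) = ee (n / d) ^ b := fun b => by
    rw [← zpow_natCast, ← ee_mul_int]
    congr 1
    push_cast
    ring
  simp only [h1]
  split_ifs with h
  · obtain ⟨q, rfl⟩ := h
    have : ee (((d * q : ℤ) : ℂ) / d) = 1 := by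
      push_cast
      rw [mul_div_cancel_left₀ _ hd', ee_int]
    simp only [this, one_pow, Finset.sum_const, Finset.card_range, nsmul_eq_mul, mul_one]
  · have hne : ee (n / d : ℂ) ≠ 1 := fun h2 => by
      obtain ⟨q, hq⟩ := ee_eq_one h2
      rw [div_eq_iff hd'] at hq
      exact h ⟨q, by have : n = q * d := by exact_mod_cast hq
                     rw [this, mul_comm]⟩
    rw [geom_sum_eq hne]
    have : ee (n / d : ℂ) ^ d = 1 := by
      rw [← h1, mul_div_assoc, div_self hd', mul_one, ee_int]
    rw [this, sub_self, zero_div]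

lemma Rep.hecke {c : T3 → ℂ} {f : ℂ → ℂ → ℂ → ℂ} (h : Rep c f) {a d : ℕ} (ha : 0 < a) (hd : 0 < d) :
    Rep (fun T => if (a : ℤ) ∣ T.1 ∧ (a : ℤ) ∣ T.2.1 ∧ (a : ℤ) ∣ T.2.2 then
      d * c (d * (T.1 / a), T.2.1 / a, T.2.2 / a) else 0)
      fun τ x₁ x₂ => ∑ b ∈ Finset.range d, f ((a * τ + b) / d) (a * x₁) (a * x₂) := by
  have ha' : (a : ℤ) ≠ 0 := by exact_mod_cast ha.ne'
  have hd' : (d : ℤ) ≠ 0 := by exact_mod_cast hd.ne'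
  have hdC : (d : ℂ) ≠ 0 := by exact_mod_cast hd.ne'
  refine ⟨fun T hT => ?_, fun τ x₁ x₂ hτ => ?_⟩
  · beta_reduce
    split_ifs with hdv
    · rw [h.1, mul_zero]
      obtain ⟨q, hq⟩ := hdv.1
      simp only [hq, Int.mul_ediv_cancel_left _ ha']
      have : q < 0 := by
        rw [hq] at hT
        by_contra! hq0
        exact absurd hT (not_lt.2 (by positivity))
      have : 0 < (d : ℤ) := by exact_mod_cast hd
      nlinarith
    · rfl
  let ι₁ : T3 → T3 := fun T => (d * T.1, T.2.1, T.2.2)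
  let ι₂ : T3 → T3 := fun T => (a * T.1, a * T.2.1, a * T.2.2)
  have hι₁ : Function.Injective ι₁ := fun S T hST => by
    simp only [ι₁, Prod.mk.injEq, mul_right_inj' hd'] at hST
    exact Prod.ext hST.1 (Prod.ext hST.2.1 hST.2.2)
  have hι₂ : Function.Injective ι₂ := fun S T hST => by
    simp only [ι₂, Prod.mk.injEq, mul_right_inj' ha'] at hST
    exact Prod.ext hST.1 (Prod.ext hST.2.1 hST.2.2)
  have hs : HasSum (fun T => ∑ b ∈ Finset.range d, c T * e3 T ((a * τ + b) / d) (a * x₁) (a * x₂))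
      (∑ b ∈ Finset.range d, f ((a * τ + b) / d) (a * x₁) (a * x₂)) :=
    hasSum_sum fun b _ => h.2 _ _ _ (im_hecke hτ ha hd b)
  have hs1 := hs.congr_fun (g := fun T : T3 => c T * (if (d : ℤ) ∣ T.1 then (d : ℂ) else 0) *
      ee (T.1 * (a * τ / d) + T.2.1 * (a * x₁) + T.2.2 * (a * x₂))) fun T => by
    rw [← sum_ee_root d hd, Finset.mul_sum, Finset.sum_mul]
    refine Finset.sum_congr rfl fun b _ => ?_
    rw [e3, mul_assoc, ← ee_add]
    congr 2
    field_simp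
    ring
  rw [← hι₁.hasSum_iff] at hs1
  · rw [← hι₂.hasSum_iff]
    · refine hs1.congr_fun fun T => ?_
      simp only [Function.comp, ι₁, ι₂, dvd_mul_right, true_and, if_true, Int.mul_ediv_cancel_left _ ha']
      rw [mul_comm (d : ℂ), e3]
      congr 2
      push_cast
      field_simp
    · intro T hT
      beta_reduce
      rw [if_neg, zero_mul]
      rintro ⟨⟨p, hp⟩, ⟨q, hq⟩, ⟨r, hr⟩⟩
      exact hT ⟨(p, q, r), Prod.ext hp.symm (Prod.ext hq.symm hr.symm)⟩
  · intro T hT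
    rw [if_neg, mul_zero, zero_mul]
    rintro ⟨p, hp⟩
    exact hT ⟨(p, T.2.1, T.2.2), Prod.ext hp.symm rfl⟩

lemma Rep.liftV {c : T3 → ℂ} {f : ℂ → ℂ → ℂ → ℂ} (h : Rep c f) (m : ℕ) :
    Rep (liftC c m) (liftV f m) :=
  Rep.sum m.divisors fun _ ha => (h.hecke (dvd_facts ha).1 (dvd_facts ha).2.1).const_mul _

theorem Jac.liftV {c : T3 → ℂ} {f : ℂ → ℂ → ℂ → ℂ} (h : Jac 7 1 c f) {m : ℕ} (hm : 0 < m) :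
    Jac 7 m (liftC c m) (liftV f m) where
  rep := h.rep.liftV m
  heis τ x₁ x₂ hτ k l := by
    unfold HermB7.liftV
    rw [Finset.mul_sum]
    refine Finset.sum_congr rfl fun a ha => ?_
    obtain ⟨h1, h2, h3⟩ := dvd_facts ha
    rw [mul_left_comm (ee _)]
    congr 1
    rw [Finset.mul_sum]
    refine Finset.sum_congr rfl fun b _ => ?_
    generalize m / a = d at *
    have hd : (d : ℂ) ≠ 0 := by exact_mod_cast h2.ne'
    have hτ' := im_hecke hτ h1 h2 b
    have hp := h.rep.periodic hτ' (a * x₁ - (k * b : ℤ) + (k * d : ℤ) * ((a * τ + b) / d))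
      (a * x₂ - (l * b : ℤ) + (l * d : ℤ) * ((a * τ + b) / d)) 0 0 0
    have hp2 := h.rep.periodic hτ' (a * x₁) (a * x₂) 0 (-(k * b)) (-(l * b))
    have hh := h.heis _ (a * x₁ - (k * b : ℤ)) (a * x₂ - (l * b : ℤ)) hτ' (k * d) (l * d)
    have e1 : ∀ (x : ℂ) (k : ℤ), ((a : ℂ) * (x + k * τ) : ℂ) =
        a * x - (k * b : ℤ) + (k * d : ℤ) * ((a * τ + b) / d) := fun x k => by
      push_cast
      field_simp
      ring
    simp only [Int.cast_zero, add_zero, Int.cast_neg, ← sub_eq_add_neg] at hp2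
    rw [e1, e1, hh, hp2]
    congr 1
    obtain ⟨q, hq⟩ : ∃ q : ℤ, q = b * d * (k ^ 2 + k * l + 2 * l ^ 2) := ⟨_, rfl⟩
    rw [← ee_add_int (-(m * (Qf k l * τ + Bf k l x₁ x₂))) q, ← h3, hq]
    congr 1
    rw [Qf, Qf, Bf, Bf]
    push_cast
    field_simp
    ring
  inv τ x₁ x₂ hτ := by
    rw [liftV_eq hm, liftV_eq hm, sum_slashF_inv h (by exact_mod_cast hm) hτ]
    norm_cast
    ring

end

section

/-- The Fourier coefficients of `phi`. -/
def c0 : T3 → ℂ := exists_jac_phi.choose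

lemma jac_phi : Jac 7 1 c0 phi := exists_jac_phi.choose_spec.1

lemma c0_zero (T : T3) (hT : T.1 < 1) : c0 T = 0 := exists_jac_phi.choose_spec.2 T hT

lemma c0_sigma (n r s : ℤ) : c0 (n, r, r - s) = -c0 (n, r, s) := by
  have h := (jac_phi.rep.lin 1 1 0 (-1) (-1) rfl rfl).unique
    ((jac_phi.rep.const_mul (-1)).congr fun τ x₁ x₂ hτ => by
      have := phi_sigma hτ x₁ x₂
      simp only [Int.cast_one, Int.cast_zero, Int.cast_neg, one_mul, zero_mul, zero_add, neg_mul]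
      exact this.symm)
  have := congrFun h (n, r, s)
  simp only [neg_mul, one_mul, zero_mul, sub_zero, neg_neg, neg_sub] at this
  exact this

lemma liftC_sigma (m : ℕ) (n r s : ℤ) : liftC c0 m (n, r, r - s) = -liftC c0 m (n, r, s) := by
  rw [liftC, liftC, ← Finset.sum_neg_distrib]
  refine Finset.sum_congr rfl fun a ha => ?_
  simp only
  by_cases h : (a : ℤ) ∣ n ∧ (a : ℤ) ∣ r ∧ (a : ℤ) ∣ s
  · rw [if_pos h, if_pos ⟨h.1, h.2.1, dvd_sub h.2.1 h.2.2⟩, Int.sub_ediv_of_dvd _ h.2.2, c0_sigma]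
    ring
  · rw [if_neg h, if_neg, mul_zero, neg_zero]
    rintro ⟨h1, h2, h3⟩
    exact h ⟨h1, h2, (dvd_sub_right h2).1 h3⟩

lemma liftC_eq {m : ℕ} (n : ℕ) (hm : 0 < m) (c : T3 → ℂ) (r s : ℤ) :
    liftC c m (n, r, s) = ∑ a ∈ (m.gcd n).divisors,
      if (a : ℤ) ∣ r ∧ (a : ℤ) ∣ s then (a : ℂ) ^ 6 * c (((m / a) * (n / a) : ℕ), r / a, s / a) else 0 := by
  symm
  refine Finset.sum_subset_zero_on_sdiff ?_ (fun a ha => ?_) fun a ha => ?_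
  · exact Nat.divisors_subset_of_dvd hm.ne' (Nat.gcd_dvd_left m n)
  · rw [Finset.mem_sdiff, Nat.mem_divisors, Nat.mem_divisors] at ha
    rw [if_neg, mul_zero]
    rintro ⟨h, -⟩
    exact ha.2 ⟨Nat.dvd_gcd ha.1.1 (Int.natCast_dvd_natCast.1 h), (Nat.gcd_pos_of_pos_left n hm).ne'⟩
  · rw [Nat.mem_divisors] at ha
    have h1 : a ∣ m := ha.1.trans (Nat.gcd_dvd_left m n)
    have h2 : a ∣ n := ha.1.trans (Nat.gcd_dvd_right m n)
    have hd : ((m / a : ℕ) : ℂ) ≠ 0 := by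
      have := Nat.div_pos (Nat.le_of_dvd hm h1) (Nat.pos_of_dvd_of_pos h1 hm)
      exact_mod_cast this.ne'
    simp only [Int.natCast_dvd_natCast, h2, true_and]
    split_ifs
    · push_cast
      field_simp
    · rw [mul_zero]

lemma liftC_swap {m n : ℕ} (hm : 0 < m) (hn : 0 < n) (r s : ℤ) :
    liftC c0 m (n, r, s) = -liftC c0 n (m, r, r - s) := by
  rw [liftC_sigma, neg_neg, liftC_eq n hm, liftC_eq m hn, Nat.gcd_comm]
  simp only [mul_comm]

lemma liftC_zero (m : ℕ) (T : T3) (hT : T.1 < 1) : liftC c0 m T = 0 := by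
  refine Finset.sum_eq_zero fun a ha => ?_
  split_ifs with h
  · rw [c0_zero, mul_zero, mul_zero]
    obtain ⟨h1, h2, h3⟩ := dvd_facts ha
    obtain ⟨q, hq⟩ := h.1
    have ha0 : (0 : ℤ) < a := by exact_mod_cast h1
    simp only [hq, Int.mul_ediv_cancel_left _ ha0.ne']
    have : q < 1 := by
      rw [hq] at hT
      by_contra! hq0
      nlinarith
    have : (0 : ℤ) < (m / a : ℕ) := by exact_mod_cast h2
    nlinarith
  · rw [mul_zero]

lemma liftC_one (T : T3) : liftC c0 1 T = c0 T := by simp [liftC]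

lemma liftV_one (τ x₁ x₂ : ℂ) : liftV phi 1 τ x₁ x₂ = phi τ x₁ x₂ := by simp [liftV]

lemma liftV_of_forall {f : ℂ → ℂ → ℂ → ℂ} {u v : ℂ → ℂ}
    (h : ∀ τ x : ℂ, 0 < τ.im → ∀ a : ℂ, f τ (a * u x) (a * v x) = 0) (m : ℕ) {τ : ℂ}
    (hτ : 0 < τ.im) (x : ℂ) : liftV f m τ (u x) (v x) = 0 :=
  Finset.sum_eq_zero fun a ha => by
    rw [Finset.sum_eq_zero fun b _ => ?_, mul_zero]
    exact h _ _ (im_hecke hτ (dvd_facts ha).1 (dvd_facts ha).2.1 b) _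

lemma liftV_x₁ (m : ℕ) {τ : ℂ} (hτ : 0 < τ.im) (x : ℂ) : liftV phi m τ 0 x = 0 :=
  liftV_of_forall (f := phi) (u := fun _ => 0) (v := fun x => x)
    (fun τ x hτ a => by simp [phi, th_zero τ hτ]) m hτ x

lemma liftV_x₁₂ (m : ℕ) {τ : ℂ} (hτ : 0 < τ.im) (x : ℂ) : liftV phi m τ x (-x) = 0 :=
  liftV_of_forall (f := phi) (u := fun x => x) (v := fun x => -x)
    (fun τ x hτ a => by simp [phi, th_zero τ hτ]) m hτ x

lemma liftV_neg (m : ℕ) {τ : ℂ} (hτ : 0 < τ.im) (x₁ x₂ : ℂ) :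
    liftV phi m τ (-x₁) (-x₂) = -liftV phi m τ x₁ x₂ := by
  rw [liftV, liftV, ← Finset.sum_neg_distrib]
  refine Finset.sum_congr rfl fun a ha => ?_
  rw [← mul_neg, ← Finset.sum_neg_distrib]
  congr 1
  refine Finset.sum_congr rfl fun b _ => ?_
  rw [mul_neg, mul_neg, phi_neg (im_hecke hτ (dvd_facts ha).1 (dvd_facts ha).2.1 b)]

lemma liftV_sigma (m : ℕ) {τ : ℂ} (hτ : 0 < τ.im) (x₁ x₂ : ℂ) :
    liftV phi m τ (x₁ + x₂) (-x₂) = -liftV phi m τ x₁ x₂ := by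
  rw [liftV, liftV, ← Finset.sum_neg_distrib]
  refine Finset.sum_congr rfl fun a ha => ?_
  rw [← mul_neg, ← Finset.sum_neg_distrib]
  congr 1
  refine Finset.sum_congr rfl fun b _ => ?_
  rw [mul_neg, mul_add, phi_sigma (im_hecke hτ (dvd_facts ha).1 (dvd_facts ha).2.1 b)]

lemma order_sum {ι : Type*} (s : Finset ι) {F : ι → ℂ → ℂ} (n : ℕ∞)
    (h : ∀ i ∈ s, n ≤ analyticOrderAt (F i) 0) : n ≤ analyticOrderAt (fun x => ∑ i ∈ s, F i x) 0 := by
  classical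
  induction s using Finset.induction_on with
  | empty =>
    simp only [Finset.sum_empty]
    rw [analyticOrderAt_eq_top.2 (by simp)]
    exact le_top
  | insert i s hi ih =>
    simp only [Finset.sum_insert hi]
    exact (le_min (h i (Finset.mem_insert_self i s))
      (ih fun j hj => h j (Finset.mem_insert_of_mem hj))).trans le_analyticOrderAt_add

lemma liftV_order (m : ℕ) {τ : ℂ} (hτ : 0 < τ.im) (x₁ : ℂ) :
    (3 : ℕ) ≤ analyticOrderAt (liftV phi m τ x₁) 0 := by
  have key : ∀ τ x₁ a : ℂ, 0 < τ.im → ∀ e : ℂ,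
      (3 : ℕ) ≤ analyticOrderAt (fun x₂ => e * phi τ x₁ (a * x₂)) 0 := fun τ x₁ a hτ e => by
    have h1 : Differentiable ℂ fun x₂ : ℂ => th τ (a * x₂) :=
      (differentiable_th hτ).comp (g := th τ) (by fun_prop)
    have h2 : Differentiable ℂ fun x₂ : ℂ => th τ (x₁ + a * x₂) :=
      (differentiable_th hτ).comp (g := th τ) (by fun_prop)
    have h3 : Differentiable ℂ fun x₂ : ℂ => ee (τ + x₁ + 2 * (a * x₂)) :=
      differentiable_ee.comp (g := ee) (by fun_prop)
    have he : (fun x₂ => e * phi τ x₁ (a * x₂)) = (fun x₂ => th τ (a * x₂)) ^ 3 * fun x₂ =>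
        e * (ee (τ + x₁ + 2 * (a * x₂)) * thD τ ^ 3 * th τ x₁ * th τ (x₁ + a * x₂)) := by
      funext x₂
      simp only [phi, Pi.mul_apply, Pi.pow_apply]
      ring
    have h4 : Differentiable ℂ fun x₂ =>
        e * (ee (τ + x₁ + 2 * (a * x₂)) * thD τ ^ 3 * th τ x₁ * th τ (x₁ + a * x₂)) := by fun_prop
    rw [he, analyticOrderAt_mul ((h1.analyticAt 0).pow 3) (h4.analyticAt 0),
      analyticOrderAt_pow (h1.analyticAt 0)]
    refine le_add_right ?_
    have : (1 : ℕ∞) ≤ analyticOrderAt (fun x₂ => th τ (a * x₂)) 0 := by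
      rw [Order.one_le_iff_ne_zero]
      exact analyticOrderAt_ne_zero.2 ⟨h1.analyticAt 0, by simp [th_zero τ hτ]⟩
    calc ((3 : ℕ) : ℕ∞) = 3 • (1 : ℕ∞) := by simp
      _ ≤ _ := nsmul_le_nsmul_right this 3
  change _ ≤ analyticOrderAt (fun x₂ => liftV phi m τ x₁ x₂) 0
  unfold liftV
  refine order_sum _ _ fun a ha => ?_
  simp only [Finset.mul_sum]
  exact order_sum _ _ fun b _ => key _ _ _ (im_hecke hτ (dvd_facts ha).1 (dvd_facts ha).2.1 b) _

/-- The quotients of the lifts by `phi`. -/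
theorem exists_psi : ∃ (d : ℕ → T3 → ℂ) (ψ : ℕ → ℂ → ℂ → ℂ → ℂ), (∀ j, Jac 0 j (d j) (ψ j)) ∧
    (∀ j, ∀ τ x₁ x₂ : ℂ, 0 < τ.im → liftV phi (j + 1) τ x₁ x₂ = phi τ x₁ x₂ * ψ j τ x₁ x₂) ∧
    ∀ τ x₁ x₂ : ℂ, 0 < τ.im → ψ 0 τ x₁ x₂ = 1 := by
  have h : ∀ j : ℕ, ∃ c g, Jac 0 j c g ∧ ∀ τ x₁ x₂ : ℂ, 0 < τ.im →
      liftV phi (j + 1) τ x₁ x₂ = phi τ x₁ x₂ * g τ x₁ x₂ := fun j => by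
    have hj := jac_phi.liftV j.succ_pos
    obtain ⟨c, g, hg, he⟩ := div_phi hj.rep (liftC_zero _) hj.qp (fun τ x₁ hτ => liftV_order _ hτ x₁)
      (fun τ x hτ => liftV_x₁ _ hτ x) (fun τ x hτ => liftV_x₁₂ _ hτ x)
    exact ⟨c, g, Jac.of_phi_mul (by rw [zero_add]; exact hj) hg he, he⟩
  choose d ψ h1 h2 using h
  obtain ⟨e, he⟩ := Rep.exp (0, 0, 0) le_rfl
  refine ⟨d, ψ, h1, h2, fun τ x₁ x₂ hτ => ?_⟩
  refine phi_cancel (A := ψ 0 τ) (B := fun _ _ => 1) hτ x₁ x₂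
    ((h1 0).rep.continuous hτ (by fun_prop) (by fun_prop)) continuous_const fun x₁ x₂ => ?_
  rw [← h2 0 τ x₁ x₂ hτ, mul_one, zero_add, liftV_one]

end

section

/-- The real norm form. -/
def qr (y₁ y₂ : ℝ) : ℝ := y₁ ^ 2 + y₁ * y₂ + 2 * y₂ ^ 2

/-- The dual of the real norm form. -/
def qs (r s : ℝ) : ℝ := (2 * r ^ 2 - r * s + s ^ 2) / 7

lemma qr_nonneg (y₁ y₂ : ℝ) : 0 ≤ qr y₁ y₂ := by
  unfold qr
  nlinarith [sq_nonneg (2 * y₁ + y₂), sq_nonneg y₂]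

lemma qs_nonneg (r s : ℝ) : 0 ≤ qs r s := by
  unfold qs
  nlinarith [sq_nonneg (4 * r - s), sq_nonneg s]

lemma qs_add (r s y₁ y₂ : ℝ) :
    qs r s + (r * y₁ + s * y₂) + qr y₁ y₂ = qr (y₁ + (4 * r - s) / 7) (y₂ + (2 * s - r) / 7) := by
  unfold qs qr
  ring

lemma sq_le_qs (r s : ℝ) : r ^ 2 ≤ 4 * qs r s ∧ s ^ 2 ≤ 8 * qs r s := by
  unfold qs
  constructor
  · nlinarith [sq_nonneg (2 * s - r)]
  · nlinarith [sq_nonneg (4 * r - s)]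

lemma pair_sq_le (r s y₁ y₂ : ℝ) : (r * y₁ + s * y₂) ^ 2 ≤ 4 * qs r s * qr y₁ y₂ := by
  have h := sq_nonneg (r * y₁ + 4 * r * y₂ - 2 * s * y₁ - s * y₂)
  unfold qs qr
  nlinarith

/-- Covering by lattice translates. -/
lemma exists_reduce (u₁ u₂ : ℝ) : ∃ k l : ℤ, qr (u₁ + k) (u₂ + l) ≤ 11 / 16 ∧
    |u₁ + k| ≤ 1 ∧ |u₂ + l| ≤ 1 := by
  obtain ⟨l, hl⟩ : ∃ l : ℤ, |u₂ + l| ≤ 1 / 2 := ⟨-round u₂, by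
    have := abs_sub_round u₂
    push_cast
    rwa [← sub_eq_add_neg]⟩
  obtain ⟨k, hk⟩ : ∃ k : ℤ, |u₁ + (u₂ + l) / 2 + k| ≤ 1 / 2 := ⟨-round (u₁ + (u₂ + l) / 2), by
    have := abs_sub_round (u₁ + (u₂ + l) / 2)
    push_cast
    rwa [← sub_eq_add_neg]⟩
  rw [abs_le] at hl hk
  refine ⟨k, l, ?_, ?_, ?_⟩
  · unfold qr
    nlinarith
  · rw [abs_le]
    constructor <;> linarith
  · rw [abs_le]
    constructor <;> linarith

/-- The invariant absolute value of a Jacobi form of index `m`. -/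
def hh (m : ℕ) (f : ℂ → ℂ → ℂ → ℂ) (τ x₁ x₂ : ℂ) : ℝ :=
  ‖f τ x₁ x₂‖ * Real.exp (-(2 * Real.pi * (m * (qr x₁.im x₂.im / τ.im))))

lemma hh_nonneg (m : ℕ) (f : ℂ → ℂ → ℂ → ℂ) (τ x₁ x₂ : ℂ) : 0 ≤ hh m f τ x₁ x₂ :=
  mul_nonneg (norm_nonneg _) (Real.exp_nonneg _)

section
variable {κ : ℤ} {m : ℕ} {c : T3 → ℂ} {f : ℂ → ℂ → ℂ → ℂ} (h : Jac κ m c f)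
include h

lemma Jac.hh_heis {τ : ℂ} (hτ : 0 < τ.im) (x₁ x₂ : ℂ) (k l : ℤ) :
    hh m f τ (x₁ + k * τ) (x₂ + l * τ) = hh m f τ x₁ x₂ := by
  have h0 : τ.im ≠ 0 := hτ.ne'
  rw [hh, hh, h.heis τ x₁ x₂ hτ, norm_mul, norm_ee, mul_comm (Real.exp _), mul_assoc, ← Real.exp_add]
  congr 2
  have e1 : (-(m * (Qf k l * τ + Bf k l x₁ x₂)) : ℂ).im = -(m * (qr k l * τ.im +
      (2 * k * x₁.im + k * x₂.im + l * x₁.im + 4 * l * x₂.im))) := by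
    have : (Qf k l : ℂ) = ((qr k l : ℝ) : ℂ) := by
      unfold Qf qr
      push_cast
      ring
    rw [this, Bf]
    simp
  rw [e1]
  simp only [Complex.add_im, Complex.mul_im, Complex.intCast_re, Complex.intCast_im, zero_mul, add_zero]
  unfold qr
  field_simp
  ring

lemma Jac.hh_T {τ : ℂ} (hτ : 0 < τ.im) (x₁ x₂ : ℂ) (k : ℤ) :
    hh m f (τ + k) x₁ x₂ = hh m f τ x₁ x₂ := by
  have := h.rep.periodic hτ x₁ x₂ k 0 0
  simp only [Int.cast_zero, add_zero] at this
  rw [hh, hh, this]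
  simp

lemma Jac.hh_S {τ : ℂ} (hτ : 0 < τ.im) (x₁ x₂ : ℂ) :
    hh m f (-1 / τ) (x₁ / τ) (x₂ / τ) = ‖τ‖ ^ κ * hh m f τ x₁ x₂ := by
  have h0 : τ.im ≠ 0 := hτ.ne'
  have hn : τ.re ^ 2 + τ.im ^ 2 ≠ 0 := by positivity
  rw [hh, hh, h.inv τ x₁ x₂ hτ, norm_mul, norm_mul, norm_ee, norm_zpow, mul_assoc, mul_assoc]
  congr 1
  rw [mul_comm (Real.exp _), mul_assoc, ← Real.exp_add]
  congr 2
  have e1 : (m * (Qf x₁ x₂ / τ) : ℂ).im = m * (qr x₁.im x₂.im / τ.im -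
      qr (x₁ / τ).im (x₂ / τ).im / (-1 / τ).im) := by
    rw [← Complex.ofReal_natCast, Complex.im_ofReal_mul]
    congr 1
    simp only [Complex.div_im, Qf, qr, Complex.normSq_apply]
    simp [pow_two]
    field_simp
    ring
  rw [e1]
  ring

lemma Jac.hh_transfer (γ : SpecialLinearGroup (Fin 2) ℤ) : ∀ τ : UpperHalfPlane,
    (∀ x₁ x₂ : ℂ, ∃ y₁ y₂ : ℂ, hh m f ((γ • τ : UpperHalfPlane) : ℂ) y₁ y₂ =
      Real.sqrt (τ.im / (γ • τ).im) ^ κ * hh m f τ x₁ x₂) ∧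
    ∀ x₁ x₂ : ℂ, ∃ y₁ y₂ : ℂ, hh m f τ y₁ y₂ =
      Real.sqrt ((γ • τ).im / τ.im) ^ κ * hh m f ((γ • τ : UpperHalfPlane) : ℂ) x₁ x₂ := by
  have hγ : γ ∈ Subgroup.closure {ModularGroup.S, ModularGroup.T} := by
    rw [SpecialLinearGroup.SL2Z_generators]
    trivial
  have trans : ∀ (a b c : UpperHalfPlane),
      (∀ x₁ x₂ : ℂ, ∃ y₁ y₂ : ℂ, hh m f b y₁ y₂ =
        Real.sqrt (a.im / b.im) ^ κ * hh m f a x₁ x₂) →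
      (∀ x₁ x₂ : ℂ, ∃ y₁ y₂ : ℂ, hh m f c y₁ y₂ =
        Real.sqrt (b.im / c.im) ^ κ * hh m f b x₁ x₂) →
      ∀ x₁ x₂ : ℂ, ∃ y₁ y₂ : ℂ, hh m f c y₁ y₂ =
        Real.sqrt (a.im / c.im) ^ κ * hh m f a x₁ x₂ := by
    intro a b c hab hbc x₁ x₂
    obtain ⟨y₁, y₂, hy⟩ := hab x₁ x₂
    obtain ⟨z₁, z₂, hz⟩ := hbc y₁ y₂
    refine ⟨z₁, z₂, ?_⟩
    have ha := a.im_pos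
    have hb := b.im_pos
    have hc := c.im_pos
    rw [hz, hy, ← mul_assoc, ← mul_zpow, ← Real.sqrt_mul (by positivity)]
    congr 3
    field_simp
  induction hγ using Subgroup.closure_induction with
  | mem x hx =>
    rcases hx with rfl | rfl
    · have key : ∀ (τ : UpperHalfPlane) (x₁ x₂ : ℂ), ∃ y₁ y₂ : ℂ,
          hh m f ((ModularGroup.S • τ : UpperHalfPlane) : ℂ) y₁ y₂ =
          Real.sqrt (τ.im / (ModularGroup.S • τ).im) ^ κ * hh m f τ x₁ x₂ := by
        intro τ x₁ x₂
        refine ⟨x₁ / τ, x₂ / τ, ?_⟩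
        have e1 : ((ModularGroup.S • τ : UpperHalfPlane) : ℂ) = -1 / (τ : ℂ) := by
          rw [UpperHalfPlane.modular_S_smul]
          simp [neg_div, inv_neg]
        have e2 : Real.sqrt (τ.im / (ModularGroup.S • τ).im) = ‖(τ : ℂ)‖ := by
          rw [ModularGroup.im_smul_eq_div_normSq, ModularGroup.denom_S,
            div_div_cancel₀ τ.im_pos.ne', Complex.normSq_eq_norm_sq, Real.sqrt_sq (norm_nonneg _)]
        rw [e1, e2]
        exact h.hh_S τ.im_pos x₁ x₂
      intro τ
      refine ⟨key τ, ?_⟩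
      have e : ModularGroup.S • (ModularGroup.S • τ) = τ := by
        rw [← mul_smul, show ModularGroup.S * ModularGroup.S = -1 by decide, ModularGroup.SL_neg_smul, one_smul]
      have := key (ModularGroup.S • τ)
      rwa [e] at this
    · intro τ
      have e1 : ((ModularGroup.T • τ : UpperHalfPlane) : ℂ) = (τ : ℂ) + (1 : ℤ) := by
        rw [UpperHalfPlane.modular_T_smul]
        simp [add_comm]
      have e2 : (ModularGroup.T • τ).im = τ.im := by
        rw [UpperHalfPlane.modular_T_smul]
        simp
      rw [e1, e2, div_self τ.im_pos.ne']
      simp only [Real.sqrt_one, _root_.one_zpow, one_mul]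
      simp only [h.hh_T (show 0 < (τ : ℂ).im from τ.im_pos)]
      exact ⟨fun x₁ x₂ => ⟨x₁, x₂, rfl⟩, fun x₁ x₂ => ⟨x₁, x₂, rfl⟩⟩
  | one =>
    intro τ
    rw [one_smul, div_self τ.im_pos.ne']
    simp only [Real.sqrt_one, _root_.one_zpow, one_mul]
    exact ⟨fun x₁ x₂ => ⟨x₁, x₂, rfl⟩, fun x₁ x₂ => ⟨x₁, x₂, rfl⟩⟩
  | mul a b _ _ ha hb =>
    intro τ
    rw [mul_smul]
    exact ⟨trans _ _ _ (hb τ).1 (ha _).1, trans _ _ _ (ha _).2 (hb τ).2⟩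
  | inv a _ ha =>
    intro τ
    have := ha (a⁻¹ • τ)
    rw [smul_inv_smul] at this
    exact ⟨this.2, this.1⟩

/-- Reduction to the Siegel domain `1 / 2 ≤ τ.im`. -/
lemma Jac.hh_reduce {τ : ℂ} (hτ : 0 < τ.im) (hτ1 : τ.im ≤ 1) (x₁ x₂ : ℂ) :
    ∃ (τ' y₁ y₂ : ℂ) (δ : ℝ), 1 / 2 ≤ τ'.im ∧ τ.im ≤ δ ∧ δ ^ 2 ≤ 2 * τ.im ∧
      hh m f τ' y₁ y₂ = δ ^ κ * hh m f τ x₁ x₂ := by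
  obtain ⟨γ, hγ⟩ := ModularGroup.exists_one_half_le_im_smul ⟨τ, hτ⟩
  obtain ⟨y₁, y₂, hy⟩ := (h.hh_transfer γ ⟨τ, hτ⟩).1 x₁ x₂
  set t : UpperHalfPlane := ⟨τ, hτ⟩ with ht
  have hp : 0 < (γ • t).im := (γ • t).im_pos
  have htm : t.im = τ.im := rfl
  have hn := UpperHalfPlane.normSq_denom_pos (γ : GL (Fin 2) ℝ) (z := (t : ℂ)) hτ.ne'
  refine ⟨_, y₁, y₂, _, hγ, ?_, ?_, hy⟩
  · apply Real.le_sqrt_of_sq_le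
    rw [ModularGroup.im_smul_eq_div_normSq, htm, div_div_cancel₀ hτ.ne',
      ModularGroup.denom_apply, Complex.normSq_apply]
    simp only [Complex.add_re, Complex.add_im, Complex.mul_re, Complex.mul_im, Complex.intCast_re,
      Complex.intCast_im, zero_mul, sub_zero, add_zero]
    change τ.im ^ 2 ≤ _ + (_ * τ.im) * (_ * τ.im)
    by_cases hc : γ 1 0 = 0
    · have hd := γ.det_coe
      rw [Matrix.det_fin_two, hc, mul_zero, sub_zero] at hd
      have hd2 : γ 1 1 * γ 1 1 = 1 := by
        rcases Int.eq_one_or_neg_one_of_mul_eq_one' hd with h | h <;> rw [h.2] <;> norm_num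
      have hd3 : ((γ 1 1 : ℤ) : ℝ) * (γ 1 1 : ℤ) = 1 := by exact_mod_cast hd2
      rw [hc]
      simp only [Int.cast_zero, zero_mul, zero_add, mul_zero, add_zero]
      rw [hd3]
      nlinarith
    · have hc1 : (1 : ℤ) ≤ γ 1 0 * γ 1 0 := by
        have := mul_self_pos.2 hc
        omega
      have hc2 : (1 : ℝ) ≤ (γ 1 0 : ℤ) * (γ 1 0 : ℤ) := by exact_mod_cast hc1
      refine le_trans ?_ (le_add_of_nonneg_left (mul_self_nonneg _))
      nlinarith [sq_nonneg τ.im]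
  · rw [Real.sq_sqrt (by positivity), htm, div_le_iff₀ hp]
    nlinarith

end

end

section

section
variable {κ : ℤ} {m : ℕ} {c : T3 → ℂ} {f : ℂ → ℂ → ℂ → ℂ} (h : Jac κ m c f)
include h

lemma Jac.coeff_heis (n r s k l : ℤ) :
    c (n + (k * r + l * s) + m * (k ^ 2 + k * l + 2 * l ^ 2), r + m * (2 * k + l),
      s + m * (k + 4 * l)) = c (n, r, s) := by
  let e : T3 ≃ T3 :=
    { toFun := fun T => (T.1 + (k * T.2.1 + l * T.2.2) + m * (k ^ 2 + k * l + 2 * l ^ 2),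
        T.2.1 + m * (2 * k + l), T.2.2 + m * (k + 4 * l))
      invFun := fun T => (T.1 - (k * T.2.1 + l * T.2.2) + m * (k ^ 2 + k * l + 2 * l ^ 2),
        T.2.1 - m * (2 * k + l), T.2.2 - m * (k + 4 * l))
      left_inv := fun T => by ext <;> dsimp only <;> ring
      right_inv := fun T => by ext <;> dsimp only <;> ring }
  have hs : ∀ τ x₁ x₂ : ℂ, 0 < τ.im →
      HasSum (fun T => c (e.symm T) * e3 T τ x₁ x₂) (f τ x₁ x₂) := by
    intro τ x₁ x₂ hτ
    rw [← e.hasSum_iff]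
    have h1 := (h.rep.2 τ (x₁ + k * τ) (x₂ + l * τ) hτ).mul_left
      (ee (m * (Qf k l * τ + Bf k l x₁ x₂)))
    rw [h.heis τ x₁ x₂ hτ, ← mul_assoc, ← ee_add, add_neg_cancel, ee_zero, one_mul] at h1
    refine h1.congr_fun fun T => ?_
    simp only [Function.comp, Equiv.symm_apply_apply]
    rw [mul_left_comm]
    congr 1
    rw [e3, e3, ← ee_add]
    congr 1
    simp only [e, Equiv.coe_fn_mk, Qf, Bf]
    push_cast
    ring
  have h2 : (fun T => c (e.symm T)) = c := by
    rw [← sub_eq_zero]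
    refine unique3 (τ := Complex.I) (x₁ := 0) (x₂ := 0) fun s t u => ?_
    have hI : 0 < (Complex.I + s).im := by simp
    have := (hs _ (0 + t) (0 + u) hI).sub (h.rep.2 _ (0 + t) (0 + u) hI)
    rw [sub_self] at this
    exact this.congr_fun fun T => by rw [Pi.sub_apply, sub_mul]
  have h3 := congrFun h2 (e (n, r, s))
  simp only [Equiv.symm_apply_apply] at h3
  exact h3.symm

/-- The coefficient bound at a point of the form adapted to a Fourier index. -/
lemma Jac.coeff_le_hh {v y₁ y₂ M : ℝ} (hv : 0 < v)
    (hM : ∀ τ x₁ x₂ : ℂ, τ.im = v → x₁.im = y₁ → x₂.im = y₂ → hh m f τ x₁ x₂ ≤ M) (T : T3) :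
    ‖c T‖ ≤ M * Real.exp (2 * Real.pi * (T.1 * v + T.2.1 * y₁ + T.2.2 * y₂ +
      m * (qr y₁ y₂ / v))) := by
  have h1 := h.rep.coeff_le (τ := Complex.I * v) (x₁ := Complex.I * y₁) (x₂ := Complex.I * y₂)
    (by simpa using hv) (M := M * Real.exp (2 * Real.pi * (m * (qr y₁ y₂ / v)))) (fun s t u => by
      have := hM (Complex.I * v + s) (Complex.I * y₁ + t) (Complex.I * y₂ + u) (by simp) (by simp)
        (by simp)
      rw [hh] at this
      have h2 := mul_le_mul_of_nonneg_right this
        (Real.exp_nonneg (2 * Real.pi * (m * (qr y₁ y₂ / v))))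
      rwa [mul_assoc, ← Real.exp_add, show (Complex.I * y₁ + t : ℂ).im = y₁ by simp,
        show (Complex.I * y₂ + u : ℂ).im = y₂ by simp, show (Complex.I * v + s : ℂ).im = v by simp,
        neg_add_cancel, Real.exp_zero, mul_one] at h2) T
  rw [norm_mul, norm_e3, ← le_div_iff₀ (Real.exp_pos _), div_eq_mul_inv, ← Real.exp_neg, mul_assoc,
    ← Real.exp_add] at h1
  refine h1.trans (le_of_eq ?_)
  congr 2
  simp
  ring

/-- Jacobi forms of negative weight whose invariant absolute value is bounded vanish. -/
lemma Jac.coeff_eq_zero {S : ℝ} (hκ : κ < 0)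
    (hS : ∀ τ x₁ x₂ : ℂ, 1 / 2 ≤ τ.im → hh m f τ x₁ x₂ ≤ S) : c = 0 := by
  funext T
  have hS0 : 0 ≤ S := (hh_nonneg m f Complex.I 0 0).trans (hS _ _ _ (by norm_num))
  obtain ⟨j, hj⟩ : ∃ j : ℕ, κ = -((j : ℤ) + 1) := ⟨(-κ - 1).toNat, by omega⟩
  have key : ∀ v : ℝ, 0 < v → v ≤ 1 / 2 → ‖c T‖ ≤ Real.sqrt (2 * v) * S *
      Real.exp (2 * Real.pi * (T.1 * v)) := by
    intro v hv hv1
    have := h.coeff_le_hh (v := v) (y₁ := 0) (y₂ := 0) (M := Real.sqrt (2 * v) * S) hv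
      (fun τ x₁ x₂ h1 _ _ => ?_) T
    · simpa [qr] using this
    obtain ⟨τ', y₁, y₂, δ, h2, h3, h4, h5⟩ := h.hh_reduce (by linarith : 0 < τ.im) (by linarith) x₁ x₂
    have h6 : 0 < δ := by linarith
    have h7 : δ ≤ Real.sqrt (2 * v) := by
      apply Real.le_sqrt_of_sq_le
      rwa [h1] at h4
    have h8 : δ ≤ 1 := by nlinarith
    have h9 : hh m f τ x₁ x₂ = δ ^ (j + 1) * hh m f τ' y₁ y₂ := by
      rw [h5, hj, _root_.zpow_neg, ← mul_assoc]
      have : (δ ^ ((j : ℤ) + 1))= δ ^ (j + 1) := by exact_mod_cast zpow_natCast δ (j + 1)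
      rw [this, mul_inv_cancel₀ (by positivity), one_mul]
    rw [h9]
    refine mul_le_mul ?_ (hS _ _ _ h2) (hh_nonneg _ _ _ _ _) (Real.sqrt_nonneg _)
    rw [pow_succ]
    exact (mul_le_of_le_one_left h6.le (pow_le_one₀ h6.le h8)).trans h7
  have lim : Tendsto (fun v : ℝ => Real.sqrt (2 * v) * S * Real.exp (2 * Real.pi * (T.1 * v)))
      (𝓝[>] 0) (𝓝 0) := by
    have : Continuous fun v : ℝ => Real.sqrt (2 * v) * S * Real.exp (2 * Real.pi * (T.1 * v)) := by
      fun_prop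
    have h1 := this.tendsto 0
    simp only [mul_zero, Real.sqrt_zero, zero_mul] at h1
    exact h1.mono_left nhdsWithin_le_nhds
  have h0 : ‖c T‖ ≤ 0 := by
    refine ge_of_tendsto lim ?_
    filter_upwards [Ioc_mem_nhdsGT (show (0 : ℝ) < 1 / 2 by norm_num)] with v hv
    exact key v hv.1 hv.2
  simpa using h0

end

section
variable {K m : ℕ} {c : T3 → ℂ} {f : ℂ → ℂ → ℂ → ℂ} (h : Jac K m c f)
include h

/-- Polynomial bound for the coefficients in terms of the invariant absolute value. -/
lemma Jac.coeff_le_poly {S : ℝ} (hS : ∀ τ x₁ x₂ : ℂ, 1 / 2 ≤ τ.im → hh m f τ x₁ x₂ ≤ S) (T : T3)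
    (hT : 0 ≤ T.1) :
    ‖c T‖ ≤ Real.exp (2 * Real.pi) * S * (1 + T.1) ^ K := by
  have hS0 : 0 ≤ S := (hh_nonneg m f Complex.I 0 0).trans (hS _ _ _ (by norm_num))
  have hn : (0 : ℝ) ≤ T.1 := by exact_mod_cast hT
  set v : ℝ := 1 / (1 + T.1) with hv
  have hv0 : 0 < v := by positivity
  have hv1 : v ≤ 1 := by rw [hv, div_le_one (by positivity)]; linarith
  have hvn : T.1 * v ≤ 1 := by rw [hv, mul_one_div, div_le_one (by positivity)]; linarith
  set r : ℝ := (T.2.1 : ℝ)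
  set s : ℝ := (T.2.2 : ℝ)
  have := h.coeff_le_hh (v := v) (y₁ := -((4 * r - s) / (7 * m) * v))
    (y₂ := -((2 * s - r) / (7 * m) * v)) (M := S * (1 + T.1) ^ K) hv0 (fun τ x₁ x₂ h1 _ _ => ?_) T
  · refine this.trans ?_
    rw [show Real.exp (2 * Real.pi) * S * (1 + T.1) ^ K =
      S * (1 + T.1) ^ K * Real.exp (2 * Real.pi) by ring]
    refine mul_le_mul_of_nonneg_left ?_ (by positivity)
    rw [Real.exp_le_exp]
    refine mul_le_of_le_one_right (by positivity) ?_
    have e : (r * -((4 * r - s) / (7 * m) * v)) + s * -((2 * s - r) / (7 * m) * v) +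
        m * (qr (-((4 * r - s) / (7 * m) * v)) (-((2 * s - r) / (7 * m) * v)) / v) ≤ 0 := by
      rcases Nat.eq_zero_or_pos m with rfl | hm
      · simp
      · have hm' : (0 : ℝ) < m := by exact_mod_cast hm
        have : (r * -((4 * r - s) / (7 * m) * v)) + s * -((2 * s - r) / (7 * m) * v) +
          m * (qr (-((4 * r - s) / (7 * m) * v)) (-((2 * s - r) / (7 * m) * v)) / v) =
          -(qs r s * v / m) := by
          unfold qr qs
          field_simp
          ring
        rw [this]
        have := qs_nonneg r s
        have : 0 ≤ qs r s * v / m := by positivity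
        linarith
    linarith
  · obtain ⟨τ', y₁, y₂, δ, h2, h3, h4, h5⟩ := h.hh_reduce (by linarith : 0 < τ.im) (by linarith) x₁ x₂
    have h6 : 0 < δ := by linarith
    have h7 : hh m f τ x₁ x₂ = hh m f τ' y₁ y₂ * (1 / δ) ^ K := by
      rw [h5, zpow_natCast, mul_right_comm, ← mul_pow, mul_one_div_cancel h6.ne', one_pow, one_mul]
    rw [h7]
    refine mul_le_mul (hS _ _ _ h2) (pow_le_pow_left₀ (by positivity) ?_ K) (by positivity) hS0
    have : 1 + (T.1 : ℝ) = 1 / v := by rw [hv, one_div_one_div]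
    rw [this]
    exact one_div_le_one_div_of_le hv0 (by linarith)

end

end

section

/-- A family of Jacobi forms whose coefficients have the Hermitian symmetry. -/
structure Fam (κ : ℤ) (c : ℕ → T3 → ℂ) (g : ℕ → ℂ → ℂ → ℂ → ℂ) : Prop where
  jac : ∀ m : ℕ, Jac κ m (c m) (g m)
  symm : ∀ (m n : ℕ) (r s : ℤ), ‖c m (n, r, s)‖ = ‖c n (m, r, r - s)‖

/-- The exponent of a Fourier term at `x = u τ`, up to the factor `τ.im`. -/
def energy (m : ℕ) (T : T3) (u₁ u₂ : ℝ) : ℝ :=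
  T.1 + (T.2.1 * u₁ + T.2.2 * u₂) + m * qr u₁ u₂

/-- The size of a Fourier index. -/
def wt (T : T3) : ℝ := |(T.1 : ℝ)| + |(T.2.1 : ℝ)| + |(T.2.2 : ℝ)|

lemma summable_wt {a : ℝ} (ha : 0 < a) : Summable fun T : T3 => Real.exp (-(a * wt T)) := by
  have h := summable_exp_neg_abs ha
  have h2 := (h.mul_of_nonneg (h.mul_of_nonneg h (fun _ => (Real.exp_pos _).le)
    (fun _ => (Real.exp_pos _).le)) (fun _ => (Real.exp_pos _).le)
    (fun _ => mul_nonneg (Real.exp_pos _).le (Real.exp_pos _).le))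
  refine h2.congr fun T => ?_
  rw [← Real.exp_add, ← Real.exp_add]
  congr 1
  unfold wt
  ring

section
variable {κ : ℤ} {c : ℕ → T3 → ℂ} {g : ℕ → ℂ → ℂ → ℂ → ℂ} (h : Fam κ c g)
include h

lemma Fam.nonneg {m : ℕ} {T : T3} (hT : c m T ≠ 0) : 0 ≤ T.1 := by
  by_contra hn
  exact hT ((h.jac m).rep.1 T (by omega))

lemma Fam.supp : ∀ (m : ℕ) (T : T3), c m T ≠ 0 → qs T.2.1 T.2.2 ≤ T.1 * m := by
  intro m
  induction m using Nat.strong_induction_on with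
  | _ m ih =>
  rintro ⟨n, r, s⟩ hT
  have hn := h.nonneg hT
  dsimp only at hn ⊢
  rcases Nat.eq_zero_or_pos m with rfl | hm
  · have h1 := (h.jac 0).coeff_heis n r s (-(r * (n + 1))) (-(s * (n + 1)))
    simp only [Nat.cast_zero, zero_mul, add_zero] at h1
    rw [← h1] at hT
    have h2 := h.nonneg hT
    dsimp only at h2
    have h3 : r * r + s * s ≤ 0 := by
      by_contra h4
      nlinarith
    have hr : r = 0 := by nlinarith [mul_self_nonneg r, mul_self_nonneg s]
    have hs : s = 0 := by nlinarith [mul_self_nonneg r, mul_self_nonneg s]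
    simp [hr, hs, qs]
  · have hm' : (0 : ℝ) < m := by exact_mod_cast hm
    obtain ⟨k, l, hkl, -, -⟩ := exists_reduce ((4 * r - s) / (7 * m)) ((2 * s - r) / (7 * m))
    rw [← (h.jac m).coeff_heis n r s k l] at hT
    set n' := n + (k * r + l * s) + m * (k ^ 2 + k * l + 2 * l ^ 2) with hn'
    set r' := r + m * (2 * k + l) with hr'
    set s' := s + m * (k + 4 * l) with hs'
    have e1 : qs r' s' = m ^ 2 * qr ((4 * r - s) / (7 * m) + k) ((2 * s - r) / (7 * m) + l) := by
      rw [hr', hs']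
      unfold qs qr
      push_cast
      field_simp
      ring
    have e2 : (n' : ℝ) * m - qs r' s' = n * m - qs r s := by
      rw [hn', hr', hs']
      unfold qs
      push_cast
      ring
    have h0 := h.nonneg hT
    dsimp only at h0
    suffices qs r' s' ≤ n' * m by linarith
    rcases le_or_gt (m : ℤ) n' with hle | hlt
    · have : (m : ℝ) ≤ n' := by exact_mod_cast hle
      rw [e1]
      nlinarith
    · obtain ⟨j, hj⟩ := Int.eq_ofNat_of_zero_le h0
      rw [hj] at hT hlt ⊢
      have h1 : c j (m, r', r' - s') ≠ 0 := by
        rw [← norm_ne_zero_iff, ← h.symm m j r' s', norm_ne_zero_iff]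
        exact hT
      have h2 := ih j (by exact_mod_cast hlt) _ h1
      dsimp only at h2
      have e3 : qs (r' : ℝ) ((r' - s' : ℤ) : ℝ) = qs r' s' := by
        unfold qs
        push_cast
        ring
      rw [e3] at h2
      push_cast at h2 ⊢
      linarith

lemma Fam.energy_nonneg {m : ℕ} {T : T3} (hT : c m T ≠ 0) (u₁ u₂ : ℝ) : 0 ≤ energy m T u₁ u₂ := by
  have h1 := h.supp m T hT
  have h0 : (0 : ℝ) ≤ T.1 := by exact_mod_cast h.nonneg hT
  unfold energy
  rcases Nat.eq_zero_or_pos m with rfl | hm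
  · simp only [Nat.cast_zero, mul_zero, zero_mul, add_zero] at h1 ⊢
    have h2 := sq_le_qs T.2.1 T.2.2
    have hr : (T.2.1 : ℝ) = 0 := by nlinarith [sq_nonneg (T.2.1 : ℝ)]
    have hs : (T.2.2 : ℝ) = 0 := by nlinarith [sq_nonneg (T.2.2 : ℝ)]
    rw [hr, hs]
    simpa using h0
  · have hm' : (0 : ℝ) < m := by exact_mod_cast hm
    have h2 := qs_add T.2.1 T.2.2 (m * u₁) (m * u₂)
    have h3 := qr_nonneg (m * u₁ + (4 * T.2.1 - T.2.2) / 7) (m * u₂ + (2 * T.2.2 - T.2.1) / 7)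
    rw [← h2] at h3
    have h4 : qr (m * u₁) (m * u₂) = m * (m * qr u₁ u₂) := by
      unfold qr
      ring
    rw [h4] at h3
    refine (mul_nonneg_iff_of_pos_left hm').1 ?_
    nlinarith

lemma Fam.hh_le {m : ℕ} {b : T3 → ℝ} (hb : Summable b)
    (hbd : ∀ u₁ u₂ : ℝ, qr u₁ u₂ ≤ 11 / 16 → |u₁| ≤ 1 → |u₂| ≤ 1 → ∀ T, c m T ≠ 0 →
      ‖c m T‖ * Real.exp (-(Real.pi * energy m T u₁ u₂)) ≤ b T) (hb0 : ∀ T, 0 ≤ b T)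
    (τ x₁ x₂ : ℂ) (hτ : 1 / 2 ≤ τ.im) : hh m (g m) τ x₁ x₂ ≤ ∑' T, b T := by
  have hτ0 : 0 < τ.im := by linarith
  obtain ⟨k, l, h1, h2, h3⟩ := exists_reduce (x₁.im / τ.im) (x₂.im / τ.im)
  rw [← (h.jac m).hh_heis hτ0 x₁ x₂ k l]
  set u₁ := x₁.im / τ.im + k with hu₁
  set u₂ := x₂.im / τ.im + l with hu₂
  have e1 : (x₁ + k * τ).im = u₁ * τ.im := by
    rw [hu₁]
    simp
    field_simp
  have e2 : (x₂ + l * τ).im = u₂ * τ.im := by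
    rw [hu₂]
    simp
    field_simp
  have h4 := ((h.jac m).rep.2 τ (x₁ + k * τ) (x₂ + l * τ) hτ0).mul_right
    ((Real.exp (-(2 * Real.pi * (m * (qr (x₁ + k * τ).im (x₂ + l * τ).im / τ.im)))) : ℝ) : ℂ)
  have h5 := h4.norm_le_of_bounded hb.hasSum fun T => ?_
  · refine le_trans (le_of_eq ?_) h5
    rw [hh, norm_mul, Complex.norm_real, Real.norm_of_nonneg (Real.exp_nonneg _)]
  · by_cases hT : c m T = 0
    · simp [hT, hb0 T]
    · refine le_trans ?_ (hbd u₁ u₂ h1 h2 h3 T hT)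
      rw [norm_mul, norm_mul, mul_assoc, Complex.norm_real, Real.norm_of_nonneg (Real.exp_nonneg _),
        norm_e3, ← Real.exp_add, e1, e2]
      refine mul_le_mul_of_nonneg_left ?_ (norm_nonneg _)
      rw [Real.exp_le_exp]
      have e3 : qr (u₁ * τ.im) (u₂ * τ.im) / τ.im = τ.im * qr u₁ u₂ := by
        unfold qr
        field_simp
      have h6 := h.energy_nonneg hT u₁ u₂
      rw [e3]
      have e4 : -(2 * Real.pi * (T.1 * τ.im + T.2.1 * (u₁ * τ.im) + T.2.2 * (u₂ * τ.im))) +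
          -(2 * Real.pi * (m * (τ.im * qr u₁ u₂))) =
          -(Real.pi * (2 * τ.im * energy m T u₁ u₂)) := by
        unfold energy
        ring
      rw [e4, neg_le_neg_iff]
      refine mul_le_mul_of_nonneg_left ?_ Real.pi_pos.le
      nlinarith

lemma Fam.exists_bound (m : ℕ) :
    ∃ S, ∀ τ x₁ x₂ : ℂ, 1 / 2 ≤ τ.im → hh m (g m) τ x₁ x₂ ≤ S := by
  have hs : ∀ ε₁ ε₂ : ℝ, Summable fun T : T3 =>
      ‖c m T‖ * Real.exp (-(Real.pi * (T.1 + T.2.1 * ε₁ + T.2.2 * ε₂))) := by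
    intro ε₁ ε₂
    have := ((h.jac m).rep.2 (Complex.I / 2) (Complex.I * (ε₁ / 2 : ℝ)) (Complex.I * (ε₂ / 2 : ℝ))
      (by simp)).summable.norm
    refine this.congr fun T => ?_
    rw [norm_mul, norm_e3]
    congr 2
    simp
    ring
  have hsum := (((hs 1 1).add (hs 1 (-1))).add (hs (-1) 1)).add (hs (-1) (-1))
  refine ⟨_, h.hh_le hsum (fun u₁ u₂ _ h1 h2 T _ => ?_) fun T => by positivity⟩
  have h3 : ∃ ε₁ ∈ ({1, -1} : Set ℝ), T.2.1 * ε₁ ≤ T.2.1 * u₁ := by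
    rw [abs_le] at h1
    rcases le_total 0 (T.2.1 : ℝ) with h | h
    · exact ⟨-1, by simp, by nlinarith⟩
    · exact ⟨1, by simp, by nlinarith⟩
  have h4 : ∃ ε₂ ∈ ({1, -1} : Set ℝ), T.2.2 * ε₂ ≤ T.2.2 * u₂ := by
    rw [abs_le] at h2
    rcases le_total 0 (T.2.2 : ℝ) with h | h
    · exact ⟨-1, by simp, by nlinarith⟩
    · exact ⟨1, by simp, by nlinarith⟩
  obtain ⟨ε₁, hε₁, h3⟩ := h3
  obtain ⟨ε₂, hε₂, h4⟩ := h4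
  have h5 : ‖c m T‖ * Real.exp (-(Real.pi * energy m T u₁ u₂)) ≤
      ‖c m T‖ * Real.exp (-(Real.pi * (T.1 + T.2.1 * ε₁ + T.2.2 * ε₂))) := by
    refine mul_le_mul_of_nonneg_left ?_ (norm_nonneg _)
    rw [Real.exp_le_exp, neg_le_neg_iff]
    refine mul_le_mul_of_nonneg_left ?_ Real.pi_pos.le
    have := mul_nonneg (Nat.cast_nonneg (α := ℝ) m) (qr_nonneg u₁ u₂)
    unfold energy
    linarith
  refine h5.trans ?_
  have hpos : ∀ ε₁ ε₂ : ℝ, 0 ≤ ‖c m T‖ * Real.exp (-(Real.pi * (T.1 + T.2.1 * ε₁ + T.2.2 * ε₂))) :=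
    fun _ _ => by positivity
  have p1 := hpos 1 1
  have p2 := hpos 1 (-1)
  have p3 := hpos (-1) 1
  have p4 := hpos (-1) (-1)
  rcases hε₁ with rfl | rfl <;> rcases hε₂ with rfl | rfl <;> linarith

/-- A symmetric family of negative weight vanishes. -/
lemma Fam.eq_zero (hκ : κ < 0) (m : ℕ) : c m = 0 := by
  obtain ⟨S, hS⟩ := h.exists_bound m
  exact (h.jac m).coeff_eq_zero hκ hS

end

end

section

lemma exists_pow_le_exp (K : ℕ) {ε : ℝ} (hε : 0 < ε) :
    ∃ C, 0 < C ∧ ∀ x : ℝ, 0 ≤ x → (1 + x) ^ K ≤ C * Real.exp (ε * x) := by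
  refine ⟨(K.factorial : ℝ) / ε ^ K * Real.exp ε, by positivity, fun x hx => ?_⟩
  have h := Real.pow_div_factorial_le_exp (ε * (1 + x)) (by positivity) K
  rw [mul_pow, mul_add, mul_one, Real.exp_add, div_le_iff₀ (by positivity)] at h
  rw [mul_assoc, div_mul_eq_mul_div, le_div_iff₀ (by positivity)]
  linarith

/-- The supremum of the invariant absolute value over a Siegel domain. -/
def supH (m : ℕ) (f : ℂ → ℂ → ℂ → ℂ) : ℝ :=
  sSup {y | ∃ τ x₁ x₂ : ℂ, 1 / 2 ≤ τ.im ∧ hh m f τ x₁ x₂ = y}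

lemma supH_le {m : ℕ} {f : ℂ → ℂ → ℂ → ℂ} {b : ℝ}
    (h : ∀ τ x₁ x₂ : ℂ, 1 / 2 ≤ τ.im → hh m f τ x₁ x₂ ≤ b) : supH m f ≤ b := by
  refine csSup_le ⟨_, Complex.I, 0, 0, by norm_num, rfl⟩ ?_
  rintro _ ⟨τ, x₁, x₂, hτ, rfl⟩
  exact h _ _ _ hτ

section
variable {κ : ℤ} {c : ℕ → T3 → ℂ} {g : ℕ → ℂ → ℂ → ℂ → ℂ} (h : Fam κ c g)
include h

lemma Fam.le_supH (m : ℕ) (τ x₁ x₂ : ℂ) (hτ : 1 / 2 ≤ τ.im) :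
    hh m (g m) τ x₁ x₂ ≤ supH m (g m) := by
  obtain ⟨S, hS⟩ := h.exists_bound m
  refine le_csSup ⟨S, ?_⟩ ⟨_, _, _, hτ, rfl⟩
  rintro _ ⟨τ, x₁, x₂, hτ, rfl⟩
  exact hS _ _ _ hτ

lemma Fam.supH_nonneg (m : ℕ) : 0 ≤ supH m (g m) :=
  (hh_nonneg m (g m) Complex.I 0 0).trans (h.le_supH m _ _ _ (by norm_num))

lemma Fam.tail {m : ℕ} {T : T3} (hT : c m T ≠ 0) (hn : 7 * (m : ℝ) < 8 * T.1) {u₁ u₂ : ℝ}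
    (hu : qr u₁ u₂ ≤ 11 / 16) :
    (T.1 : ℝ) / 100 ≤ energy m T u₁ u₂ ∧ wt T ≤ 8 * T.1 := by
  have h0 : (0 : ℝ) ≤ T.1 := by exact_mod_cast h.nonneg hT
  have hm : (0 : ℝ) ≤ m := Nat.cast_nonneg m
  have h1 := h.supp m T hT
  have h2 := pair_sq_le T.2.1 T.2.2 u₁ u₂
  have h3 := sq_le_qs T.2.1 T.2.2
  have hq := qr_nonneg u₁ u₂
  constructor
  · set t := m * qr u₁ u₂ with ht
    set n : ℝ := (T.1 : ℝ)
    have ht1 : t ≤ 0.81 * n := by nlinarith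
    have h4 : (T.2.1 * u₁ + T.2.2 * u₂) ^ 2 ≤ 4 * n * t := by
      rw [ht]
      nlinarith
    unfold energy
    by_contra hlt
    push Not at hlt
    have ht0 : 0 ≤ t := by positivity
    have h5 : (0.99 * n + t) ^ 2 < (T.2.1 * u₁ + T.2.2 * u₂) ^ 2 := by
      rw [← neg_sq (T.2.1 * u₁ + T.2.2 * u₂)]
      refine pow_lt_pow_left₀ (by linarith) (by positivity) two_ne_zero
    nlinarith [mul_nonneg (sub_nonneg.2 ht1) (sub_nonneg.2 (show t ≤ 1.21 * n by linarith))]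
  · have h5 : |(T.2.1 : ℝ)| ≤ 3 * T.1 := by
      refine abs_le_of_sq_le_sq ?_ (by linarith)
      nlinarith
    have h6 : |(T.2.2 : ℝ)| ≤ 4 * T.1 := by
      refine abs_le_of_sq_le_sq ?_ (by linarith)
      nlinarith
    unfold wt
    rw [abs_of_nonneg h0]
    linarith

lemma Fam.head {m : ℕ} {T : T3} (hT : c m T ≠ 0) (hn : 8 * (T.1 : ℝ) ≤ 7 * m) :
    wt T ≤ 7 * m := by
  have h0 : (0 : ℝ) ≤ T.1 := by exact_mod_cast h.nonneg hT
  have hm : (0 : ℝ) ≤ m := Nat.cast_nonneg m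
  have h1 := h.supp m T hT
  have h3 := sq_le_qs T.2.1 T.2.2
  have h5 : |(T.2.1 : ℝ)| ≤ 3 * m := by
    refine abs_le_of_sq_le_sq ?_ (by linarith)
    nlinarith
  have h6 : |(T.2.2 : ℝ)| ≤ 3 * m := by
    refine abs_le_of_sq_le_sq ?_ (by linarith)
    nlinarith
  unfold wt
  rw [abs_of_nonneg h0]
  linarith

end

section
variable {K : ℕ} {c : ℕ → T3 → ℂ} {g : ℕ → ℂ → ℂ → ℂ → ℂ} (h : Fam K c g)
include h

lemma Fam.coeff_le (m : ℕ) {T : T3} (hT : c m T ≠ 0) :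
    ‖c m T‖ ≤ Real.exp (2 * Real.pi) * supH m (g m) * (1 + T.1) ^ K :=
  (h.jac m).coeff_le_poly (h.le_supH m) T (h.nonneg hT)

lemma Fam.bootstrap {a : ℝ} (ha : 0 < a) (ha1 : a ≤ 1 / 1600) :
    ∃ (C : ℝ) (M₀ : ℕ), 0 < C ∧ ∀ m, M₀ ≤ m → ∀ B : ℝ,
      (∀ j : ℕ, 8 * (j : ℝ) ≤ 7 * m → supH j (g j) ≤ B) →
      supH m (g m) ≤ C * Real.exp (8 * a * m) * B := by
  obtain ⟨C₁, hC₁, hC₁'⟩ := exists_pow_le_exp K (ε := 1 / 100) (by norm_num)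
  obtain ⟨C₂, hC₂, hC₂'⟩ := exists_pow_le_exp K ha
  set W := ∑' T, Real.exp (-(a * wt T)) with hW
  have hWs := summable_wt ha
  have hW0 : 0 < W := hWs.tsum_pos (fun T => (Real.exp_pos _).le) 0 (Real.exp_pos _)
  obtain ⟨M₀, hM₀⟩ : ∃ M₀ : ℕ, ∀ m, M₀ ≤ m →
      Real.exp (2 * Real.pi) * C₁ * W * Real.exp (-(1 / 400 * m)) ≤ 1 / 2 := by
    have h1 : Tendsto (fun m : ℕ => Real.exp (2 * Real.pi) * C₁ * W *
        Real.exp (-(1 / 400 * (m : ℝ)))) atTop (𝓝 (Real.exp (2 * Real.pi) * C₁ * W * 0)) :=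
      (Real.tendsto_exp_neg_atTop_nhds_zero.comp
        (tendsto_natCast_atTop_atTop.const_mul_atTop (by norm_num))).const_mul _
    rw [mul_zero] at h1
    exact eventually_atTop.1 (h1.eventually_le_const (by norm_num))
  refine ⟨2 * (Real.exp (2 * Real.pi) * C₂ * W), M₀, by positivity, fun m hm B hB => ?_⟩
  have hB0 : 0 ≤ B := (h.supH_nonneg 0).trans (hB 0 (by simp))
  have hm0 : (0 : ℝ) ≤ m := Nat.cast_nonneg m
  set S := supH m (g m) with hS
  have hS0 : 0 ≤ S := h.supH_nonneg m
  set A₁ := Real.exp (2 * Real.pi) * C₂ * B * Real.exp (8 * a * m) with hA₁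
  set A₂ := Real.exp (2 * Real.pi) * S * C₁ * Real.exp (-(1 / 400 * m)) with hA₂
  have hA₁0 : 0 ≤ A₁ := by positivity
  have hA₂0 : 0 ≤ A₂ := by positivity
  have key := h.hh_le (m := m) (hWs.mul_left (A₁ + A₂)) (fun u₁ u₂ hu _ _ T hT => ?_)
    (fun T => by positivity)
  · have h1 : S ≤ (A₁ + A₂) * W := by
      rw [hW, ← tsum_mul_left]
      exact supH_le key
    have h2 : A₂ * W ≤ S * (1 / 2) := by
      refine le_trans (le_of_eq ?_) (mul_le_mul_of_nonneg_left (hM₀ m hm) hS0)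
      rw [hA₂]
      ring
    have h3 : 2 * (Real.exp (2 * Real.pi) * C₂ * W) * Real.exp (8 * a * m) * B = 2 * (A₁ * W) := by
      rw [hA₁]
      ring
    rw [h3]
    linarith
  · have hn0 : (0 : ℝ) ≤ T.1 := by exact_mod_cast h.nonneg hT
    rcases le_or_gt (8 * (T.1 : ℝ)) (7 * m) with hle | hlt
    · have h1 := h.head hT hle
      have h2 : ‖c m T‖ ≤ Real.exp (2 * Real.pi) * B * (1 + m) ^ K := by
        obtain ⟨n, r, s⟩ := T
        obtain ⟨j, rfl⟩ := Int.eq_ofNat_of_zero_le (h.nonneg hT)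
        have e := h.symm m j r s
        have h3 : c j (m, r, r - s) ≠ 0 := by
          rw [← norm_ne_zero_iff, ← e, norm_ne_zero_iff]
          exact hT
        have h4 := h.coeff_le j h3
        change ‖c m (j, r, s)‖ ≤ _
        rw [e]
        refine h4.trans ?_
        have := hB j (by simpa using hle)
        simp only [Int.cast_natCast]
        gcongr
      have h3 := h.energy_nonneg hT u₁ u₂
      refine (mul_le_of_le_one_right (norm_nonneg _) ?_).trans (h2.trans ?_)
      · rw [Real.exp_le_one_iff]
        have := Real.pi_pos
        nlinarith
      · refine le_trans ?_ (mul_le_mul_of_nonneg_right (le_add_of_nonneg_right hA₂0)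
          (Real.exp_nonneg _))
        have h5 : (1 + (m : ℝ)) ^ K ≤ C₂ * (Real.exp (8 * a * m) * Real.exp (-(a * wt T))) := by
          refine (hC₂' m hm0).trans (mul_le_mul_of_nonneg_left ?_ hC₂.le)
          rw [← Real.exp_add, Real.exp_le_exp]
          nlinarith
        calc _ ≤ Real.exp (2 * Real.pi) * B * (C₂ * (Real.exp (8 * a * m) *
              Real.exp (-(a * wt T)))) := by gcongr
          _ = _ := by
            rw [hA₁]
            ring
    · obtain ⟨h1, h2⟩ := h.tail hT hlt hu
      have h3 := h.coeff_le m hT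
      refine le_trans ?_ (mul_le_mul_of_nonneg_right (le_add_of_nonneg_left hA₁0)
          (Real.exp_nonneg _))
      have h4 : Real.exp (-(Real.pi * energy m T u₁ u₂)) ≤ Real.exp (-(3 / 100 * T.1)) := by
        rw [Real.exp_le_exp]
        have := Real.pi_gt_three
        nlinarith
      calc _ ≤ (Real.exp (2 * Real.pi) * S * (C₁ * Real.exp (1 / 100 * T.1))) *
            Real.exp (-(3 / 100 * T.1)) := by
            refine mul_le_mul (h3.trans ?_) h4 (Real.exp_nonneg _) (by positivity)
            exact mul_le_mul_of_nonneg_left (hC₁' _ hn0) (by positivity)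
        _ = Real.exp (2 * Real.pi) * S * C₁ * Real.exp (-(2 / 100 * T.1)) := by
            rw [mul_assoc, mul_assoc C₁, ← Real.exp_add, ← mul_assoc]
            congr 2
            ring
        _ ≤ Real.exp (2 * Real.pi) * S * C₁ * (Real.exp (-(1 / 400 * m)) *
            Real.exp (-(a * wt T))) := by
            refine mul_le_mul_of_nonneg_left ?_ (by positivity)
            rw [← Real.exp_add, Real.exp_le_exp]
            nlinarith
        _ = _ := by
            rw [hA₂]
            ring

/-- Subexponential growth of the invariant absolute values of a symmetric family. -/
lemma Fam.supH_growth {ε : ℝ} (hε : 0 < ε) :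
    ∃ C, 0 < C ∧ ∀ m : ℕ, supH m (g m) ≤ C * Real.exp (ε * m) := by
  set a := min (ε / 128) (1 / 1600) with ha
  have ha0 : 0 < a := by positivity
  have ha1 : a ≤ ε / 128 := min_le_left _ _
  obtain ⟨C, M₀, hC, hM⟩ := h.bootstrap ha0 (min_le_right _ _)
  obtain ⟨M₁, hM₁⟩ : ∃ M₁ : ℕ, ∀ m, M₁ ≤ m → C ≤ Real.exp (ε / 16 * m) := by
    have h1 : Tendsto (fun m : ℕ => Real.exp (ε / 16 * (m : ℝ))) atTop atTop :=
      Real.tendsto_exp_atTop.comp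
        (tendsto_natCast_atTop_atTop.const_mul_atTop (by positivity))
    exact eventually_atTop.1 (h1.eventually_ge_atTop C)
  have hS0 := h.supH_nonneg
  set D := 1 + ∑ j ∈ Finset.range (M₀ + M₁ + 1), supH j (g j) with hD
  have hsum : 0 ≤ ∑ j ∈ Finset.range (M₀ + M₁ + 1), supH j (g j) :=
    Finset.sum_nonneg fun j _ => hS0 j
  refine ⟨D, by linarith, fun m => ?_⟩
  induction m using Nat.strong_induction_on with
  | _ m ih =>
  have hm0 : (0 : ℝ) ≤ m := Nat.cast_nonneg m
  rcases lt_or_ge m (M₀ + M₁ + 1) with hlt | hge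
  · have h1 : supH m (g m) ≤ D := by
      have := Finset.single_le_sum (f := fun j => supH j (g j)) (fun j _ => hS0 j)
        (Finset.mem_range.2 hlt)
      linarith
    refine h1.trans (le_mul_of_one_le_right (by linarith) ?_)
    rw [Real.one_le_exp_iff]
    positivity
  · have hm1 : (1 : ℝ) ≤ m := by exact_mod_cast (by omega : 1 ≤ m)
    have h1 := hM m (by omega) (D * Real.exp (ε * (7 / 8 * m))) fun j hj => by
      have hjm : j < m := by
        have : (j : ℝ) < m := by linarith
        exact_mod_cast this
      refine (ih j hjm).trans (mul_le_mul_of_nonneg_left ?_ (by linarith))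
      rw [Real.exp_le_exp]
      nlinarith
    refine h1.trans ?_
    have h2 : C * Real.exp (8 * a * m) ≤ Real.exp (ε / 8 * m) := by
      calc _ ≤ Real.exp (ε / 16 * m) * Real.exp (8 * a * m) :=
            mul_le_mul_of_nonneg_right (hM₁ m (by omega)) (Real.exp_nonneg _)
        _ ≤ _ := by
            rw [← Real.exp_add, Real.exp_le_exp]
            nlinarith
    calc _ ≤ Real.exp (ε / 8 * m) * (D * Real.exp (ε * (7 / 8 * m))) :=
          mul_le_mul_of_nonneg_right h2 (by positivity)
      _ = D * Real.exp (ε * m) := by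
          rw [mul_left_comm, ← Real.exp_add]
          congr 2
          ring

/-- Absolute convergence of the Fourier expansion attached to a symmetric family. -/
theorem Fam.summable {τ x₁ x₂ ω : ℂ} (hτ : 0 < τ.im) (hω : 0 < ω.im)
    (hq : qr x₁.im x₂.im < τ.im * ω.im) :
    Summable fun p : ℕ × T3 => c p.1 p.2 * e3 p.2 τ x₁ x₂ * ee (p.1 * ω) := by
  set v := τ.im
  set w := ω.im
  set q := qr x₁.im x₂.im with hqd
  have hq0 : 0 ≤ q := qr_nonneg _ _
  obtain ⟨η, hη0, hηv, hηw, hη⟩ : ∃ η : ℝ, 0 < η ∧ η < v ∧ η < w ∧ q ≤ (v - η) * (w - η) := by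
    have hp : 0 < 2 * (v + w) := by positivity
    refine ⟨(v * w - q) / (2 * (v + w)), div_pos (by linarith) hp, ?_, ?_, ?_⟩
    · rw [div_lt_iff₀ hp]
      nlinarith
    · rw [div_lt_iff₀ hp]
      nlinarith
    · have : (v * w - q) / (2 * (v + w)) * (v + w) = (v * w - q) / 2 := by
        field_simp
      nlinarith [sq_nonneg ((v * w - q) / (2 * (v + w)))]
  obtain ⟨C₁, hC₁, hC₁'⟩ := exists_pow_le_exp K hη0
  obtain ⟨C₂, hC₂, hC₂'⟩ := h.supH_growth hη0
  have hs1 : Summable fun m : ℕ => Real.exp (-(η * m)) :=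
    (Real.summable_exp_nat_mul_iff.2 (neg_lt_zero.2 hη0)).congr fun n => by ring_nf
  have hs := (hs1.mul_of_nonneg (summable_wt hη0) (fun _ => (Real.exp_pos _).le)
    (fun _ => (Real.exp_pos _).le)).mul_left (Real.exp (2 * Real.pi) * C₂ * C₁)
  refine Summable.of_norm_bounded hs fun p => ?_
  obtain ⟨m, T⟩ := p
  dsimp only
  by_cases hT : c m T = 0
  · rw [hT, zero_mul, zero_mul, norm_zero]
    positivity
  have hn0 : (0 : ℝ) ≤ T.1 := by exact_mod_cast h.nonneg hT
  have hm0 : (0 : ℝ) ≤ m := Nat.cast_nonneg m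
  have h1 := h.coeff_le m hT
  have h2 := h.supp m T hT
  have h3 := sq_le_qs T.2.1 T.2.2
  have h4 := pair_sq_le T.2.1 T.2.2 x₁.im x₂.im
  rw [← hqd] at h4
  set n : ℝ := (T.1 : ℝ)
  have h5 : η * (n + m) ≤ n * v + (T.2.1 * x₁.im + T.2.2 * x₂.im) + m * w := by
    have h6 : (T.2.1 * x₁.im + T.2.2 * x₂.im) ^ 2 ≤ (n * (v - η) + m * (w - η)) ^ 2 := by
      have h7 : qs T.2.1 T.2.2 * q ≤ n * m * ((v - η) * (w - η)) :=
        mul_le_mul h2 hη hq0 (by positivity)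
      nlinarith [sq_nonneg (n * (v - η) - m * (w - η))]
    have h8 := abs_le_of_sq_le_sq h6 (by
      have := sub_pos.2 hηv
      have := sub_pos.2 hηw
      positivity)
    linarith [(abs_le.1 h8).1]
  have h6 : wt T + m ≤ 4 * (n + m) := by
    have h5 : |(T.2.1 : ℝ)| ≤ n + m := by
      refine abs_le_of_sq_le_sq ?_ (by linarith)
      nlinarith [sq_nonneg (n - m)]
    have h6 : |(T.2.2 : ℝ)| ≤ 2 * (n + m) := by
      refine abs_le_of_sq_le_sq ?_ (by linarith)
      nlinarith [sq_nonneg (n - m)]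
    unfold wt
    rw [abs_of_nonneg hn0]
    linarith
  rw [norm_mul, norm_mul, norm_e3, norm_ee, mul_assoc, ← Real.exp_add]
  have e1 : (m * ω : ℂ).im = m * w := by simp [w]
  rw [e1]
  calc _ ≤ (Real.exp (2 * Real.pi) * (C₂ * Real.exp (η * m)) * (C₁ * Real.exp (η * n))) *
        Real.exp (-(6 * (η * (n + m)))) := by
        refine mul_le_mul (h1.trans ?_) ?_ (Real.exp_nonneg _) (by positivity)
        · refine mul_le_mul ?_ (hC₁' n hn0) (by positivity) (by positivity)
          exact mul_le_mul_of_nonneg_left (hC₂' m) (Real.exp_nonneg _)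
        · rw [Real.exp_le_exp]
          have := Real.pi_gt_three
          have h7 : 0 ≤ η * (n + m) := by positivity
          nlinarith
    _ = Real.exp (2 * Real.pi) * C₂ * C₁ * Real.exp (η * m + η * n + -(6 * (η * (n + m)))) := by
        rw [Real.exp_add, Real.exp_add]
        ring
    _ ≤ _ := by
        rw [← Real.exp_add]
        refine mul_le_mul_of_nonneg_left ?_ (by positivity)
        rw [Real.exp_le_exp]
        nlinarith

end

end

section

lemma omg_re : (omg 7).re = 1 / 2 := by
  simp [omg]

lemma omg_im : (omg 7).im = Real.sqrt 7 / 2 := by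
  simp [omg]

lemma conj_omg : (starRingEnd ℂ) (omg 7) = 1 - omg 7 := by
  apply Complex.ext
  · simp only [Complex.conj_re, Complex.sub_re, Complex.one_re, omg_re]
    norm_num
  · simp [omg_im]

lemma omg_mul_self : omg 7 * omg 7 = omg 7 - 2 := by
  have h : Real.sqrt 7 * Real.sqrt 7 = 7 := Real.mul_self_sqrt (by norm_num)
  apply Complex.ext
  · simp only [Complex.mul_re, Complex.sub_re, omg_re, omg_im, Complex.re_ofNat]
    nlinarith
  · simp only [Complex.mul_im, Complex.sub_im, omg_re, omg_im, Complex.im_ofNat]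
    ring

lemma omg_ne : 2 * omg 7 - 1 ≠ 0 := by
  intro h
  have h1 : (2 * omg 7 - 1) * (2 * omg 7 - 1) = -7 := by linear_combination 4 * omg_mul_self
  rw [h] at h1
  norm_num at h1

/-- Linear coordinates on `2 × 2` matrices. -/
def mk (τ x₁ x₂ ω : ℂ) : Matrix (Fin 2) (Fin 2) ℂ :=
  !![τ, x₁ + omg 7 * x₂; x₁ + (1 - omg 7) * x₂, ω]

/-- The second inner coordinate. -/
def cx₂ (Z : Matrix (Fin 2) (Fin 2) ℂ) : ℂ := (Z 0 1 - Z 1 0) / (2 * omg 7 - 1)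

/-- The first inner coordinate. -/
def cx₁ (Z : Matrix (Fin 2) (Fin 2) ℂ) : ℂ := Z 0 1 - omg 7 * cx₂ Z

lemma mk_coord (Z : Matrix (Fin 2) (Fin 2) ℂ) : mk (Z 0 0) (cx₁ Z) (cx₂ Z) (Z 1 1) = Z := by
  have h : cx₂ Z * (2 * omg 7 - 1) = Z 0 1 - Z 1 0 := div_mul_cancel₀ _ omg_ne
  ext i j
  fin_cases i <;> fin_cases j
  · simp [mk]
  · simp [mk, cx₁]
  · simp only [mk, cx₁, Fin.mk_one, Fin.zero_eta, of_apply, cons_val_zero, cons_val_one]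
    linear_combination -h
  · simp [mk]

lemma cx₂_mk (τ x₁ x₂ ω : ℂ) : cx₂ (mk τ x₁ x₂ ω) = x₂ := by
  rw [cx₂, div_eq_iff omg_ne]
  simp [mk]
  ring

lemma cx₁_mk (τ x₁ x₂ ω : ℂ) : cx₁ (mk τ x₁ x₂ ω) = x₁ := by
  rw [cx₁, cx₂_mk]
  simp [mk]

/-- The coordinate description of the Hermitian upper half-space. -/
def HC (τ x₁ x₂ ω : ℂ) : Prop :=
  0 < τ.im ∧ 0 < ω.im ∧ qr x₁.im x₂.im < τ.im * ω.im

lemma normSq_omg (a b : ℝ) : Complex.normSq (a + omg 7 * b) = qr a b := by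
  have h : Real.sqrt 7 * Real.sqrt 7 = 7 := Real.mul_self_sqrt (by norm_num)
  rw [Complex.normSq_apply]
  simp only [Complex.add_re, Complex.add_im, Complex.mul_re, Complex.mul_im, omg_re, omg_im,
    Complex.ofReal_re, Complex.ofReal_im, qr]
  nlinarith

lemma posDef_two {a d : ℝ} {b : ℂ} :
    (!![(a : ℂ), b; (starRingEnd ℂ) b, (d : ℂ)]).PosDef ↔
      0 < a ∧ 0 < d ∧ Complex.normSq b < a * d := by
  constructor
  · intro h
    have h0 := h.diag_pos (i := 0)
    have h1 := h.diag_pos (i := 1)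
    have h2 := h.det_pos
    rw [Matrix.det_fin_two] at h2
    simp only [of_apply, cons_val_zero, cons_val_one] at h0 h1 h2
    rw [Complex.mul_conj, ← Complex.ofReal_mul, ← Complex.ofReal_sub] at h2
    exact ⟨by exact_mod_cast h0, by exact_mod_cast h1, by
      have : 0 < a * d - Complex.normSq b := by exact_mod_cast h2
      linarith⟩
  · rintro ⟨ha, hd, hb⟩
    refine Matrix.PosDef.of_dotProduct_mulVec_pos ?_ ?_
    · ext i j
      fin_cases i <;> fin_cases j <;> simp
    · intro x hx
      have e : star x ⬝ᵥ (!![(a : ℂ), b; (starRingEnd ℂ) b, (d : ℂ)] *ᵥ x) =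
          (((Complex.normSq (a * x 0 + b * x 1) + (a * d - Complex.normSq b) *
            Complex.normSq (x 1)) / a : ℝ) : ℂ) := by
        have ha' : (a : ℂ) ≠ 0 := by exact_mod_cast ha.ne'
        push_cast
        rw [eq_div_iff ha']
        simp only [Complex.normSq_eq_conj_mul_self, map_add, map_mul, Complex.conj_ofReal]
        simp [Matrix.mulVec, dotProduct, Fin.sum_univ_two]
        ring
      rw [e, Complex.zero_lt_real]
      refine div_pos ?_ ha
      have hb' : 0 < a * d - Complex.normSq b := by linarith
      by_cases h1 : x 1 = 0
      · have h0 : x 0 ≠ 0 := by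
          intro h0
          apply hx
          ext i
          fin_cases i <;> simp [h0, h1]
        have ha' : (a : ℂ) ≠ 0 := by exact_mod_cast ha.ne'
        have : 0 < Complex.normSq (a * x 0) := Complex.normSq_pos.2 (mul_ne_zero ha' h0)
        simpa [h1] using this
      · have h2 := Complex.normSq_pos.2 h1
        have h3 := Complex.normSq_nonneg (a * x 0 + b * x 1)
        positivity

lemma mk_mem (τ x₁ x₂ ω : ℂ) : mk τ x₁ x₂ ω ∈ HH2 ↔ HC τ x₁ x₂ ω := by
  have e : (Matrix.of fun i j => (mk τ x₁ x₂ ω i j - (starRingEnd ℂ) (mk τ x₁ x₂ ω j i)) /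
      (2 * Complex.I)) = !![((τ.im : ℝ) : ℂ), (x₁.im + omg 7 * x₂.im : ℂ);
        (starRingEnd ℂ) (x₁.im + omg 7 * x₂.im : ℂ), ((ω.im : ℝ) : ℂ)] := by
    have hI : ∀ z : ℂ, z - (starRingEnd ℂ) z = 2 * Complex.I * z.im := fun z => by
      rw [Complex.sub_conj]
      push_cast
      ring
    have h2 : (2 * Complex.I : ℂ) ≠ 0 := by simp
    ext i j
    fin_cases i <;> fin_cases j <;>
      simp only [mk, Fin.mk_one, Fin.zero_eta, of_apply, cons_val_zero, cons_val_one,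
        map_add, map_mul, map_sub, map_one, conj_omg, Complex.conj_ofReal] <;>
      rw [div_eq_iff h2]
    · rw [hI]
      ring
    · linear_combination hI x₁ + omg 7 * hI x₂
    · linear_combination hI x₁ + (1 - omg 7) * hI x₂
    · rw [hI]
      ring
  rw [HH2, Set.mem_ofPred_eq, e, posDef_two, normSq_omg]
  rfl

lemma mem_HH2_iff (Z : Matrix (Fin 2) (Fin 2) ℂ) :
    Z ∈ HH2 ↔ HC (Z 0 0) (cx₁ Z) (cx₂ Z) (Z 1 1) := by
  rw [← mk_mem, mk_coord]

end

section

lemma ringInts_add {x y : ℂ} (hx : x ∈ ringInts 7) (hy : y ∈ ringInts 7) :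
    x + y ∈ ringInts 7 := by
  obtain ⟨a, b, rfl⟩ := hx
  obtain ⟨c, d, rfl⟩ := hy
  exact ⟨a + c, b + d, by push_cast; ring⟩

lemma ringInts_mul {x y : ℂ} (hx : x ∈ ringInts 7) (hy : y ∈ ringInts 7) :
    x * y ∈ ringInts 7 := by
  obtain ⟨a, b, rfl⟩ := hx
  obtain ⟨c, d, rfl⟩ := hy
  exact ⟨a * c - 2 * (b * d), a * d + b * c + b * d, by
    push_cast
    linear_combination (b * d : ℂ) * omg_mul_self⟩

lemma ringInts_normSq {x : ℂ} (hx : x ∈ ringInts 7) : ∃ n : ℕ, Complex.normSq x = n := by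
  obtain ⟨a, b, rfl⟩ := hx
  have h : (0 : ℤ) ≤ a ^ 2 + a * b + 2 * b ^ 2 := by nlinarith [sq_nonneg (2 * a + b)]
  refine ⟨(a ^ 2 + a * b + 2 * b ^ 2).toNat, ?_⟩
  have e : ((a ^ 2 + a * b + 2 * b ^ 2).toNat : ℝ) = ((a ^ 2 + a * b + 2 * b ^ 2 : ℤ) : ℝ) := by
    exact_mod_cast Int.toNat_of_nonneg h
  rw [e, mul_comm (b : ℂ)]
  have := normSq_omg a b
  push_cast at this ⊢
  rw [this, qr]

lemma ringInts_unit {x y : ℂ} (hx : x ∈ ringInts 7) (hy : y ∈ ringInts 7) (h : x * y = 1) :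
    x = 1 ∨ x = -1 := by
  obtain ⟨n, hn⟩ := ringInts_normSq hx
  obtain ⟨m, hm⟩ := ringInts_normSq hy
  have h1 : Complex.normSq (x * y) = 1 := by rw [h]; simp
  rw [Complex.normSq_mul, hn, hm] at h1
  have h2 : n * m = 1 := by exact_mod_cast h1
  have h3 : n = 1 := Nat.eq_one_of_mul_eq_one_right h2
  obtain ⟨a, b, rfl⟩ := hx
  rw [h3] at hn
  have := normSq_omg a b
  push_cast at this
  rw [mul_comm (b : ℂ), this, qr] at hn
  have h4 : a ^ 2 + a * b + 2 * b ^ 2 = 1 := by exact_mod_cast hn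
  have hb : b = 0 := by
    by_contra hb
    have : 1 ≤ b ^ 2 := Int.one_le_abs hb |> fun h => by nlinarith [sq_abs b]
    nlinarith [sq_nonneg (2 * a + b)]
  subst hb
  have h5 : (a - 1) * (a + 1) = 0 := by linear_combination h4
  rcases mul_eq_zero.1 h5 with h6 | h6
  · left
    rw [show a = 1 by omega]
    simp
  · right
    rw [show a = -1 by omega]
    simp

/-- The unitary group without the determinant condition. -/
def InU (M : Matrix (Fin 4) (Fin 4) ℂ) : Prop :=
  (∀ i j, M i j ∈ ringInts 7) ∧ Mᵀ * Jmat * M.map (starRingEnd ℂ) = Jmat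

lemma InU.mul {M M' : Matrix (Fin 4) (Fin 4) ℂ} (h : InU M) (h' : InU M') : InU (M * M') := by
  refine ⟨fun i j => ?_, ?_⟩
  · rw [Matrix.mul_apply, Fin.sum_univ_four]
    exact ringInts_add (ringInts_add (ringInts_add (ringInts_mul (h.1 _ _) (h'.1 _ _))
      (ringInts_mul (h.1 _ _) (h'.1 _ _))) (ringInts_mul (h.1 _ _) (h'.1 _ _)))
      (ringInts_mul (h.1 _ _) (h'.1 _ _))
  · rw [Matrix.transpose_mul, Matrix.map_mul]
    calc M'ᵀ * Mᵀ * Jmat * (M.map (starRingEnd ℂ) * M'.map (starRingEnd ℂ))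
        = M'ᵀ * (Mᵀ * Jmat * M.map (starRingEnd ℂ)) * M'.map (starRingEnd ℂ) := by
          simp only [Matrix.mul_assoc]
      _ = Jmat := by rw [h.2, h'.2]

lemma InU.rel {M : Matrix (Fin 4) (Fin 4) ℂ} (h : InU M) (i j : Fin 4) :
    M 2 i * (starRingEnd ℂ) (M 0 j) + M 3 i * (starRingEnd ℂ) (M 1 j)
      - M 0 i * (starRingEnd ℂ) (M 2 j) - M 1 i * (starRingEnd ℂ) (M 3 j) = Jmat i j := by
  have := congr_fun (congr_fun h.2 i) j
  rw [← this]
  simp [Matrix.mul_apply, Fin.sum_univ_four, Jmat]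
  ring

/-- Translations. -/
def gT (a b c d : ℤ) : Matrix (Fin 4) (Fin 4) ℂ :=
  !![1, 0, a, b + c * omg 7; 0, 1, b + c * (1 - omg 7), d; 0, 0, 1, 0; 0, 0, 0, 1]

/-- Unipotent elements of the Levi subgroup. -/
def gH (k l : ℤ) : Matrix (Fin 4) (Fin 4) ℂ :=
  !![1, 0, 0, 0; k + l * (1 - omg 7), 1, 0, 0; 0, 0, 1, -(k + l * omg 7); 0, 0, 0, 1]

/-- The swap. -/
def gW : Matrix (Fin 4) (Fin 4) ℂ := !![0, 1, 0, 0; 1, 0, 0, 0; 0, 0, 0, 1; 0, 0, 1, 0]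

/-- The sign change. -/
def gN : Matrix (Fin 4) (Fin 4) ℂ := !![-1, 0, 0, 0; 0, 1, 0, 0; 0, 0, -1, 0; 0, 0, 0, 1]

/-- The partial inversion. -/
def gS : Matrix (Fin 4) (Fin 4) ℂ := !![0, 0, -1, 0; 0, 1, 0, 0; 1, 0, 0, 0; 0, 0, 0, 1]

lemma ringInts_int (a : ℤ) : (a : ℂ) ∈ ringInts 7 := ⟨a, 0, by simp⟩

lemma ringInts_lin (a b : ℤ) : (a : ℂ) + b * omg 7 ∈ ringInts 7 := ⟨a, b, rfl⟩

lemma ringInts_lin' (a b : ℤ) : (a : ℂ) + b * (1 - omg 7) ∈ ringInts 7 :=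
  ⟨a + b, -b, by push_cast; ring⟩

lemma ringInts_neg {x : ℂ} (h : x ∈ ringInts 7) : -x ∈ ringInts 7 := by
  obtain ⟨a, b, rfl⟩ := h
  exact ⟨-a, -b, by push_cast; ring⟩

lemma ringInts_zero : (0 : ℂ) ∈ ringInts 7 := ⟨0, 0, by simp⟩

lemma ringInts_one : (1 : ℂ) ∈ ringInts 7 := ⟨1, 0, by simp⟩

lemma inSU_gT (a b c d : ℤ) : inSU 7 (gT a b c d) := by
  refine ⟨fun i j => ?_, ?_, ?_⟩
  · fin_cases i <;> fin_cases j <;>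
      simp [gT, ringInts_int, ringInts_lin, ringInts_lin', ringInts_zero, ringInts_one]
  · simp [gT, Matrix.det_succ_row_zero, Fin.sum_univ_succ, Fin.succAbove]
  · ext i j
    fin_cases i <;> fin_cases j <;>
      simp [gT, Jmat, Matrix.mul_apply, Fin.sum_univ_four, conj_omg]

lemma inSU_gH (k l : ℤ) : inSU 7 (gH k l) := by
  refine ⟨fun i j => ?_, ?_, ?_⟩
  · fin_cases i <;> fin_cases j <;>
      simp [-neg_add_rev, gH, ringInts_lin, ringInts_lin', ringInts_zero, ringInts_one, ringInts_neg]
  · simp [gH, Matrix.det_succ_row_zero, Fin.sum_univ_succ, Fin.succAbove]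
  · ext i j
    fin_cases i <;> fin_cases j <;>
      simp [gH, Jmat, Matrix.mul_apply, Fin.sum_univ_four, conj_omg]

lemma inSU_gW : inSU 7 gW := by
  refine ⟨fun i j => ?_, ?_, ?_⟩
  · fin_cases i <;> fin_cases j <;> simp [gW, ringInts_zero, ringInts_one]
  · simp [gW, Matrix.det_succ_row_zero, Fin.sum_univ_succ, Fin.succAbove]
  · ext i j
    fin_cases i <;> fin_cases j <;> simp [gW, Jmat, Matrix.mul_apply, Fin.sum_univ_four]

lemma inSU_gN : inSU 7 gN := by
  refine ⟨fun i j => ?_, ?_, ?_⟩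
  · fin_cases i <;> fin_cases j <;> simp [gN, ringInts_zero, ringInts_one, ringInts_neg]
  · simp [gN, Matrix.det_succ_row_zero, Fin.sum_univ_succ, Fin.succAbove]
  · ext i j
    fin_cases i <;> fin_cases j <;> simp [gN, Jmat, Matrix.mul_apply, Fin.sum_univ_four]

lemma inSU_gS : inSU 7 gS := by
  refine ⟨fun i j => ?_, ?_, ?_⟩
  · fin_cases i <;> fin_cases j <;> simp [gS, ringInts_zero, ringInts_one, ringInts_neg]
  · simp [gS, Matrix.det_succ_row_zero, Fin.sum_univ_succ, Fin.succAbove]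
  · ext i j
    fin_cases i <;> fin_cases j <;> simp [gS, Jmat, Matrix.mul_apply, Fin.sum_univ_four]

lemma inU_of_inSU {M : Matrix (Fin 4) (Fin 4) ℂ} (h : inSU 7 M) : InU M := ⟨h.1, h.2.2⟩

/-- The monoid generated by the explicit elements. -/
inductive Gen : Matrix (Fin 4) (Fin 4) ℂ → Prop
  | t (a b c d : ℤ) : Gen (gT a b c d)
  | h (k l : ℤ) : Gen (gH k l)
  | w : Gen gW
  | n : Gen gN
  | s : Gen gS
  | mul {M M' : Matrix (Fin 4) (Fin 4) ℂ} : Gen M → Gen M' → Gen (M * M')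

lemma gT_inv (a b c d : ℤ) : gT (-a) (-b) (-c) (-d) * gT a b c d = 1 := by
  ext i j
  fin_cases i <;> fin_cases j <;> simp [gT, Matrix.mul_apply, Fin.sum_univ_four] <;> ring

lemma gH_inv (k l : ℤ) : gH (-k) (-l) * gH k l = 1 := by
  ext i j
  fin_cases i <;> fin_cases j <;> simp [gH, Matrix.mul_apply, Fin.sum_univ_four] <;> ring

lemma gW_inv : gW * gW = 1 := by
  ext i j
  fin_cases i <;> fin_cases j <;> simp [gW, Matrix.mul_apply, Fin.sum_univ_four]

lemma gN_inv : gN * gN = 1 := by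
  ext i j
  fin_cases i <;> fin_cases j <;> simp [gN, Matrix.mul_apply, Fin.sum_univ_four]

lemma gS_inv : (gN * gS) * gS = 1 := by
  ext i j
  fin_cases i <;> fin_cases j <;> simp [gN, gS, Matrix.mul_apply, Fin.sum_univ_four]

/-- `g` can be cancelled in the generated monoid. -/
def Canc (g : Matrix (Fin 4) (Fin 4) ℂ) : Prop := InU g ∧ ∀ M, Gen (g * M) → Gen M

lemma canc_of_inv {g g' : Matrix (Fin 4) (Fin 4) ℂ} (hg : InU g) (hg' : Gen g')
    (h : g' * g = 1) : Canc g :=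
  ⟨hg, fun M hM => by
    have := Gen.mul hg' hM
    rwa [← Matrix.mul_assoc, h, Matrix.one_mul] at this⟩

lemma Canc.mul {g g' : Matrix (Fin 4) (Fin 4) ℂ} (h : Canc g) (h' : Canc g') : Canc (g * g') :=
  ⟨h.1.mul h'.1, fun M hM => h'.2 _ (h.2 _ (by rwa [← Matrix.mul_assoc]))⟩

lemma canc_T (a b c d : ℤ) : Canc (gT a b c d) :=
  canc_of_inv (inU_of_inSU (inSU_gT a b c d)) (Gen.t _ _ _ _) (gT_inv a b c d)

lemma canc_H (k l : ℤ) : Canc (gH k l) :=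
  canc_of_inv (inU_of_inSU (inSU_gH k l)) (Gen.h _ _) (gH_inv k l)

lemma canc_W : Canc gW := canc_of_inv (inU_of_inSU inSU_gW) Gen.w gW_inv

lemma canc_N : Canc gN := canc_of_inv (inU_of_inSU inSU_gN) Gen.n gN_inv

lemma canc_S : Canc gS := canc_of_inv (inU_of_inSU inSU_gS) (Gen.mul Gen.n Gen.s) gS_inv

/-- Descent on the norm of a matrix entry. -/
lemma gen_descent (P : Matrix (Fin 4) (Fin 4) ℂ → Prop) (i j : Fin 4)
    (step : ∀ M, InU M → P M → M i j ≠ 0 → ∃ g, Canc g ∧ P (g * M) ∧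
      Complex.normSq ((g * M) i j) < Complex.normSq (M i j))
    (base : ∀ M, InU M → P M → M i j = 0 → Gen M) (M : Matrix (Fin 4) (Fin 4) ℂ)
    (hM : InU M) (hP : P M) : Gen M := by
  obtain ⟨n, hn⟩ := ringInts_normSq (hM.1 i j)
  induction n using Nat.strong_induction_on generalizing M with
  | _ n ih =>
    by_cases h0 : M i j = 0
    · exact base M hM hP h0
    · obtain ⟨g, hg, hgP, hlt⟩ := step M hM hP h0
      have hU := hg.1.mul hM
      obtain ⟨m, hm⟩ := ringInts_normSq (hU.1 i j)
      rw [hn, hm] at hlt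
      exact hg.2 M (ih m (by exact_mod_cast hlt) _ hU hgP hm)

lemma euclid {a b : ℂ} (hb : b ≠ 0) :
    ∃ k l : ℤ, Complex.normSq (a + (k + l * omg 7) * b) < Complex.normSq b := by
  set w := a / b with hw
  set v : ℝ := w.im / (Real.sqrt 7 / 2) with hv
  set u : ℝ := w.re - v / 2 with hu
  have h7 : (Real.sqrt 7 / 2) ≠ 0 := by positivity
  have e : w = (u : ℂ) + omg 7 * v := by
    apply Complex.ext
    · simp [omg_re, hu]
      ring
    · simp only [Complex.add_im, Complex.mul_im, omg_im, Complex.ofReal_im, Complex.ofReal_re,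
        mul_zero, zero_add]
      rw [hv]
      field_simp
  obtain ⟨k, l, h, -, -⟩ := exists_reduce u v
  refine ⟨k, l, ?_⟩
  have e2 : a + (k + l * omg 7) * b = b * ((u + k : ℝ) + omg 7 * (v + l : ℝ)) := by
    have : a = b * w := by rw [hw]; field_simp
    rw [this, e]
    push_cast
    ring
  rw [e2, Complex.normSq_mul, normSq_omg]
  have := Complex.normSq_pos.2 hb
  nlinarith

lemma euclid' {a b : ℂ} (hb : b ≠ 0) :
    ∃ k l : ℤ, Complex.normSq (a + (k + l * (1 - omg 7)) * b) < Complex.normSq b := by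
  obtain ⟨k, l, h⟩ := euclid (a := a) hb
  refine ⟨k + l, -l, ?_⟩
  convert h using 3
  push_cast
  ring

lemma euclid_real {a b : ℂ} (hb : b ≠ 0)
    (h : b * (starRingEnd ℂ) a = a * (starRingEnd ℂ) b) :
    ∃ k : ℤ, Complex.normSq (a + k * b) < Complex.normSq b := by
  have hr : (starRingEnd ℂ) (a / b) = a / b := by
    have hb' : (starRingEnd ℂ) b ≠ 0 := by simpa using hb
    rw [map_div₀, div_eq_div_iff hb' hb]
    linear_combination h
  obtain ⟨r, hr⟩ := Complex.conj_eq_iff_real.1 hr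
  refine ⟨-round r, ?_⟩
  have e2 : a + ((-round r : ℤ) : ℂ) * b = b * ((r - round r : ℝ) : ℂ) := by
    have : a = b * r := by rw [← hr]; field_simp
    rw [this]
    push_cast
    ring
  rw [e2, Complex.normSq_mul, Complex.normSq_ofReal]
  have := Complex.normSq_pos.2 hb
  have h2 := abs_sub_round r
  have h3 : (r - round r) * (r - round r) ≤ 1 / 4 := by
    have := abs_le.1 h2
    nlinarith
  nlinarith

lemma ringInts_real {x : ℂ} (hx : x ∈ ringInts 7) (h : (starRingEnd ℂ) x = x) :
    ∃ a : ℤ, x = a := by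
  obtain ⟨a, b, rfl⟩ := hx
  refine ⟨a, ?_⟩
  simp only [map_add, map_mul, map_intCast, conj_omg] at h
  have h1 : (b : ℂ) * (2 * omg 7 - 1) = 0 := by linear_combination -h
  rcases mul_eq_zero.1 h1 with h2 | h2
  · simp [h2]
  · exact absurd h2 omg_ne

lemma gen_of_cols {M : Matrix (Fin 4) (Fin 4) ℂ} (hM : InU M)
    (h0 : ∀ i, M i 0 = (1 : Matrix (Fin 4) (Fin 4) ℂ) i 0)
    (h1 : ∀ i, M i 1 = (1 : Matrix (Fin 4) (Fin 4) ℂ) i 1) : Gen M := by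
  have r2 : ∀ j, (starRingEnd ℂ) (M 2 j) = -Jmat 0 j := fun j => by
    rw [← hM.rel 0 j]
    simp [h0]
  have r3 : ∀ j, (starRingEnd ℂ) (M 3 j) = -Jmat 1 j := fun j => by
    rw [← hM.rel 1 j]
    simp [h1]
  have t2 : ∀ j, M 2 j = (starRingEnd ℂ) (-Jmat 0 j) := fun j => by rw [← r2 j]; simp
  have t3 : ∀ j, M 3 j = (starRingEnd ℂ) (-Jmat 1 j) := fun j => by rw [← r3 j]; simp
  have e22 : (starRingEnd ℂ) (M 0 2) = M 0 2 := by
    have := hM.rel 2 2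
    simp [t2, t3, Jmat] at this
    linear_combination this
  have e33 : (starRingEnd ℂ) (M 1 3) = M 1 3 := by
    have := hM.rel 3 3
    simp [t2, t3, Jmat] at this
    linear_combination this
  have e23 : (starRingEnd ℂ) (M 0 3) = M 1 2 := by
    have := hM.rel 2 3
    simp [t2, t3, Jmat] at this
    linear_combination this
  obtain ⟨a, ha⟩ := ringInts_real (hM.1 0 2) e22
  obtain ⟨d, hd⟩ := ringInts_real (hM.1 1 3) e33
  obtain ⟨b, c, hbc⟩ := hM.1 0 3
  rw [hbc] at e23
  simp only [map_add, map_mul, map_intCast, conj_omg] at e23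
  have : M = gT a b c d := by
    ext i j
    fin_cases i <;> fin_cases j <;> simp [h0, h1, t2, t3, Jmat, gT, ha, hd, hbc, ← e23]
  rw [this]
  exact Gen.t _ _ _ _

lemma gen_of_col {M : Matrix (Fin 4) (Fin 4) ℂ} (hM : InU M)
    (h0 : ∀ i, M i 0 = (1 : Matrix (Fin 4) (Fin 4) ℂ) i 0) : Gen M := by
  have r2 : ∀ {M : Matrix (Fin 4) (Fin 4) ℂ}, InU M →
      (∀ i, M i 0 = (1 : Matrix (Fin 4) (Fin 4) ℂ) i 0) →
      ∀ j, (starRingEnd ℂ) (M 2 j) = -Jmat 0 j := fun hM h0 j => by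
    rw [← hM.rel 0 j]
    simp [h0]
  refine gen_descent (fun M => ∀ i, M i 0 = (1 : Matrix (Fin 4) (Fin 4) ℂ) i 0) 3 1
    ?_ ?_ M hM h0
  · intro M hM h0 hne
    have e21 : M 2 1 = 0 := by simpa [Jmat] using r2 hM h0 1
    have hr : M 3 1 * (starRingEnd ℂ) (M 1 1) = M 1 1 * (starRingEnd ℂ) (M 3 1) := by
      have := hM.rel 1 1
      simp [e21, Jmat] at this
      linear_combination this
    obtain ⟨d, hd⟩ := euclid_real hne hr
    refine ⟨gW * gS * gW * gT 0 0 0 d,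
      ((canc_W.mul canc_S).mul canc_W).mul (canc_T _ _ _ _), ?_, ?_⟩
    · intro i
      fin_cases i <;> simp [Matrix.mul_apply, Fin.sum_univ_four, gW, gS, gT, h0]
      rfl
    · have : (gW * gS * gW * gT 0 0 0 d * M) 3 1 = M 1 1 + d * M 3 1 := by
        simp [Matrix.mul_apply, Fin.sum_univ_four, gW, gS, gT]
      rw [this]
      exact hd
  · intro M hM h0 e31
    have e21 : M 2 1 = 0 := by simpa [Jmat] using r2 hM h0 1
    have e23 : M 2 3 = 0 := by simpa [Jmat] using r2 hM h0 3
    have main : ∀ M, InU M → (∀ i, M i 0 = (1 : Matrix (Fin 4) (Fin 4) ℂ) i 0) →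
        M 2 1 = 0 → M 3 1 = 0 → M 1 1 = 1 → Gen M := by
      intro M hM h0 e21 e31 e11
      obtain ⟨a, b, hab⟩ := hM.1 0 1
      have hc := (canc_W.mul (canc_H (-a - b) b)).mul canc_W
      refine hc.2 _ (gen_of_cols (hc.1.mul hM) ?_ ?_)
      · intro i
        fin_cases i <;> simp [Matrix.mul_apply, Fin.sum_univ_four, gW, gH, h0]
        rfl
      · intro i
        fin_cases i <;>
          simp [Matrix.mul_apply, Fin.sum_univ_four, gW, gH, e21, e31, e11, hab]
        · ring
        · rfl
    have hu : M 1 1 * (starRingEnd ℂ) (M 3 3) = 1 := by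
      have := hM.rel 1 3
      simp [e21, e23, e31, Jmat] at this
      linear_combination this
    have h33 : (starRingEnd ℂ) (M 3 3) ∈ ringInts 7 := by
      obtain ⟨a, b, hab⟩ := hM.1 3 3
      exact ⟨a + b, -b, by
        rw [hab]
        simp only [map_add, map_mul, map_intCast, conj_omg]
        push_cast
        ring⟩
    rcases ringInts_unit (hM.1 1 1) h33 hu with h1 | h1
    · exact main M hM h0 e21 e31 h1
    · have hc := (canc_W.mul canc_N).mul canc_W
      refine hc.2 _ (main _ (hc.1.mul hM) ?_ ?_ ?_ ?_)
      · intro i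
        fin_cases i <;> simp [Matrix.mul_apply, Fin.sum_univ_four, gW, gN, h0]
        rfl
      all_goals simp [Matrix.mul_apply, Fin.sum_univ_four, gW, gN, e21, e31, h1]

lemma gen_of_mem {M : Matrix (Fin 4) (Fin 4) ℂ} (hM : InU M) : Gen M := by
  refine gen_descent (fun _ => True) 3 0 ?_ ?_ M hM trivial
  · intro M _ _ hne
    obtain ⟨k, l, h⟩ := euclid (a := M 2 0) hne
    refine ⟨gW * gH (-k) (-l), canc_W.mul (canc_H _ _), trivial, ?_⟩
    have : (gW * gH (-k) (-l) * M) 3 0 = M 2 0 + (k + l * omg 7) * M 3 0 := by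
      simp [-mul_eq_mul_right_iff, -add_left_inj, Matrix.mul_apply, Fin.sum_univ_four, gW, gH]
      ring
    rw [this]
    exact h
  intro M hM _ e30
  refine gen_descent (fun M => M 3 0 = 0) 2 0 ?_ ?_ M hM e30
  · intro M hM e30 hne
    have hr : M 2 0 * (starRingEnd ℂ) (M 0 0) = M 0 0 * (starRingEnd ℂ) (M 2 0) := by
      have := hM.rel 0 0
      simp [e30, Jmat] at this
      linear_combination this
    obtain ⟨d, hd⟩ := euclid_real hne hr
    refine ⟨gS * gT d 0 0 0, canc_S.mul (canc_T _ _ _ _), ?_, ?_⟩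
    · simp [Matrix.mul_apply, Fin.sum_univ_four, gS, gT, e30]
    · have : (gS * gT d 0 0 0 * M) 2 0 = M 0 0 + d * M 2 0 := by
        simp [Matrix.mul_apply, Fin.sum_univ_four, gS, gT]
      rw [this]
      exact hd
  intro M hM e30 e20
  refine gen_descent (fun M => M 3 0 = 0 ∧ M 2 0 = 0) 1 0 ?_ ?_ M hM ⟨e30, e20⟩
  · rintro M - ⟨e30, e20⟩ hne
    obtain ⟨k, l, h⟩ := euclid' (a := M 0 0) hne
    refine ⟨gH k l * gW, (canc_H _ _).mul canc_W, ⟨?_, ?_⟩, ?_⟩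
    · simp [Matrix.mul_apply, Fin.sum_univ_four, gW, gH, e20]
    · simp [Matrix.mul_apply, Fin.sum_univ_four, gW, gH, e20, e30]
    · have : (gH k l * gW * M) 1 0 = M 0 0 + (k + l * (1 - omg 7)) * M 1 0 := by
        simp [Matrix.mul_apply, Fin.sum_univ_four, gW, gH]
      rw [this]
      exact h
  rintro M hM ⟨e30, e20⟩ e10
  have hu : M 0 0 * (starRingEnd ℂ) (M 2 2) = 1 := by
    have := hM.rel 0 2
    simp [e20, e10, e30, Jmat] at this
    linear_combination this
  have h22 : (starRingEnd ℂ) (M 2 2) ∈ ringInts 7 := by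
    obtain ⟨a, b, hab⟩ := hM.1 2 2
    exact ⟨a + b, -b, by
      rw [hab]
      simp only [map_add, map_mul, map_intCast, conj_omg]
      push_cast
      ring⟩
  rcases ringInts_unit (hM.1 0 0) h22 hu with h1 | h1
  · refine gen_of_col hM fun i => ?_
    fin_cases i <;> simp [e20, e10, e30, h1]
    rfl
  · refine canc_N.2 _ (gen_of_col (canc_N.1.mul hM) fun i => ?_)
    fin_cases i <;> simp [Matrix.mul_apply, Fin.sum_univ_four, gN, e20, e10, e30, h1]
    rfl

end

section

/-- `M` acts at `Z` with automorphy factor `j` and image `W`. -/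
def ActsAt (M : Matrix (Fin 4) (Fin 4) ℂ) (Z W : Matrix (Fin 2) (Fin 2) ℂ) (j : ℂ) : Prop :=
  (blkC M * Z + blkD M).det = j ∧ blkA M * Z + blkB M = W * (blkC M * Z + blkD M)

lemma ActsAt.moebius {M : Matrix (Fin 4) (Fin 4) ℂ} {Z W : Matrix (Fin 2) (Fin 2) ℂ} {j : ℂ}
    (h : ActsAt M Z W j) (hj : j ≠ 0) : moebius M Z = W := by
  have hu : IsUnit (blkC M * Z + blkD M).det := by rw [h.1]; exact hj.isUnit
  rw [_root_.moebius, h.2, Matrix.mul_assoc, Matrix.mul_nonsing_inv _ hu, Matrix.mul_one]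

/-- The transformation law of weight `k` for `F` at `M`, including the geometric facts. -/
def Act (k : ℕ) (F : Matrix (Fin 2) (Fin 2) ℂ → ℂ) (M : Matrix (Fin 4) (Fin 4) ℂ) : Prop :=
  ∀ Z ∈ HH2, ∃ W ∈ HH2, ∃ j ≠ 0, ActsAt M Z W j ∧ F W = j ^ k * F Z

lemma blk_mul (M M' : Matrix (Fin 4) (Fin 4) ℂ) :
    blkA (M * M') = blkA M * blkA M' + blkB M * blkC M' ∧
    blkB (M * M') = blkA M * blkB M' + blkB M * blkD M' ∧
    blkC (M * M') = blkC M * blkA M' + blkD M * blkC M' ∧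
    blkD (M * M') = blkC M * blkB M' + blkD M * blkD M' := by
  refine ⟨?_, ?_, ?_, ?_⟩ <;>
  · ext i j
    fin_cases i <;> fin_cases j <;>
      simp [blkA, blkB, blkC, blkD, Matrix.mul_apply, Fin.sum_univ_four] <;>
      ring

lemma Act.mul {k : ℕ} {F : Matrix (Fin 2) (Fin 2) ℂ → ℂ} {M M' : Matrix (Fin 4) (Fin 4) ℂ}
    (h : Act k F M) (h' : Act k F M') : Act k F (M * M') := by
  intro Z hZ
  obtain ⟨W', hW', j', hj', ⟨a', b'⟩, hF'⟩ := h' Z hZ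
  obtain ⟨W, hW, j, hj, ⟨a, b⟩, hF⟩ := h W' hW'
  obtain ⟨eA, eB, eC, eD⟩ := blk_mul M M'
  have e1 : blkC (M * M') * Z + blkD (M * M') =
      (blkC M * W' + blkD M) * (blkC M' * Z + blkD M') := by
    rw [eC, eD, Matrix.add_mul, Matrix.add_mul _ _ (blkC M' * Z + blkD M'),
      Matrix.mul_assoc _ W', ← b']
    simp only [Matrix.mul_add, Matrix.mul_assoc]
    abel
  have e2 : blkA (M * M') * Z + blkB (M * M') =
      (blkA M * W' + blkB M) * (blkC M' * Z + blkD M') := by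
    rw [eA, eB, Matrix.add_mul, Matrix.add_mul _ _ (blkC M' * Z + blkD M'),
      Matrix.mul_assoc _ W', ← b']
    simp only [Matrix.mul_add, Matrix.mul_assoc]
    abel
  refine ⟨W, hW, j * j', mul_ne_zero hj hj', ⟨?_, ?_⟩, ?_⟩
  · rw [e1, Matrix.det_mul, a, a']
  · rw [e2, e1, b, Matrix.mul_assoc]
  · rw [hF, hF']
    ring

lemma act_of_gen {k : ℕ} {F : Matrix (Fin 2) (Fin 2) ℂ → ℂ} (hT : ∀ a b c d, Act k F (gT a b c d))
    (hH : ∀ a b, Act k F (gH a b)) (hW : Act k F gW) (hN : Act k F gN) (hS : Act k F gS)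
    {M : Matrix (Fin 4) (Fin 4) ℂ} (hM : Gen M) : Act k F M := by
  induction hM with
  | t a b c d => exact hT a b c d
  | h a b => exact hH a b
  | w => exact hW
  | n => exact hN
  | s => exact hS
  | mul _ _ h1 h2 => exact h1.mul h2

lemma actsAt_gT (a b c d : ℤ) (τ x₁ x₂ ω : ℂ) :
    ActsAt (gT a b c d) (mk τ x₁ x₂ ω) (mk (τ + a) (x₁ + b) (x₂ + c) (ω + d)) 1 := by
  constructor
  · simp [blkC, blkD, gT, mk, Matrix.det_fin_two]
  · ext i j
    fin_cases i <;> fin_cases j <;>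
      simp [blkA, blkB, blkC, blkD, gT, mk, Matrix.mul_apply, Fin.sum_univ_two] <;> ring

lemma actsAt_gH (k l : ℤ) (τ x₁ x₂ ω : ℂ) :
    ActsAt (gH k l) (mk τ x₁ x₂ ω)
      (mk τ (x₁ + k * τ) (x₂ + l * τ) (ω + Qf k l * τ + Bf k l x₁ x₂)) 1 := by
  constructor
  · simp [blkC, blkD, gH, mk, Matrix.det_fin_two]
  · ext i j
    fin_cases i <;> fin_cases j <;>
      simp [blkA, blkB, blkC, blkD, gH, mk, Matrix.mul_apply, Fin.sum_univ_two, Qf, Bf]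
    · ring
    · ring
    · linear_combination (-l * l * τ - 2 * l * x₂) * omg_mul_self

lemma actsAt_gW (τ x₁ x₂ ω : ℂ) :
    ActsAt gW (mk τ x₁ x₂ ω) (mk ω (x₁ + x₂) (-x₂) τ) (-1) := by
  constructor
  · simp [blkC, blkD, gW, mk, Matrix.det_fin_two]
  · ext i j
    fin_cases i <;> fin_cases j <;>
      simp [blkA, blkB, blkC, blkD, gW, mk, Matrix.mul_apply, Fin.sum_univ_two] <;> ring

lemma actsAt_gN (τ x₁ x₂ ω : ℂ) :
    ActsAt gN (mk τ x₁ x₂ ω) (mk τ (-x₁) (-x₂) ω) (-1) := by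
  constructor
  · simp [blkC, blkD, gN, mk, Matrix.det_fin_two]
  · ext i j
    fin_cases i <;> fin_cases j <;>
      simp [blkA, blkB, blkC, blkD, gN, mk, Matrix.mul_apply, Fin.sum_univ_two] <;> ring

lemma actsAt_gS {τ : ℂ} (hτ : τ ≠ 0) (x₁ x₂ ω : ℂ) :
    ActsAt gS (mk τ x₁ x₂ ω) (mk (-1 / τ) (x₁ / τ) (x₂ / τ) (ω - Qf x₁ x₂ / τ)) τ := by
  constructor
  · simp [blkC, blkD, gS, mk, Matrix.det_fin_two]
  · ext i j
    fin_cases i <;> fin_cases j <;>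
      simp [blkA, blkB, blkC, blkD, gS, mk, Matrix.mul_apply, Fin.sum_univ_two, Qf] <;>
      field_simp
    · ring
    · linear_combination (x₂ ^ 2) * omg_mul_self

lemma HC.ne_zero {τ x₁ x₂ ω : ℂ} (h : HC τ x₁ x₂ ω) : τ ≠ 0 := ne_zero_of_im_pos h.1

lemma HC.translate {τ x₁ x₂ ω : ℂ} (h : HC τ x₁ x₂ ω) (a b c d : ℤ) :
    HC (τ + a) (x₁ + b) (x₂ + c) (ω + d) := by
  simpa [HC] using h

lemma intCast_mul_im (n : ℤ) (z : ℂ) : ((n : ℂ) * z).im = n * z.im := by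
  simp [Complex.mul_im]

lemma HC.heis {τ x₁ x₂ ω : ℂ} (h : HC τ x₁ x₂ ω) (k l : ℤ) :
    HC τ (x₁ + k * τ) (x₂ + l * τ) (ω + Qf k l * τ + Bf k l x₁ x₂) := by
  obtain ⟨h1, h2, h3⟩ := h
  have e : (ω + Qf k l * τ + Bf k l x₁ x₂).im =
      ω.im + (k ^ 2 + k * l + 2 * l ^ 2) * τ.im + (2 * k * x₁.im + k * x₂.im + l * x₁.im
        + 4 * l * x₂.im) := by
    have : Qf k l * τ + Bf k l x₁ x₂ = ((k ^ 2 + k * l + 2 * l ^ 2 : ℤ) : ℂ) * τ +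
        ((2 * k + l : ℤ) : ℂ) * x₁ + ((k + 4 * l : ℤ) : ℂ) * x₂ := by
      simp only [Qf, Bf]
      push_cast
      ring
    rw [add_assoc, this]
    simp only [Complex.add_im, intCast_mul_im]
    push_cast
    ring
  have e3 : qr (x₁ + k * τ).im (x₂ + l * τ).im <
      τ.im * (ω + Qf k l * τ + Bf k l x₁ x₂).im := by
    rw [e]
    simp only [qr, Complex.add_im, intCast_mul_im] at h3 ⊢
    nlinarith
  refine ⟨h1, ?_, e3⟩
  have := qr_nonneg (x₁ + k * τ).im (x₂ + l * τ).im
  by_contra hc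
  push Not at hc
  nlinarith

lemma HC.swap {τ x₁ x₂ ω : ℂ} (h : HC τ x₁ x₂ ω) : HC ω (x₁ + x₂) (-x₂) τ := by
  obtain ⟨h1, h2, h3⟩ := h
  refine ⟨h2, h1, ?_⟩
  simp only [qr, Complex.add_im, Complex.neg_im] at h3 ⊢
  nlinarith

lemma HC.neg {τ x₁ x₂ ω : ℂ} (h : HC τ x₁ x₂ ω) : HC τ (-x₁) (-x₂) ω := by
  obtain ⟨h1, h2, h3⟩ := h
  refine ⟨h1, h2, ?_⟩
  simp only [qr, Complex.neg_im] at h3 ⊢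
  nlinarith

lemma qr_div_im {τ : ℂ} (hτ : 0 < τ.im) (x₁ x₂ : ℂ) :
    τ.im * (Qf x₁ x₂ / τ).im + qr (x₁ / τ).im (x₂ / τ).im * (τ.im ^ 2 + τ.re ^ 2) / τ.im * τ.im
      = qr x₁.im x₂.im := by
  have h : τ.re * τ.re + τ.im * τ.im ≠ 0 :=
    (by nlinarith [mul_self_nonneg τ.re, mul_pos hτ hτ] : 0 < τ.re * τ.re + τ.im * τ.im).ne'
  simp only [Qf, qr, Complex.div_im, Complex.normSq_apply, Complex.add_im, Complex.mul_im,
    Complex.add_re, Complex.mul_re, pow_two, Complex.re_ofNat, Complex.im_ofNat]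
  field_simp
  ring

lemma HC.inv {τ x₁ x₂ ω : ℂ} (h : HC τ x₁ x₂ ω) :
    HC (-1 / τ) (x₁ / τ) (x₂ / τ) (ω - Qf x₁ x₂ / τ) := by
  obtain ⟨h1, h2, h3⟩ := h
  have e := qr_div_im h1 x₁ x₂
  have h4 : (-1 / τ).im = τ.im / (τ.im ^ 2 + τ.re ^ 2) := by
    simp only [Complex.div_im, Complex.neg_re, Complex.neg_im, Complex.one_re, Complex.one_im,
      Complex.normSq_apply]
    field_simp
    ring
  have hp : 0 < τ.im ^ 2 + τ.re ^ 2 := by positivity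
  have h5 : 0 < (-1 / τ).im := by
    rw [h4]
    positivity
  have h6 : qr (x₁ / τ).im (x₂ / τ).im < (-1 / τ).im * (ω - Qf x₁ x₂ / τ).im := by
    rw [h4, Complex.sub_im, div_mul_eq_mul_div, lt_div_iff₀ hp, mul_sub]
    rw [div_mul_cancel₀ _ h1.ne'] at e
    linarith
  refine ⟨h5, ?_, h6⟩
  have := qr_nonneg (x₁ / τ).im (x₂ / τ).im
  by_contra hc
  push Not at hc
  nlinarith

/-- Modularity in coordinates. -/
structure CoordMod (k : ℕ) (f : ℂ → ℂ → ℂ → ℂ → ℂ) : Prop where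
  translate : ∀ τ x₁ x₂ ω, HC τ x₁ x₂ ω → ∀ a b c d : ℤ,
    f (τ + a) (x₁ + b) (x₂ + c) (ω + d) = f τ x₁ x₂ ω
  heis : ∀ τ x₁ x₂ ω, HC τ x₁ x₂ ω → ∀ k l : ℤ,
    f τ (x₁ + k * τ) (x₂ + l * τ) (ω + Qf k l * τ + Bf k l x₁ x₂) = f τ x₁ x₂ ω
  swap : ∀ τ x₁ x₂ ω, HC τ x₁ x₂ ω → f ω (x₁ + x₂) (-x₂) τ = (-1) ^ k * f τ x₁ x₂ ω
  neg : ∀ τ x₁ x₂ ω, HC τ x₁ x₂ ω → f τ (-x₁) (-x₂) ω = (-1) ^ k * f τ x₁ x₂ ω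
  inv : ∀ τ x₁ x₂ ω, HC τ x₁ x₂ ω →
    f (-1 / τ) (x₁ / τ) (x₂ / τ) (ω - Qf x₁ x₂ / τ) = τ ^ k * f τ x₁ x₂ ω

lemma act_of_coord {k : ℕ} {F : Matrix (Fin 2) (Fin 2) ℂ → ℂ} {M : Matrix (Fin 4) (Fin 4) ℂ}
    (h : ∀ τ x₁ x₂ ω, HC τ x₁ x₂ ω → ∃ W ∈ HH2, ∃ j ≠ 0, ActsAt M (mk τ x₁ x₂ ω) W j ∧
      F W = j ^ k * F (mk τ x₁ x₂ ω)) : Act k F M := by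
  intro Z hZ
  have := h _ _ _ _ ((mem_HH2_iff Z).1 hZ)
  rwa [mk_coord] at this

lemma isHMF_of_coord {k : ℕ} {F : Matrix (Fin 2) (Fin 2) ℂ → ℂ} (hd : DifferentiableOn ℂ F HH2)
    (h : CoordMod k fun τ x₁ x₂ ω => F (mk τ x₁ x₂ ω)) : IsHMF 7 k F := by
  refine ⟨hd, fun M hM Z hZ => ?_⟩
  have hA : Act k F M := by
    refine act_of_gen ?_ ?_ ?_ ?_ ?_ (gen_of_mem (inU_of_inSU hM))
    · exact fun a b c d => act_of_coord fun τ x₁ x₂ ω hC => ⟨_, (mk_mem _ _ _ _).2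
        (hC.translate a b c d), 1, one_ne_zero, actsAt_gT a b c d _ _ _ _, by
          rw [one_pow, one_mul]; exact h.translate _ _ _ _ hC a b c d⟩
    · exact fun a b => act_of_coord fun τ x₁ x₂ ω hC => ⟨_, (mk_mem _ _ _ _).2
        (hC.heis a b), 1, one_ne_zero, actsAt_gH a b _ _ _ _, by
          rw [one_pow, one_mul]; exact h.heis _ _ _ _ hC a b⟩
    · exact act_of_coord fun τ x₁ x₂ ω hC => ⟨_, (mk_mem _ _ _ _).2 hC.swap, -1, by simp,
        actsAt_gW _ _ _ _, h.swap _ _ _ _ hC⟩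
    · exact act_of_coord fun τ x₁ x₂ ω hC => ⟨_, (mk_mem _ _ _ _).2 hC.neg, -1, by simp,
        actsAt_gN _ _ _ _, h.neg _ _ _ _ hC⟩
    · exact act_of_coord fun τ x₁ x₂ ω hC => ⟨_, (mk_mem _ _ _ _).2 hC.inv, τ, hC.ne_zero,
        actsAt_gS hC.ne_zero _ _ _, h.inv _ _ _ _ hC⟩
  obtain ⟨W, -, j, hj, h1, h2⟩ := hA Z hZ
  rw [h1.moebius hj, h2, h1.1]

lemma coord_of_isHMF {k : ℕ} {F : Matrix (Fin 2) (Fin 2) ℂ → ℂ} (h : IsHMF 7 k F) :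
    CoordMod k fun τ x₁ x₂ ω => F (mk τ x₁ x₂ ω) := by
  have key : ∀ {M Z W j}, inSU 7 M → Z ∈ HH2 → ActsAt M Z W j → j ≠ 0 → F W = j ^ k * F Z := by
    intro M Z W j hM hZ hA hj
    have := h.2 M hM Z hZ
    rwa [hA.moebius hj, hA.1] at this
  constructor
  · intro τ x₁ x₂ ω hC a b c d
    simpa using key (inSU_gT a b c d) ((mk_mem _ _ _ _).2 hC) (actsAt_gT a b c d _ _ _ _)
      one_ne_zero
  · intro τ x₁ x₂ ω hC a b
    simpa using key (inSU_gH a b) ((mk_mem _ _ _ _).2 hC) (actsAt_gH a b _ _ _ _) one_ne_zero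
  · intro τ x₁ x₂ ω hC
    exact key inSU_gW ((mk_mem _ _ _ _).2 hC) (actsAt_gW _ _ _ _) (by simp)
  · intro τ x₁ x₂ ω hC
    exact key inSU_gN ((mk_mem _ _ _ _).2 hC) (actsAt_gN _ _ _ _) (by simp)
  · intro τ x₁ x₂ ω hC
    exact key inSU_gS ((mk_mem _ _ _ _).2 hC) (actsAt_gS hC.ne_zero _ _ _) hC.ne_zero

end

section

/-- The cone of imaginary parts. -/
def OC : Set (Fin 4 → ℝ) := {y | 0 < y 0 ∧ 0 < y 3 ∧ qr (y 1) (y 2) < y 0 * y 3}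

lemma isOpen_OC : IsOpen OC := by
  have c : ∀ i, Continuous fun y : Fin 4 → ℝ => y i := fun i => continuous_apply i
  refine (isOpen_lt continuous_const (c 0)).inter ((isOpen_lt continuous_const (c 3)).inter
    (isOpen_lt ?_ ((c 0).mul (c 3))))
  unfold qr
  fun_prop

lemma mem_OC_iff (y : Fin 4 → ℝ) : y ∈ OC ↔ 0 < y 0 ∧ ∀ u₁ u₂ : ℝ,
    0 < y 0 * qr u₁ u₂ + (2 * u₁ * y 1 + u₁ * y 2 + u₂ * y 1 + 4 * u₂ * y 2) + y 3 := by
  have e : ∀ u₁ u₂ : ℝ,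
      y 0 * (y 0 * qr u₁ u₂ + (2 * u₁ * y 1 + u₁ * y 2 + u₂ * y 1 + 4 * u₂ * y 2) + y 3) =
      qr (y 0 * u₁ + y 1) (y 0 * u₂ + y 2) + (y 0 * y 3 - qr (y 1) (y 2)) := fun u₁ u₂ => by
    unfold qr
    ring
  constructor
  · rintro ⟨h0, -, h1⟩
    refine ⟨h0, fun u₁ u₂ => ?_⟩
    rw [← mul_pos_iff_of_pos_left h0, e]
    have := qr_nonneg (y 0 * u₁ + y 1) (y 0 * u₂ + y 2)
    linarith
  · rintro ⟨h0, h1⟩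
    refine ⟨h0, by simpa [qr] using h1 0 0, ?_⟩
    have h2 := mul_pos h0 (h1 (-(y 1 / y 0)) (-(y 2 / y 0)))
    rw [e] at h2
    have e1 : ∀ a, y 0 * -(a / y 0) + a = 0 := fun a => by field_simp; ring
    rw [e1, e1] at h2
    simp only [qr] at h2 ⊢
    linarith

lemma convex_OC : Convex ℝ OC := by
  intro y hy z hz a b ha hb hab
  rw [mem_OC_iff] at hy hz ⊢
  have key : ∀ p q : ℝ, 0 < p → 0 < q → 0 < a * p + b * q := fun p q hp hq => by
    rcases ha.eq_or_lt with rfl | ha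
    · rw [show b = 1 by linarith]
      linarith
    · have := mul_pos ha hp
      have := mul_nonneg hb hq.le
      linarith
  refine ⟨by simpa using key _ _ hy.1 hz.1, fun u₁ u₂ => ?_⟩
  have := key _ _ (hy.2 u₁ u₂) (hz.2 u₁ u₂)
  simp only [Pi.add_apply, Pi.smul_apply, smul_eq_mul]
  linarith

lemma HC_of_tube {z : Fin 4 → ℂ} : z ∈ tube OC ↔ HC (z 0) (z 1) (z 2) (z 3) := Iff.rfl

/-- Integral vectors of length four. -/
def vec4 : (Fin 4 → ℤ) ≃ ℤ × T3 where
  toFun n := (n 3, n 0, n 1, n 2)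
  invFun p := ![p.2.1, p.2.2.1, p.2.2.2, p.1]
  left_inv n := by ext i; fin_cases i <;> rfl
  right_inv p := rfl

/-- Fourier monomials in four variables. -/
def e4 (p : ℤ × T3) (τ x₁ x₂ ω : ℂ) : ℂ := e3 p.2 τ x₁ x₂ * ee (p.1 * ω)

lemma ee_dot_vec4 (n : Fin 4 → ℤ) (z : Fin 4 → ℂ) :
    ee (dot n z) = e4 (vec4 n) (z 0) (z 1) (z 2) (z 3) := by
  simp only [dot, Fin.sum_univ_four, e4, e3, ← ee_add]
  rfl

/-- An absolutely convergent four-variable Fourier expansion. -/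
def Rep4 (c : ℤ × T3 → ℂ) (f : ℂ → ℂ → ℂ → ℂ → ℂ) : Prop :=
  ∀ τ x₁ x₂ ω, HC τ x₁ x₂ ω → HasSum (fun p => c p * e4 p τ x₁ x₂ ω) (f τ x₁ x₂ ω)

lemma Rep4.hasSum_vec {c : ℤ × T3 → ℂ} {f : ℂ → ℂ → ℂ → ℂ → ℂ} (h : Rep4 c f) {z : Fin 4 → ℂ}
    (hz : z ∈ tube OC) :
    HasSum (fun n => c (vec4 n) * ee (dot n z)) (f (z 0) (z 1) (z 2) (z 3)) :=
  (vec4.hasSum_iff.2 (h _ _ _ _ (HC_of_tube.1 hz))).congr_fun fun n => by rw [ee_dot_vec4]; rfl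

/-- The coordinate vector of a matrix. -/
def crd (Z : Matrix (Fin 2) (Fin 2) ℂ) : Fin 4 → ℂ := ![Z 0 0, cx₁ Z, cx₂ Z, Z 1 1]

lemma differentiable_crd : Differentiable ℂ crd := by
  have h : ∀ i j, Differentiable ℂ fun Z : Matrix (Fin 2) (Fin 2) ℂ => Z i j := fun i j =>
    differentiable_pi.1 (differentiable_pi.1 (differentiable_id (𝕜 := ℂ)
      (E := Fin 2 → Fin 2 → ℂ)) i) j
  have h2 : Differentiable ℂ cx₂ := by
    unfold cx₂
    simp only [div_eq_mul_inv]
    exact ((h 0 1).sub (h 1 0)).mul_const _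
  have h1 : Differentiable ℂ cx₁ := (h 0 1).sub (h2.const_mul _)
  refine differentiable_pi.2 fun i => ?_
  fin_cases i
  · exact h 0 0
  · exact h1
  · exact h2
  · exact h 1 1

lemma Rep4.differentiableOn {c : ℤ × T3 → ℂ} {f : ℂ → ℂ → ℂ → ℂ → ℂ} (h : Rep4 c f) :
    DifferentiableOn ℂ (fun Z => f (Z 0 0) (cx₁ Z) (cx₂ Z) (Z 1 1)) HH2 := by
  have h1 := series_differentiableOn (f := fun z : Fin 4 → ℂ => f (z 0) (z 1) (z 2) (z 3))
    isOpen_OC fun _ hz => h.hasSum_vec hz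
  exact h1.comp differentiable_crd.differentiableOn fun Z hZ => (mem_HH2_iff Z).1 hZ

lemma differentiable_mk : Differentiable ℂ
    fun z : Fin 4 → ℂ => mk (z 0) (z 1) (z 2) (z 3) := by
  have h : ∀ i, Differentiable ℂ fun z : Fin 4 → ℂ => z i := fun i => differentiable_apply i
  have key : Differentiable ℂ fun (z : Fin 4 → ℂ) (i j : Fin 2) => mk (z 0) (z 1) (z 2) (z 3) i j := by
    rw [differentiable_pi]
    intro i
    rw [differentiable_pi]
    intro j
    fin_cases i <;> fin_cases j
    · exact h 0
    · exact (h 1).add ((h 2).const_mul _)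
    · exact (h 1).add ((h 2).const_mul _)
    · exact h 3
  exact key

/-- The Fourier expansion of a translation-invariant holomorphic function on `HH2`. -/
theorem exists_rep4 {F : Matrix (Fin 2) (Fin 2) ℂ → ℂ} (hF : DifferentiableOn ℂ F HH2)
    (hp : ∀ τ x₁ x₂ ω, HC τ x₁ x₂ ω → ∀ a b c d : ℤ,
      F (mk (τ + a) (x₁ + b) (x₂ + c) (ω + d)) = F (mk τ x₁ x₂ ω)) :
    ∃ c : ℤ × T3 → ℂ, Rep4 c fun τ x₁ x₂ ω => F (mk τ x₁ x₂ ω) := by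
  have hper : Periodic OC fun z : Fin 4 → ℂ => F (mk (z 0) (z 1) (z 2) (z 3)) := by
    intro z hz n
    have := hp _ _ _ _ (HC_of_tube.1 hz) (n 0) (n 1) (n 2) (n 3)
    simpa using this
  obtain ⟨c, h1, -⟩ := fourier_expansion (f := fun z : Fin 4 → ℂ => F (mk (z 0) (z 1) (z 2) (z 3)))
    isOpen_OC convex_OC (hF.comp differentiable_mk.differentiableOn
      fun z hz => (mk_mem _ _ _ _).2 hz) hper
  · refine ⟨fun p => c (vec4.symm p), fun τ x₁ x₂ ω h => ?_⟩
    rw [← vec4.hasSum_iff]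
    refine (h1 ![τ, x₁, x₂, ω] h).congr_fun fun n => ?_
    rw [ee_dot_vec4]
    simp

/-- The Fourier–Jacobi series attached to a family of Jacobi forms. -/
def FJ (g : ℕ → ℂ → ℂ → ℂ → ℂ) (τ x₁ x₂ ω : ℂ) : ℂ := ∑' m : ℕ, g m τ x₁ x₂ * ee (m * ω)

/-- A family of Jacobi forms of weight `K` with the exact symmetries of a Hermitian form. -/
structure SFam (κ : ℤ) (ε : ℂ) (c : ℕ → T3 → ℂ) (g : ℕ → ℂ → ℂ → ℂ → ℂ) : Prop where
  jac : ∀ m : ℕ, Jac κ m (c m) (g m)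
  swap : ∀ (m n : ℕ) (r s : ℤ), c m (n, r, s) = ε * c n (m, r, r - s)
  neg : ∀ m τ x₁ x₂, 0 < τ.im → g m τ (-x₁) (-x₂) = ε * g m τ x₁ x₂

lemma SFam.fam {κ : ℤ} {ε : ℂ} {c : ℕ → T3 → ℂ} {g : ℕ → ℂ → ℂ → ℂ → ℂ} (h : SFam κ ε c g)
    (hε : ‖ε‖ = 1) : Fam κ c g :=
  ⟨h.jac, fun m n r s => by rw [h.swap, norm_mul, hε, one_mul]⟩

/-- Extension of the coefficients by zero. -/
def ext4 (c : ℕ → T3 → ℂ) (p : ℤ × T3) : ℂ := if 0 ≤ p.1 then c p.1.toNat p.2 else 0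

lemma ext4_nat (c : ℕ → T3 → ℂ) (m : ℕ) (T : T3) : ext4 c (m, T) = c m T := by simp [ext4]

lemma hasSum_ext4 {c : ℕ → T3 → ℂ} {τ x₁ x₂ ω a : ℂ} :
    HasSum (fun p : ℕ × T3 => c p.1 p.2 * (e3 p.2 τ x₁ x₂ * ee (p.1 * ω))) a ↔
      HasSum (fun p => ext4 c p * e4 p τ x₁ x₂ ω) a := by
  have hi : Function.Injective fun p : ℕ × T3 => ((p.1 : ℤ), p.2) := by
    rintro ⟨a, b⟩ ⟨a', b'⟩ h
    simpa using h
  rw [← hi.hasSum_iff]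
  · refine iff_of_eq (congrArg (fun f => HasSum f a) ?_)
    funext p
    simp [ext4, e4]
  · rintro ⟨m, T⟩ hp
    rw [ext4, if_neg, zero_mul]
    intro hm
    exact hp ⟨(m.toNat, T), by simpa using hm⟩

section

variable {k : ℕ} {ε : ℂ} {c : ℕ → T3 → ℂ} {g : ℕ → ℂ → ℂ → ℂ → ℂ}

lemma Fam.hasSum (h : Fam k c g) {τ x₁ x₂ ω : ℂ} (hC : HC τ x₁ x₂ ω) :
    HasSum (fun p : ℕ × T3 => c p.1 p.2 * (e3 p.2 τ x₁ x₂ * ee (p.1 * ω))) (FJ g τ x₁ x₂ ω) ∧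
      HasSum (fun m : ℕ => g m τ x₁ x₂ * ee (m * ω)) (FJ g τ x₁ x₂ ω) := by
  have h1 := h.summable hC.1 hC.2.1 hC.2.2
  simp only [mul_assoc] at h1
  have h2 := h1.hasSum.prod_fiberwise (g := fun m : ℕ => g m τ x₁ x₂ * ee (m * ω)) fun m => by
    refine (((h.jac m).rep.2 τ x₁ x₂ hC.1).mul_right (ee (m * ω))).congr_fun fun T => ?_
    ring
  have h3 : FJ g τ x₁ x₂ ω = _ := h2.tsum_eq
  rw [h3]
  exact ⟨h1.hasSum, h2⟩

lemma Fam.rep4 (h : Fam k c g) : Rep4 (ext4 c) (FJ g) :=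
  fun _ _ _ _ hC => hasSum_ext4.1 (h.hasSum hC).1

lemma FJ_congr {τ x₁ x₂ ω τ' x₁' x₂' ω' a : ℂ}
    (h : ∀ m : ℕ, g m τ' x₁' x₂' * ee (m * ω') = a * (g m τ x₁ x₂ * ee (m * ω))) :
    FJ g τ' x₁' x₂' ω' = a * FJ g τ x₁ x₂ ω := by
  rw [FJ, FJ, ← tsum_mul_left]
  exact tsum_congr h

lemma ee_nat_mul_int (m : ℕ) (d : ℤ) : ee (m * d) = 1 := by
  have := ee_int (m * d)
  push_cast at this
  exact this

theorem SFam.coordMod (h : SFam k ((-1) ^ k) c g) : CoordMod k (FJ g) := by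
  have hF := h.fam (by simp)
  constructor
  · intro τ x₁ x₂ ω hC a b c d
    rw [FJ_congr (a := 1), one_mul]
    intro m
    rw [(h.jac m).rep.periodic hC.1, mul_add, ee_add, ee_nat_mul_int, mul_one, one_mul]
  · intro τ x₁ x₂ ω hC k l
    rw [FJ_congr (a := 1), one_mul]
    intro m
    rw [(h.jac m).heis _ _ _ hC.1, add_assoc, mul_add (m : ℂ) ω, ee_add, ee_neg, one_mul]
    have := ee_ne_zero (m * (Qf k l * τ + Bf k l x₁ x₂))
    field_simp
  · intro τ x₁ x₂ ω hC
    have h1 := hF.rep4 _ _ _ _ hC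
    have h2 := hF.rep4 _ _ _ _ hC.swap
    let σ : ℤ × T3 ≃ ℤ × T3 :=
      ⟨fun p => (p.2.1, p.1, p.2.2.1, p.2.2.1 - p.2.2.2),
       fun p => (p.2.1, p.1, p.2.2.1, p.2.2.1 - p.2.2.2),
       fun p => by simp, fun p => by simp⟩
    rw [← σ.hasSum_iff] at h2
    refine h2.unique ((h1.mul_left ((-1) ^ k)).congr_fun ?_)
    rintro ⟨m, n, r, s⟩
    have e : e4 (n, m, r, r - s) ω (x₁ + x₂) (-x₂) τ = e4 (m, n, r, s) τ x₁ x₂ ω := by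
      simp only [e4, e3, ← ee_add]
      congr 1
      push_cast
      ring
    have e2 : ext4 c (n, m, r, r - s) = (-1) ^ k * ext4 c (m, n, r, s) := by
      by_cases hm : 0 ≤ m
      · by_cases hn : 0 ≤ n
        · lift m to ℕ using hm
          lift n to ℕ using hn
          rw [ext4_nat, ext4_nat, h.swap n m, sub_sub_cancel]
        · rw [ext4, if_neg hn, ext4, if_pos hm, (h.jac _).rep.1 _ (by simpa using hn), mul_zero]
      · rw [ext4, ext4, if_neg (c := 0 ≤ (m, n, r, s).1) hm, mul_zero]
        split_ifs with hn
        · exact (h.jac _).rep.1 _ (by simpa using hm)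
        · rfl
    change ext4 c (n, m, r, r - s) * e4 (n, m, r, r - s) ω (x₁ + x₂) (-x₂) τ = _
    rw [e, e2, mul_assoc]
  · intro τ x₁ x₂ ω hC
    refine FJ_congr fun m => ?_
    rw [h.neg m _ _ _ hC.1, mul_assoc]
  · intro τ x₁ x₂ ω hC
    refine FJ_congr fun m => ?_
    rw [(h.jac m).inv _ _ _ hC.1, mul_sub, sub_eq_add_neg, ee_add, ee_neg, zpow_natCast]
    have := mul_inv_cancel₀ (ee_ne_zero (m * (Qf x₁ x₂ / τ)))
    linear_combination (τ ^ k * g m τ x₁ x₂ * ee (m * ω)) * this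

/-- The Hermitian modular form attached to a symmetric family. -/
def HF (g : ℕ → ℂ → ℂ → ℂ → ℂ) (Z : Matrix (Fin 2) (Fin 2) ℂ) : ℂ :=
  FJ g (Z 0 0) (cx₁ Z) (cx₂ Z) (Z 1 1)

lemma HF_mk (τ x₁ x₂ ω : ℂ) : HF g (mk τ x₁ x₂ ω) = FJ g τ x₁ x₂ ω := by
  rw [HF, cx₁_mk, cx₂_mk]
  rfl

theorem SFam.isHMF (h : SFam k ((-1) ^ k) c g) : IsHMF 7 k (HF g) := by
  refine isHMF_of_coord (h.fam (by simp)).rep4.differentiableOn ?_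
  simp only [HF_mk]
  exact h.coordMod

end

end

section

/-- The first three moments of `c` along an affine progression vanish. -/
def Mom (a β : ℂ) (c : ℤ → ℂ) : Prop := ∀ j < 3, HasSum (fun s : ℤ => (a + β * s) ^ j * c s) 0

lemma Mom.change {a β : ℂ} {c : ℤ → ℂ} (h : Mom a β c) (hβ : β ≠ 0) (a' β' : ℂ) : Mom a' β' c := by
  have h0 := h 0 (by norm_num)
  have h1 := h 1 (by norm_num)
  have h2 := h 2 (by norm_num)
  set γ := β' / β with hγ
  set δ := a' - γ * a with hδ
  have e : ∀ s : ℤ, a' + β' * s = γ * (a + β * s) + δ := fun s => by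
    rw [hδ, hγ]
    field_simp
    ring
  intro j hj
  simp only [e]
  interval_cases j
  · exact h0
  · have := (h1.mul_left γ).add (h0.mul_left δ)
    rw [mul_zero, mul_zero, add_zero] at this
    exact this.congr_fun fun s => by ring
  · have := ((h2.mul_left (γ ^ 2)).add (h1.mul_left (2 * γ * δ))).add (h0.mul_left (δ ^ 2))
    rw [mul_zero, mul_zero, mul_zero, add_zero, add_zero] at this
    exact this.congr_fun fun s => by ring

section

variable {P : Type*} {a E : P → ℂ} {β : ℂ} {c : P → ℤ → ℂ} {j : ℕ}

lemma jet_eq_zero {S : ℂ} (h : ∀ p, HasSum (fun s : ℤ => (a p + β * s) ^ j * c p s) 0)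
    (hs : HasSum (fun q : P × ℤ => (a q.1 + β * q.2) ^ j * c q.1 q.2 * E q.1) S) : S = 0 := by
  have := hs.prod_fiberwise fun p => (h p).mul_right (E p)
  simp only [zero_mul] at this
  exact this.unique hasSum_zero

lemma jet_fiber (hE : ∀ p, E p ≠ 0)
    (hs : HasSum (fun q : P × ℤ => (a q.1 + β * q.2) ^ j * c q.1 q.2 * E q.1) 0) :
    (∀ p, Summable fun s : ℤ => (a p + β * s) ^ j * c p s) ∧
      HasSum (fun p => (∑' s : ℤ, (a p + β * s) ^ j * c p s) * E p) 0 := by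
  have h1 : ∀ p, Summable fun s : ℤ => (a p + β * s) ^ j * c p s := fun p =>
    (summable_mul_right_iff (hE p)).1 (hs.summable.prod_factor p)
  exact ⟨h1, hs.prod_fiberwise fun p => (h1 p).hasSum.mul_right (E p)⟩

end

lemma two_pi_I_ne : 2 * (Real.pi : ℂ) * Complex.I ≠ 0 := Complex.two_pi_I_ne_zero

/-- Regrouping of the exponents of three variables. -/
def grp3 : (ℤ × ℤ) × ℤ ≃ T3 :=
  ⟨fun q => (q.1.1, q.1.2, q.2), fun T => ((T.1, T.2.1), T.2.2), fun _ => rfl, fun _ => rfl⟩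

/-- Regrouping of the exponents of four variables. -/
def grp4 : T3 × ℤ ≃ ℤ × T3 :=
  ⟨fun q => (q.1.1, q.1.2.1, q.1.2.2, q.2), fun p => ((p.1, p.2.1, p.2.2.1), p.2.2.2),
    fun _ => rfl, fun _ => rfl⟩

lemma Rep.jet {c : T3 → ℂ} {f : ℂ → ℂ → ℂ → ℂ} (h : Rep c f) {τ x₁ : ℂ} (hτ : 0 < τ.im) (j : ℕ) :
    HasSum (fun q : (ℤ × ℤ) × ℤ => (0 + 1 * (q.2 : ℂ)) ^ j * c (q.1.1, q.1.2, q.2) *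
      ee (q.1.1 * τ + q.1.2 * x₁))
      (iteratedDeriv j (f τ x₁) 0 / (2 * Real.pi * Complex.I) ^ j) := by
  have h1 := series_iteratedDeriv (f := fun z : Fin 3 → ℂ => f (z 0) (z 1) (z 2)) isOpen_UH3
    (fun z hz => h.hasSum_vec hz) ![0, 0, 1] j (z := ![τ, x₁, 0]) (t := 0)
    (by simpa [tube, UH3, imv] using hτ)
  have e : (fun t : ℂ => (fun z : Fin 3 → ℂ => f (z 0) (z 1) (z 2))
      (![τ, x₁, 0] + t • ![0, 0, 1])) = f τ x₁ := by
    funext t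
    simp
  rw [e] at h1
  rw [← (grp3.trans vec3.symm).hasSum_iff] at h1
  refine (h1.div_const ((2 * Real.pi * Complex.I) ^ j)).congr_fun ?_
  rintro ⟨⟨n, r⟩, s⟩
  have := pow_ne_zero j two_pi_I_ne
  have e1 : vec3.symm (n, r, s) = ![n, r, s] := rfl
  have e2 : grp3 ((n, r), s) = (n, r, s) := rfl
  have e4 : vec3 ![n, r, s] = (n, r, s) := rfl
  simp [dot, e1, e2, Fin.sum_univ_three, mul_pow]
  field_simp
  rw [e4]
  ring

theorem Rep.order_iff {c : T3 → ℂ} {f : ℂ → ℂ → ℂ → ℂ} (h : Rep c f) :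
    (∀ τ x₁ : ℂ, 0 < τ.im → (3 : ℕ) ≤ analyticOrderAt (f τ x₁) 0) ↔
      ∀ n r : ℤ, Mom 0 1 fun s => c (n, r, s) := by
  have key : ∀ τ x₁ : ℂ, 0 < τ.im → ((3 : ℕ) ≤ analyticOrderAt (f τ x₁) 0 ↔
      ∀ j < 3, iteratedDeriv j (f τ x₁) 0 = 0) := fun τ x₁ hτ => by
    have hd : Differentiable ℂ (f τ x₁) := by
      have := h.differentiable hτ (p := fun _ => x₁) (q := id) (by fun_prop) (by fun_prop)
      exact this
    rw [natCast_le_analyticOrderAt_iff_iteratedDeriv_eq_zero (hd.analyticAt 0)]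
  constructor
  · intro ho
    have h1 : ∀ (s t : ℝ) (j : ℕ), j < 3 → _ := fun s t j hj => by
      have hI : 0 < (Complex.I + s).im := by simp
      have h2 := h.jet (x₁ := 0 + t) hI j
      rw [(key _ _ hI).1 (ho _ _ hI) j hj, zero_div] at h2
      exact jet_fiber (a := fun _ => 0) (c := fun p s => c (p.1, p.2, s))
        (E := fun p : ℤ × ℤ => ee (p.1 * (Complex.I + s) + p.2 * (0 + t)))
        (fun p => ee_ne_zero _) h2
    intro n r j hj
    have h3 := unique2 fun s t => (h1 s t j hj).2
    have h4 := ((h1 0 0 j hj).1 (n, r)).hasSum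
    rwa [show ∑' s : ℤ, ((0 : ℂ) + 1 * s) ^ j * c (n, r, s) = 0 from congrFun h3 (n, r)] at h4
  · intro hm τ x₁ hτ
    refine (key _ _ hτ).2 fun j hj => ?_
    have := jet_eq_zero (a := fun _ => 0) (c := fun p s => c (p.1, p.2, s))
      (E := fun p : ℤ × ℤ => ee (p.1 * τ + p.2 * x₁)) (fun p => hm p.1 p.2 j hj) (h.jet hτ j)
    rwa [div_eq_zero_iff, or_iff_left (pow_ne_zero j two_pi_I_ne)] at this

lemma Rep4.jet {c : ℤ × T3 → ℂ} {f : ℂ → ℂ → ℂ → ℂ → ℂ} (h : Rep4 c f) {τ x₁ ω : ℂ}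
    (hC : HC τ x₁ 0 ω) (α β : ℂ) (j : ℕ) :
    HasSum (fun q : T3 × ℤ => (α * q.1.2.2 + β * q.2) ^ j * c (q.1.1, q.1.2.1, q.1.2.2, q.2) *
      e3 q.1 ω τ x₁)
      (iteratedDeriv j (fun t => f τ (x₁ + t * α) (t * β) ω) 0 /
        (2 * Real.pi * Complex.I) ^ j) := by
  have h1 := series_iteratedDeriv (f := fun z : Fin 4 → ℂ => f (z 0) (z 1) (z 2) (z 3)) isOpen_OC
    (fun z hz => h.hasSum_vec hz) ![0, α, β, 0] j (z := ![τ, x₁, 0, ω]) (t := 0)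
    (by rw [zero_smul, add_zero]; exact hC)
  have e : (fun t : ℂ => (fun z : Fin 4 → ℂ => f (z 0) (z 1) (z 2) (z 3))
      (![τ, x₁, 0, ω] + t • ![0, α, β, 0])) = fun t => f τ (x₁ + t * α) (t * β) ω := by
    funext t
    simp
  rw [e] at h1
  rw [← (grp4.trans vec4.symm).hasSum_iff] at h1
  refine (h1.div_const ((2 * Real.pi * Complex.I) ^ j)).congr_fun ?_
  rintro ⟨⟨m, n, r⟩, s⟩
  have := pow_ne_zero j two_pi_I_ne
  have e2 : e3 (m, n, r) ω τ x₁ = ee (n * τ + r * x₁ + m * ω) := by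
    rw [e3]
    congr 1
    ring
  have e1 : vec4.symm (m, n, r, s) = ![n, r, s, m] := rfl
  have e5 : grp4 ((m, n, r), s) = (m, n, r, s) := rfl
  have e6 : vec4 ![n, r, s, m] = (m, n, r, s) := rfl
  simp [dot, e1, e5, Fin.sum_univ_four, mul_pow, e2]
  field_simp
  rw [e6]
  ring

theorem Rep4.mom_iff {c : ℤ × T3 → ℂ} {f : ℂ → ℂ → ℂ → ℂ → ℂ} (h : Rep4 c f) {α β : ℂ}
    (hβ : β ≠ 0) :
    (∀ τ x₁ ω, HC τ x₁ 0 ω → ∀ j < 3, iteratedDeriv j (fun t => f τ (x₁ + t * α) (t * β) ω) 0 = 0) ↔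
      ∀ m n r : ℤ, Mom 0 1 fun s => c (m, n, r, s) := by
  constructor
  · intro ho
    have h1 : ∀ (s t u : ℝ) (j : ℕ), j < 3 → _ := fun s t u j hj => by
      have hI : HC (Complex.I + t) (0 + u) 0 (Complex.I + s) := by simp [HC, qr]
      have h2 := h.jet hI α β j
      rw [ho _ _ _ hI j hj, zero_div] at h2
      exact jet_fiber (a := fun p : T3 => α * p.2.2) (c := fun p s => c (p.1, p.2.1, p.2.2, s))
        (E := fun p : T3 => e3 p (Complex.I + s) (Complex.I + t) (0 + u))
        (fun p => e3_ne_zero _ _ _ _) h2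
    intro m n r
    refine Mom.change (a := α * r) (β := β) (fun j hj => ?_) hβ 0 1
    have h3 := unique3 fun s t u => (h1 s t u j hj).2
    have h4 := ((h1 0 0 0 j hj).1 (m, n, r)).hasSum
    rwa [show ∑' s : ℤ, (α * r + β * s) ^ j * c (m, n, r, s) = 0 from congrFun h3 (m, n, r)] at h4
  · intro hm τ x₁ ω hC j hj
    have := jet_eq_zero (a := fun p : T3 => α * p.2.2) (c := fun p s => c (p.1, p.2.1, p.2.2, s))
      (E := fun p : T3 => e3 p ω τ x₁)
      (fun p => (hm p.1 p.2.1 p.2.2).change one_ne_zero _ β j hj) (h.jet hC α β j)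
    rwa [div_eq_zero_iff, or_iff_left (pow_ne_zero j two_pi_I_ne)] at this

end

section

theorem unique4 {c : ℤ × T3 → ℂ} {f : ℂ → ℂ → ℂ → ℂ → ℂ} (h : Rep4 c f)
    (hf : ∀ τ x₁ x₂ ω, HC τ x₁ x₂ ω → f τ x₁ x₂ ω = 0) : c = 0 := by
  have hI : ∀ x : Fin 4 → ℝ, HC (Complex.I + x 0) (0 + x 1) (0 + x 2) (Complex.I + x 3) :=
    fun x => by simp [HC, qr]
  have h' : ∀ x : Fin 4 → ℝ, HasSum (fun n : Fin 4 → ℤ =>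
      (c (vec4 n) * e4 (vec4 n) Complex.I 0 0 Complex.I) * ee (dot n (rc x))) 0 := fun x => by
    have h1 := h _ _ _ _ (hI x)
    rw [hf _ _ _ _ (hI x)] at h1
    refine (vec4.hasSum_iff.2 h1).congr_fun fun n => ?_
    rw [ee_dot_vec4, Function.comp, mul_assoc]
    congr 1
    simp only [e4, e3, ← ee_add, rc]
    congr 1
    ring
  have key := fourier_unique (by simpa [rc, dot, ee_zero] using (h' 0).summable) fun x => (h' x).tsum_eq
  funext p
  have := congrFun key (vec4.symm p)
  rw [Equiv.apply_symm_apply] at this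
  exact (mul_eq_zero.1 this).resolve_right (mul_ne_zero (e3_ne_zero _ _ _ _) (ee_ne_zero _))

lemma Rep4.unique {c c' : ℤ × T3 → ℂ} {f : ℂ → ℂ → ℂ → ℂ → ℂ} (h : Rep4 c f) (h' : Rep4 c' f) :
    c = c' := by
  refine sub_eq_zero.1 (unique4 (f := fun _ _ _ _ => 0) (fun τ x₁ x₂ ω hC => ?_)
    fun _ _ _ _ _ => rfl)
  have := (h _ _ _ _ hC).sub (h' _ _ _ _ hC)
  rw [sub_self] at this
  exact this.congr_fun fun p => by rw [Pi.sub_apply, sub_mul]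

lemma vanishesAlongH1_iff (F : Matrix (Fin 2) (Fin 2) ℂ → ℂ) : VanishesAlongH1 F 3 ↔
    ∀ τ x₁ ω, HC τ x₁ 0 ω → ∀ j < 3, iteratedDeriv j (fun t : ℂ =>
      F (mk τ (x₁ + t * (-1 / (2 * omg 7 - 1))) (t * (2 / (2 * omg 7 - 1))) ω)) 0 = 0 := by
  have e : ∀ τ x₁ ω t, mk τ x₁ 0 ω + t • matA =
      mk τ (x₁ + t * (-1 / (2 * omg 7 - 1))) (t * (2 / (2 * omg 7 - 1))) ω := fun τ x₁ ω t => by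
    have := omg_ne
    ext i j
    fin_cases i <;> fin_cases j <;> simp [mk, matA] <;> field_simp <;> ring
  constructor
  · intro h τ x₁ ω hC j hj
    have := h (mk τ x₁ 0 ω) ((mk_mem _ _ _ _).2 hC) (by ext i j; fin_cases i <;> fin_cases j <;> simp [mk])
      j hj
    simpa only [e] using this
  · intro h Z hZ hs j hj
    have h01 : Z 0 1 = Z 1 0 := congrFun (congrFun hs 1) 0
    have h2 : cx₂ Z = 0 := by rw [cx₂, h01, sub_self, zero_div]
    have hC := (mem_HH2_iff Z).1 hZ
    rw [h2] at hC
    have hm := mk_coord Z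
    rw [h2] at hm
    have := h _ _ _ hC j hj
    simpa only [← e, hm] using this

lemma vanishesOnHeegner_iff (F : Matrix (Fin 2) (Fin 2) ℂ → ℂ) : VanishesOnHeegner (omg 7) F ↔
    ∀ τ x ω, HC τ x (-x) ω → F (mk τ x (-x) ω) = 0 := by
  have e : ∀ τ x ω, phiLam (omg 7) (mk τ x 0 ω) = mk τ x (-x) (2 * ω) := fun τ x ω => by
    have := omg_mul_self
    ext i j
    fin_cases i <;> fin_cases j <;> simp [mk, phiLam, conj_omg]
    · ring
    · ring
    · exact Or.inl (by linear_combination -this)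
  have e2 : ∀ τ x ω : ℂ, HC τ x (-x) (2 * ω) ↔ HC τ x 0 ω := fun τ x ω => by
    have : (2 * ω).im = 2 * ω.im := by simp
    simp only [HC, this, qr, Complex.neg_im, Complex.zero_im]
    constructor <;> rintro ⟨h1, h2, h3⟩ <;> exact ⟨h1, by linarith, by linarith⟩
  constructor
  · intro h τ x ω hC
    have h2 : 2 * (ω / 2) = ω := by ring
    have := h (mk τ x 0 (ω / 2)) ((mk_mem _ _ _ _).2 ((e2 _ _ _).1 (by rwa [h2])))
      (by ext i j; fin_cases i <;> fin_cases j <;> simp [mk])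
    rwa [e, h2] at this
  · intro h Z hZ hs
    have h01 : Z 0 1 = Z 1 0 := congrFun (congrFun hs 1) 0
    have h2 : cx₂ Z = 0 := by rw [cx₂, h01, sub_self, zero_div]
    have hC := (mem_HH2_iff Z).1 hZ
    rw [h2] at hC
    have hm := mk_coord Z
    rw [h2] at hm
    rw [← hm, e]
    exact h _ _ _ ((e2 _ _ _).2 hC)

/-- The Gritsenko lift of `phi`. -/
def B7 : Matrix (Fin 2) (Fin 2) ℂ → ℂ := HF (liftV phi)

lemma jac_liftV (m : ℕ) : Jac 7 m (liftC c0 m) (liftV phi m) := by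
  rcases Nat.eq_zero_or_pos m with rfl | hm
  · refine ⟨⟨fun T _ => by simp [liftC], fun τ x₁ x₂ _ => ?_⟩, fun _ _ _ _ _ _ => by simp [liftV],
      fun _ _ _ _ => by simp [liftV]⟩
    simp [liftC, liftV, hasSum_zero]
  · exact jac_phi.liftV hm

lemma sfam_liftV : SFam (7 : ℕ) ((-1) ^ 7) (liftC c0) (liftV phi) where
  jac := jac_liftV
  swap m n r s := by
    have h0 : ∀ T, liftC c0 0 T = 0 := fun T => by simp [liftC]
    rcases Nat.eq_zero_or_pos m with rfl | hm
    · rw [h0, liftC_zero n _ (by simp), mul_zero]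
    · rcases Nat.eq_zero_or_pos n with rfl | hn
      · rw [h0, liftC_zero m _ (by simp), mul_zero]
      · rw [liftC_swap hm hn]
        norm_num
  neg m τ x₁ x₂ hτ := by
    rw [liftV_neg m hτ]
    norm_num

lemma B7_mk (τ x₁ x₂ ω : ℂ) : B7 (mk τ x₁ x₂ ω) = FJ (liftV phi) τ x₁ x₂ ω := HF_mk _ _ _ _

lemma fam_liftV : Fam (7 : ℕ) (liftC c0) (liftV phi) := sfam_liftV.fam (by simp)

lemma exists_phi_ne_zero {τ : ℂ} (hτ : 0 < τ.im) : ∃ x₁ x₂, phi τ x₁ x₂ ≠ 0 := by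
  by_contra! h
  refine not_countable_complex ((countable_phi hτ 0 0).mono fun t _ => ?_)
  exact h _ _

theorem isSymHMF_B7 : IsSymHMF 7 7 B7 := by
  refine ⟨sfam_liftV.isHMF, fun Z hZ => ?_⟩
  have h := (mem_HH2_iff Z).1 hZ
  have e : Zᵀ = mk (Z 0 0) (cx₁ Z + cx₂ Z) (-cx₂ Z) (Z 1 1) := by
    conv_lhs => rw [← mk_coord Z]
    ext i j
    fin_cases i <;> fin_cases j <;> simp [mk] <;> ring
  rw [e, B7_mk]
  conv_rhs => rw [← mk_coord Z, B7_mk]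
  refine FJ_congr fun m => ?_
  rw [liftV_sigma m h.1]
  ring

theorem B7_ne_zero : ∃ Z ∈ HH2, B7 Z ≠ 0 := by
  by_contra! h
  have h1 := unique4 fam_liftV.rep4 fun τ x₁ x₂ ω hC => by
    rw [← B7_mk]
    exact h _ ((mk_mem _ _ _ _).2 hC)
  have h2 : c0 = 0 := by
    funext T
    rw [← liftC_one, ← ext4_nat (liftC c0), h1]
    rfl
  have hI : 0 < Complex.I.im := by simp
  obtain ⟨x₁, x₂, hne⟩ := exists_phi_ne_zero hI
  have h3 := jac_phi.rep.2 _ x₁ x₂ hI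
  rw [h2] at h3
  simp only [Pi.zero_apply, zero_mul] at h3
  exact hne (h3.unique hasSum_zero)

theorem B7_vanishesAlongH1 : VanishesAlongH1 B7 3 := by
  rw [vanishesAlongH1_iff]
  simp only [B7_mk]
  refine (fam_liftV.rep4.mom_iff (div_ne_zero two_ne_zero omg_ne)).2 fun m n r => ?_
  have := (jac_liftV m.toNat).rep.order_iff.1 (fun τ x₁ hτ => liftV_order _ hτ x₁) n r
  intro j hj
  by_cases hm : 0 ≤ m
  · simpa only [ext4, if_pos hm] using this j hj
  · simp [ext4, if_neg hm, hasSum_zero]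

theorem B7_vanishesOnHeegner : VanishesOnHeegner (omg 7) B7 := by
  rw [vanishesOnHeegner_iff]
  intro τ x ω hC
  rw [B7_mk, FJ]
  simp [liftV_x₁₂ _ hC.1]

end

section

section

variable {k : ℕ} {f : ℂ → ℂ → ℂ → ℂ → ℂ} {c : ℤ × T3 → ℂ}

/-- Vanishing on one Heegner divisor of discriminant two carries over to its transpose. -/
lemma CoordMod.x₁_zero (h : CoordMod k f) (h0 : ∀ τ x ω, HC τ x (-x) ω → f τ x (-x) ω = 0)
    {τ x ω : ℂ} (hC : HC τ 0 x ω) : f τ 0 x ω = 0 := by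
  have hε : ((-1 : ℂ) ^ k) ≠ 0 := pow_ne_zero _ (by norm_num)
  have step : ∀ τ x₁ x₂ ω, HC τ x₁ x₂ ω → ∀ a : ℤ, ∃ τ' x₁' x₂' ω' : ℂ, HC τ' x₁' x₂' ω' ∧
      (f τ' x₁' x₂' ω' = 0 → f τ x₁ x₂ ω = 0) ∧ τ' = ω + a ^ 2 * τ + a * (2 * x₁ + x₂) ∧
      x₁' = x₁ + a * τ + x₂ ∧ x₂' = -x₂ ∧ ω' = τ := fun τ x₁ x₂ ω hC a => by
    have hh := hC.heis a 0
    refine ⟨_, _, _, _, hh.swap, fun h1 => ?_, ?_, ?_, ?_, rfl⟩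
    · rw [h.swap _ _ _ _ hh, h.heis _ _ _ _ hC] at h1
      exact (mul_eq_zero.1 h1).resolve_left hε
    · simp only [Qf, Bf, Int.cast_zero]
      ring
    · simp
    · simp
  obtain ⟨τ₁, a₁, b₁, ω₁, hC₁, hf₁, rfl, rfl, rfl, rfl⟩ := step _ _ _ _ hC (-1)
  refine hf₁ ?_
  obtain ⟨τ₂, a₂, b₂, ω₂, hC₂, hf₂, e1, e2, rfl, rfl⟩ := step _ _ _ _ hC₁ 1
  refine hf₂ ?_
  rw [← h.heis _ _ _ _ hC₂ (-1) 0]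
  have hh := hC₂.heis (-1) 0
  have e3 : a₂ + ((-1 : ℤ) : ℂ) * τ₂ = -x := by
    rw [e1, e2]
    push_cast
    ring
  have e4 : - -x + ((0 : ℤ) : ℂ) * τ₂ = -(-x) := by simp
  rw [e3, e4] at hh ⊢
  exact h0 _ _ _ hh

lemma CoordMod.coeff_heis (h : CoordMod k f) (hr : Rep4 c f) (m n r s k l : ℤ) :
    c (m, n + (k * r + l * s) + m * (k ^ 2 + k * l + 2 * l ^ 2), r + m * (2 * k + l),
      s + m * (k + 4 * l)) = c (m, n, r, s) := by
  let e : ℤ × T3 ≃ ℤ × T3 :=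
    { toFun := fun p => (p.1, p.2.1 + (k * p.2.2.1 + l * p.2.2.2) +
        p.1 * (k ^ 2 + k * l + 2 * l ^ 2), p.2.2.1 + p.1 * (2 * k + l), p.2.2.2 + p.1 * (k + 4 * l))
      invFun := fun p => (p.1, p.2.1 - (k * p.2.2.1 + l * p.2.2.2) +
        p.1 * (k ^ 2 + k * l + 2 * l ^ 2), p.2.2.1 - p.1 * (2 * k + l), p.2.2.2 - p.1 * (k + 4 * l))
      left_inv := fun p => by ext <;> dsimp only <;> ring
      right_inv := fun p => by ext <;> dsimp only <;> ring }
  have h1 : Rep4 (fun p => c (e.symm p)) f := fun τ x₁ x₂ ω hC => by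
    have h3 := hr _ _ _ _ (hC.heis k l)
    rw [h.heis _ _ _ _ hC] at h3
    rw [← e.hasSum_iff]
    refine h3.congr_fun fun p => ?_
    have e1 : e4 p τ (x₁ + k * τ) (x₂ + l * τ) (ω + Qf k l * τ + Bf k l x₁ x₂) =
        e4 (e p) τ x₁ x₂ ω := by
      simp only [e4, e3, ← ee_add, Qf, Bf, e, Equiv.coe_fn_mk]
      congr 1
      push_cast
      ring
    rw [e1, Function.comp]
    beta_reduce
    rw [Equiv.symm_apply_apply]
  have := congrFun (h1.unique hr) (e (m, n, r, s))
  rw [Equiv.symm_apply_apply] at this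
  exact this.symm

lemma CoordMod.coeff_swap (h : CoordMod k f) (hr : Rep4 c f) (m n r s : ℤ) :
    c (m, n, r, s) = (-1) ^ k * c (n, m, r, r - s) := by
  let σ : ℤ × T3 ≃ ℤ × T3 :=
    ⟨fun p => (p.2.1, p.1, p.2.2.1, p.2.2.1 - p.2.2.2),
     fun p => (p.2.1, p.1, p.2.2.1, p.2.2.1 - p.2.2.2),
     fun p => by simp, fun p => by simp⟩
  have hε : ((-1 : ℂ) ^ k) * (-1) ^ k = 1 := by rw [← mul_pow]; simp
  have h1 : Rep4 (fun p => (-1) ^ k * c (σ p)) f := fun τ x₁ x₂ ω hC => by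
    have h2 := hr _ _ _ _ hC.swap
    rw [h.swap _ _ _ _ hC, ← σ.hasSum_iff] at h2
    have h3 := h2.mul_left ((-1) ^ k)
    rw [← mul_assoc, hε, one_mul] at h3
    refine h3.congr_fun ?_
    rintro ⟨m, n, r, s⟩
    have e : e4 (n, m, r, r - s) ω (x₁ + x₂) (-x₂) τ = e4 (m, n, r, s) τ x₁ x₂ ω := by
      simp only [e4, e3, ← ee_add]
      congr 1
      push_cast
      ring
    change _ = (-1) ^ k * (c (n, m, r, r - s) * e4 (n, m, r, r - s) ω (x₁ + x₂) (-x₂) τ)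
    rw [e, ← mul_assoc]
    rfl
  exact (congrFun (h1.unique hr) (m, n, r, s)).symm

/-- The Koecher principle in the last variable. -/
lemma CoordMod.coeff_neg (h : CoordMod k f) (hr : Rep4 c f) {m : ℤ} (hm : m < 0) (T : T3) :
    c (m, T) = 0 := by
  obtain ⟨n, r, s⟩ := T
  by_contra hne
  have hs := (hr Complex.I 0 0 Complex.I (by simp [HC, qr])).summable.tendsto_cofinite_zero
  let p : ℕ → ℤ × T3 := fun j => (m, n + (j * r + 0 * s) + m * (j ^ 2 + j * 0 + 2 * 0 ^ 2),
    r + m * (2 * j + 0), s + m * (j + 4 * 0))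
  have hp : Function.Injective p := fun i j hij => by
    have h1 : r + m * (2 * (i : ℤ) + 0) = r + m * (2 * j + 0) := congrArg (fun p => p.2.2.1) hij
    have h2 : m * ((i : ℤ) - j) = 0 := by linarith
    rcases mul_eq_zero.1 h2 with h3 | h3 <;> omega
  have h1 := (hs.comp hp.tendsto_cofinite).norm
  rw [norm_zero] at h1
  have h2 := h1.eventually_lt_const (norm_pos_iff.2 hne)
  rw [Nat.cofinite_eq_atTop] at h2
  obtain ⟨j, hj, hj2⟩ := (h2.and (eventually_ge_atTop (n.natAbs + r.natAbs + 1))).exists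
  have e : c (p j) = c (m, n, r, s) := h.coeff_heis hr m n r s j 0
  simp only [Function.comp, norm_mul, e] at hj
  have h3 : 1 ≤ ‖e4 (p j) Complex.I 0 0 Complex.I‖ := by
    rw [e4, norm_mul, norm_e3, norm_ee, ← Real.exp_add]
    refine Real.one_le_exp ?_
    have h4 : (p j).2.1 + (p j).1 ≤ 0 := by
      change n + (j * r + 0 * s) + m * ((j : ℤ) ^ 2 + j * 0 + 2 * 0 ^ 2) + m ≤ 0
      have a1 : n ≤ |n| := le_abs_self n
      have a2 : r ≤ |r| := le_abs_self r
      have a3 : |n| + |r| + 1 ≤ (j : ℤ) := by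
        rw [← Int.natCast_natAbs, ← Int.natCast_natAbs]
        omega
      have a4 : 0 ≤ |n| := abs_nonneg n
      have a5 : 0 ≤ |r| := abs_nonneg r
      nlinarith [mul_nonneg (show (0 : ℤ) ≤ j by omega) (show (0 : ℤ) ≤ |r| - r by omega),
        mul_nonneg (show (0 : ℤ) ≤ j by omega) (show (0 : ℤ) ≤ j - (|n| + |r| + 1) by omega),
        mul_nonneg (show (0 : ℤ) ≤ -m - 1 by omega) (sq_nonneg (j : ℤ)),
        mul_nonneg (show (0 : ℤ) ≤ j - 1 by omega) a4]
    have h5 : ((p j).2.1 : ℝ) + (p j).1 ≤ 0 := by exact_mod_cast h4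
    have h6 := Real.pi_pos
    simp only [Complex.I_im, Complex.zero_im, mul_zero, add_zero, mul_one, intCast_mul_im]
    nlinarith
  have := norm_nonneg (c (m, n, r, s))
  nlinarith

end

end

section

section

variable {k : ℕ} {f : ℂ → ℂ → ℂ → ℂ → ℂ} {c : ℤ × T3 → ℂ}

/-- Fourier–Jacobi coefficients. -/
def fjc (c : ℤ × T3 → ℂ) (m : ℤ) (τ x₁ x₂ : ℂ) : ℂ := ∑' T, c (m, T) * e3 T τ x₁ x₂

lemma exists_HC {τ : ℂ} (hτ : 0 < τ.im) (x₁ x₂ : ℂ) : ∃ ω, HC τ x₁ x₂ ω := by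
  have h := qr_nonneg x₁.im x₂.im
  have h2 : (((qr x₁.im x₂.im + 1) / τ.im : ℝ) * Complex.I).im = (qr x₁.im x₂.im + 1) / τ.im := by
    simp
  refine ⟨((qr x₁.im x₂.im + 1) / τ.im : ℝ) * Complex.I, hτ, ?_, ?_⟩
  · rw [h2]
    positivity
  · rw [h2, mul_div_cancel₀ _ hτ.ne']
    linarith

lemma HC.add_real {τ x₁ x₂ ω : ℂ} (h : HC τ x₁ x₂ ω) (s : ℝ) : HC τ x₁ x₂ (ω + s) := by
  simpa [HC] using h

lemma Rep4.fiber (hr : Rep4 c f) {τ : ℂ} (hτ : 0 < τ.im) (x₁ x₂ : ℂ) (m : ℤ) :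
    HasSum (fun T => c (m, T) * e3 T τ x₁ x₂) (fjc c m τ x₁ x₂) := by
  obtain ⟨ω, hC⟩ := exists_HC hτ x₁ x₂
  have h1 := (hr _ _ _ _ hC).summable.prod_factor m
  simp only [e4, ← mul_assoc] at h1
  exact ((summable_mul_right_iff (ee_ne_zero _)).1 h1).hasSum

lemma Rep4.hasSum_fjc (hr : Rep4 c f) {τ x₁ x₂ ω : ℂ} (hC : HC τ x₁ x₂ ω) :
    HasSum (fun m : ℤ => fjc c m τ x₁ x₂ * ee (m * ω)) (f τ x₁ x₂ ω) :=
  (hr _ _ _ _ hC).prod_fiberwise fun m =>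
    ((hr.fiber hC.1 x₁ x₂ m).mul_right (ee (m * ω))).congr_fun fun T => by rw [e4, mul_assoc]

/-- Transfer of an identity to the Fourier–Jacobi coefficients. -/
lemma Rep4.fjc_transfer (hr : Rep4 c f) {τ x₁ x₂ τ' x₁' x₂' a b : ℂ} (hτ : 0 < τ.im)
    (h : ∀ ω, HC τ x₁ x₂ ω → HC τ' x₁' x₂' (ω + b) ∧ f τ' x₁' x₂' (ω + b) = a * f τ x₁ x₂ ω)
    (m : ℤ) : fjc c m τ' x₁' x₂' * ee (m * b) = a * fjc c m τ x₁ x₂ := by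
  obtain ⟨ω, hC⟩ := exists_HC hτ x₁ x₂
  refine sub_eq_zero.1 (congrFun (unique1 (c := fun m : ℤ =>
    fjc c m τ' x₁' x₂' * ee (m * b) - a * fjc c m τ x₁ x₂) (x := ω) fun s => ?_) m)
  obtain ⟨h1, h2⟩ := h _ (hC.add_real s)
  have h3 := (hr.hasSum_fjc h1).sub ((hr.hasSum_fjc (hC.add_real s)).mul_left a)
  rw [h2, sub_self] at h3
  refine h3.congr_fun fun m => ?_
  rw [mul_add (m : ℂ) (ω + s) b, ee_add]
  ring

lemma Rep4.fjc_zero (hr : Rep4 c f) {τ x₁ x₂ : ℂ} (hτ : 0 < τ.im)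
    (h : ∀ ω, HC τ x₁ x₂ ω → f τ x₁ x₂ ω = 0) (m : ℤ) : fjc c m τ x₁ x₂ = 0 := by
  have := hr.fjc_transfer (τ' := τ) (x₁' := x₁) (x₂' := x₂) (a := 0) (b := 0) hτ
    (fun ω hC => by rw [add_zero, zero_mul]; exact ⟨hC, h ω hC⟩) m
  rw [zero_mul] at this
  exact (mul_eq_zero.1 this).resolve_right (ee_ne_zero _)

lemma CoordMod.coeff_first_neg (h : CoordMod k f) (hr : Rep4 c f) (m : ℤ) (T : T3) (hT : T.1 < 0) :
    c (m, T) = 0 := by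
  obtain ⟨n, r, s⟩ := T
  rw [h.coeff_swap hr, h.coeff_neg hr hT, mul_zero]

lemma CoordMod.jac (h : CoordMod k f) (hr : Rep4 c f) (m : ℕ) :
    Jac k m (fun T => c (m, T)) (fjc c m) where
  rep := ⟨fun T hT => h.coeff_first_neg hr m T hT, fun τ x₁ x₂ hτ => hr.fiber hτ x₁ x₂ m⟩
  heis τ x₁ x₂ hτ a b := by
    have h1 := hr.fjc_transfer (τ' := τ) (x₁' := x₁ + a * τ) (x₂' := x₂ + b * τ) (a := 1)
      (b := Qf a b * τ + Bf a b x₁ x₂) hτ (fun ω hC => by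
        rw [one_mul, ← add_assoc]
        exact ⟨hC.heis a b, h.heis _ _ _ _ hC a b⟩) m
    rw [one_mul] at h1
    rw [← h1, ee_neg]
    push_cast
    field_simp [ee_ne_zero]
  inv τ x₁ x₂ hτ := by
    have h1 := hr.fjc_transfer (τ' := -1 / τ) (x₁' := x₁ / τ) (x₂' := x₂ / τ) (a := τ ^ k)
      (b := -(Qf x₁ x₂ / τ)) hτ (fun ω hC => by
        rw [← sub_eq_add_neg]
        exact ⟨hC.inv, h.inv _ _ _ _ hC⟩) m
    rw [mul_neg, ee_neg] at h1
    rw [zpow_natCast, mul_right_comm, ← h1]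
    push_cast
    field_simp [ee_ne_zero]

lemma CoordMod.sfam (h : CoordMod k f) (hr : Rep4 c f) :
    SFam k ((-1) ^ k) (fun m T => c (m, T)) fun m => fjc c m where
  jac := h.jac hr
  swap m n r s := h.coeff_swap hr m n r s
  neg m τ x₁ x₂ hτ := by
    have h1 := hr.fjc_transfer (τ' := τ) (x₁' := -x₁) (x₂' := -x₂) (a := (-1) ^ k) (b := 0) hτ
      (fun ω hC => by
        rw [add_zero]
        exact ⟨hC.neg, h.neg _ _ _ _ hC⟩) m
    rwa [mul_zero, ee_zero, mul_one] at h1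

lemma CoordMod.eq_FJ (h : CoordMod k f) (hr : Rep4 c f) {τ x₁ x₂ ω : ℂ} (hC : HC τ x₁ x₂ ω) :
    f τ x₁ x₂ ω = FJ (fun m => fjc c m) τ x₁ x₂ ω := by
  have e : ext4 (fun (m : ℕ) T => c (m, T)) = c := by
    funext ⟨m, T⟩
    rw [ext4]
    split_ifs with hm
    · change c ((m.toNat : ℤ), T) = _
      rw [Int.toNat_of_nonneg hm]
    · exact (h.coeff_neg hr (not_le.1 hm) T).symm
  have h1 := ((h.sfam hr).fam (by simp)).rep4 _ _ _ _ hC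
  rw [e] at h1
  exact (hr _ _ _ _ hC).unique h1

/-- Coefficients of index zero are supported on multiples of the zero vector. -/
lemma CoordMod.coeff_index_zero (h : CoordMod k f) (hr : Rep4 c f) {n r s : ℤ}
    (hne : c (0, n, r, s) ≠ 0) : r = 0 ∧ s = 0 := by
  by_contra hrs
  have h1 := h.coeff_heis hr 0 n r s (-(|n| + 1) * r) (-(|n| + 1) * s)
  have h2 : 0 < r ^ 2 + s ^ 2 := by
    by_contra h3
    refine hrs ⟨?_, ?_⟩ <;> nlinarith [sq_nonneg r, sq_nonneg s]
  rw [h.coeff_first_neg hr] at h1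
  · exact hne h1.symm
  · have := abs_nonneg n
    have := le_abs_self n
    change n + (-(|n| + 1) * r * r + -(|n| + 1) * s * s) + 0 * _ < 0
    nlinarith

end

/-- Fourier–Jacobi data of a Hermitian modular form with the prescribed zeros. -/
theorem exists_sfam {k : ℕ} {F : Matrix (Fin 2) (Fin 2) ℂ → ℂ} (hF : IsHMF 7 k F)
    (h1 : VanishesAlongH1 F 3) (h2 : VanishesOnHeegner (omg 7) F) :
    ∃ (c : ℕ → T3 → ℂ) (f : ℕ → ℂ → ℂ → ℂ → ℂ), SFam k ((-1) ^ k) c f ∧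
      (∀ τ x₁ x₂ ω, HC τ x₁ x₂ ω → F (mk τ x₁ x₂ ω) = FJ f τ x₁ x₂ ω) ∧ (∀ T, c 0 T = 0) ∧
      (∀ m τ x₁, 0 < τ.im → (3 : ℕ) ≤ analyticOrderAt (f m τ x₁) 0) ∧
      (∀ m τ x, 0 < τ.im → f m τ 0 x = 0) ∧ ∀ m τ x, 0 < τ.im → f m τ x (-x) = 0 := by
  have h := coord_of_isHMF hF
  obtain ⟨c, hr⟩ := exists_rep4 hF.1 fun τ x₁ x₂ ω hC => h.translate τ x₁ x₂ ω hC
  have hm := (hr.mom_iff (div_ne_zero two_ne_zero omg_ne)).1 ((vanishesAlongH1_iff F).1 h1)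
  have h12 := (vanishesOnHeegner_iff F).1 h2
  refine ⟨_, _, h.sfam hr, fun τ x₁ x₂ ω hC => h.eq_FJ hr hC, ?_, fun m τ x₁ hτ => ?_,
    fun m τ x hτ => ?_, fun m τ x hτ => ?_⟩
  · rintro ⟨n, r, s⟩
    by_contra hne
    obtain ⟨rfl, rfl⟩ := h.coeff_index_zero hr hne
    have h3 := hm 0 n 0 0 (by norm_num)
    have h4 : HasSum (fun s : ℤ => (0 + 1 * (s : ℂ)) ^ 0 * c (0, n, 0, s)) (c (0, n, 0, 0)) := by
      have := hasSum_single (f := fun s : ℤ => (0 + 1 * (s : ℂ)) ^ 0 * c (0, n, 0, s)) 0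
        fun s hs => by
          rw [pow_zero, one_mul]
          by_contra hs'
          exact hs (h.coeff_index_zero hr hs').2
      simpa using this
    exact hne (h4.unique h3)
  · exact (h.jac hr m).rep.order_iff.2 (fun n r => hm m n r) τ x₁ hτ
  · exact hr.fjc_zero hτ (fun ω hC => h.x₁_zero h12 hC) m
  · exact hr.fjc_zero hτ (fun ω hC => h12 _ _ _ hC) m

end

section

/-- The coefficient of `ee (n * τ)` in a series, as a function of the elliptic variables. -/
def slice (c : T3 → ℂ) (n : ℕ) (x₁ x₂ : ℂ) : ℂ :=
  ∑' p : ℤ × ℤ, c (n, p.1, p.2) * ee (p.1 * x₁ + p.2 * x₂)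

lemma e3_eq_mul (T : T3) (τ x₁ x₂ : ℂ) :
    e3 T τ x₁ x₂ = ee (T.2.1 * x₁ + T.2.2 * x₂) * ee (T.1 * τ) := by
  rw [e3, ← ee_add]
  congr 1
  ring

lemma Rep.hasSum_fiber {c : T3 → ℂ} {f : ℂ → ℂ → ℂ → ℂ} (h : Rep c f) (n : ℕ) {τ : ℂ}
    (hτ : 0 < τ.im) (x₁ x₂ : ℂ) :
    HasSum (fun p : ℤ × ℤ => c (n, p) * e3 (n, p) τ x₁ x₂) (slice c n x₁ x₂ * ee (n * τ)) := by
  have hs : Summable fun p : ℤ × ℤ => c (n, p) * e3 (n, p) τ x₁ x₂ :=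
    (h.2 τ x₁ x₂ hτ).summable.comp_injective (i := fun p : ℤ × ℤ => ((n : ℤ), p))
      fun a b hab => by simpa using hab
  have he : ∑' p : ℤ × ℤ, c (n, p) * e3 (n, p) τ x₁ x₂ = slice c n x₁ x₂ * ee (n * τ) := by
    rw [slice, ← tsum_mul_right]
    refine tsum_congr fun p => ?_
    rw [e3_eq_mul, mul_assoc]
    rfl
  exact he ▸ hs.hasSum

lemma Rep.slice_rep {c : T3 → ℂ} {f : ℂ → ℂ → ℂ → ℂ} (h : Rep c f) (n : ℕ) :
    Rep (fun T => if T.1 = n then c T else 0)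
      fun τ x₁ x₂ => slice c n x₁ x₂ * ee (n * τ) := by
  refine ⟨fun T hT => if_neg (by omega), fun τ x₁ x₂ hτ => ?_⟩
  have hi : Function.Injective fun p : ℤ × ℤ => ((n : ℤ), p) := fun a b hab => by simpa using hab
  rw [← hi.hasSum_iff]
  · exact (h.hasSum_fiber n hτ x₁ x₂).congr_fun fun p => by simp
  · rintro ⟨m, p⟩ hT
    have : m ≠ n := by
      rintro rfl
      exact hT ⟨p, rfl⟩
    simp [this]

lemma Rep.hasSum_slice {c : T3 → ℂ} {f : ℂ → ℂ → ℂ → ℂ} (h : Rep c f) {τ : ℂ} (hτ : 0 < τ.im)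
    (x₁ x₂ : ℂ) : HasSum (fun n : ℕ => slice c n x₁ x₂ * ee (n * τ)) (f τ x₁ x₂) := by
  have h1 := h.2 τ x₁ x₂ hτ
  have h2 := h1.prod_fiberwise fun n => (h1.summable.prod_factor n).hasSum
  rw [← (Nat.cast_injective (R := ℤ)).hasSum_iff] at h2
  · refine h2.congr_fun fun n => ?_
    exact (h.hasSum_fiber n hτ x₁ x₂).tsum_eq.symm
  · intro n hn
    have hn' : n < 0 := by
      by_contra h0
      exact hn ⟨n.toNat, by simp; omega⟩
    refine (tsum_congr fun p => ?_).trans tsum_zero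
    rw [h.1 (n, p) hn', zero_mul]

lemma unique_nat {a b : ℕ → ℂ} {z : ℝ → ℂ}
    (ha : ∀ s : ℝ, HasSum (fun n : ℕ => a n * ee (n * (Complex.I + s))) (z s))
    (hb : ∀ s : ℝ, HasSum (fun n : ℕ => b n * ee (n * (Complex.I + s))) (z s)) : a = b := by
  have hi := Nat.cast_injective (R := ℤ)
  have := unique1 (c := Function.extend (Nat.cast : ℕ → ℤ) (a - b) 0) (x := Complex.I) fun s => by
    rw [← hi.hasSum_iff]
    · have h := (ha s).sub (hb s)
      rw [sub_self] at h
      refine h.congr_fun fun n => ?_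
      rw [Function.comp, hi.extend_apply, Pi.sub_apply, sub_mul, Int.cast_natCast]
    · intro n hn
      rw [Function.extend_apply' _ _ _ hn]
      simp
  rw [← sub_eq_zero]
  funext n
  have h := congrFun this n
  rwa [hi.extend_apply] at h

lemma slice_sum_mul {ι : Type*} (s : Finset ι) {c : T3 → ℂ} {f : ℂ → ℂ → ℂ → ℂ}
    {a b : ι → T3 → ℂ} {A B : ι → ℂ → ℂ → ℂ → ℂ} (h : Rep c f) (ha : ∀ i, Rep (a i) (A i))
    (hb : ∀ i, Rep (b i) (B i))
    (he : ∀ τ x₁ x₂ : ℂ, 0 < τ.im → f τ x₁ x₂ = ∑ i ∈ s, A i τ x₁ x₂ * B i τ x₁ x₂) (n : ℕ)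
    (x₁ x₂ : ℂ) : slice c n x₁ x₂ = ∑ i ∈ s, ∑ p ∈ Finset.HasAntidiagonal.antidiagonal n,
      slice (a i) p.1 x₁ x₂ * slice (b i) p.2 x₁ x₂ := by
  refine congrFun (unique_nat (a := fun n => slice c n x₁ x₂) (b := fun n => ∑ i ∈ s,
    ∑ p ∈ Finset.HasAntidiagonal.antidiagonal n, slice (a i) p.1 x₁ x₂ * slice (b i) p.2 x₁ x₂)
    (z := fun s => f (Complex.I + s) x₁ x₂) (fun t => h.hasSum_slice (by simp) x₁ x₂) fun t => ?_) n
  have hI : 0 < (Complex.I + t).im := by simp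
  rw [he _ _ _ hI]
  have hi : ∀ i, HasSum (fun n : ℕ => ∑ p ∈ Finset.HasAntidiagonal.antidiagonal n,
      (slice (a i) p.1 x₁ x₂ * ee (p.1 * (Complex.I + t))) *
        (slice (b i) p.2 x₁ x₂ * ee (p.2 * (Complex.I + t))))
      (A i (Complex.I + t) x₁ x₂ * B i (Complex.I + t) x₁ x₂) := fun i => by
    have h1 := (ha i).hasSum_slice hI x₁ x₂
    have h2 := (hb i).hasSum_slice hI x₁ x₂
    rw [← h1.tsum_eq, ← h2.tsum_eq,
      tsum_mul_tsum_eq_tsum_sum_antidiagonal_of_summable_norm h1.summable.norm h2.summable.norm]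
    exact (summable_norm_sum_mul_antidiagonal_of_summable_norm h1.summable.norm
      h2.summable.norm).of_norm.hasSum
  refine (hasSum_sum fun i _ => hi i).congr_fun fun n => ?_
  rw [Finset.sum_mul]
  refine Finset.sum_congr rfl fun i _ => ?_
  rw [Finset.sum_mul]
  refine Finset.sum_congr rfl fun p hp => ?_
  rw [← Finset.HasAntidiagonal.mem_antidiagonal.1 hp, Nat.cast_add, add_mul, ee_add]
  ring

/-- The double generating series of the coefficients of a family. -/
def gen (c : ℕ → T3 → ℂ) (x₁ x₂ : ℂ) : PowerSeries (PowerSeries ℂ) :=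
  PowerSeries.mk fun m => PowerSeries.mk fun n => slice (c m) n x₁ x₂

lemma gen_mul {κ κ₁ κ₂ : ℤ} {c a b : ℕ → T3 → ℂ} {f A B : ℕ → ℂ → ℂ → ℂ → ℂ}
    (hc : ∀ m, Jac κ m (c m) (f m)) (ha : ∀ m, Jac κ₁ m (a m) (A m))
    (hb : ∀ m, Jac κ₂ m (b m) (B m))
    (he : ∀ m τ x₁ x₂, 0 < τ.im → f m τ x₁ x₂ =
      ∑ p ∈ Finset.HasAntidiagonal.antidiagonal m, A p.1 τ x₁ x₂ * B p.2 τ x₁ x₂) (x₁ x₂ : ℂ) :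
    gen c x₁ x₂ = gen a x₁ x₂ * gen b x₁ x₂ := by
  ext m n
  rw [PowerSeries.coeff_mul, map_sum]
  simp only [gen, PowerSeries.coeff_mk, PowerSeries.coeff_mul]
  exact slice_sum_mul (a := fun p : ℕ × ℕ => a p.1) (b := fun p => b p.2) (A := fun p => A p.1)
    (B := fun p => B p.2) _ (hc m).rep (fun p => (ha p.1).rep) (fun p => (hb p.2).rep) (he m) n x₁ x₂

/-- The series `gen` with its two variables and the elliptic variables exchanged. -/
def genSwap (c : ℕ → T3 → ℂ) (x₁ x₂ : ℂ) : PowerSeries (PowerSeries ℂ) :=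
  PowerSeries.mk fun m => PowerSeries.mk fun n => slice (c n) m (x₁ + x₂) (-x₂)

lemma genSwap_mul {c a b : ℕ → T3 → ℂ} {x₁ x₂ : ℂ}
    (h : gen c (x₁ + x₂) (-x₂) = gen a (x₁ + x₂) (-x₂) * gen b (x₁ + x₂) (-x₂)) :
    genSwap c x₁ x₂ = genSwap a x₁ x₂ * genSwap b x₁ x₂ := by
  ext m n
  have := congrArg (fun F => PowerSeries.coeff m (PowerSeries.coeff n F)) h
  simp only [gen, PowerSeries.coeff_mul, PowerSeries.coeff_mk, map_sum] at this
  simp only [genSwap, PowerSeries.coeff_mul, PowerSeries.coeff_mk, map_sum]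
  rw [this, Finset.sum_comm]

lemma slice_swap {ε : ℂ} {c : ℕ → T3 → ℂ}
    (h : ∀ (m n : ℕ) (r s : ℤ), c m (n, r, s) = ε * c n (m, r, r - s)) (m n : ℕ) (x₁ x₂ : ℂ) :
    slice (c m) n x₁ x₂ = ε * slice (c n) m (x₁ + x₂) (-x₂) := by
  let σ : ℤ × ℤ ≃ ℤ × ℤ := ⟨fun p => (p.1, p.1 - p.2), fun p => (p.1, p.1 - p.2),
    fun p => by simp, fun p => by simp⟩
  rw [slice, slice, ← tsum_mul_left, ← σ.tsum_eq]
  refine tsum_congr fun p => ?_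
  simp only [σ, Equiv.coe_fn_mk]
  rw [h, sub_sub_cancel, mul_assoc]
  congr 3
  push_cast
  ring

lemma gen_swap {ε : ℂ} {c : ℕ → T3 → ℂ}
    (h : ∀ (m n : ℕ) (r s : ℤ), c m (n, r, s) = ε * c n (m, r, r - s)) (x₁ x₂ : ℂ) :
    gen c x₁ x₂ = PowerSeries.C (PowerSeries.C ε) * genSwap c x₁ x₂ := by
  ext m n
  simp only [gen, genSwap, PowerSeries.coeff_mk, PowerSeries.coeff_C_mul]
  exact slice_swap h m n x₁ x₂

end

section

/-- The quotient of a power series by a power series with constant coefficient one. -/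
def quotF (ψ h : ℕ → ℂ → ℂ → ℂ → ℂ) : ℕ → ℂ → ℂ → ℂ → ℂ
  | m => fun τ x₁ x₂ => h m τ x₁ x₂ - ∑ j : Fin m, ψ (m - j) τ x₁ x₂ * quotF ψ h j τ x₁ x₂
  decreasing_by exact j.2

/-- Fourier coefficients of `quotF`. -/
def quotC (d e : ℕ → T3 → ℂ) : ℕ → T3 → ℂ
  | m => fun T => e m T - ∑ j : Fin m, ∑' S, d (m - j) S * quotC d e j (T - S)
  decreasing_by exact j.2

lemma jac_quot {κ : ℤ} {d e : ℕ → T3 → ℂ} {ψ h : ℕ → ℂ → ℂ → ℂ → ℂ}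
    (hψ : ∀ j, Jac 0 j (d j) (ψ j)) (hh : ∀ m, Jac κ m (e m) (h m)) (m : ℕ) :
    Jac κ m (quotC d e m) (quotF ψ h m) := by
  induction m using Nat.strong_induction_on with
  | _ m ih =>
    rw [quotC, quotF]
    refine (hh m).sub (Jac.sum _ fun j _ => ?_)
    have := (hψ (m - j)).mul (ih j j.2)
    rwa [zero_add, Nat.sub_add_cancel j.2.le] at this

lemma quotF_spec {ψ h : ℕ → ℂ → ℂ → ℂ → ℂ} {τ x₁ x₂ : ℂ} (h1 : ψ 0 τ x₁ x₂ = 1) (m : ℕ) :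
    h m τ x₁ x₂ = ∑ p ∈ Finset.HasAntidiagonal.antidiagonal m,
      ψ p.1 τ x₁ x₂ * quotF ψ h p.2 τ x₁ x₂ := by
  rw [← Finset.Nat.sum_antidiagonal_swap]
  simp only [Prod.fst_swap, Prod.snd_swap]
  rw [Finset.Nat.sum_antidiagonal_eq_sum_range_succ
    (fun i j => ψ j τ x₁ x₂ * quotF ψ h i τ x₁ x₂), Finset.sum_range_succ, Nat.sub_self, h1, one_mul,
    Finset.sum_range]
  conv_rhs => enter [2]; rw [quotF]
  ring

lemma gen_phi_ne_zero {τ x₁ x₂ : ℂ} (hτ : 0 < τ.im) (h : phi τ x₁ x₂ ≠ 0) :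
    gen (liftC c0) x₁ x₂ ≠ 0 := by
  intro h0
  have h1 := (jac_liftV 1).rep.hasSum_slice hτ x₁ x₂
  rw [liftV_one] at h1
  refine h (h1.unique (hasSum_zero.congr_fun fun n => ?_))
  have := congrArg (fun F => PowerSeries.coeff n (PowerSeries.coeff 1 F)) h0
  simp only [gen, PowerSeries.coeff_mk, map_zero] at this
  rw [this, zero_mul]

lemma Rep.continuous_slice {c : T3 → ℂ} {f : ℂ → ℂ → ℂ → ℂ} (h : Rep c f) (n : ℕ)
    {y₁ y₂ : ℂ → ℂ} (h1 : Continuous y₁) (h2 : Continuous y₂) :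
    Continuous fun t => slice c n (y₁ t) (y₂ t) := by
  have hI : 0 < Complex.I.im := by simp
  have := ((h.slice_rep n).continuous hI h1 h2).mul
    (continuous_const (y := ee (-(n * Complex.I))))
  refine this.congr fun t => ?_
  rw [Pi.mul_apply, mul_assoc, ← ee_add, add_neg_cancel, ee_zero, mul_one]

section
variable {κ : ℤ} {ε : ℂ} {c b : ℕ → T3 → ℂ} {f g : ℕ → ℂ → ℂ → ℂ → ℂ}

lemma quot_neg (hf : SFam (κ + 7) ε c f) (hg : ∀ m, Jac κ m (b m) (g m))
    (he : ∀ m τ x₁ x₂, 0 < τ.im → f m τ x₁ x₂ = ∑ p ∈ Finset.HasAntidiagonal.antidiagonal m,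
      liftV phi p.1 τ x₁ x₂ * g p.2 τ x₁ x₂) (m : ℕ) (τ x₁ x₂ : ℂ) (hτ : 0 < τ.im) :
    g m τ (-x₁) (-x₂) = -ε * g m τ x₁ x₂ := by
  refine phi_cancel (A := fun x₁ x₂ => g m τ (-x₁) (-x₂)) (B := fun x₁ x₂ => -ε * g m τ x₁ x₂) hτ
    x₁ x₂ ((hg m).rep.continuous hτ (by fun_prop) (by fun_prop))
    (continuous_const.mul ((hg m).rep.continuous hτ (by fun_prop) (by fun_prop))) fun x₁ x₂ => ?_
  rcases eq_or_ne (phi τ x₁ x₂) 0 with h0 | h0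
  · rw [h0, zero_mul, zero_mul]
  congr 1
  have hB : (PowerSeries.mk fun m => liftV phi m τ x₁ x₂) ≠ 0 := fun h => h0 <| by
    have := congrArg (PowerSeries.coeff 1) h
    rwa [PowerSeries.coeff_mk, liftV_one, map_zero] at this
  have hP : (PowerSeries.mk fun m => liftV phi m τ x₁ x₂) *
        (PowerSeries.mk fun m => g m τ (-x₁) (-x₂)) =
      (PowerSeries.mk fun m => liftV phi m τ x₁ x₂) * PowerSeries.mk fun m => -ε * g m τ x₁ x₂ := by
    ext n
    simp only [PowerSeries.coeff_mul, PowerSeries.coeff_mk]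
    have h1 := hf.neg n τ x₁ x₂ hτ
    rw [he _ _ _ _ hτ, he _ _ _ _ hτ] at h1
    simp only [liftV_neg _ hτ, neg_mul, Finset.sum_neg_distrib] at h1
    simp only [mul_left_comm _ (-ε), ← Finset.mul_sum]
    linear_combination -h1
  have := congrArg (PowerSeries.coeff m) (mul_left_cancel₀ hB hP)
  simpa only [PowerSeries.coeff_mk] using this

lemma quot_swap (hf : SFam (κ + 7) ε c f) (hg : ∀ m, Jac κ m (b m) (g m))
    (he : ∀ m τ x₁ x₂, 0 < τ.im → f m τ x₁ x₂ = ∑ p ∈ Finset.HasAntidiagonal.antidiagonal m,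
      liftV phi p.1 τ x₁ x₂ * g p.2 τ x₁ x₂) (m n : ℕ) (r s : ℤ) :
    b m (n, r, s) = -ε * b n (m, r, r - s) := by
  have hI : 0 < Complex.I.im := by simp
  have hgen : ∀ x₁ x₂, gen c x₁ x₂ = gen (liftC c0) x₁ x₂ * gen b x₁ x₂ :=
    gen_mul hf.jac jac_liftV hg he
  have key : ∀ x₁ x₂, slice (b m) n x₁ x₂ = -ε * slice (b n) m (x₁ + x₂) (-x₂) := fun x₁ x₂ => by
    refine phi_cancel (A := slice (b m) n) (B := fun x₁ x₂ => -ε * slice (b n) m (x₁ + x₂) (-x₂)) hI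
      x₁ x₂ ((hg m).rep.continuous_slice n (by fun_prop) (by fun_prop)) (continuous_const.mul
      ((hg n).rep.continuous_slice m (by fun_prop) (by fun_prop))) fun x₁ x₂ => ?_
    rcases eq_or_ne (phi Complex.I x₁ x₂) 0 with h0 | h0
    · rw [h0, zero_mul, zero_mul]
    congr 1
    have h1 := hgen x₁ x₂
    have h2 := gen_swap sfam_liftV.swap x₁ x₂
    have h3 : gen (liftC c0) x₁ x₂ * gen b x₁ x₂ = gen (liftC c0) x₁ x₂ *
        (PowerSeries.C (PowerSeries.C (-ε)) * genSwap b x₁ x₂) := by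
      rw [← h1, gen_swap hf.swap, genSwap_mul (hgen _ _), h2]
      simp only [map_neg, map_pow, map_one]
      ring
    have := congrArg (fun F => PowerSeries.coeff n (PowerSeries.coeff m F))
      (mul_left_cancel₀ (gen_phi_ne_zero hI h0) h3)
    simpa only [gen, genSwap, PowerSeries.coeff_mk, PowerSeries.coeff_C_mul] using this
  have hu := unique2 (c := fun p => b m (n, p.1, p.2) - -ε * b n (m, p.1, p.1 - p.2)) (x := 0)
    (y := 0) fun s t => by
    have h1 := (hg m).rep.hasSum_fiber n hI (0 + s) (0 + t)
    have h2 := (hg n).rep.hasSum_fiber m hI (0 + s + (0 + t)) (-(0 + t))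
    let σ : ℤ × ℤ ≃ ℤ × ℤ := ⟨fun p => (p.1, p.1 - p.2), fun p => (p.1, p.1 - p.2),
      fun p => by simp, fun p => by simp⟩
    have h3 := (h1.mul_right (ee (-(n * Complex.I)))).sub
      (((σ.hasSum_iff.2 h2).mul_right (ee (-(m * Complex.I)))).mul_left (-ε))
    have hc : ∀ k : ℕ, ee (k * Complex.I) * ee (-(k * Complex.I)) = 1 := fun k => by
      rw [← ee_add, add_neg_cancel, ee_zero]
    have hz : slice (b m) n (0 + s) (0 + t) * ee (n * Complex.I) * ee (-(n * Complex.I)) -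
        -ε * (slice (b n) m (0 + s + (0 + t)) (-(0 + t)) * ee (m * Complex.I) *
          ee (-(m * Complex.I))) = 0 := by
      rw [mul_assoc, hc, mul_assoc (slice (b n) m _ _), hc, key]
      ring
    rw [hz] at h3
    refine h3.congr_fun fun p => ?_
    simp only [Function.comp, σ, Equiv.coe_fn_mk, e3_eq_mul, Int.cast_natCast]
    have hs : (p.1 : ℂ) * (0 + s + (0 + t)) + ((p.1 - p.2 : ℤ) : ℂ) * -(0 + t) =
        p.1 * (0 + s) + p.2 * (0 + t) := by
      push_cast
      ring
    rw [hs]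
    linear_combination (-b m (n, p.1, p.2) * ee (p.1 * (0 + s) + p.2 * (0 + t))) * hc n +
      (-ε * b n (m, p.1, p.1 - p.2) * ee (p.1 * (0 + s) + p.2 * (0 + t))) * hc m
  exact sub_eq_zero.1 (congrFun hu (r, s))

theorem exists_quotient (hf : SFam (κ + 7) ε c f) (h0 : ∀ T, c 0 T = 0)
    (h2 : ∀ m τ x₁, 0 < τ.im → (3 : ℕ) ≤ analyticOrderAt (f m τ x₁) 0)
    (h1 : ∀ m τ x, 0 < τ.im → f m τ 0 x = 0) (h12 : ∀ m τ x, 0 < τ.im → f m τ x (-x) = 0) :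
    ∃ b g, SFam κ (-ε) b g ∧ ∀ m τ x₁ x₂, 0 < τ.im → f m τ x₁ x₂ =
      ∑ p ∈ Finset.HasAntidiagonal.antidiagonal m, liftV phi p.1 τ x₁ x₂ * g p.2 τ x₁ x₂ := by
  obtain ⟨d, ψ, hψ, hψ1, hψ0⟩ := exists_psi
  have hc : ∀ m, ∀ T : T3, T.1 < 1 → c m T = 0 := by
    rintro m ⟨n, r, s⟩ hT
    have hT' : n < 1 := hT
    rcases (show n ≤ 0 by omega).lt_or_eq with h | rfl
    · exact (hf.jac m).rep.1 _ h
    · have := hf.swap m 0 r s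
      rw [h0, mul_zero] at this
      exact_mod_cast this
  have hd : ∀ m : ℕ, ∃ e h, Jac κ m e h ∧ ∀ τ x₁ x₂ : ℂ, 0 < τ.im →
      f (m + 1) τ x₁ x₂ = phi τ x₁ x₂ * h τ x₁ x₂ := fun m => by
    obtain ⟨e, h, hr, he⟩ := div_phi (hf.jac (m + 1)).rep (hc _) (hf.jac (m + 1)).qp
      (h2 (m + 1)) (h1 (m + 1)) (h12 (m + 1))
    exact ⟨e, h, Jac.of_phi_mul (hf.jac (m + 1)) hr he, he⟩
  choose e h hJ hfh using hd
  have hq : ∀ m τ x₁ x₂, 0 < τ.im → f m τ x₁ x₂ = ∑ p ∈ Finset.HasAntidiagonal.antidiagonal m,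
      liftV phi p.1 τ x₁ x₂ * quotF ψ h p.2 τ x₁ x₂ := by
    rintro (_ | m) τ x₁ x₂ hτ
    · have hz := ((hf.jac 0).rep.2 τ x₁ x₂ hτ).unique (hasSum_zero.congr_fun fun T => by
        rw [h0, zero_mul])
      rw [hz]
      simp [liftV]
    · rw [Finset.Nat.antidiagonal_succ, Finset.sum_cons, Finset.sum_map, hfh m τ x₁ x₂ hτ,
        quotF_spec (ψ := ψ) (h := h) (hψ0 τ x₁ x₂ hτ) m, Finset.mul_sum]
      have hz : liftV phi 0 τ x₁ x₂ = 0 := by simp [liftV]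
      rw [hz, zero_mul, zero_add]
      refine Finset.sum_congr rfl fun p _ => ?_
      simp only [Function.Embedding.prodMap, Function.Embedding.coeFn_mk, Prod.map,
        Function.Embedding.refl_apply, Nat.succ_eq_add_one]
      rw [hψ1 _ _ _ _ hτ, mul_assoc]
  have hb := jac_quot hψ hJ
  exact ⟨_, _, ⟨hb, quot_swap hf hb hq, quot_neg hf hb hq⟩, hq⟩

end

theorem division {k : ℕ} {F : Matrix (Fin 2) (Fin 2) ℂ → ℂ} (hF : IsHMF 7 k F)
    (h1 : VanishesAlongH1 F 3) (h2 : VanishesOnHeegner (omg 7) F) :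
    ∃ G : Matrix (Fin 2) (Fin 2) ℂ → ℂ, IsHMF 7 (k - 7) G ∧ ∀ τ ∈ HH2, F τ = B7 τ * G τ := by
  obtain ⟨c, f, hf, hFf, hc0, ho, hv, hv'⟩ := exists_sfam hF h1 h2
  obtain ⟨b, g, hg, he⟩ := exists_quotient (κ := (k : ℤ) - 7) (by simpa using hf) hc0 ho hv hv'
  have hcoord : ∀ G : Matrix (Fin 2) (Fin 2) ℂ → ℂ,
      (∀ τ x₁ x₂ ω, HC τ x₁ x₂ ω → FJ f τ x₁ x₂ ω = FJ (liftV phi) τ x₁ x₂ ω *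
        G (mk τ x₁ x₂ ω)) → ∀ Z ∈ HH2, F Z = B7 Z * G Z := fun G hG Z hZ => by
    have hC := (mem_HH2_iff Z).1 hZ
    rw [← mk_coord Z, hFf _ _ _ _ hC, B7_mk, hG _ _ _ _ hC]
  rcases lt_or_ge k 7 with hk | hk
  · have hb0 := fun m => (hg.fam (by simp)).eq_zero (by omega) m
    have hg0 : ∀ m τ x₁ x₂, 0 < τ.im → g m τ x₁ x₂ = 0 := fun m τ x₁ x₂ hτ =>
      ((hg.jac m).rep.2 τ x₁ x₂ hτ).unique (hasSum_zero.congr_fun fun T => by simp [hb0 m])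
    have hz : IsHMF 7 (k - 7) fun _ => 0 := by
      refine ⟨?_, fun M _ τ _ => by simp⟩
      exact differentiableOn_const _
    refine ⟨fun _ => 0, hz, hcoord _ fun τ x₁ x₂ ω hC => ?_⟩
    rw [mul_zero, FJ]
    refine (tsum_congr fun m => ?_).trans tsum_zero
    rw [he _ _ _ _ hC.1, Finset.sum_eq_zero fun p _ => by rw [hg0 _ _ _ _ hC.1, mul_zero], zero_mul]
  · have hg' : SFam ((k - 7 : ℕ) : ℤ) ((-1) ^ (k - 7)) b g := by
      have hε : -(-1 : ℂ) ^ k = (-1) ^ (k - 7) := by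
        obtain ⟨j, rfl⟩ := Nat.exists_eq_add_of_le hk
        rw [Nat.add_sub_cancel_left, pow_add]
        norm_num
      rw [← hε, Nat.cast_sub hk]
      exact hg
    refine ⟨HF g, hg'.isHMF, hcoord _ fun τ x₁ x₂ ω hC => ?_⟩
    rw [HF_mk]
    have s1 := (fam_liftV.hasSum hC).2
    have s2 := ((hg'.fam (by simp)).hasSum hC).2
    rw [← s1.tsum_eq, ← s2.tsum_eq,
      tsum_mul_tsum_eq_tsum_sum_antidiagonal_of_summable_norm s1.summable.norm s2.summable.norm, FJ]
    refine tsum_congr fun m => ?_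
    rw [he _ _ _ _ hC.1, Finset.sum_mul]
    refine Finset.sum_congr rfl fun p hp => ?_
    rw [← Finset.HasAntidiagonal.mem_antidiagonal.1 hp, Nat.cast_add, add_mul, ee_add]
    ring

end

end HermB7

/-- For K = ℚ(√-7) and λ = (1+√-7)/2 of norm 2, there is a nonzero symmetric
Hermitian modular form b₇ of weight 7 vanishing to order ≥ 3 along ℋ₁ and vanishing on ℋ₂,
such that every Hermitian modular form of weight k with these vanishing properties is
divisible by b₇, with quotient a Hermitian modular form of weight k - 7. -/
theorem borcherds_product_b7 :
    ∃ b7 : Matrix (Fin 2) (Fin 2) ℂ → ℂ,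
      IsSymHMF 7 7 b7 ∧ (∃ τ ∈ HH2, b7 τ ≠ 0) ∧
      VanishesAlongH1 b7 3 ∧
      VanishesOnHeegner (omg 7) b7 ∧
      ∀ k : ℕ, ∀ F : Matrix (Fin 2) (Fin 2) ℂ → ℂ, IsHMF 7 k F →
        VanishesAlongH1 F 3 → VanishesOnHeegner (omg 7) F →
        ∃ G : Matrix (Fin 2) (Fin 2) ℂ → ℂ,
          IsHMF 7 (k - 7) G ∧ ∀ τ ∈ HH2, F τ = b7 τ * G τ := by
  exact ⟨HermB7.B7, HermB7.isSymHMF_B7, HermB7.B7_ne_zero, HermB7.B7_vanishesAlongH1,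
    HermB7.B7_vanishesOnHeegner, fun _ _ hF h1 h2 => HermB7.division hF h1 h2⟩

end
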